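/- Let H be a (possibly non-connected) reductive linear algebraic group over an algebraically closed field K of characteristic 0 with H^0 split, acting on H^n by simultaneous conjugation through H^0. Then a tuple (g_1,...,g_n) ∈ H(K)^n has closed H^0-orbit in H^n if and only if the Zariski closure of the subgroup generated by g_1,...,g_n is reductive. Moreover, the closed H^0-orbits in H^n are in canonical bijection with the K-points of the affine GIT quotient Spec(O(H^n)^{H^0}). -/

import Mathlib

/-!
**STATEMENT 13.**  Let `H` be a (possibly non-connected) reductive linear algebraic group over
an algebraically closed field `K` of characteristic `0` (with `H⁰` split — automatic over an
algebraically closed field), acting on `H^n` by simultaneous conjugation through `H⁰`.  Then a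
tuple `(g_1,…,g_n) ∈ H(K)^n` has closed `H⁰`-orbit in `H^n` if and only if the Zariski closure
of the subgroup generated by `g_1,…,g_n` is reductive.  Moreover, the closed `H⁰`-orbits in
`H^n` are in canonical bijection (via evaluation of invariant functions at any point of the
orbit) with the `K`-points of the affine GIT quotient `Spec (O(H^n)^{H⁰})`, i.e. with the
`K`-algebra homomorphisms `O(H^n)^{H⁰} → K`.

Encoding: `H` is a Zariski-closed subgroup of `GL_N(K)`; regular functions on `H^n` are
restrictions of polynomials in the matrix entries and the entries of the inverses; `H^n`
carries the Zariski topology generated by the non-vanishing loci of its regular functions;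
`H⁰` is the connected component of `1` in `H`; `O(H^n)^{H⁰}` is the subalgebra `regInvAlg` of
`H⁰`-conjugation-invariant regular functions.  Since `K` is algebraically closed of
characteristic `0`, "the Zariski closure of the subgroup generated by the `g_i` is reductive"
is used in its equivalent form: the natural module `K^N` is semisimple over the subgroup
generated by the `g_i` (`NatSemisimpleOn`; semisimplicity over a subgroup and over its Zariski
closure agree, and in characteristic `0` it characterizes reductivity of the closure).
-/

open MvPolynomial Matrix

noncomputable def glCoords (K : Type) [Field K] (N : ℕ) {I : Type}
    (g : I → Matrix.GeneralLinearGroup (Fin N) K) :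
    I × ((Fin N × Fin N) ⊕ (Fin N × Fin N)) → K := fun p =>
  Sum.elim (fun q => ((g p.1 : Matrix (Fin N) (Fin N) K)) q.1 q.2)
    (fun q => (((g p.1)⁻¹ : Matrix (Fin N) (Fin N) K)) q.1 q.2) p.2

def IsRegularOnPow (K : Type) [Field K] (N : ℕ)
    (G : Subgroup (Matrix.GeneralLinearGroup (Fin N) K)) {I : Type}
    (f : (I → G) → K) : Prop :=
  ∃ P : MvPolynomial (I × ((Fin N × Fin N) ⊕ (Fin N × Fin N))) K,
    ∀ g : I → G,
      f g = eval (glCoords K N fun i => (g i : Matrix.GeneralLinearGroup (Fin N) K)) P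

def IsZarClosed (K : Type) [Field K] (N : ℕ)
    (G : Subgroup (Matrix.GeneralLinearGroup (Fin N) K)) : Prop :=
  ∃ 𝒮 : Set (MvPolynomial (Unit × ((Fin N × Fin N) ⊕ (Fin N × Fin N))) K),
    ∀ g : Matrix.GeneralLinearGroup (Fin N) K,
      g ∈ G ↔ ∀ P ∈ 𝒮, eval (glCoords K N fun _ : Unit => g) P = 0

/-- The Zariski topology on `G^m`, generated by the non-vanishing loci of regular functions. -/
def tupleZarTop (K : Type) [Field K] (N : ℕ)
    (G : Subgroup (Matrix.GeneralLinearGroup (Fin N) K)) (m : ℕ) :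
    TopologicalSpace (Fin m → G) :=
  TopologicalSpace.generateFrom
    {U | ∃ f : (Fin m → G) → K, IsRegularOnPow K N G f ∧ U = {g | f g ≠ 0}}

/-- The identity component `G⁰`: the connected component of `1` for the Zariski topology. -/
def identityComponent (K : Type) [Field K] (N : ℕ)
    (G : Subgroup (Matrix.GeneralLinearGroup (Fin N) K)) : Set G :=
  @connectedComponent _ (tupleZarTop K N G 1) (fun _ => 1) |>.image (fun g => g 0)

def NatSemisimpleOn (K : Type) [Field K] (N : ℕ)
    (S : Set (Matrix.GeneralLinearGroup (Fin N) K)) : Prop :=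
  ∀ W : Submodule K (Fin N → K),
    (∀ u ∈ S, ∀ v ∈ W, (u : Matrix (Fin N) (Fin N) K) *ᵥ v ∈ W) →
    ∃ W' : Submodule K (Fin N → K),
      (∀ u ∈ S, ∀ v ∈ W', (u : Matrix (Fin N) (Fin N) K) *ᵥ v ∈ W') ∧ IsCompl W W'

/-- The `H⁰`-conjugation orbit of a tuple `g ∈ H^n`. -/
def conjOrbit (K : Type) [Field K] (N : ℕ)
    (H : Subgroup (Matrix.GeneralLinearGroup (Fin N) K)) (n : ℕ) (g : Fin n → H) :
    Set (Fin n → H) :=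
  {g' | ∃ h ∈ identityComponent K N H, ∀ i, g' i = h * g i * h⁻¹}

/-- The algebra `O(H^n)^{H⁰}` of regular functions on `H^n` invariant under simultaneous
conjugation by the identity component `H⁰`. -/
def regInvAlg (K : Type) [Field K] (N : ℕ)
    (H : Subgroup (Matrix.GeneralLinearGroup (Fin N) K)) (n : ℕ) :
    Subalgebra K ((Fin n → H) → K) where
  carrier := {f | IsRegularOnPow K N H f ∧
    ∀ h ∈ identityComponent K N H, ∀ g : Fin n → H, f (fun i => h * g i * h⁻¹) = f g}
  mul_mem' := by
    rintro f f' ⟨⟨P, hP⟩, hf⟩ ⟨⟨Q, hQ⟩, hf'⟩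
    exact ⟨⟨P * Q, fun g => by simp [hP g, hQ g]⟩,
      fun h hh g => by simp [Pi.mul_apply, hf h hh g, hf' h hh g]⟩
  one_mem' := ⟨⟨1, fun g => by simp⟩, fun h hh g => rfl⟩
  add_mem' := by
    rintro f f' ⟨⟨P, hP⟩, hf⟩ ⟨⟨Q, hQ⟩, hf'⟩
    exact ⟨⟨P + Q, fun g => by simp [hP g, hQ g]⟩,
      fun h hh g => by simp [Pi.add_apply, hf h hh g, hf' h hh g]⟩
  zero_mem' := ⟨⟨0, fun g => by simp⟩, fun h hh g => rfl⟩
  algebraMap_mem' := fun r =>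
    ⟨⟨C r, fun g => by simp⟩, fun h hh g => rfl⟩

namespace Richardson

set_option linter.unusedSectionVars false

/-! ### Engel's theorem for spaces of nilpotent operators -/

/-- A subspace of an associative algebra closed under commutators. -/
def BracketClosed {K A : Type*} [Field K] [Ring A] [Algebra K A] (S : Submodule K A) : Prop :=
  ∀ x ∈ S, ∀ y ∈ S, x * y - y * x ∈ S

section Engel

variable {K V : Type*} [Field K] [AddCommGroup V] [Module K V]

theorem mul_mem_pow_mul_top (S : Submodule K (Module.End K V)) {y : Module.End K V}
    (hy : ∀ x ∈ S, y * x - x * y ∈ S) (j : ℕ) :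
    ∀ T ∈ S ^ j * ⊤, y * T ∈ S ^ j * (⊤ : Submodule K (Module.End K V)) := by
  induction j with
  | zero => intro T _; rw [pow_zero, one_mul]; trivial
  | succ j ih =>
    intro T hT
    rw [pow_succ', mul_assoc] at hT ⊢
    induction hT using Submodule.mul_induction_on' with
    | mem_mul_mem x hx T hT =>
      have : y * (x * T) = (y * x - x * y) * T + x * (y * T) := by noncomm_ring
      rw [this]
      exact add_mem (Submodule.mul_mem_mul (hy x hx) hT) (Submodule.mul_mem_mul hx (ih T hT))
    | add x _ y _ hx hy => rw [mul_add]; exact add_mem hx hy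

variable [FiniteDimensional K V]

attribute [local instance] LieRing.ofAssociativeRing in
theorem exists_pow_eq_bot_of_forall_isNilpotent (S : Submodule K (Module.End K V))
    (hS : BracketClosed S) (hn : ∀ x ∈ S, IsNilpotent x) : ∃ k : ℕ, S ^ k = ⊥ := by
  let L : LieSubalgebra K (Module.End K V) := { S with lie_mem' := fun {x y} hx hy => hS x hx y hy }
  have hnil : LieModule.IsNilpotent L V := by
    refine LieAlgebra.isEngelian_of_isNoetherian (R := K) (L := L) V ?_
    rintro ⟨x, hx⟩
    exact hn x hx
  obtain ⟨k, hk⟩ := (LieModule.isNilpotent_iff K L V).1 hnil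
  refine ⟨k, ?_⟩
  have key : ∀ j : ℕ, ∀ T ∈ S ^ j, ∀ v : V, T v ∈ LieModule.lowerCentralSeries K L V j := by
    intro j
    induction j with
    | zero => intro T _ v; simp
    | succ j ih =>
      intro T hT v
      rw [pow_succ'] at hT
      induction hT using Submodule.mul_induction_on' with
      | mem_mul_mem x hx T hT =>
        rw [LieModule.lowerCentralSeries_succ]
        exact LieSubmodule.lie_mem_lie (x := (⟨x, hx⟩ : L)) (LieSubmodule.mem_top _) (ih T hT v)
      | add x _ y _ hx hy => exact add_mem hx hy
  rw [eq_bot_iff]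
  intro T hT
  rw [Submodule.mem_bot]
  ext v
  have := key k T hT v
  rw [hk] at this
  simpa using this

/-- Engel's theorem in the form: a nilpotent Lie algebra acting on `B` kills a vector of `B / A`. -/
theorem exists_mem_not_mem_of_engel (S : Submodule K (Module.End K V))
    (hS : BracketClosed S) (hn : ∀ x ∈ S, IsNilpotent x) (A B : Submodule K V)
    (hAB : ¬ B ≤ A) (hB : ∀ x ∈ S, ∀ b ∈ B, x b ∈ B) :
    ∃ b ∈ B, b ∉ A ∧ ∀ x ∈ S, x b ∈ A := by
  classical
  obtain ⟨k, hk⟩ := exists_pow_eq_bot_of_forall_isNilpotent S hS hn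
  have hex : ∃ k : ℕ, ∀ T ∈ S ^ k, ∀ b ∈ B, T b ∈ A :=
    ⟨k, fun T hT b _ => by rw [hk, Submodule.mem_bot] at hT; simp [hT]⟩
  have hst : ∀ j : ℕ, ∀ T ∈ S ^ j, ∀ b ∈ B, T b ∈ B := by
    intro j
    induction j with
    | zero =>
      intro T hT b hb
      rw [pow_zero, Submodule.mem_one] at hT
      obtain ⟨c, rfl⟩ := hT
      exact B.smul_mem c hb
    | succ j ih =>
      intro T hT b hb
      rw [pow_succ'] at hT
      induction hT using Submodule.mul_induction_on' with
      | mem_mul_mem x hx T hT => exact hB x hx _ (ih T hT b hb)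
      | add x _ y _ hx hy => exact add_mem hx hy
  have hmin := fun j (hj : j < Nat.find hex) => Nat.find_min hex hj
  have hspec := Nat.find_spec hex
  rcases hkk : Nat.find hex with _ | j
  · rw [hkk] at hspec
    have h1 : (1 : Module.End K V) ∈ S ^ 0 := by rw [pow_zero]; exact Submodule.one_le.1 le_rfl
    exact absurd (fun b hb => hspec 1 h1 b hb) hAB
  · have h1 := hmin j (by omega)
    push Not at h1
    obtain ⟨T, hT, b, hb, hTb⟩ := h1
    refine ⟨T b, hst j T hT b hb, hTb, fun x hx => ?_⟩
    rw [hkk, pow_succ'] at hspec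
    exact hspec (x * T) (Submodule.mul_mem_mul hx hT) b hb

/-- The commutant-type statement: if `S` is a nilpotent Lie algebra normalized by `y` then `ν * y`
is nilpotent for `ν ∈ S`. -/
theorem isNilpotent_mul_of_normalizes (S : Submodule K (Module.End K V))
    (hS : BracketClosed S) (hn : ∀ x ∈ S, IsNilpotent x) {ν y : Module.End K V} (hν : ν ∈ S)
    (hy : ∀ x ∈ S, y * x - x * y ∈ S) : IsNilpotent (ν * y) := by
  obtain ⟨k, hk⟩ := exists_pow_eq_bot_of_forall_isNilpotent S hS hn
  have h1 := fun j => mul_mem_pow_mul_top S hy j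
  have h2 : ∀ j : ℕ, (ν * y) ^ j ∈ S ^ j * (⊤ : Submodule K (Module.End K V)) := by
    intro j
    induction j with
    | zero => rw [pow_zero, one_mul]; trivial
    | succ j ih =>
      rw [pow_succ', pow_succ', mul_assoc, mul_assoc]
      exact Submodule.mul_mem_mul hν (h1 j _ ih)
  refine ⟨k, ?_⟩
  have := h2 k
  rwa [hk, Submodule.bot_mul, Submodule.mem_bot] at this

theorem trace_mul_eq_zero_of_normalizes (S : Submodule K (Module.End K V))
    (hS : BracketClosed S) (hn : ∀ x ∈ S, IsNilpotent x) {ν y : Module.End K V} (hν : ν ∈ S)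
    (hy : ∀ x ∈ S, y * x - x * y ∈ S) : LinearMap.trace K V (ν * y) = 0 :=
  (LinearMap.isNilpotent_trace_of_isNilpotent
    (isNilpotent_mul_of_normalizes S hS hn hν hy)).eq_zero

/-- The sum of an element of a nilpotent Lie algebra and a nilpotent operator normalizing it is
nilpotent. -/
theorem isNilpotent_add_of_normalizes (S : Submodule K (Module.End K V))
    (hS : BracketClosed S) (hn : ∀ x ∈ S, IsNilpotent x) {a b : Module.End K V} (ha : a ∈ S)
    (hb : ∀ x ∈ S, b * x - x * b ∈ S) (hbn : IsNilpotent b) : IsNilpotent (a + b) := by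
  obtain ⟨k, hk⟩ := exists_pow_eq_bot_of_forall_isNilpotent S hS hn
  obtain ⟨m, hm⟩ := hbn
  have h1 := fun j => mul_mem_pow_mul_top S hb j
  have ha' : ∀ j : ℕ, ∀ T ∈ S ^ j * ⊤, a * T ∈ S ^ (j + 1) * (⊤ :
      Submodule K (Module.End K V)) := by
    intro j T hT
    rw [pow_succ', mul_assoc]
    exact Submodule.mul_mem_mul ha hT
  have hle : ∀ j : ℕ, ∀ T ∈ S ^ (j + 1) * ⊤, T ∈ S ^ j * (⊤ : Submodule K (Module.End K V)) := by
    intro j T hT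
    rw [pow_succ, mul_assoc] at hT
    exact (mul_le_mul_right le_top (S ^ j)) hT
  have h2 : ∀ j i : ℕ, ∀ T ∈ S ^ j * ⊤, b ^ i * T ∈ S ^ j * (⊤ : Submodule K (Module.End K V)) ∧
      (a + b) ^ i * T - b ^ i * T ∈ S ^ (j + 1) * (⊤ : Submodule K (Module.End K V)) := by
    intro j i T hT
    induction i with
    | zero => simpa using hT
    | succ i ih =>
      refine ⟨by rw [pow_succ', mul_assoc]; exact h1 j _ ih.1, ?_⟩
      have : (a + b) ^ (i + 1) * T - b ^ (i + 1) * T =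
          a * ((a + b) ^ i * T - b ^ i * T) + b * ((a + b) ^ i * T - b ^ i * T)
            + a * (b ^ i * T) := by
        rw [pow_succ', pow_succ']; noncomm_ring
      rw [this]
      exact add_mem (add_mem (hle _ _ (ha' _ _ ih.2)) (h1 _ _ ih.2)) (ha' _ _ ih.1)
  have h3 : ∀ j : ℕ, ((a + b) ^ m) ^ j ∈ S ^ j * (⊤ : Submodule K (Module.End K V)) := by
    intro j
    induction j with
    | zero => rw [pow_zero, one_mul]; trivial
    | succ j ih =>
      have := (h2 j m _ ih).2
      rwa [hm, zero_mul, sub_zero, ← pow_succ'] at this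
  refine ⟨m * k, ?_⟩
  have := h3 k
  rwa [hk, Submodule.bot_mul, Submodule.mem_bot, ← pow_mul] at this

end Engel

/-! ### Replicas -/

section Replica

variable {K V W X : Type*} [Field K] [CharZero K] [AddCommGroup V] [Module K V]
  [AddCommGroup W] [Module K W] [AddCommGroup X] [Module K X]

/-- The part of the generalized eigenspace of `T` for `c` on which `T'` acts as `θ c`. -/
noncomputable def replicaSpace (θ : K →ₗ[ℚ] ℚ) (T T' : Module.End K V) (c : K) : Submodule K V :=
  T.maxGenEigenspace c ⊓ LinearMap.ker (T' - ((θ c : ℚ) : K) • 1)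

theorem mem_replicaSpace {θ : K →ₗ[ℚ] ℚ} {T T' : Module.End K V} {c : K} {x : V} :
    x ∈ replicaSpace θ T T' c ↔
      x ∈ T.maxGenEigenspace c ∧ T' x = ((θ c : ℚ) : K) • x := by
  simp [replicaSpace, sub_eq_zero]

/-- `T'` acts as `θ c` on the generalized eigenspace of `T` for `c`, for each `c`. -/
def IsReplica (θ : K →ₗ[ℚ] ℚ) (T T' : Module.End K V) : Prop :=
  ∀ c : K, ∀ x ∈ T.maxGenEigenspace c, T' x = ((θ c : ℚ) : K) • x

theorem isReplica_of_iSup_replicaSpace {θ : K →ₗ[ℚ] ℚ} {T T' : Module.End K V}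
    (h : ⨆ c, replicaSpace θ T T' c = ⊤) : IsReplica θ T T' := by
  have hle : ∀ c, replicaSpace θ T T' c ≤ T.maxGenEigenspace c := fun c => inf_le_left
  intro c x hx
  have h2 : (⊤ : Submodule K V) ≤
      replicaSpace θ T T' c ⊔ ⨆ d, ⨆ (_ : d ≠ c), T.maxGenEigenspace d := by
    rw [← h]
    refine iSup_le fun d => ?_
    by_cases hd : d = c
    · subst hd; exact le_sup_left
    · exact (hle d).trans (le_sup_of_le_right (le_iSup₂_of_le d hd le_rfl))
  obtain ⟨y, hy, z, hz, hyz⟩ := Submodule.mem_sup.1 (h2 (Submodule.mem_top (x := x)))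
  have hzc : z ∈ T.maxGenEigenspace c := by
    have : z = x - y := by rw [← hyz]; abel
    rw [this]; exact sub_mem hx (hle c hy)
  have := (T.independent_maxGenEigenspace c).le_bot ⟨hzc, hz⟩
  rw [Submodule.mem_bot] at this
  rw [← hyz, this, add_zero]
  exact (mem_replicaSpace.1 hy).2

theorem IsReplica.mem_replicaSpace {θ : K →ₗ[ℚ] ℚ} {T T' : Module.End K V}
    (h : IsReplica θ T T') {c : K} {x : V} (hx : x ∈ T.maxGenEigenspace c) :
    x ∈ replicaSpace θ T T' c :=
  Richardson.mem_replicaSpace.2 ⟨hx, h c x hx⟩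

theorem pow_sub_smul_intertwine {T : Module.End K V} {S : Module.End K W} {f : V →ₗ[K] W}
    (h : ∀ v, f (T v) = S (f v)) (c : K) (k : ℕ) (v : V) :
    f (((T - c • 1) ^ k) v) = ((S - c • 1) ^ k) (f v) := by
  induction k generalizing v with
  | zero => simp
  | succ k ih =>
    rw [pow_succ, pow_succ, Module.End.mul_apply, Module.End.mul_apply, ih]
    simp [h]

theorem mem_maxGenEigenspace_of_intertwine {T : Module.End K V} {S : Module.End K W}
    {f : V →ₗ[K] W} (h : ∀ v, f (T v) = S (f v)) {c : K} {v : V}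
    (hv : v ∈ T.maxGenEigenspace c) : f v ∈ S.maxGenEigenspace c := by
  rw [Module.End.mem_maxGenEigenspace] at hv ⊢
  obtain ⟨k, hk⟩ := hv
  exact ⟨k, by rw [← pow_sub_smul_intertwine h, hk, map_zero]⟩

theorem mem_replicaSpace_of_intertwine {θ : K →ₗ[ℚ] ℚ} {T T' : Module.End K V}
    {S S' : Module.End K W} {f : V →ₗ[K] W} (h : ∀ v, f (T v) = S (f v))
    (h' : ∀ v, f (T' v) = S' (f v)) {c : K} {v : V}
    (hv : v ∈ replicaSpace θ T T' c) : f v ∈ replicaSpace θ S S' c := by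
  rw [mem_replicaSpace] at hv ⊢
  refine ⟨mem_maxGenEigenspace_of_intertwine h hv.1, ?_⟩
  rw [← h', hv.2, map_smul]

theorem mem_maxGenEigenspace_bilin {T : Module.End K V} {U : Module.End K W} {S : Module.End K X}
    {b : V →ₗ[K] W →ₗ[K] X} (h : ∀ v w, S (b v w) = b (T v) w + b v (U w)) {c d : K} {v : V}
    {w : W} (hv : v ∈ T.maxGenEigenspace c) (hw : w ∈ U.maxGenEigenspace d) :
    b v w ∈ S.maxGenEigenspace (c + d) := by
  rw [Module.End.mem_maxGenEigenspace] at hv hw ⊢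
  obtain ⟨k, hk⟩ := hv
  obtain ⟨l, hl⟩ := hw
  refine ⟨k + l, ?_⟩
  suffices H : ∀ m k l : ℕ, k + l = m → ∀ v w, ((T - c • 1) ^ k) v = 0 →
      ((U - d • 1) ^ l) w = 0 → ((S - (c + d) • 1) ^ m) (b v w) = 0 from H _ k l rfl v w hk hl
  intro m
  induction m with
  | zero =>
    intro k l hkl v w hv _
    obtain rfl : k = 0 := by omega
    simp only [pow_zero, Module.End.one_apply] at hv
    simp [hv]
  | succ m ih =>
    intro k l hkl v w hv hw
    rcases k with _ | k
    · simp only [pow_zero, Module.End.one_apply] at hv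
      simp [hv]
    rcases l with _ | l
    · simp only [pow_zero, Module.End.one_apply] at hw
      simp [hw]
    have e : (S - (c + d) • 1) (b v w) = b ((T - c • 1) v) w + b v ((U - d • 1) w) := by
      simp [h]
      module
    rw [pow_succ, Module.End.mul_apply, e, map_add]
    rw [pow_succ, Module.End.mul_apply] at hv hw
    rw [ih k (l + 1) (by omega) _ _ hv (by rw [pow_succ, Module.End.mul_apply, hw]),
      ih (k + 1) l (by omega) _ _ (by rw [pow_succ, Module.End.mul_apply, hv]) hw, add_zero]

theorem mem_replicaSpace_bilin {θ : K →ₗ[ℚ] ℚ} {T T' : Module.End K V} {U U' : Module.End K W}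
    {S S' : Module.End K X} {b : V →ₗ[K] W →ₗ[K] X}
    (h : ∀ v w, S (b v w) = b (T v) w + b v (U w))
    (h' : ∀ v w, S' (b v w) = b (T' v) w + b v (U' w)) {c d : K} {v : V}
    {w : W} (hv : v ∈ replicaSpace θ T T' c) (hw : w ∈ replicaSpace θ U U' d) :
    b v w ∈ replicaSpace θ S S' (c + d) := by
  rw [mem_replicaSpace] at hv hw ⊢
  refine ⟨mem_maxGenEigenspace_bilin h hv.1 hw.1, ?_⟩
  rw [h', hv.2, hw.2]
  simp
  module

theorem IsReplica.neg {θ : K →ₗ[ℚ] ℚ} {T T' : Module.End K V} (h : IsReplica θ T T') :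
    IsReplica θ (-T) (-T') := by
  intro c x hx
  have hx' : x ∈ T.maxGenEigenspace (-c) := by
    rw [Module.End.mem_maxGenEigenspace] at hx ⊢
    obtain ⟨k, hk⟩ := hx
    refine ⟨k, ?_⟩
    have : T - (-c) • 1 = -(-T - c • 1) := by simp; abel
    rw [this, neg_pow, Module.End.mul_apply, hk, map_zero]
  rw [LinearMap.neg_apply, h _ _ hx']
  simp

theorem pow_restrict {T : Module.End K V} {A : Submodule K V} (hT : ∀ a ∈ A, T a ∈ A) (a : A) :
    A.subtype ((T.restrict hT) a) = T (A.subtype a) := rfl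

theorem IsReplica.restrict {θ : K →ₗ[ℚ] ℚ} {T T' : Module.End K V} (h : IsReplica θ T T')
    {A : Submodule K V} (hT : ∀ a ∈ A, T a ∈ A) (hT' : ∀ a ∈ A, T' a ∈ A) :
    IsReplica θ (T.restrict hT) (T'.restrict hT') := by
  intro c x hx
  have := mem_maxGenEigenspace_of_intertwine (pow_restrict hT) hx
  apply Subtype.ext
  exact h c _ this

section FD

variable [FiniteDimensional K V] [IsAlgClosed K]

theorem IsReplica.iSup_replicaSpace {θ : K →ₗ[ℚ] ℚ} {T T' : Module.End K V}
    (h : IsReplica θ T T') : ⨆ c, replicaSpace θ T T' c = ⊤ := by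
  rw [eq_top_iff, ← T.iSup_maxGenEigenspace_eq_top]
  exact iSup_mono fun c x hx => h.mem_replicaSpace hx

theorem IsReplica.unique {θ : K →ₗ[ℚ] ℚ} {T T₁ T₂ : Module.End K V}
    (h₁ : IsReplica θ T T₁) (h₂ : IsReplica θ T T₂) : T₁ = T₂ := by
  have : (⊤ : Submodule K V) ≤ LinearMap.eqLocus T₁ T₂ := by
    rw [← T.iSup_maxGenEigenspace_eq_top]
    exact iSup_le fun c x hx => by
      rw [LinearMap.mem_eqLocus, h₁ c x hx, h₂ c x hx]
  ext x
  exact this (Submodule.mem_top (x := x))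

open Classical in
theorem exists_polynomial_replica (θ : K →ₗ[ℚ] ℚ) (T : Module.End K V) :
    ∃ p : Polynomial K, ∀ c : K, minpoly K T ∣ (p - Polynomial.C ((θ c : ℚ) : K)) *
      ∏ d ∈ (minpoly K T).roots.toFinset.erase c, (Polynomial.X - Polynomial.C d) ^
        (minpoly K T).rootMultiplicity d := by
  set m := minpoly K T with hm
  let ι := m.roots.toFinset
  have hcop : Pairwise (Function.onFun IsCoprime
      fun i : ι => Ideal.span {(Polynomial.X - Polynomial.C (i : K)) ^ m.rootMultiplicity (i :
          K)}) := by
    intro i j hij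
    rw [Function.onFun, Ideal.isCoprime_span_singleton_iff]
    exact IsCoprime.pow (Polynomial.isCoprime_X_sub_C_of_isUnit_sub
      (sub_ne_zero.2 fun h => hij (Subtype.ext h)).isUnit)
  obtain ⟨p, hp⟩ := Ideal.exists_forall_sub_mem_ideal hcop fun i => Polynomial.C ((θ
      (i : K) : ℚ) : K)
  refine ⟨p, fun c => ?_⟩
  have hm0 : m ≠ 0 := minpoly.ne_zero (Algebra.IsIntegral.isIntegral T)
  have hmprod : m = ∏ d ∈ m.roots.toFinset,
      (Polynomial.X - Polynomial.C d) ^ m.rootMultiplicity d := by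
    have hs : m.Splits := IsAlgClosed.splits m
    have hmo : m.Monic := minpoly.monic (Algebra.IsIntegral.isIntegral T)
    conv_lhs => rw [hs.eq_prod_roots_of_monic hmo]
    rw [Finset.prod_multiset_map_count]
    simp
  by_cases hc : c ∈ m.roots.toFinset
  · nth_rewrite 1 [hmprod]
    rw [← Finset.mul_prod_erase _ _ hc]
    exact mul_dvd_mul_right (Ideal.mem_span_singleton.1 (hp ⟨c, hc⟩)) _
  · rw [Finset.erase_eq_of_notMem hc, ← hmprod]
    exact dvd_mul_left _ _

open Classical in
theorem isReplica_aeval_of_polynomial {θ : K →ₗ[ℚ] ℚ} {T : Module.End K V} {p : Polynomial K}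
    (hp : ∀ c : K, minpoly K T ∣ (p - Polynomial.C ((θ c : ℚ) : K)) *
      ∏ d ∈ (minpoly K T).roots.toFinset.erase c, (Polynomial.X - Polynomial.C d) ^
        (minpoly K T).rootMultiplicity d)
    {S : Module.End K W} (hS : Polynomial.aeval S (minpoly K T) = 0) : IsReplica θ S
        (Polynomial.aeval S p) := by
  intro c x hx
  rw [Module.End.mem_maxGenEigenspace] at hx
  obtain ⟨k, hk⟩ := hx
  set q := ∏ d ∈ (minpoly K T).roots.toFinset.erase c,
    (Polynomial.X - Polynomial.C d) ^ (minpoly K T).rootMultiplicity d with hq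
  have hcop : IsCoprime ((Polynomial.X - Polynomial.C c) ^ k) q := by
    refine IsCoprime.prod_right fun d hd => IsCoprime.pow
        (Polynomial.isCoprime_X_sub_C_of_isUnit_sub
      (sub_ne_zero.2 (Finset.ne_of_mem_erase hd).symm).isUnit)
  obtain ⟨a, b, hab⟩ := hcop
  have h0 : Polynomial.aeval S ((p - Polynomial.C ((θ c : ℚ) : K)) * q) = 0 := by
    obtain ⟨r, hr⟩ := hp c
    rw [hr, map_mul, hS, zero_mul]
  have h1 : Polynomial.aeval S ((Polynomial.X - Polynomial.C c) ^ k) x = 0 := by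
    simpa [Module.algebraMap_end_eq_smul_id, Algebra.algebraMap_eq_smul_one] using hk
  have h2 : Polynomial.aeval S (p - Polynomial.C ((θ c : ℚ) : K)) x = 0 := by
    have : (p - Polynomial.C ((θ c : ℚ) : K)) = (p - Polynomial.C ((θ c : ℚ) : K)) * a *
        (Polynomial.X - Polynomial.C c) ^ k
        + b * ((p - Polynomial.C ((θ c : ℚ) : K)) * q) := by
      linear_combination (-(p - Polynomial.C ((θ c : ℚ) : K))) * hab
    rw [this, map_add, map_mul, map_mul (Polynomial.aeval S) b, h0]
    simp only [mul_zero, add_zero, Module.End.mul_apply, h1, map_zero]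
  rw [map_sub, LinearMap.sub_apply, sub_eq_zero] at h2
  rw [h2]
  simp [Algebra.algebraMap_eq_smul_one]

theorem exists_isReplica (θ : K →ₗ[ℚ] ℚ) (T : Module.End K V) : ∃ T', IsReplica θ T T' :=
  (exists_polynomial_replica θ T).elim fun _ hp =>
    ⟨_, isReplica_aeval_of_polynomial hp (minpoly.aeval K T)⟩

theorem IsReplica.exists_eq_aeval {θ : K →ₗ[ℚ] ℚ} {T T' : Module.End K V}
    (h : IsReplica θ T T') : ∃ p : Polynomial K, T' = Polynomial.aeval T p :=
  (exists_polynomial_replica θ T).elim fun p hp =>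
    ⟨p, h.unique (isReplica_aeval_of_polynomial hp (minpoly.aeval K T))⟩

/-- Replicas are preserved by linear maps between algebras of operators compatible with powers. -/
theorem IsReplica.map {θ : K →ₗ[ℚ] ℚ} {T T' : Module.End K V} (h : IsReplica θ T T')
    (F : Module.End K V →ₗ[K] Module.End K W) (hF : ∀ n : ℕ, F (T ^ n) = F T ^ n) :
    IsReplica θ (F T) (F T') := by
  obtain ⟨p, hp⟩ := exists_polynomial_replica θ T
  have hFp : ∀ q : Polynomial K, F (Polynomial.aeval T q) = Polynomial.aeval (F T) q := by
    intro q
    rw [Polynomial.aeval_eq_sum_range, Polynomial.aeval_eq_sum_range, map_sum]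
    simp [hF]
  rw [h.unique (isReplica_aeval_of_polynomial hp (minpoly.aeval K T)), hFp]
  refine isReplica_aeval_of_polynomial hp ?_
  rw [← hFp, minpoly.aeval, map_zero]

theorem IsReplica.commute {θ : K →ₗ[ℚ] ℚ} {T T' S : Module.End K V} (h : IsReplica θ T T')
    (hS : Commute S T) : Commute S T' := by
  obtain ⟨p, rfl⟩ := h.exists_eq_aeval
  rw [Polynomial.aeval_eq_sum_range]
  exact Commute.sum_right _ _ _ fun i _ => ((hS.pow_right i).smul_right _)

theorem IsReplica.mem_of_forall_mem {θ : K →ₗ[ℚ] ℚ} {T T' : Module.End K V} (h : IsReplica θ T T')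
    {A : Submodule K V} (hT : ∀ a ∈ A, T a ∈ A) : ∀ a ∈ A, T' a ∈ A := by
  obtain ⟨p, rfl⟩ := h.exists_eq_aeval
  have hk : ∀ k : ℕ, ∀ a ∈ A, (T ^ k) a ∈ A := by
    intro k
    induction k with
    | zero => simp
    | succ k ih => intro a ha; rw [pow_succ, Module.End.mul_apply]; exact ih _ (hT a ha)
  intro a ha
  rw [Polynomial.aeval_eq_sum_range, LinearMap.sum_apply]
  exact sum_mem fun i _ => A.smul_mem _ (hk i a ha)

theorem trace_mul_replica {θ : K →ₗ[ℚ] ℚ} {T T' : Module.End K V} (h : IsReplica θ T T') :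
    ∃ s : Finset K, (∀ c, T.maxGenEigenspace c ≠ ⊥ ↔ c ∈ s) ∧
    LinearMap.trace K V (T * T') =
      ∑ c ∈ s, (Module.finrank K (T.maxGenEigenspace c) : K) * (c * ((θ c : ℚ) : K)) := by
  classical
  have hds := DirectSum.isInternal_submodule_of_iSupIndep_of_iSup_eq_top
      T.independent_maxGenEigenspace T.iSup_maxGenEigenspace_eq_top
  have h_fin : {μ | T.maxGenEigenspace μ ≠ ⊥}.Finite :=
    WellFoundedGT.finite_ne_bot_of_iSupIndep T.independent_maxGenEigenspace
  have hT : ∀ c, Set.MapsTo T (T.maxGenEigenspace c) (T.maxGenEigenspace c) :=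
    fun c => T.mapsTo_maxGenEigenspace_of_comm rfl c
  have hTT : ∀ c, Set.MapsTo (T * T') (T.maxGenEigenspace c) (T.maxGenEigenspace c) := by
    intro c x hx
    rw [Module.End.mul_apply, h c x hx, map_smul]
    exact Submodule.smul_mem _ _ (hT c hx)
  refine ⟨h_fin.toFinset, fun c => by simp, ?_⟩
  rw [LinearMap.trace_eq_sum_trace_restrict' hds h_fin hTT]
  refine Finset.sum_congr rfl fun c _ => ?_
  have e1 : (T * T').restrict (hTT c) = ((θ c : ℚ) : K) • T.restrict (hT c) := by
    ext x
    change T (T' x) = ((θ c : ℚ) : K) • T x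
    rw [h c x x.2, map_smul]
  have e2 := LinearMap.trace_comp_eq_mul_of_commute_of_isNilpotent (R := K)
    (M := T.maxGenEigenspace c) c (g := T.restrict (hT c)) (f := 1) (Commute.one_left _) (by
      have := T.isNilpotent_restrict_maxGenEigenspace_sub_algebraMap c
      exact this)
  rw [e1, map_smul, smul_eq_mul]
  have e3 : (1 : Module.End K (T.maxGenEigenspace c)) ∘ₗ T.restrict (hT c) = T.restrict (hT c) :=
      rfl
  rw [e3] at e2
  rw [e2, LinearMap.trace_one]
  ring

/-- An operator orthogonal to all its replicas is nilpotent. -/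
theorem isNilpotent_of_trace_mul_replica {T : Module.End K V}
    (h : ∀ (θ : K →ₗ[ℚ] ℚ) (T' : Module.End K V), IsReplica θ T T' →
      LinearMap.trace K V (T * T') = 0) : IsNilpotent T := by
  have h0 : ∀ c, T.maxGenEigenspace c ≠ ⊥ → c = 0 := by
    intro c hc
    rw [← Module.forall_dual_apply_eq_zero_iff ℚ]
    intro θ
    obtain ⟨T', hT'⟩ := exists_isReplica θ T
    obtain ⟨s, hs, hs'⟩ := trace_mul_replica hT'
    rw [h θ T' hT'] at hs'
    have e := congrArg θ hs'
    rw [map_zero, map_sum] at e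
    have e2 : ∀ d ∈ s, θ ((Module.finrank K (T.maxGenEigenspace d) : K) * (d * ((θ d : ℚ) : K)))
        = (Module.finrank K (T.maxGenEigenspace d) : ℚ) * (θ d) ^ 2 := by
      intro d _
      have : (Module.finrank K (T.maxGenEigenspace d) : K) * (d * ((θ d : ℚ) : K)) =
          ((Module.finrank K (T.maxGenEigenspace d) : ℚ) * θ d) • d := by
        rw [Algebra.smul_def]; simp; ring
      rw [this, map_smul, smul_eq_mul]; ring
    rw [Finset.sum_congr rfl e2, eq_comm, Finset.sum_eq_zero_iff_of_nonneg
      (fun d _ => by positivity)] at e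
    have := e c ((hs c).1 hc)
    have hf : (Module.finrank K (T.maxGenEigenspace c) : ℚ) ≠ 0 := by
      rw [Nat.cast_ne_zero]
      exact fun h0 => hc (Submodule.finrank_eq_zero.1 h0)
    simpa [hf] using this
  have htop : T.maxGenEigenspace 0 = ⊤ := by
    rw [← T.iSup_maxGenEigenspace_eq_top]
    refine le_antisymm (le_iSup _ _) (iSup_le fun c => ?_)
    by_cases hc : T.maxGenEigenspace c = ⊥
    · rw [hc]; exact bot_le
    · rw [h0 c hc]
  rw [T.maxGenEigenspace_eq] at htop
  refine ⟨T.maxGenEigenspaceIndex 0, ?_⟩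
  ext x
  have : x ∈ T.genEigenspace 0 (T.maxGenEigenspaceIndex 0) := htop ▸ Submodule.mem_top
  rw [Module.End.mem_genEigenspace_nat] at this
  simpa using this

end FD

end Replica

/-! ### Trace forms and complete reducibility -/

section TraceForm

variable {K V : Type*} [Field K] [AddCommGroup V] [Module K V] [FiniteDimensional K V]

/-- The trace form is nondegenerate on `S`. -/
def NondegOn (S : Submodule K (Module.End K V)) : Prop :=
  ∀ x ∈ S, (∀ y ∈ S, LinearMap.trace K V (x * y) = 0) → x = 0

/-- The elements of `h` orthogonal to `S` for the trace form. -/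
noncomputable def orthIn (h S : Submodule K (Module.End K V)) : Submodule K (Module.End K V) where
  carrier := {x | x ∈ h ∧ ∀ y ∈ S, LinearMap.trace K V (x * y) = 0}
  add_mem' := fun {x x'} hx hx' => ⟨add_mem hx.1 hx'.1, fun y hy => by
    rw [add_mul, map_add, hx.2 y hy, hx'.2 y hy, add_zero]⟩
  zero_mem' := ⟨zero_mem _, fun y _ => by simp⟩
  smul_mem' := fun c x hx => ⟨h.smul_mem c hx.1, fun y hy => by
    rw [smul_mul_assoc, map_smul, hx.2 y hy, smul_zero]⟩

theorem mem_orthIn {h S : Submodule K (Module.End K V)} {x : Module.End K V} :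
    x ∈ orthIn h S ↔ x ∈ h ∧ ∀ y ∈ S, LinearMap.trace K V (x * y) = 0 := Iff.rfl

theorem trace_bracket_mul (x y z : Module.End K V) :
    LinearMap.trace K V ((x * y - y * x) * z) = LinearMap.trace K V (x * (y * z - z * y)) := by
  have := LinearMap.trace_mul_comm K y (x * z)
  have h2 := LinearMap.trace_mul_comm K (x * z) y
  simp only [sub_mul, mul_sub, map_sub, mul_assoc] at *
  rw [this]

theorem NondegOn.exists_eq_trace {S : Submodule K (Module.End K V)} (hS : NondegOn S)
    (φ : Module.End K V →ₗ[K] K) :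
    ∃ a ∈ S, ∀ y ∈ S, LinearMap.trace K V (a * y) = φ y := by
  let F : S →ₗ[K] Module.Dual K S :=
    ((LinearMap.mul K (Module.End K V)).compr₂ (LinearMap.trace K V)).domRestrict₁₂ S S
  have hF : ∀ x y : S, F x y = LinearMap.trace K V (x.1 * y.1) := fun x y => rfl
  have hinj : Function.Injective F := by
    rw [injective_iff_map_eq_zero]
    intro x hx
    apply Subtype.ext
    refine hS x.1 x.2 fun y hy => ?_
    rw [← hF x ⟨y, hy⟩, hx, LinearMap.zero_apply]
  have hsurj := (LinearMap.injective_iff_surjective_of_finrank_eq_finrank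
    (by rw [Subspace.dual_finrank_eq])).1 hinj
  obtain ⟨a, ha⟩ := hsurj (φ.domRestrict S)
  exact ⟨a.1, a.2, fun y hy => by rw [← hF a ⟨y, hy⟩, ha]; rfl⟩

theorem NondegOn.exists_sub_mem_orthIn {h S : Submodule K (Module.End K V)} (hS : NondegOn S)
    (hSh : S ≤ h) {x : Module.End K V} (hx : x ∈ h) : ∃ a ∈ S, x - a ∈ orthIn h S := by
  obtain ⟨a, ha, haS⟩ := hS.exists_eq_trace ((LinearMap.trace K V).comp (LinearMap.mulLeft K x))
  refine ⟨a, ha, sub_mem hx (hSh ha), fun y hy => ?_⟩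
  rw [sub_mul, map_sub, haS y hy]
  simp

/-- A nilpotent ideal is orthogonal to everything. -/
theorem NondegOn.eq_zero_of_mem_nilpotent_ideal {h S : Submodule K (Module.End K V)}
    (hh : NondegOn h) (hSh : S ≤ h) (hn : ∀ x ∈ S, IsNilpotent x)
    (hid : ∀ x ∈ S, ∀ y ∈ h, y * x - x * y ∈ S) {x : Module.End K V} (hx : x ∈ S) : x = 0 :=
  hh x (hSh hx) fun y hy => trace_mul_eq_zero_of_normalizes S
    (fun a ha b hb => hid b hb a (hSh ha)) hn hx fun z hz => hid z hz y hy

/-- Casimir element of a nondegenerate form pulled back from a trace. -/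
theorem exists_casimir {E A : Type*} [AddCommGroup E] [Module K E] [FiniteDimensional K E]
    [Ring A] [Algebra K A] (τ : A →ₗ[K] K) (hτ : ∀ a b, τ (a * b) = τ (b * a)) (r : E →ₗ[K] A)
    (hr : ∀ x, (∀ y, τ (r x * r y) = 0) → x = 0) :
    ∃ Ω : A, τ Ω = (Module.finrank K E : K) ∧
      (∀ B : Submodule K A, (∀ x y, r x * r y ∈ B) → Ω ∈ B) ∧
      ∀ a : A, (∀ x, ∃ x', a * r x - r x * a = r x') → Commute a Ω := by
  classical
  let B : LinearMap.BilinForm K E := ((LinearMap.mul K A).compr₂ τ).compl₁₂ r r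
  have hB : ∀ x y, B x y = τ (r x * r y) := fun x y => rfl
  have hsymm : B.IsSymm := ⟨fun x y => by simp [hB, hτ (r x)]⟩
  have hnd : B.Nondegenerate := by
    refine ⟨fun x hx => hr x fun y => by rw [← hB]; exact hx y,
      fun x hx => hr x fun y => by rw [hτ, ← hB]; exact hx y⟩
  let b := Module.finBasis K E
  let f := B.dualBasis hnd b
  have hfb : ∀ i j, B (f i) (b j) = if j = i then 1 else 0 := B.apply_dualBasis_left hnd b
  refine ⟨∑ i, r (b i) * r (f i), ?_, ?_, ?_⟩
  · rw [map_sum]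
    have : ∀ i, τ (r (b i) * r (f i)) = 1 := fun i => by
      rw [hτ, ← hB, hfb]; simp
    simp [this]
  · intro C hC
    exact sum_mem fun i _ => hC _ _
  · intro a ha
    choose d hd using ha
    have hbx : ∀ x, x = ∑ k, B (f k) x • b k := by
      intro x
      conv_lhs => rw [← b.sum_repr x]
      refine Finset.sum_congr rfl fun k _ => ?_
      congr 1
      conv_rhs => rw [← b.sum_repr x]
      rw [map_sum]
      simp only [map_smul, smul_eq_mul, hfb]
      simp
    have hfx : ∀ x, x = ∑ k, B x (b k) • f k := by
      intro x
      conv_lhs => rw [← f.sum_repr x]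
      refine Finset.sum_congr rfl fun k _ => ?_
      congr 1
      exact B.dualBasis_repr_apply hnd b x k
    have hskew : ∀ i k, B (f k) (d (b i)) = - B (d (f k)) (b i) := by
      intro i k
      rw [hB, hB, ← hd, ← hd, ← map_neg]
      have e1 := hτ a (r (f k) * r (b i))
      simp only [mul_sub, sub_mul, map_sub, map_neg, mul_assoc] at *
      rw [e1]; ring
    have e : a * (∑ i, r (b i) * r (f i)) - (∑ i, r (b i) * r (f i)) * a =
        ∑ i, (r (d (b i)) * r (f i)) + ∑ i, r (b i) * r (d (f i)) := by
      rw [Finset.mul_sum, Finset.sum_mul, ← Finset.sum_sub_distrib, ← Finset.sum_add_distrib]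
      refine Finset.sum_congr rfl fun i _ => ?_
      rw [← hd, ← hd]; noncomm_ring
    rw [Commute, SemiconjBy, ← sub_eq_zero, e]
    have e1 : ∑ i, (r (d (b i)) * r (f i)) =
        ∑ i, ∑ k, B (f k) (d (b i)) • (r (b k) * r (f i)) := by
      refine Finset.sum_congr rfl fun i _ => ?_
      conv_lhs => rw [hbx (d (b i))]
      simp [map_sum, Finset.sum_mul]
    have e2 : ∑ i, (r (b i) * r (d (f i))) =
        ∑ i, ∑ k, B (d (f i)) (b k) • (r (b i) * r (f k)) := by
      refine Finset.sum_congr rfl fun i _ => ?_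
      conv_lhs => rw [hfx (d (f i))]
      simp [map_sum, Finset.mul_sum]
    rw [e1, e2, Finset.sum_comm, ← Finset.sum_add_distrib]
    refine Finset.sum_eq_zero fun k _ => ?_
    rw [← Finset.sum_add_distrib]
    refine Finset.sum_eq_zero fun i _ => ?_
    rw [hskew, neg_smul, neg_add_cancel]

end TraceForm

section Reductive

variable {K V X : Type*} [Field K] [CharZero K] [IsAlgClosed K] [AddCommGroup V] [Module K V]
  [FiniteDimensional K V] [AddCommGroup X] [Module K X] [FiniteDimensional K X]

/-- Closed under replicas. -/
def ReplicaClosed (h : Submodule K (Module.End K V)) : Prop :=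
  ∀ (θ : K →ₗ[ℚ] ℚ) (T T' : Module.End K V), T ∈ h → IsReplica θ T T' → T' ∈ h

theorem IsReplica.eq_zero_of_isNilpotent {θ : K →ₗ[ℚ] ℚ} {T T' : Module.End K V}
    (h : IsReplica θ T T') (hT : IsNilpotent T) : T' = 0 := by
  ext x
  obtain ⟨k, hk⟩ := hT
  rw [h 0 x (by
    rw [Module.End.mem_maxGenEigenspace]
    exact ⟨k, by simp [hk]⟩)]
  simp

/-- Data of a representation of `h` compatible with replicas. -/
structure IsRep (h : Submodule K (Module.End K V)) (ρ : Module.End K V →ₗ[K] Module.End K X) :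
    Prop where
  bracket : ∀ x ∈ h, ∀ y ∈ h, ρ (x * y - y * x) = ρ x * ρ y - ρ y * ρ x
  replica : ∀ (θ : K →ₗ[ℚ] ℚ) (T T' : Module.End K V), T ∈ h → IsReplica θ T T' →
    IsReplica θ (ρ T) (ρ T')

variable {h : Submodule K (Module.End K V)} {ρ : Module.End K V →ₗ[K] Module.End K X}

theorem IsRep.eq_zero_of_minimal (hbr : BracketClosed h) (hrep : ReplicaClosed h)
    (hnd : NondegOn h) (hρ : IsRep h ρ) {X0 : Submodule K X} (hX0 : X0 ≠ ⊤)
    (hX : ∀ ξ ∈ h, ∀ x, ρ ξ x ∈ X0)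
    (hmin : ∀ Y : Submodule K X, (∀ ξ ∈ h, ∀ y ∈ Y, ρ ξ y ∈ Y) → ¬ Y ≤ X0 → Y = ⊤) :
    ∀ ξ ∈ h, ρ ξ = 0 := by
  set k := h ⊓ LinearMap.ker ρ with hk
  have hkh : k ≤ h := inf_le_left
  have hkρ : ∀ x ∈ k, ρ x = 0 := fun x hx => hx.2
  have hkid : ∀ x ∈ k, ∀ y ∈ h, y * x - x * y ∈ k := fun x hx y hy =>
    ⟨hbr y hy x hx.1, by
      change ρ (y * x - x * y) = 0
      rw [hρ.bracket y hy x hx.1, hkρ x hx, mul_zero, zero_mul, sub_zero]⟩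
  have hort : ∀ x ∈ orthIn h k, ∀ y ∈ h, y * x - x * y ∈ orthIn h k := fun x hx y hy =>
    ⟨hbr y hy x hx.1, fun z hz => by
      have := trace_bracket_mul x y z
      rw [hx.2 _ (hkid z hz y hy)] at this
      rw [← neg_sub, neg_mul, map_neg, this, neg_zero]⟩
  have hknd : NondegOn k := by
    intro x hx hxk
    refine hnd.eq_zero_of_mem_nilpotent_ideal (S := k ⊓ orthIn h k) (inf_le_left.trans hkh)
      (fun y hy => ?_) (fun y hy z hz => ⟨hkid y hy.1 z hz, hort y hy.2 z hz⟩)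
      ⟨hx, hkh hx, hxk⟩
    refine isNilpotent_of_trace_mul_replica fun θ y' hy' => hy.2.2 y' ⟨hrep θ y y' hy.1.1 hy', ?_⟩
    have := hρ.replica θ y y' hy.1.1 hy'
    rw [hkρ y hy.1] at this
    exact this.eq_zero_of_isNilpotent IsNilpotent.zero
  set j := orthIn h k with hj
  have hjh : j ≤ h := fun x hx => hx.1
  have hjnd : ∀ x ∈ j, (∀ y ∈ j, LinearMap.trace K X (ρ x * ρ y) = 0) → x = 0 := by
    have hall : ∀ x ∈ j, (∀ y ∈ j, LinearMap.trace K X (ρ x * ρ y) = 0) →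
        ∀ y ∈ h, LinearMap.trace K X (ρ x * ρ y) = 0 := by
      intro x _ hxj y hy
      obtain ⟨a, ha, hya⟩ := hknd.exists_sub_mem_orthIn hkh hy
      have := hxj _ hya
      rwa [map_sub, hkρ a ha, sub_zero] at this
    let R : Submodule K (Module.End K V) :=
      { carrier := {x | x ∈ j ∧ ∀ y ∈ h, LinearMap.trace K X (ρ x * ρ y) = 0}
        add_mem' := fun {x x'} hx hx' => ⟨add_mem hx.1 hx'.1, fun y hy => by
          rw [map_add, add_mul, map_add, hx.2 y hy, hx'.2 y hy, add_zero]⟩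
        zero_mem' := ⟨zero_mem _, fun y _ => by simp⟩
        smul_mem' := fun c x hx => ⟨j.smul_mem c hx.1, fun y hy => by
          rw [map_smul, smul_mul_assoc, map_smul, hx.2 y hy, smul_zero]⟩ }
    intro x hx hxj
    refine hnd.eq_zero_of_mem_nilpotent_ideal (S := R) (fun x hx => hjh hx.1) ?_ ?_
      (⟨hx, hall x hx hxj⟩ : x ∈ R)
    · rintro y ⟨hyj, hy⟩
      have hnil : IsNilpotent (ρ y) := isNilpotent_of_trace_mul_replica fun θ T' hT' => by
        obtain ⟨y', hy'⟩ := exists_isReplica θ y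
        rw [hT'.unique (hρ.replica θ y y' hyj.1 hy')]
        exact hy y' (hrep θ y y' hyj.1 hy')
      exact isNilpotent_of_trace_mul_replica fun θ y' hy' => hyj.2 y' ⟨hrep θ y y' hyj.1 hy',
        (hρ.replica θ y y' hyj.1 hy').eq_zero_of_isNilpotent hnil⟩
    · rintro y ⟨hyj, hy⟩ z hz
      refine ⟨hort y hyj z hz, fun w hw => ?_⟩
      rw [hρ.bracket z hz y hyj.1]
      have := trace_bracket_mul (ρ y) (ρ z) (ρ w)
      rw [← hρ.bracket z hz w hw, hy _ (hbr z hz w hw)] at this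
      rw [← neg_sub, neg_mul, map_neg, this, neg_zero]
  obtain ⟨Ω, hΩ, hΩmem, hΩcomm⟩ := exists_casimir (LinearMap.trace K X)
    (fun a b => LinearMap.trace_mul_comm K a b) (ρ.domRestrict j) (fun x hx => by
      apply Subtype.ext
      exact hjnd x.1 x.2 fun y hy => hx ⟨y, hy⟩)
  have hΩX : ∀ x, Ω x ∈ X0 := by
    let B : Submodule K (Module.End K X) :=
      { carrier := {T | ∀ x, T x ∈ X0}
        add_mem' := fun ha hb x => add_mem (ha x) (hb x)
        zero_mem' := fun x => zero_mem _
        smul_mem' := fun c T hT x => X0.smul_mem c (hT x) }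
    exact hΩmem B fun x y z => hX x.1 (hjh x.2) _
  have hcomm : ∀ ξ ∈ h, Commute (ρ ξ) Ω := fun ξ hξ => hΩcomm _ fun x =>
    ⟨⟨_, hort x.1 x.2 ξ hξ⟩, (hρ.bracket ξ hξ x.1 (hjh x.2)).symm⟩
  have hnil : IsNilpotent Ω := by
    obtain ⟨n, hn1, hn⟩ := ((LinearMap.eventually_isCompl_ker_pow_range_pow Ω).and
      (Filter.eventually_ge_atTop 1)).exists
    have htop : LinearMap.ker (Ω ^ n) = ⊤ := by
      refine hmin _ (fun ξ hξ y hy => ?_) fun hle => hX0 ?_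
      · rw [LinearMap.mem_ker] at hy ⊢
        rw [← Module.End.mul_apply, ← ((hcomm ξ hξ).pow_right n).eq, Module.End.mul_apply, hy,
          map_zero]
      · rw [eq_top_iff, ← hn1.sup_eq_top]
        refine sup_le hle ?_
        rintro _ ⟨x, rfl⟩
        obtain ⟨m, rfl⟩ := Nat.exists_eq_add_of_le hn
        rw [add_comm, pow_succ']
        exact hΩX _
    exact ⟨n, LinearMap.ker_eq_top.1 htop⟩
  have hj0 : Module.finrank K j = 0 := by
    have := (LinearMap.isNilpotent_trace_of_isNilpotent hnil).eq_zero
    rw [hΩ] at this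
    exact_mod_cast this
  have hjbot : j = ⊥ := Submodule.finrank_eq_zero.1 hj0
  intro ξ hξ
  obtain ⟨a, ha, hξa⟩ := hknd.exists_sub_mem_orthIn hkh hξ
  rw [← hj, hjbot, Submodule.mem_bot, sub_eq_zero] at hξa
  rw [hξa, hkρ a ha]

/-- Complete reducibility in the form: a vector spanning a trivial quotient can be lifted to an
invariant vector. -/
theorem IsRep.exists_invariant (hbr : BracketClosed h) (hrep : ReplicaClosed h)
    (hnd : NondegOn h) (hρ : IsRep h ρ) {X0 : Submodule K X} (hX0 : X0 ≠ ⊤)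
    (hX : ∀ ξ ∈ h, ∀ x, ρ ξ x ∈ X0) : ∃ v, v ∉ X0 ∧ ∀ ξ ∈ h, ρ ξ v = 0 := by
  classical
  let P : ℕ → Prop := fun d => ∃ Y : Submodule K X, Module.finrank K Y = d ∧
    (∀ ξ ∈ h, ∀ y ∈ Y, ρ ξ y ∈ Y) ∧ ¬ Y ≤ X0
  have hP : ∃ d, P d := ⟨_, ⊤, rfl, fun _ _ _ _ => Submodule.mem_top, by rwa [top_le_iff]⟩
  obtain ⟨Y, hYd, hY, hYX0⟩ := Nat.find_spec hP
  have hmin : ∀ Z : Submodule K X, Z ≤ Y → (∀ ξ ∈ h, ∀ y ∈ Z, ρ ξ y ∈ Z) → ¬ Z ≤ X0 → Z = Y := by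
    intro Z hZY hZ hZX0
    refine Submodule.eq_of_le_of_finrank_le hZY ?_
    rw [hYd]
    exact Nat.find_min' hP ⟨Z, rfl, hZ, hZX0⟩
  let ρ0 : h →ₗ[K] Module.End K Y :=
    { toFun := fun ξ => (ρ ξ.1).restrict (hY ξ.1 ξ.2)
      map_add' := fun ξ η => by ext y; simp
      map_smul' := fun c ξ => by ext y; simp }
  obtain ⟨ρ1, hρ1⟩ := ρ0.exists_extend
  have hρ1a : ∀ ξ ∈ h, ∀ y : Y, ((ρ1 ξ y : Y) : X) = ρ ξ y := fun ξ hξ y => by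
    have := congrArg (fun F => ((F ⟨ξ, hξ⟩ y : Y) : X)) hρ1
    exact this
  have hρ1' : IsRep h ρ1 := by
    refine ⟨fun x hx y hy => ?_, fun θ T T' hT hTT' => ?_⟩
    · ext v
      rw [hρ1a _ (hbr x hx y hy), hρ.bracket x hx y hy]
      simp [hρ1a, hx, hy]
    · have e1 : ρ1 T = (ρ T).restrict (hY T hT) := by
        ext v; exact hρ1a T hT v
      have hT' := hrep θ T T' hT hTT'
      have e2 : ρ1 T' = (ρ T').restrict (hY T' hT') := by
        ext v; exact hρ1a T' hT' v
      rw [e1, e2]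
      exact (hρ.replica θ T T' hT hTT').restrict _ _
  have h0 := hρ1'.eq_zero_of_minimal hbr hrep hnd (X0 := X0.comap Y.subtype)
    (by rwa [Ne, Submodule.comap_subtype_eq_top])
    (fun ξ hξ x => by rw [Submodule.mem_comap, Submodule.subtype_apply, hρ1a ξ hξ]; exact hX ξ hξ _)
    (fun Z hZ hZX0 => by
      have := hmin (Z.map Y.subtype) (Submodule.map_subtype_le _ _) (by
        rintro ξ hξ _ ⟨y, hy, rfl⟩
        exact ⟨ρ1 ξ y, hZ ξ hξ y hy, hρ1a ξ hξ y⟩) (by rwa [Submodule.map_le_iff_le_comap])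
      rw [eq_top_iff]
      intro y _
      have hy : (y : X) ∈ Z.map Y.subtype := this.symm ▸ y.2
      obtain ⟨z, hz, hzy⟩ := hy
      rwa [← Subtype.ext hzy])
  obtain ⟨v, hvY, hvX0⟩ := Set.not_subset.1 hYX0
  refine ⟨v, hvX0, fun ξ hξ => ?_⟩
  rw [← hρ1a ξ hξ ⟨v, hvY⟩, h0 ξ hξ]
  rfl

end Reductive

/-! ### Traces on subspaces stable under a Borel subalgebra of `sl₂` -/

section SlTwo

variable {K E : Type*} [Field K] [AddCommGroup E] [Module K E] [FiniteDimensional K E]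

theorem trace_eq_sum_finrank [IsAlgClosed K] (T : Module.End K E) (s : Finset K)
    (hs : ∀ c, T.maxGenEigenspace c ≠ ⊥ → c ∈ s) :
    LinearMap.trace K E T = ∑ c ∈ s, (Module.finrank K (T.maxGenEigenspace c) : K) * c := by
  classical
  have hds := DirectSum.isInternal_submodule_of_iSupIndep_of_iSup_eq_top
      T.independent_maxGenEigenspace T.iSup_maxGenEigenspace_eq_top
  have h_fin : {μ | T.maxGenEigenspace μ ≠ ⊥}.Finite :=
    WellFoundedGT.finite_ne_bot_of_iSupIndep T.independent_maxGenEigenspace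
  have hT : ∀ c, Set.MapsTo T (T.maxGenEigenspace c) (T.maxGenEigenspace c) :=
    fun c => T.mapsTo_maxGenEigenspace_of_comm rfl c
  rw [LinearMap.trace_eq_sum_trace_restrict' hds h_fin hT]
  refine (Finset.sum_subset_zero_on_sdiff (fun c hc => hs c (by simpa using hc)) ?_ ?_)
  · intro c hc
    have : T.maxGenEigenspace c = ⊥ := by
      by_contra hne
      exact (Finset.mem_sdiff.1 hc).2 (by simpa using hne)
    rw [this]; simp
  intro c _
  have e2 := LinearMap.trace_comp_eq_mul_of_commute_of_isNilpotent (R := K)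
    (M := T.maxGenEigenspace c) c (g := T.restrict (hT c)) (f := 1) (Commute.one_left _)
    (T.isNilpotent_restrict_maxGenEigenspace_sub_algebraMap c)
  have e3 : (1 : Module.End K (T.maxGenEigenspace c)) ∘ₗ T.restrict (hT c) = T.restrict (hT c) :=
      rfl
  rw [e3] at e2
  rw [e2, LinearMap.trace_one]
  ring

variable [CharZero K]

theorem apply_pow_of_bracket {h T : Module.End K E} {c : K} (hT : h * T - T * h = c • T) {w : K}
    {x : E} (hx : h x = w • x) (i : ℕ) : h ((T ^ i) x) = (w + c * i) • (T ^ i) x := by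
  induction i with
  | zero => simpa using hx
  | succ i ih =>
    have := LinearMap.congr_fun hT ((T ^ i) x)
    simp only [LinearMap.sub_apply, Module.End.mul_apply, LinearMap.smul_apply, ih,
        map_smul] at this
    rw [pow_succ', Module.End.mul_apply, sub_eq_iff_eq_add.1 this, ← add_smul]
    push_cast; ring_nf

theorem exists_pow_apply_eq_zero {h T : Module.End K E} {c : K} (hc : c ≠ 0)
    (hT : h * T - T * h = c • T) {w : K} {x : E} (hx : h x = w • x) : ∃ i : ℕ, (T ^ i) x = 0 := by
  by_contra! hne
  have : Set.Infinite {μ | h.HasEigenvalue μ} := by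
    refine Set.infinite_of_injective_forall_mem (f := fun i : ℕ => w + c * i) ?_ ?_
    · intro i j hij
      simpa [hc] using hij
    · intro i
      exact Module.End.hasEigenvalue_of_hasEigenvector (x := (T ^ i) x)
        ⟨Module.End.mem_eigenspace_iff.2 (apply_pow_of_bracket hT hx i), hne i⟩
  exact this h.finite_hasEigenvalue

theorem casimir_commute {A : Type*} [Ring A] {h e f : A} (he : h * e - e * h = 2 * e)
    (hef : e * f - f * e = h) : Commute (4 * (f * e) + h * h + 2 * h) e := by
  have h1 : (4 * (f * e) + h * h + 2 * h) * e - e * (4 * (f * e) + h * h + 2 * h) =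
      -4 * (e * f - f * e - h) * e + h * (h * e - e * h - 2 * e) + (h * e - e * h - 2 * e) * h := by
    noncomm_ring
  rw [he, hef, sub_self, sub_self] at h1
  exact sub_eq_zero.1 (by simpa using h1)

theorem casimir_commute_lowering {A : Type*} [Ring A] {h e f : A}
    (hf : h * f - f * h = -2 * f) (hef : e * f - f * e = h) :
    Commute (4 * (f * e) + h * h + 2 * h) f := by
  have h1 : (4 * (f * e) + h * h + 2 * h) * f - f * (4 * (f * e) + h * h + 2 * h) =
      4 * f * (e * f - f * e - h) + h * (h * f - f * h - (-2) * f) +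
      (h * f - f * h - (-2) * f) * h := by
    noncomm_ring
  rw [hf, hef, sub_self, sub_self] at h1
  exact sub_eq_zero.1 (by simpa using h1)

/-- In a finite dimensional representation of `sl₂`, a vector of weight `w` killed by `e ^ (j + 1)`
has integral weight `w ≥ -j`. -/
theorem exists_int_weight {h e f : Module.End K E} (he : h * e - e * h = (2 : K) • e)
    (hf : h * f - f * h = (-2 : K) • f) (hef : e * f - f * e = h) (j : ℕ) :
    ∀ {w : K} {x : E}, x ≠ 0 → h x = w • x → (e ^ (j + 1)) x = 0 → ∃ z : ℤ, w = z ∧ -z ≤ j := by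
  set Ω : Module.End K E := 4 * (f * e) + h * h + 2 * h with hΩ
  have four : ∀ y : E, (4 : Module.End K E) y = (4 : K) • y := fun y => by
    have := Module.End.ofNat_apply (R := K) 4 y
    rw [this]; norm_num [ofNat_smul_eq_nsmul]
  have two : ∀ y : E, (2 : Module.End K E) y = (2 : K) • y := fun y => by
    have := Module.End.ofNat_apply (R := K) 2 y
    rw [this]; norm_num [ofNat_smul_eq_nsmul]
  have hΩe : Commute Ω e := casimir_commute (by rw [he]; ext y; simp [two]) hef
  have hΩf : Commute Ω f := casimir_commute_lowering (by rw [hf]; ext y; simp [two]) hef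
  have hΩapp : ∀ (y : E) (μ : K), h y = μ • y → Ω y = (4 : K) • f (e y) + (μ * μ + 2 * μ) • y := by
    intro y μ hy
    simp only [hΩ, LinearMap.add_apply, Module.End.mul_apply, four, two, hy, map_smul, smul_smul]
    rw [add_smul, add_assoc]
  have key : ∀ (j : ℕ) {w : K} {x : E}, x ≠ 0 → h x = w • x →
      Ω x = ((w + 2 * j) * (w + 2 * j) + 2 * (w + 2 * j)) • x → ∃ z : ℤ, w = z ∧ -z ≤ j := by
    intro j w x hx hw hc
    have hex := exists_pow_apply_eq_zero (by norm_num) hf hw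
    classical
    obtain ⟨i, hi0, hi1⟩ : ∃ i : ℕ, (f ^ i) x ≠ 0 ∧ (f ^ (i + 1)) x = 0 := by
      have := Nat.find_spec hex
      have hpos : Nat.find hex ≠ 0 := fun h0 => hx (by rw [h0] at this; simpa using this)
      obtain ⟨i, hi⟩ := Nat.exists_eq_succ_of_ne_zero hpos
      exact ⟨i, Nat.find_min hex (by omega), by rw [← Nat.succ_eq_add_one, ← hi]; exact this⟩
    set y := (f ^ i) x with hy
    have hfy : f y = 0 := by rw [hy, ← Module.End.mul_apply, ← pow_succ', hi1]
    have hμ := apply_pow_of_bracket hf hw i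
    set μ := w + -2 * (i : K) with hμd
    have hΩy : Ω y = ((w + 2 * j) * (w + 2 * j) + 2 * (w + 2 * j)) • y := by
      have := LinearMap.congr_fun (hΩf.pow_right i).eq x
      simp only [Module.End.mul_apply] at this
      rw [hy, this, hc, map_smul]
    have hefy : f (e y) = - (μ • y) := by
      have := LinearMap.congr_fun hef y
      simp only [LinearMap.sub_apply, Module.End.mul_apply, hfy, map_zero, zero_sub] at this
      rw [hμ] at this
      rw [← this, neg_neg]
    rw [hΩapp y μ hμ, hefy, smul_neg, smul_smul, ← neg_smul, ← add_smul] at hΩy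
    have hq := smul_left_injective K hi0 hΩy
    have hq2 : (2 * w + 2 * j - 2 * i) * (2 * (j + i + 1) : K) = 0 := by
      linear_combination -hq + (-2 + (μ + w + (-2) * (i:K))) * hμd
    have hne : (2 * (j + i + 1) : K) ≠ 0 := by
      have : ((2 * (j + i + 1) : ℕ) : K) ≠ 0 := Nat.cast_ne_zero.2 (by omega)
      exact_mod_cast this
    have h3 := (mul_eq_zero.1 hq2).resolve_right hne
    refine ⟨(i : ℤ) - j, ?_, by omega⟩
    push_cast
    linear_combination h3 / 2
  induction j with
  | zero =>
    intro w x hx hw hex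
    refine key 0 hx hw ?_
    rw [hΩapp x w hw]
    have : e x = 0 := by simpa using hex
    simp [this]
  | succ j ih =>
    intro w x hx hw hex
    set c : K := ((w + 2 * (j + 1 : ℕ)) * (w + 2 * (j + 1 : ℕ)) + 2 * (w + 2 * (j + 1 : ℕ)))
    by_cases h0 : Ω x = c • x
    · exact key (j + 1) hx hw h0
    have hx' : Ω x - c • x ≠ 0 := sub_ne_zero.2 h0
    have hΩh : Ω (h x) = h (Ω x) := by
      have := LinearMap.congr_fun (hef ▸ ((hΩe.mul_right hΩf).sub_right (hΩf.mul_right hΩe))).eq x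
      exact this
    obtain ⟨z, hz, hzj⟩ := ih (w := w) hx' (by
      rw [map_sub, map_smul, ← hΩh, hw, map_smul, smul_sub, smul_comm]) (by
      have hpy := apply_pow_of_bracket he hw (j + 1)
      have hcm := LinearMap.congr_fun (hΩe.pow_right (j + 1)).eq x
      simp only [Module.End.mul_apply] at hcm
      rw [map_sub, map_smul, ← hcm, hΩapp _ _ hpy, ← Module.End.mul_apply e, ← pow_succ', hex,
        map_zero, smul_zero, zero_add, sub_self])
    exact ⟨z, hz, by push_cast; omega⟩

theorem IsSemisimple_maxGenEigenspace {T : Module.End K E} (hT : T.IsSemisimple) (c : K) :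
    T.maxGenEigenspace c = T.eigenspace c :=
  hT.isFinitelySemisimple.maxGenEigenspace_eq_eigenspace c

/-- A subspace of a representation of `sl₂` stable under `h` and `e` has nonnegative `h`-trace;
here is a criterion for positivity. -/
theorem exists_pos_trace_restrict [IsAlgClosed K] {h e f : Module.End K E}
    (he : h * e - e * h = (2 : K) • e)
    (hf : h * f - f * h = (-2 : K) • f) (hef : e * f - f * e = h) (hss : h.IsSemisimple)
    {n : Submodule K E} (hn : ∀ x ∈ n, h x ∈ n) (hne : ∀ x ∈ n, e x ∈ n) {ν : E} (hν : ν ∈ n)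
    (hν2 : h ν = (2 : K) • ν) (hνe : ∀ x ∈ n, e (e x) ≠ ν) :
    ∃ q : ℚ, 0 < q ∧ LinearMap.trace K n (h.restrict hn) = q := by
  classical
  set T : Module.End K n := h.restrict hn with hT
  set S : Module.End K n := e.restrict hne with hS
  have hTss : T.IsSemisimple := hss.restrict (p := n) (by
    rw [Module.End.mem_invtSubmodule]; exact hn)
  have hTS : T * S - S * T = (2 : K) • S := by
    ext x
    exact LinearMap.congr_fun he x.1
  have hmem : ∀ (c : K) (x : n), x ∈ T.maxGenEigenspace c ↔ T x = c • x := fun c x => by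
    rw [IsSemisimple_maxGenEigenspace hTss, Module.End.mem_eigenspace_iff]
  have hSpow : ∀ (k : ℕ) (x : n), (((S ^ k) x : n) : E) = (e ^ k) x := by
    intro k x
    induction k with
    | zero => rfl
    | succ k ih =>
      rw [pow_succ', pow_succ', Module.End.mul_apply, Module.End.mul_apply, ← ih]; rfl
  have hint : ∀ c, T.maxGenEigenspace c ≠ ⊥ → ∃ z : ℤ, (z : K) = c := by
    intro c hc
    obtain ⟨x, hx, hx0⟩ := Submodule.exists_mem_ne_zero_of_ne_bot hc
    have hx1 : h x.1 = c • x.1 := congrArg Subtype.val ((hmem c x).1 hx)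
    obtain ⟨i, hi⟩ := exists_pow_apply_eq_zero (by norm_num) he hx1
    obtain ⟨z, hz, _⟩ := exists_int_weight he hf hef i (fun h0 => hx0 (Subtype.ext h0)) hx1
      (by rw [pow_succ', Module.End.mul_apply, hi, map_zero])
    exact ⟨z, hz.symm⟩
  have h_fin : {μ | T.maxGenEigenspace μ ≠ ⊥}.Finite :=
    WellFoundedGT.finite_ne_bot_of_iSupIndep T.independent_maxGenEigenspace
  obtain ⟨M, hM⟩ : ∃ M : ℕ, ∀ z : ℤ, T.maxGenEigenspace (z : K) ≠ ⊥ → z ∈ Finset.Icc (-(M :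
      ℤ)) M := by
    have h2 : {z : ℤ | T.maxGenEigenspace (z : K) ≠ ⊥}.Finite :=
      h_fin.preimage (Int.cast_injective.injOn)
    obtain ⟨M, hM⟩ := (h2.image Int.natAbs).bddAbove
    refine ⟨M, fun z hz => ?_⟩
    have := hM ⟨z, hz, rfl⟩
    rw [Finset.mem_Icc]; omega
  set d : ℤ → ℕ := fun z => Module.finrank K (T.maxGenEigenspace (z : K)) with hd
  let φ : ∀ k : ℕ, T.maxGenEigenspace ((-(k : ℤ) : ℤ) : K) →ₗ[K] T.maxGenEigenspace ((k : ℤ) : K) :=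
    fun k => (S ^ k).restrict (fun x hx => by
      have hx := (hmem _ _).1 hx
      refine (hmem _ _).2 ?_
      rw [apply_pow_of_bracket hTS hx]
      push_cast; ring_nf)
  have hφ : ∀ (k : ℕ) x, (((φ k x : n)) : E) = (e ^ k) ((x : n) : E) := fun k x => hSpow k x
  have hφinj : ∀ k, Function.Injective (φ k) := by
    intro k
    rw [injective_iff_map_eq_zero]
    intro x hx
    by_contra hx0
    have hx1 : h x.1.1 = (((-(k : ℤ)) : ℤ) : K) • x.1.1 :=
      congrArg Subtype.val ((hmem _ x.1).1 x.2)
    have hx2 : (e ^ k) x.1.1 = 0 := by rw [← hφ, hx]; rfl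
    have hx3 : x.1.1 ≠ 0 := fun h0 => hx0 (Subtype.ext (Subtype.ext h0))
    cases k with
    | zero => exact hx3 (by simpa using hx2)
    | succ k =>
      obtain ⟨z, hz, hzj⟩ := exists_int_weight he hf hef k hx3 hx1 hx2
      have := Int.cast_injective hz
      omega
  have hle : ∀ k : ℕ, d (-k) ≤ d k := fun k =>
    LinearMap.finrank_le_finrank_of_injective (hφinj k)
  have hlt : d (-2) < d 2 := by
    refine lt_of_le_of_ne (hle 2) fun heq => ?_
    have hsurj := (LinearMap.injective_iff_surjective_of_finrank_eq_finrank heq).1 (hφinj 2)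
    obtain ⟨x, hx⟩ := hsurj ⟨⟨ν, hν⟩, (hmem _ _).2 (Subtype.ext (by
      change h ν = ((2 : ℤ) : K) • ν
      rw [hν2]; norm_num))⟩
    refine hνe x.1.1 x.1.2 ?_
    have := hφ 2 x
    rw [hx] at this
    rw [← Module.End.mul_apply, ← sq]
    exact this.symm
  have htr : LinearMap.trace K n T = ((∑ z ∈ Finset.Icc (-(M : ℤ)) M, (d z : ℤ) * z : ℤ) : K) := by
    rw [trace_eq_sum_finrank T ((Finset.Icc (-(M : ℤ)) M).image (fun z : ℤ => (z : K))) (by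
      intro c hc
      obtain ⟨z, rfl⟩ := hint c hc
      exact Finset.mem_image_of_mem _ (hM z hc))]
    rw [Finset.sum_image (fun a _ b _ hab => Int.cast_injective hab)]
    push_cast; rfl
  have hrefl : ∑ z ∈ Finset.Icc (-(M : ℤ)) M, (d z : ℤ) * z =
      ∑ z ∈ Finset.Icc (-(M : ℤ)) M, (d (-z) : ℤ) * (-z) :=
    Finset.sum_nbij' (fun z => -z) (fun z => -z) (by simp; omega) (by simp; omega) (by simp)
      (by simp) (by simp)
  set Z := ∑ z ∈ Finset.Icc (-(M : ℤ)) M, (d z : ℤ) * z with hZ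
  have h2Z : 2 * Z = ∑ z ∈ Finset.Icc (-(M : ℤ)) M, ((d z : ℤ) - d (-z)) * z := by
    rw [two_mul]
    nth_rewrite 2 [hrefl]
    rw [hZ, ← Finset.sum_add_distrib]
    exact Finset.sum_congr rfl fun z _ => by ring
  have hpos : 0 < 2 * Z := by
    rw [h2Z]
    refine Finset.sum_pos' (fun z _ => ?_) ⟨2, ?_, ?_⟩
    · obtain ⟨k, rfl | rfl⟩ := z.eq_nat_or_neg
      · exact mul_nonneg (by have := hle k; omega) (by omega)
      · rw [neg_neg]
        exact mul_nonneg_of_nonpos_of_nonpos (by have := hle k; omega) (by omega)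
    · refine hM 2 fun h0 => ?_
      have : d 2 = 0 := by
        simp only [hd]; rw [h0]; simp
      omega
    · omega
  exact ⟨Z, by exact_mod_cast (by omega : 0 < Z), by rw [htr]; simp⟩

end SlTwo

/-! ### Commutator operators and rational semisimple operators -/

section Ad

variable {K V W : Type*} [Field K] [AddCommGroup V] [Module K V] [AddCommGroup W] [Module K W]

/-- `adL x y = x * y - y * x`. -/
noncomputable def adL : Module.End K V →ₗ[K] Module.End K (Module.End K V) where
  toFun x := LinearMap.mulLeft K x - LinearMap.mulRight K x
  map_add' x y := by ext z : 1; simp [add_mul, mul_add]; abel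
  map_smul' c x := by ext z : 1; simp [smul_sub]

@[simp] theorem adL_apply (x y : Module.End K V) : adL x y = x * y - y * x := rfl

theorem adL_eq (x : Module.End K V) : adL x = LinearMap.mulLeft K x - LinearMap.mulRight K x := rfl

theorem adL_bracket (x y : Module.End K V) :
    adL (x * y - y * x) = adL x * adL y - adL y * adL x := by
  ext z : 1
  simp only [adL_apply, LinearMap.sub_apply, Module.End.mul_apply]
  noncomm_ring

theorem isNilpotent_adL {x : Module.End K V} (h : IsNilpotent x) : IsNilpotent (adL x) :=
  (LinearMap.commute_mulLeft_right x x).isNilpotent_sub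
    (by rwa [LinearMap.isNilpotent_mulLeft_iff]) (by rwa [LinearMap.isNilpotent_mulRight_iff])

theorem commute_adL {x y : Module.End K V} (h : Commute x y) : Commute (adL x) (adL y) := by
  have := adL_bracket x y
  rw [h.eq, sub_self, map_zero] at this
  exact (sub_eq_zero.1 this.symm)

variable [FiniteDimensional K V] [FiniteDimensional K W]

theorem trace_adL_mul (x y z : Module.End K V) :
    LinearMap.trace K V (adL x y * z) = - LinearMap.trace K V (y * adL x z) := by
  have h := trace_bracket_mul y x z
  rw [adL_apply, adL_apply, ← h, ← map_neg, ← neg_mul, neg_sub]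

theorem bracketClosed_map_adL {S : Submodule K (Module.End K V)} (hS : BracketClosed S) :
    BracketClosed (S.map adL) := by
  rintro _ ⟨x, hx, rfl⟩ _ ⟨y, hy, rfl⟩
  exact ⟨_, hS x hx y hy, adL_bracket x y⟩

/-- Engel's theorem for the adjoint action. -/
theorem exists_mem_not_mem_of_engel_adL {S : Submodule K (Module.End K V)}
    (hS : BracketClosed S) (hn : ∀ x ∈ S, IsNilpotent x) {A B : Submodule K (Module.End K V)}
    (hAB : ¬ B ≤ A) (hB : ∀ x ∈ S, ∀ b ∈ B, x * b - b * x ∈ B) :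
    ∃ b ∈ B, b ∉ A ∧ ∀ x ∈ S, x * b - b * x ∈ A := by
  obtain ⟨b, hb, hbA, h⟩ := exists_mem_not_mem_of_engel (S.map adL) (bracketClosed_map_adL hS)
    (by rintro _ ⟨x, hx, rfl⟩; exact isNilpotent_adL (hn x hx)) A B hAB
    (by rintro _ ⟨x, hx, rfl⟩ b hb; exact hB x hx b hb)
  exact ⟨b, hb, hbA, fun x hx => h _ ⟨x, hx, rfl⟩⟩

variable [CharZero K] [IsAlgClosed K]

theorem IsReplica.adL {θ : K →ₗ[ℚ] ℚ} {T T' : Module.End K V} (h : IsReplica θ T T') :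
    IsReplica θ (adL T) (adL T') := by
  have hl : IsReplica θ (LinearMap.mulLeft K T) (LinearMap.mulLeft K T') :=
    h.map (LinearMap.mul K (Module.End K V)) fun n => (LinearMap.pow_mulLeft K _ T n).symm
  have hr : IsReplica θ (-LinearMap.mulRight K T) (-LinearMap.mulRight K T') :=
    (h.map ((LinearMap.mul K (Module.End K V)).flip) fun n =>
      (LinearMap.pow_mulRight K _ T n).symm).neg
  refine isReplica_of_iSup_replicaSpace (top_le_iff.1 ?_)
  have key : ∀ (c d : K), ∀ v ∈ replicaSpace θ (LinearMap.mulLeft K T) (LinearMap.mulLeft K T') c,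
      ∀ w ∈ replicaSpace θ (-LinearMap.mulRight K T) (-LinearMap.mulRight K T') d,
      v * w ∈ replicaSpace θ (Richardson.adL T) (Richardson.adL T') (c + d) := by
    intro c d v hv w hw
    refine mem_replicaSpace_bilin (b := LinearMap.mul K (Module.End K V))
      ?_ ?_ hv hw
    · intro v w; simp [adL_apply, mul_assoc]; noncomm_ring
    · intro v w; simp [adL_apply, mul_assoc]; noncomm_ring
  rw [← hr.iSup_replicaSpace]
  refine iSup_le fun d w hw => ?_
  have h1 : (1 : Module.End K V) ∈
      ⨆ c, replicaSpace θ (LinearMap.mulLeft K T) (LinearMap.mulLeft K T') c := by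
    rw [hl.iSup_replicaSpace]; trivial
  have h2 : (⨆ c, replicaSpace θ (LinearMap.mulLeft K T) (LinearMap.mulLeft K T') c) ≤
      (⨆ c, replicaSpace θ (Richardson.adL T) (Richardson.adL T') c).comap
          (LinearMap.mulRight K w) :=
    iSup_le fun c v hv => Submodule.mem_iSup_of_mem _ (key c d v hv w hw)
  simpa using h2 h1

/-- Semisimple operators with rational eigenvalues. -/
def RatSS (T : Module.End K V) : Prop :=
  T.IsSemisimple ∧ ∀ c, T.HasEigenvalue c → ∃ r : ℚ, (r : K) = c

theorem isSemisimple_of_iSup_eigenspace_eq_top {T : Module.End K V}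
    (h : ⨆ c, T.eigenspace c = ⊤) : T.IsSemisimple := by
  classical
  set s := (T.finite_hasEigenvalue).toFinset
  refine Module.End.isSemisimple_of_squarefree_aeval_eq_zero
    (p := ∏ c ∈ s, (Polynomial.X - Polynomial.C c)) ?_ ?_
  · refine Polynomial.Separable.squarefree ?_
    exact Polynomial.separable_prod_X_sub_C_iff'.2 fun _ _ _ _ h => h
  · rw [← LinearMap.ker_eq_top, ← top_le_iff, ← h]
    refine iSup_le fun c x hx => ?_
    by_cases hx0 : x = 0
    · rw [hx0]; exact zero_mem _
    have hc : c ∈ s := by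
      simp only [s, Set.Finite.mem_toFinset]
      exact Module.End.hasEigenvalue_of_hasEigenvector ⟨hx, hx0⟩
    rw [LinearMap.mem_ker, Module.End.aeval_apply_of_hasEigenvector ⟨hx, hx0⟩]
    rw [Polynomial.eval_prod, Finset.prod_eq_zero hc (by simp), zero_smul]

theorem hasEigenvalue_mem_range {ι : Type*} {T : Module.End K V} (f : ι → K)
    (h : ⨆ i, T.eigenspace (f i) = ⊤) {c : K} (hc : T.HasEigenvalue c) : ∃ i, f i = c := by
  by_contra! hne
  refine hc ?_
  have := T.eigenspaces_iSupIndep c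
  rw [← disjoint_self]
  refine this.mono_right (le_top.trans ?_)
  rw [← h]
  exact iSup_le fun i => le_iSup₂_of_le (f i) (hne i) le_rfl

theorem RatSS.of_iSup {T : Module.End K V} (h : ⨆ r : ℚ, T.eigenspace (r : K) = ⊤) : RatSS T :=
  ⟨isSemisimple_of_iSup_eigenspace_eq_top (top_le_iff.1 (h.symm.trans_le
    (iSup_le fun r => le_iSup (fun c => T.eigenspace c) (r : K)))),
    fun _ hc => hasEigenvalue_mem_range _ h hc⟩

theorem IsReplica.ratSS {θ : K →ₗ[ℚ] ℚ} {T T' : Module.End K V} (h : IsReplica θ T T') :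
    RatSS T' := by
  refine RatSS.of_iSup (top_le_iff.1 ?_)
  rw [← T.iSup_maxGenEigenspace_eq_top]
  exact iSup_le fun c x hx => Submodule.mem_iSup_of_mem (θ c)
    (Module.End.mem_eigenspace_iff.2 (h c x hx))

theorem RatSS.zero : RatSS (0 : Module.End K V) :=
  RatSS.of_iSup (top_le_iff.1 fun x _ => Submodule.mem_iSup_of_mem (0 : ℚ)
    (Module.End.mem_eigenspace_iff.2 (by simp)))

/-- Commuting operators on a nonzero space have a common eigenvector. -/
theorem exists_common_eigenvector {S T : Module.End K V} (h : Commute S T) {c : K}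
    (hc : T.HasEigenvalue c) : ∃ a : K, ∃ v : V, v ≠ 0 ∧ S v = a • v ∧ T v = c • v := by
  have hS : ∀ x ∈ T.eigenspace c, S x ∈ T.eigenspace c := by
    intro x hx
    rw [Module.End.mem_eigenspace_iff] at hx ⊢
    rw [← Module.End.mul_apply, ← h.eq, Module.End.mul_apply, hx, map_smul]
  have : Nontrivial (T.eigenspace c) := (Submodule.nontrivial_iff_ne_bot).2 hc
  obtain ⟨a, ha⟩ := Module.End.exists_eigenvalue (S.restrict hS)
  obtain ⟨v, hv⟩ := ha.exists_hasEigenvector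
  refine ⟨a, v.1, fun h0 => hv.2 (Subtype.ext h0), ?_, Module.End.mem_eigenspace_iff.1 v.2⟩
  exact congrArg Subtype.val (Module.End.mem_eigenspace_iff.1 hv.1)

theorem RatSS.add_smul {S T : Module.End K V} (hS : RatSS S) (hT : RatSS T) (h : Commute S T)
    (r : ℚ) : RatSS (S + (r : K) • T) := by
  refine ⟨hS.1.add_of_commute (h.smul_right _) (Module.End.IsSemisimple_smul _ hT.1),
    fun c hc => ?_⟩
  obtain ⟨a, v, hv0, ha, hcv⟩ := exists_common_eigenvector (S := S)
    ((Commute.refl S).add_right (h.smul_right (r : K))) hc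
  have hTv : (r : K) • T v = (c - a) • v := by
    rw [sub_smul, ← hcv, ← ha]; simp
  obtain ⟨q, hq⟩ := hS.2 a (Module.End.hasEigenvalue_of_hasEigenvector
    ⟨Module.End.mem_eigenspace_iff.2 ha, hv0⟩)
  by_cases hr : (r : K) = 0
  · rw [hr, zero_smul] at hTv
    refine ⟨q, ?_⟩
    rw [hq]
    exact (sub_eq_zero.1 ((smul_eq_zero.1 hTv.symm).resolve_right hv0)).symm
  · have : T v = ((r : K)⁻¹ * (c - a)) • v := by
      rw [mul_smul, ← hTv, smul_smul, inv_mul_cancel₀ hr, one_smul]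
    obtain ⟨q', hq'⟩ := hT.2 _ (Module.End.hasEigenvalue_of_hasEigenvector
      ⟨Module.End.mem_eigenspace_iff.2 this, hv0⟩)
    refine ⟨r * q' + q, ?_⟩
    push_cast
    rw [hq', hq, mul_inv_cancel_left₀ hr]; ring

theorem RatSS.eq_zero_of_isNilpotent {T : Module.End K V} (hT : T.IsSemisimple)
    (hn : IsNilpotent T) : T = 0 :=
  Module.End.eq_zero_of_isNilpotent_isSemisimple hn hT

theorem hasEigenvalue_of_mul_eq {T a : Module.End K V} {c : K} (ha : a ≠ 0)
    (h : T * a = c • a ∨ a * T = c • a) : T.HasEigenvalue c := by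
  rw [Module.End.hasEigenvalue_iff_mem_spectrum, spectrum.mem_iff]
  rintro ⟨u, hu⟩
  rcases h with h | h
  · have h2 : (u : Module.End K V) * a = 0 := by
      rw [hu, sub_mul, h, Algebra.algebraMap_eq_smul_one, smul_mul_assoc, one_mul, sub_self]
    exact ha (by simpa using congrArg (fun z => (↑u⁻¹ : Module.End K V) * z) h2)
  · have h2 : a * (u : Module.End K V) = 0 := by
      rw [hu, mul_sub, h, Algebra.algebraMap_eq_smul_one, mul_smul_comm, mul_one, sub_self]
    refine ha ?_
    have := congrArg (fun z => z * (↑u⁻¹ : Module.End K V)) h2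
    simpa [mul_assoc] using this

theorem isSemisimple_adL {T : Module.End K V} (hT : T.IsSemisimple) : (adL T).IsSemisimple := by
  let _ := LieRing.ofAssociativeRing (A := Module.End K V)
  exact LieAlgebra.ad_isSemisimple_of_isSemisimple hT

theorem RatSS.adL {T : Module.End K V} (hT : RatSS T) : RatSS (adL T) := by
  refine ⟨isSemisimple_adL hT.1, fun c hc => ?_⟩
  obtain ⟨a, v, hv0, ha, hcv⟩ := exists_common_eigenvector (S := LinearMap.mulLeft K T)
    ((Commute.refl _).sub_right (LinearMap.commute_mulLeft_right T T)) hc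
  rw [← adL_eq, adL_apply, sub_eq_iff_eq_add] at hcv
  have ha' : T * v = a • v := ha
  have hr : v * T = (a - c) • v := by
    rw [sub_smul, ← ha', hcv]; abel
  obtain ⟨q, hq⟩ := hT.2 a (hasEigenvalue_of_mul_eq hv0 (Or.inl ha'))
  obtain ⟨q', hq'⟩ := hT.2 _ (hasEigenvalue_of_mul_eq hv0 (Or.inr hr))
  exact ⟨q - q', by push_cast; rw [hq, hq']; ring⟩

theorem RatSS.restrict {T : Module.End K V} (hT : RatSS T) {p : Submodule K V}
    (hp : ∀ x ∈ p, T x ∈ p) : RatSS (T.restrict hp : Module.End K p) := by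
  refine ⟨hT.1.restrict (p := p) (by rw [Module.End.mem_invtSubmodule]; exact hp), fun c hc => ?_⟩
  obtain ⟨v, hv⟩ := hc.exists_hasEigenvector
  exact hT.2 c (Module.End.hasEigenvalue_of_hasEigenvector (x := v.1)
    ⟨Module.End.mem_eigenspace_iff.2 (congrArg Subtype.val (Module.End.mem_eigenspace_iff.1 hv.1)),
      fun h0 => hv.2 (Subtype.ext h0)⟩)

/-- The trace of a rational semisimple operator is rational. -/
theorem RatSS.exists_trace_eq {T : Module.End K V} (hT : RatSS T) :
    ∃ q : ℚ, LinearMap.trace K V T = q := by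
  have h_fin : {μ | T.maxGenEigenspace μ ≠ ⊥}.Finite :=
    WellFoundedGT.finite_ne_bot_of_iSupIndep T.independent_maxGenEigenspace
  rw [trace_eq_sum_finrank T h_fin.toFinset (by simp)]
  refine Finset.sum_induction _ (fun x : K => ∃ q : ℚ, x = q) ?_ ⟨0, by simp⟩ ?_
  · rintro _ _ ⟨a, rfl⟩ ⟨b, rfl⟩
    exact ⟨a + b, by simp⟩
  · intro c hc
    obtain ⟨r, rfl⟩ := hT.2 c (by
      have : T.maxGenEigenspace c ≠ ⊥ := by simpa using hc
      rw [IsSemisimple_maxGenEigenspace hT.1] at this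
      exact this)
    exact ⟨Module.finrank K (T.maxGenEigenspace (r : K)) * r, by push_cast; rfl⟩

/-- The fixed part of a semisimple operator on a stable subspace is a complement of the image. -/
theorem exists_ker_add_range {T : Module.End K V} (hT : T.IsSemisimple) {p : Submodule K V}
    (hp : ∀ x ∈ p, T x ∈ p) {x : V} (hx : x ∈ p) :
    ∃ x0 ∈ p, T x0 = 0 ∧ ∃ y ∈ p, x = x0 + T y := by
  have hTp : Module.End.IsSemisimple (T.restrict hp : Module.End K p) :=
    hT.restrict (p := p) (by rw [Module.End.mem_invtSubmodule]; exact hp)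
  have h1 : (⟨x, hx⟩ : p) ∈ ⨆ c : K, Module.End.eigenspace (T.restrict hp : Module.End K p) c := by
    rw [hTp.iSup_eigenspace_eq_top]; trivial
  have h2 : (⨆ c : K, Module.End.eigenspace (T.restrict hp : Module.End K p) c) ≤
      LinearMap.ker (T.restrict hp) ⊔ LinearMap.range (T.restrict hp) := by
    refine iSup_le fun c v hv => ?_
    rw [Module.End.mem_eigenspace_iff] at hv
    by_cases hc : c = 0
    · exact Submodule.mem_sup_left (by rw [LinearMap.mem_ker, hv, hc, zero_smul])
    · exact Submodule.mem_sup_right ⟨c⁻¹ • v, by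
        rw [map_smul, hv, smul_smul, inv_mul_cancel₀ hc, one_smul]⟩
  obtain ⟨y, hy, z, ⟨w, rfl⟩, hyz⟩ := Submodule.mem_sup.1 (h2 h1)
  exact ⟨y.1, y.2, congrArg Subtype.val hy, w.1, w.2, (congrArg Subtype.val hyz).symm⟩

/-- A linear form on a stable subspace of a semisimple operator is nonzero on some eigenvector. -/
theorem exists_eigenvector_of_ne_zero {T : Module.End K V} (hT : T.IsSemisimple)
    {p : Submodule K V} (hp : ∀ x ∈ p, T x ∈ p) (φ : V →ₗ[K] K) {x : V} (hx : x ∈ p)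
    (hφ : φ x ≠ 0) : ∃ c : K, ∃ z ∈ p, T z = c • z ∧ φ z ≠ 0 := by
  by_contra! hne
  have hTp : Module.End.IsSemisimple (T.restrict hp : Module.End K p) :=
    hT.restrict (p := p) (by rw [Module.End.mem_invtSubmodule]; exact hp)
  have h1 : (⟨x, hx⟩ : p) ∈ ⨆ c : K, Module.End.eigenspace (T.restrict hp : Module.End K p) c := by
    rw [hTp.iSup_eigenspace_eq_top]; trivial
  have h2 : (⨆ c : K, Module.End.eigenspace (T.restrict hp : Module.End K p) c) ≤
      LinearMap.ker (φ.comp p.subtype) := iSup_le fun c v hv =>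
    hne c v.1 v.2 (congrArg Subtype.val (Module.End.mem_eigenspace_iff.1 hv))
  exact hφ (h2 h1)

end Ad

/-! ### Parabolic subalgebras attached to Lie algebras of nilpotent operators -/

section Parabolic

variable {K V : Type*} [Field K] [AddCommGroup V] [Module K V]

/-- Stability of a space of operators under conjugation by a group of invertible operators. -/
def ConjStable (Γ : Subgroup (Module.End K V)ˣ) (S : Submodule K (Module.End K V)) : Prop :=
  ∀ γ ∈ Γ, ∀ x ∈ S, (γ : Module.End K V) * x * (↑γ⁻¹ : Module.End K V) ∈ S

/-- The normalizer of `n` in `h`. -/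
noncomputable def normIn (h n : Submodule K (Module.End K V)) : Submodule K (Module.End K V) where
  carrier := {x | x ∈ h ∧ ∀ ν ∈ n, x * ν - ν * x ∈ n}
  add_mem' := fun {x y} hx hy => ⟨add_mem hx.1 hy.1, fun ν hν => by
    have := add_mem (hx.2 ν hν) (hy.2 ν hν)
    convert this using 1; noncomm_ring⟩
  zero_mem' := ⟨zero_mem _, fun ν _ => by simp⟩
  smul_mem' := fun c x hx => ⟨Submodule.smul_mem _ c hx.1, fun ν hν => by
    have := Submodule.smul_mem _ c (hx.2 ν hν)
    rwa [smul_sub, ← smul_mul_assoc, ← mul_smul_comm] at this⟩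

theorem BracketClosed.normIn {h n : Submodule K (Module.End K V)} (hbr : BracketClosed h) :
    BracketClosed (normIn h n) := fun x hx y hy => ⟨hbr x hx.1 y hy.1, fun ν hν => by
  have := sub_mem (hx.2 _ (hy.2 ν hν)) (hy.2 _ (hx.2 ν hν))
  convert this using 1; noncomm_ring⟩

theorem conj_bracket (γ : (Module.End K V)ˣ) (x y : Module.End K V) :
    (γ : Module.End K V) * (x * y - y * x) * (↑γ⁻¹ : Module.End K V) =
    (γ * x * (↑γ⁻¹ : Module.End K V)) * (γ * y * (↑γ⁻¹ : Module.End K V)) -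
    (γ * y * (↑γ⁻¹ : Module.End K V)) * (γ * x * (↑γ⁻¹ : Module.End K V)) := by
  simp only [mul_sub, sub_mul, mul_assoc, Units.inv_mul_cancel_left]

theorem conj_conj_inv (γ : (Module.End K V)ˣ) (x : Module.End K V) :
    (γ : Module.End K V) * ((↑γ⁻¹ : Module.End K V) * x * γ) * (↑γ⁻¹ : Module.End K V) = x := by
  simp only [mul_assoc, Units.mul_inv, Units.mul_inv_cancel_left, mul_one]

theorem ConjStable.inv_mem {Γ : Subgroup (Module.End K V)ˣ} {S : Submodule K (Module.End K V)}
    (h : ConjStable Γ S) {γ : (Module.End K V)ˣ} (hγ : γ ∈ Γ) {x : Module.End K V} (hx : x ∈ S) :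
    (↑γ⁻¹ : Module.End K V) * x * γ ∈ S := by
  simpa using h γ⁻¹ (Subgroup.inv_mem Γ hγ) x hx

theorem ConjStable.normIn {Γ : Subgroup (Module.End K V)ˣ} {h n : Submodule K (Module.End K V)}
    (hh : ConjStable Γ h) (hn : ConjStable Γ n) : ConjStable Γ (normIn h n) :=
  fun γ hγ x hx => ⟨hh γ hγ x hx.1, fun ν hν => by
    have := hn γ hγ _ (hx.2 _ (hn.inv_mem hγ hν))
    rwa [conj_bracket, conj_conj_inv] at this⟩

theorem trace_conj_mul (γ : (Module.End K V)ˣ) (x y : Module.End K V) :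
    LinearMap.trace K V ((γ * x * (↑γ⁻¹ : Module.End K V)) * y) =
    LinearMap.trace K V (x * ((↑γ⁻¹ : Module.End K V) * y * γ)) := by
  rw [mul_assoc, mul_assoc, LinearMap.trace_mul_comm]
  simp only [mul_assoc]

theorem ConjStable.orthIn {Γ : Subgroup (Module.End K V)ˣ} {h n : Submodule K (Module.End K V)}
    (hh : ConjStable Γ h) (hn : ConjStable Γ n) : ConjStable Γ (orthIn h n) :=
  fun γ hγ x hx => ⟨hh γ hγ x hx.1, fun ν hν => by
    rw [trace_conj_mul]; exact hx.2 _ (hn.inv_mem hγ hν)⟩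

variable [FiniteDimensional K V]

theorem NondegOn.orthIn_orthIn_le {h S : Submodule K (Module.End K V)} (hnd : NondegOn h)
    (hS : S ≤ h) : orthIn h (orthIn h S) ≤ S := by
  intro x hx
  by_contra hxS
  obtain ⟨φ, hφ, hφS⟩ := Submodule.exists_le_ker_of_notMem hxS
  obtain ⟨a, ha, hay⟩ := hnd.exists_eq_trace φ
  refine hφ ?_
  rw [← hay x hx.1, LinearMap.trace_mul_comm]
  exact hx.2 a ⟨ha, fun y hy => by rw [hay y (hS hy)]; exact hφS hy⟩

variable [CharZero K] [IsAlgClosed K]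

theorem ReplicaClosed.normIn {h n : Submodule K (Module.End K V)} (hrep : ReplicaClosed h) :
    ReplicaClosed (normIn h n) := fun θ T T' hT hTT' =>
  ⟨hrep θ T T' hT.1 hTT', fun ν hν => hTT'.adL.mem_of_forall_mem (A := n)
    (fun a ha => hT.2 a ha) ν hν⟩

/-- A stable Lie algebra of nilpotent operators is contained in one which is the orthogonal of its
normalizer. -/
theorem exists_le_orthIn_normIn {Γ : Subgroup (Module.End K V)ˣ}
    {h n0 : Submodule K (Module.End K V)} (hbr : BracketClosed h) (hrep : ReplicaClosed h)
    (hnd : NondegOn h) (hΓ : ConjStable Γ h) (hn0 : n0 ≤ h) (hn0br : BracketClosed n0)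
    (hn0nil : ∀ x ∈ n0, IsNilpotent x) (hn0Γ : ConjStable Γ n0) :
    ∃ n, n0 ≤ n ∧ n ≤ h ∧ BracketClosed n ∧ (∀ x ∈ n, IsNilpotent x) ∧ ConjStable Γ n ∧
      orthIn h (normIn h n) = n ∧ orthIn h n = normIn h n := by
  obtain ⟨n, ⟨h1, h2, h3, h4, h5⟩, hmax⟩ := wellFounded_gt.has_min
    {n : Submodule K (Module.End K V) | n0 ≤ n ∧ n ≤ h ∧ BracketClosed n ∧
      (∀ x ∈ n, IsNilpotent x) ∧ ConjStable Γ n} ⟨n0, le_rfl, hn0, hn0br, hn0nil, hn0Γ⟩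
  set q := normIn h n with hq
  have hnq : n ≤ q := fun x hx => ⟨h2 hx, fun ν hν => h3 x hx ν hν⟩
  have hqh : q ≤ h := fun x hx => hx.1
  have hno : n ≤ orthIn h q := fun x hx => ⟨h2 hx, fun y hy =>
    trace_mul_eq_zero_of_normalizes n h3 h4 hx hy.2⟩
  have hqΓ : ConjStable Γ q := hΓ.normIn h5
  set r := q ⊓ orthIn h q with hr
  have hqrep : ReplicaClosed q := hrep.normIn
  have hqbr : BracketClosed q := hbr.normIn
  have hrn : ∀ x ∈ r, IsNilpotent x := fun x hx => isNilpotent_of_trace_mul_replica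
    fun θ T' hT' => hx.2.2 T' (hqrep θ x T' hx.1 hT')
  have hrid : ∀ x ∈ r, ∀ y ∈ q, x * y - y * x ∈ r := fun x hx y hy =>
    ⟨hqbr x hx.1 y hy, hbr x (hqh hx.1) y (hqh hy), fun z hz => by
      rw [trace_bracket_mul]; exact hx.2.2 _ (hqbr y hy z hz)⟩
  have hrle : r ≤ n := by
    have hge : n ≤ n ⊔ r := le_sup_left
    have hP : n ⊔ r ∈ {n : Submodule K (Module.End K V) | n0 ≤ n ∧ n ≤ h ∧ BracketClosed n ∧
      (∀ x ∈ n, IsNilpotent x) ∧ ConjStable Γ n} := by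
      refine ⟨h1.trans hge, sup_le h2 (inf_le_left.trans hqh), ?_, ?_, ?_⟩
      · intro x hx y hy
        obtain ⟨a, ha, b, hb, rfl⟩ := Submodule.mem_sup.1 hx
        obtain ⟨c, hc, d, hd, rfl⟩ := Submodule.mem_sup.1 hy
        have e : (a + b) * (c + d) - (c + d) * (a + b) =
            ((a * c - c * a)) + ((b * (c + d) - (c + d) * b) - (d * a - a * d)) := by noncomm_ring
        rw [e]
        exact Submodule.add_mem_sup (h3 a ha c hc) (sub_mem (hrid b hb _ (add_mem (hnq hc) hd.1))
          (hrid d hd a (hnq ha)))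
      · intro x hx
        obtain ⟨a, ha, b, hb, rfl⟩ := Submodule.mem_sup.1 hx
        exact isNilpotent_add_of_normalizes n h3 h4 ha hb.1.2 (hrn b hb)
      · intro γ hγ x hx
        obtain ⟨a, ha, b, hb, rfl⟩ := Submodule.mem_sup.1 hx
        rw [mul_add, add_mul]
        exact Submodule.add_mem_sup (h5 γ hγ a ha)
          ⟨hqΓ γ hγ b hb.1, hΓ.orthIn hqΓ γ hγ b hb.2⟩
    have := hmax _ hP
    have heq : n = n ⊔ r := by
      by_contra hne
      exact this (lt_of_le_of_ne hge hne)
    rw [heq]; exact le_sup_right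
  have hqn : orthIn h q = n := by
    refine le_antisymm ?_ hno
    by_contra hlt
    obtain ⟨b, hb, hbn, hbb⟩ := exists_mem_not_mem_of_engel_adL h3 h4 hlt (fun x hx b hb =>
      ⟨hbr x (h2 hx) b hb.1, fun y hy => by
        rw [← neg_sub, neg_mul, map_neg, trace_bracket_mul, hb.2 _ (hqbr x (hnq hx) y hy),
            neg_zero]⟩)
    exact hbn (hrle ⟨⟨hb.1, fun ν hν => by rw [← neg_sub]; exact neg_mem (hbb ν hν)⟩, hb⟩)
  refine ⟨n, h1, h2, h3, h4, h5, hqn, le_antisymm ?_ ?_⟩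
  · have := hnd.orthIn_orthIn_le hqh
    rwa [hqn] at this
  · intro x hx
    exact ⟨hqh hx, fun y hy => by rw [LinearMap.trace_mul_comm]; exact (hno hy).2 x hx⟩

end Parabolic

section Toral

variable {K V : Type*} [Field K] [AddCommGroup V] [Module K V] [FiniteDimensional K V]
  [CharZero K] [IsAlgClosed K]

theorem exists_rat_ker_add_smul_le {A B : Module.End K V} (hAB : Commute A B)
    (hA : A.IsSemisimple) : ∃ r : ℚ, ∀ x, A x + (r : K) • B x = 0 → A x = 0 ∧ B x = 0 := by
  classical
  have hfin : (Set.image2 (fun a b : K => -a / b) {a | A.HasEigenvalue a}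
      {b | B.HasEigenvalue b}).Finite := A.finite_hasEigenvalue.image2 _ B.finite_hasEigenvalue
  have hinf : (Set.range fun k : ℕ => ((k + 1 : ℕ) : K)).Infinite :=
    Set.infinite_range_of_injective fun a b hab => by
      have := Nat.cast_injective hab; omega
  obtain ⟨_, ⟨k, rfl⟩, hk⟩ := hinf.exists_notMem_finite hfin
  have hk0 : ((k + 1 : ℕ) : K) ≠ 0 := Nat.cast_ne_zero.2 (by omega)
  refine ⟨((k + 1 : ℕ) : ℚ), fun x hx => ?_⟩
  rw [Rat.cast_natCast] at hx
  simp only at hk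
  set r : K := ((k + 1 : ℕ) : K) with hr
  set P := LinearMap.ker (A + r • B) with hP
  have hPA : ∀ y ∈ P, A y ∈ P := by
    intro y hy
    have hc : Commute A (A + r • B) := (Commute.refl A).add_right (hAB.smul_right r)
    rw [hP, LinearMap.mem_ker] at hy ⊢
    rw [← Module.End.mul_apply, ← hc.eq, Module.End.mul_apply, hy, map_zero]
  have hAx : A x = 0 := by
    by_contra hne
    obtain ⟨φ, hφ⟩ : ∃ φ : Module.Dual K V, φ (A x) ≠ 0 := by
      by_contra hcon
      push Not at hcon
      exact hne ((Module.forall_dual_apply_eq_zero_iff K (A x)).1 hcon)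
    obtain ⟨c, z, hz, hcz, hφz⟩ := exists_eigenvector_of_ne_zero hA hPA (φ.comp A)
      (x := x) (by rw [hP, LinearMap.mem_ker]; exact hx) hφ
    have hz0 : z ≠ 0 := by rintro rfl; simp at hφz
    have hc0 : c ≠ 0 := by
      rintro rfl
      rw [LinearMap.comp_apply, hcz] at hφz
      simp at hφz
    have hBz : B z = (-c / r) • z := by
      rw [hP, LinearMap.mem_ker, LinearMap.add_apply, hcz, LinearMap.smul_apply] at hz
      have : r • B z = (-c) • z := by rw [neg_smul]; exact (neg_eq_of_add_eq_zero_right hz).symm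
      rw [div_eq_inv_mul, mul_smul, ← this, smul_smul, inv_mul_cancel₀ hk0, one_smul]
    refine hk ⟨c, Module.End.hasEigenvalue_of_hasEigenvector
      ⟨Module.End.mem_eigenspace_iff.2 hcz, hz0⟩, -c / r, Module.End.hasEigenvalue_of_hasEigenvector
      ⟨Module.End.mem_eigenspace_iff.2 hBz, hz0⟩, ?_⟩
    field_simp
  rw [hAx, zero_add] at hx
  exact ⟨hAx, (smul_eq_zero.1 hx).resolve_left hk0⟩

/-- The centralizer of `τ` in `h`. -/
noncomputable def centIn (h : Submodule K (Module.End K V)) (τ : Module.End K V) :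
    Submodule K (Module.End K V) := h ⊓ LinearMap.ker (adL τ)

theorem mem_centIn {h : Submodule K (Module.End K V)} {τ x : Module.End K V} :
    x ∈ centIn h τ ↔ x ∈ h ∧ Commute τ x := by
  rw [centIn, Submodule.mem_inf, LinearMap.mem_ker, adL_apply, sub_eq_zero]; rfl

theorem Commute.bracket {x y z : Module.End K V} (hy : Commute x y) (hz : Commute x z) :
    Commute x (y * z - z * y) := (hy.mul_right hz).sub_right (hz.mul_right hy)

/-- Elements commuting with `τ` are orthogonal to the brackets with `τ`. -/
theorem trace_mul_adL_of_commute {τ x y : Module.End K V} (hx : Commute τ x) :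
    LinearMap.trace K V (x * adL τ y) = 0 := by
  rw [← neg_eq_zero, ← trace_adL_mul, adL_apply, hx.eq, sub_self, zero_mul, map_zero]

theorem isSemisimple_of_mem_span {s : Set (Module.End K V)} (hs : ∀ x ∈ s, x.IsSemisimple)
    (hc : ∀ x ∈ s, ∀ y ∈ s, Commute x y) : ∀ x ∈ Submodule.span K s, x.IsSemisimple := by
  have hcs : ∀ x ∈ s, ∀ y ∈ Submodule.span K s, Commute x y := by
    intro x hx y hy
    induction hy using Submodule.span_induction with
    | mem y hy => exact hc x hx y hy
    | zero => exact Commute.zero_right x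
    | add y z _ _ h1 h2 => exact h1.add_right h2
    | smul c y _ h1 => exact h1.smul_right c
  have hcss : ∀ x ∈ Submodule.span K s, ∀ y ∈ Submodule.span K s, Commute x y := by
    intro x hx y hy
    induction hx using Submodule.span_induction with
    | mem x hx => exact hcs x hx y hy
    | zero => exact Commute.zero_left y
    | add x z _ _ h1 h2 => exact h1.add_left h2
    | smul c x _ h1 => exact h1.smul_left c
  intro x hx
  induction hx using Submodule.span_induction with
  | mem x hx => exact hs x hx
  | zero => exact RatSS.zero.1
  | add x y hx hy h1 h2 => exact h1.add_of_commute (hcss x hx y hy) h2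
  | smul c x _ h1 => exact Module.End.IsSemisimple_smul c h1

theorem exists_toral {h n q : Submodule K (Module.End K V)} (hbr : BracketClosed h)
    (hrep : ReplicaClosed h) (hnd : NondegOn h) (hnh : n ≤ h) (hnbr : BracketClosed n)
    (hnil : ∀ x ∈ n, IsNilpotent x) (hq : q = normIn h n) (hqn : orthIn h q = n)
    (hnq : orthIn h n = q) :
    ∃ τ ∈ q, RatSS τ ∧ centIn h τ ≤ q ∧ NondegOn (centIn h τ) ∧
      centIn h τ ≤ Submodule.span K {σ | σ ∈ centIn h τ ∧ RatSS σ} ∧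
      (∀ x ∈ centIn h τ, ∀ y ∈ centIn h τ, Commute x y) ∧ centIn h τ ⊓ n = ⊥ := by
  classical
  have hqh : q ≤ h := by rw [hq]; exact fun x hx => hx.1
  have hqbr : BracketClosed q := by rw [hq]; exact hbr.normIn
  have hqrep : ReplicaClosed q := by rw [hq]; exact hrep.normIn
  have hnleq : n ≤ q := by rw [hq]; exact fun x hx => ⟨hnh hx, fun ν hν => hnbr x hx ν hν⟩
  let P : ℕ → Prop := fun d => ∃ τ ∈ q, RatSS τ ∧ Module.finrank K (centIn h τ) = d
  have hP : ∃ d, P d := ⟨_, 0, zero_mem _, RatSS.zero, rfl⟩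
  obtain ⟨τ, hτq, hτ, hτd⟩ := Nat.find_spec hP
  have hmin : ∀ τ' ∈ q, RatSS τ' → Module.finrank K (centIn h τ) ≤ Module.finrank K (centIn h τ') :=
    fun τ' h1 h2 => by rw [hτd]; exact Nat.find_min' hP ⟨τ', h1, h2, rfl⟩
  set f := centIn h τ with hf
  have hfh : f ≤ h := fun x hx => (mem_centIn.1 hx).1
  have hfbr : BracketClosed f := fun x hx y hy => mem_centIn.2 ⟨hbr x (hfh hx) y (hfh hy),
    Commute.bracket (mem_centIn.1 hx).2 (mem_centIn.1 hy).2⟩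
  have hfrep : ReplicaClosed f := fun θ T T' hT hTT' =>
    mem_centIn.2 ⟨hrep θ T T' (hfh hT) hTT', hTT'.commute (mem_centIn.1 hT).2⟩
  have hcentral : ∀ σ ∈ q, RatSS σ → σ ∈ f → ∀ x ∈ f, Commute σ x := by
    intro σ hσq hσ hσf x hx
    have hc : Commute τ σ := (mem_centIn.1 hσf).2
    obtain ⟨r, hr⟩ := exists_rat_ker_add_smul_le (commute_adL hc) (isSemisimple_adL hτ.1)
    have hker : ∀ y, y ∈ centIn h (τ + (r : K) • σ) → y ∈ f ∧ Commute σ y := by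
      intro y hy
      have h2 : adL (τ + (r : K) • σ) y = 0 := hy.2
      rw [map_add, map_smul] at h2
      obtain ⟨h3, h4⟩ := hr y h2
      exact ⟨⟨hy.1, h3⟩, sub_eq_zero.1 h4⟩
    have heq : centIn h (τ + (r : K) • σ) = f := Submodule.eq_of_le_of_finrank_le
      (fun y hy => (hker y hy).1) (hmin _ (add_mem hτq (Submodule.smul_mem _ _ hσq))
        (hτ.add_smul hσ hc r))
    exact (hker x (heq ▸ hx)).2
  have hdec : ∀ (p : Submodule K (Module.End K V)), p ≤ h → (∀ x ∈ p, τ * x - x * τ ∈ p) → ∀ x ∈ p,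
      ∃ x0 ∈ p ⊓ f, ∃ y ∈ p, x = x0 + adL τ y := by
    intro p hph hp x hx
    obtain ⟨x0, h0, h1, y, hy, hxy⟩ := exists_ker_add_range (isSemisimple_adL hτ.1) hp hx
    exact ⟨x0, ⟨h0, hph h0, h1⟩, y, hy, hxy⟩
  have horth : ∀ (p : Submodule K (Module.End K V)), p ≤ h → (∀ x ∈ p, τ * x - x * τ ∈ p) →
      orthIn f (p ⊓ f) = orthIn h p ⊓ f := by
    intro p hph hp
    refine le_antisymm ?_ ?_
    · intro x hx
      refine ⟨⟨hfh hx.1, fun y hy => ?_⟩, hx.1⟩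
      obtain ⟨y0, h0, z, _, rfl⟩ := hdec p hph hp y hy
      rw [mul_add, map_add, hx.2 y0 h0, trace_mul_adL_of_commute (mem_centIn.1 hx.1).2, zero_add]
    · intro x hx
      exact ⟨hx.2, fun y hy => hx.1.2 y hy.1⟩
  have hτh := hqh hτq
  have hfnd : NondegOn f := by
    intro x hx hxf
    refine hnd x (hfh hx) fun y hy => ?_
    obtain ⟨y0, h0, z, _, rfl⟩ := hdec h le_rfl (fun y hy => hbr τ hτh y hy) y hy
    rw [mul_add, map_add, hxf y0 h0.2, trace_mul_adL_of_commute (mem_centIn.1 hx).2, zero_add]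
  set q0 := q ⊓ f with hq0
  set nf := n ⊓ f with hnf
  have hτn : ∀ x ∈ n, τ * x - x * τ ∈ n := by
    have := hτq; rw [hq] at this; exact this.2
  have ho1 : orthIn f nf = q0 := by rw [hnf, horth n hnh hτn, hnq]
  have ho2 : orthIn f q0 = nf := by rw [hq0, horth q hqh (fun x hx => hqbr τ hτq x hx), hqn]
  have hnfbr : BracketClosed nf := fun x hx y hy => ⟨hnbr x hx.1 y hy.1, hfbr x hx.2 y hy.2⟩
  have hnfnil : ∀ x ∈ nf, IsNilpotent x := fun x hx => hnil x hx.1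
  set s := {σ | σ ∈ q0 ∧ RatSS σ} with hs
  set t := Submodule.span K s with ht
  have hst : ∀ σ ∈ s, ∀ x ∈ f, Commute σ x := fun σ hσ x hx =>
    hcentral σ hσ.1.1 hσ.2 hσ.1.2 x hx
  have htq0 : t ≤ q0 := Submodule.span_le.2 fun σ hσ => hσ.1
  have htc : ∀ y ∈ t, ∀ x ∈ f, Commute y x := by
    intro y hy x hx
    induction hy using Submodule.span_induction with
    | mem y hy => exact hst y hy x hx
    | zero => exact Commute.zero_left x
    | add y z _ _ h1 h2 => exact h1.add_left h2
    | smul c y _ h1 => exact h1.smul_left c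
  have htss : ∀ x ∈ t, x.IsSemisimple :=
    isSemisimple_of_mem_span (fun x hx => hx.2.1) fun x hx y hy => hst x hx y hy.1.2
  set N := normIn f nf with hN
  have hNbr : BracketClosed N := hfbr.normIn
  have hNrep : ReplicaClosed N := hfrep.normIn
  have hq0N : q0 ≤ N := fun x hx => ⟨hx.2, fun ν hν => ⟨by
    have := hx.1; rw [hq] at this; exact this.2 ν hν.1, hfbr x hx.2 ν hν.2⟩⟩
  have hNθ : ∀ θ T T', T ∈ N → IsReplica θ T T' → T' ∈ t := by
    intro θ T T' hT hTT'
    have hT'N := hNrep θ T T' hT hTT'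
    refine Submodule.subset_span ⟨?_, hTT'.ratSS⟩
    rw [← ho1]
    exact ⟨hT'N.1, fun ν hν => by
      rw [LinearMap.trace_mul_comm]
      exact trace_mul_eq_zero_of_normalizes nf hnfbr hnfnil hν hT'N.2⟩
  have hN'nil : ∀ x ∈ orthIn N t, IsNilpotent x := fun x hx =>
    isNilpotent_of_trace_mul_replica fun θ T' hT' => hx.2 T' (hNθ θ x T' hx.1 hT')
  have hN'id : ∀ x ∈ orthIn N t, ∀ y ∈ N, y * x - x * y ∈ orthIn N t := by
    intro x hx y hy
    refine ⟨hNbr y hy x hx.1, fun z hz => ?_⟩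
    have := (htc z hz x hx.1.1).eq
    rw [trace_bracket_mul, ← this, sub_self, mul_zero, map_zero]
  have hN'le : orthIn N t ≤ nf := by
    intro x hx
    rw [← ho2]
    refine ⟨hx.1.1, fun y hy => ?_⟩
    exact trace_mul_eq_zero_of_normalizes (orthIn N t)
      (fun a ha b hb => hN'id b hb a ha.1) hN'nil hx (fun z hz => hN'id z hz y (hq0N hy))
  have htnd : NondegOn t := by
    intro x hx hxt
    exact RatSS.eq_zero_of_isNilpotent (htss x hx) (hN'nil x ⟨hq0N (htq0 hx), hxt⟩)
  have hnfq0 : nf ≤ q0 := inf_le_inf_right _ hnleq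
  have hNdec : ∀ x ∈ N, ∃ a ∈ t, x - a ∈ nf := fun x hx => by
    obtain ⟨a, ha, hxa⟩ := htnd.exists_sub_mem_orthIn (htq0.trans hq0N) hx
    exact ⟨a, ha, hN'le hxa⟩
  have hNq0 : N ≤ q0 := fun x hx => by
    obtain ⟨a, ha, hxa⟩ := hNdec x hx
    have := add_mem (hnfq0 hxa) (htq0 ha)
    rwa [sub_add_cancel] at this
  have hfq0 : f ≤ q0 := by
    by_contra hne
    obtain ⟨x, hx, hxq, hxn⟩ := exists_mem_not_mem_of_engel_adL hnfbr hnfnil hne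
      (fun ν hν x hx => hfbr ν hν.2 x hx)
    refine hxq (hNq0 ⟨hx, fun ν hν => ?_⟩)
    have h1 : ν * x - x * ν ∈ orthIn N t := by
      refine ⟨hq0N (hxn ν hν), fun z hz => ?_⟩
      have := (htc z hz x hx).eq
      rw [trace_bracket_mul, ← this, sub_self, mul_zero, map_zero]
    rw [← neg_sub]
    exact neg_mem (hN'le h1)
  have hnf0 : nf = ⊥ := by
    rw [eq_bot_iff]
    intro x hx
    rw [← ho2] at hx
    exact (Submodule.mem_bot K).2 (hfnd x hx.1 fun y hy => hx.2 y (hfq0 hy))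
  have hft : f ≤ t := fun x hx => by
    obtain ⟨a, ha, hxa⟩ := hNdec x (hq0N (hfq0 hx))
    rw [hnf0, Submodule.mem_bot, sub_eq_zero] at hxa
    rw [hxa]; exact ha
  refine ⟨τ, hτq, hτ, hfq0.trans inf_le_left, hfnd, ?_, ?_, ?_⟩
  · refine hft.trans (Submodule.span_mono fun σ hσ => ⟨hσ.1.2, hσ.2⟩)
  · exact fun x hx y hy => htc x (hft hx) y hy
  · rw [inf_comm]; exact hnf0

end Toral

section Weight

variable {K V : Type*} [Field K] [AddCommGroup V] [Module K V] [FiniteDimensional K V]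

theorem exists_traceOn (n : Submodule K (Module.End K V)) :
    ∃ κ : Module.End K V →ₗ[K] K, ∀ σ, ∀ hσ : ∀ x ∈ n, adL σ x ∈ n,
      κ σ = LinearMap.trace K n ((adL σ).restrict hσ) := by
  obtain ⟨π, hπ⟩ := LinearMap.exists_leftInverse_of_injective n.subtype n.ker_subtype
  refine ⟨LinearMap.trace K n ∘ₗ LinearMap.llcomp K n (Module.End K V) n π ∘ₗ
    (LinearMap.lcomp K (Module.End K V) n.subtype) ∘ₗ adL, fun σ hσ => ?_⟩
  have : (π ∘ₗ (adL σ) ∘ₗ n.subtype : Module.End K n) = (adL σ).restrict hσ := by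
    refine LinearMap.ext fun x => ?_
    exact LinearMap.congr_fun hπ ⟨adL σ x, hσ x x.2⟩
  exact congrArg (LinearMap.trace K n) this

theorem trace_restrict_adL_bracket {n : Submodule K (Module.End K V)} {x y : Module.End K V}
    (hx : ∀ z ∈ n, adL x z ∈ n) (hy : ∀ z ∈ n, adL y z ∈ n)
    (hxy : ∀ z ∈ n, adL (x * y - y * x) z ∈ n) :
    LinearMap.trace K n ((adL (x * y - y * x)).restrict hxy) = 0 := by
  have : (adL (x * y - y * x)).restrict hxy = ((adL x).restrict hx * (adL y).restrict hy -
      (adL y).restrict hy * (adL x).restrict hx : Module.End K n) := by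
    refine LinearMap.ext fun z => Subtype.ext ?_
    exact LinearMap.congr_fun (adL_bracket x y) z.1
  rw [this]
  exact (map_sub (LinearMap.trace K n) _ _).trans (by rw [LinearMap.trace_mul_comm, sub_self])

theorem trace_restrict_adL_conj {n : Submodule K (Module.End K V)} {Γ : Subgroup (Module.End K V)ˣ}
    (hn : ConjStable Γ n) {γ : (Module.End K V)ˣ} (hγ : γ ∈ Γ) {x : Module.End K V}
    (hx : ∀ z ∈ n, adL x z ∈ n) (hx' : ∀ z ∈ n, adL ((γ : Module.End K V) * x *
        (↑γ⁻¹ : Module.End K V)) z ∈ n) :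
    LinearMap.trace K n ((adL ((γ : Module.End K V) * x * (↑γ⁻¹ : Module.End K V))).restrict hx') =
      LinearMap.trace K n ((adL x).restrict hx) := by
  let f : (Module.End K V) →ₗ[K] (Module.End K V) :=
    LinearMap.mulRight K (↑γ⁻¹ : Module.End K V) ∘ₗ LinearMap.mulLeft K (γ : Module.End K V)
  let g : (Module.End K V) →ₗ[K] (Module.End K V) :=
    LinearMap.mulRight K (γ : Module.End K V) ∘ₗ LinearMap.mulLeft K (↑γ⁻¹ : Module.End K V)
  have hf : ∀ z ∈ n, f z ∈ n := fun z hz => hn γ hγ z hz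
  have hg : ∀ z ∈ n, g z ∈ n := fun z hz => hn.inv_mem hγ hz
  let e : n ≃ₗ[K] n := LinearEquiv.ofLinearMap (f.restrict hf) (g.restrict hg)
    (by ext z; simp [f, g, mul_assoc]) (by ext z; simp [f, g, mul_assoc])
  rw [← LinearMap.trace_conj' ((adL x).restrict hx) e]
  congr 1
  ext z : 2
  have : (e.conj ((adL x).restrict hx) z : Module.End K V) = f (adL x (g z)) := by
    rw [LinearEquiv.conj_apply_apply]; rfl
  rw [this]
  simp only [LinearMap.coe_restrict_apply, adL_apply, f, g, LinearMap.comp_apply,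
    LinearMap.mulRight_apply, LinearMap.mulLeft_apply, mul_sub, sub_mul]
  simp only [mul_assoc, Units.mul_inv_cancel_left, Units.mul_inv, mul_one]

/-- A family of commuting operators stabilizing a nonzero subspace has a common eigenvector. -/
theorem exists_common_eigenvector_of_commute [IsAlgClosed K] (S : Set (Module.End K V))
    (hS : ∀ x ∈ S, ∀ y ∈ S, Commute x y) (p : Submodule K V) (hp : p ≠ ⊥)
    (hpS : ∀ x ∈ S, ∀ v ∈ p, x v ∈ p) :
    ∃ v ∈ p, v ≠ 0 ∧ ∀ x ∈ S, ∃ a : K, x v = a • v := by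
  let P : Set (Submodule K V) := {p' | p' ≤ p ∧ p' ≠ ⊥ ∧ ∀ x ∈ S, ∀ v ∈ p', x v ∈ p'}
  obtain ⟨m, ⟨hm1, hm2, hm3⟩, hmin⟩ := wellFounded_lt.has_min P ⟨p, le_rfl, hp, hpS⟩
  obtain ⟨v, hv, hv0⟩ := (Submodule.ne_bot_iff m).1 hm2
  refine ⟨v, hm1 hv, hv0, fun x hx => ?_⟩
  have : Nontrivial m := ⟨⟨v, hv⟩, 0, fun h => hv0 (congrArg Subtype.val h)⟩
  set T : Module.End K m := x.restrict (hm3 x hx) with hT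
  obtain ⟨a, ha⟩ := Module.End.exists_eigenvalue T
  obtain ⟨w, hw⟩ := ha.exists_hasEigenvector
  have hxw : x w.1 = a • w.1 := by
    have := Module.End.mem_eigenspace_iff.1 hw.1
    exact congrArg Subtype.val this
  refine ⟨a, ?_⟩
  by_contra hne
  refine hmin (m ⊓ x.eigenspace a) ⟨inf_le_left.trans hm1, ?_, fun y hy u hu => ⟨hm3 y hy u hu.1,
      ?_⟩⟩ ?_
  · exact (Submodule.ne_bot_iff _).2 ⟨w.1, ⟨w.2, Module.End.mem_eigenspace_iff.2 hxw⟩,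
      fun h => hw.2 (Subtype.ext h)⟩
  · have := Module.End.mem_eigenspace_iff.1 hu.2
    refine Module.End.mem_eigenspace_iff.2 ?_
    rw [← Module.End.mul_apply, (hS x hx y hy).eq, Module.End.mul_apply, this, map_smul]
  · refine lt_of_le_of_ne inf_le_left fun h => hne ?_
    rw [← h] at hv
    exact Module.End.mem_eigenspace_iff.1 hv.2

variable [CharZero K] [IsAlgClosed K]

theorem ratSS_of_trace_rat {t : Submodule K (Module.End K V)} (hrep : ReplicaClosed t)
    {l : Module.End K V} (hl : l ∈ t) (hss : l.IsSemisimple)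
    (htr : ∀ σ ∈ t, RatSS σ → ∃ r : ℚ, LinearMap.trace K V (l * σ) = r) : RatSS l := by
  refine ⟨hss, fun c hc => ?_⟩
  by_contra hne
  have hc1 : c ∉ Submodule.span ℚ {(1 : K)} := by
    intro h
    obtain ⟨r, hr⟩ := Submodule.mem_span_singleton.1 h
    exact hne ⟨r, by rw [← hr, Algebra.smul_def, mul_one]; rfl⟩
  obtain ⟨θ, hθc, hθ1⟩ := Submodule.exists_le_ker_of_notMem hc1
  have hθ1 : θ 1 = 0 := hθ1 (Submodule.mem_span_singleton_self 1)
  obtain ⟨T', hT'⟩ := exists_isReplica θ l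
  obtain ⟨r, hr⟩ := htr T' (hrep θ l T' hl hT') hT'.ratSS
  obtain ⟨s, hs, htrs⟩ := trace_mul_replica hT'
  rw [htrs] at hr
  have h1 := congrArg θ hr
  have h2 : ∀ x : K, ∀ r : ℚ, θ (x * r) = r * θ x := fun x r => by
    rw [mul_comm, ← smul_eq_mul (a := r), ← map_smul, Rat.smul_def]
  rw [← one_mul (r : K), h2, hθ1, mul_zero, map_sum] at h1
  have h3 : ∀ x ∈ s, θ ((Module.finrank K (l.maxGenEigenspace x) : K) * (x * ((θ x : ℚ) : K))) =
      Module.finrank K (l.maxGenEigenspace x) * (θ x * θ x) := by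
    intro x _
    rw [← mul_assoc, h2, mul_comm _ x, ← Rat.cast_natCast, h2]; ring
  rw [Finset.sum_congr rfl h3, Finset.sum_eq_zero_iff_of_nonneg
    (fun x _ => mul_nonneg (Nat.cast_nonneg _) (mul_self_nonneg _))] at h1
  have hcb : l.maxGenEigenspace c ≠ ⊥ := fun h => hc.exists_hasEigenvector.elim fun v hv =>
    hv.2 ((Submodule.mem_bot K).1 (h ▸ Module.End.genEigenspace_le_maximal _ _ 1 hv.1))
  have h4 := h1 c ((hs c).1 hcb)
  rcases mul_eq_zero.1 h4 with h | h
  · exact hcb (Submodule.finrank_eq_zero.1 (by exact_mod_cast h))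
  · exact hθc (mul_self_eq_zero.1 h)

theorem RatSS.exists_trace_sq_pos {T : Module.End K V} (hT : RatSS T) (h0 : T ≠ 0) :
    ∃ r : ℚ, 0 < r ∧ LinearMap.trace K V (T * T) = r := by
  have h1 : (1 : K) ∉ (⊥ : Submodule ℚ K) := by simp
  obtain ⟨θ', hθ', -⟩ := Submodule.exists_le_ker_of_notMem h1
  let θ : K →ₗ[ℚ] ℚ := (θ' 1)⁻¹ • θ'
  have hθ : ∀ r : ℚ, θ (r : K) = r := fun r => by
    have : (r : K) = r • (1 : K) := by rw [Algebra.smul_def, mul_one]; rfl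
    rw [this, map_smul, LinearMap.smul_apply, smul_eq_mul, smul_eq_mul, inv_mul_cancel₀ hθ',
        mul_one]
  have hmg : ∀ c, T.maxGenEigenspace c = T.eigenspace c := fun c =>
      IsSemisimple_maxGenEigenspace hT.1 c
  have hrat : ∀ c, T.maxGenEigenspace c ≠ ⊥ → c = ((θ c : ℚ) : K) := fun c hc => by
    rw [hmg] at hc
    obtain ⟨r, hr⟩ := hT.2 c hc
    rw [← hr, hθ]
  have hrep : IsReplica θ T T := by
    intro c x hx
    by_cases hc : T.maxGenEigenspace c = ⊥
    · rw [hc, Submodule.mem_bot] at hx; simp [hx]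
    · rw [← hrat c hc]
      rw [hmg] at hx
      exact Module.End.mem_eigenspace_iff.1 hx
  obtain ⟨s, hs, htr⟩ := trace_mul_replica hrep
  refine ⟨∑ c ∈ s, Module.finrank K (T.maxGenEigenspace c) * (θ c * θ c), ?_, ?_⟩
  · have hnn : ∀ c ∈ s, 0 ≤ (Module.finrank K (T.maxGenEigenspace c) : ℚ) * (θ c * θ c) :=
      fun x _ => mul_nonneg (Nat.cast_nonneg _) (mul_self_nonneg _)
    refine lt_of_le_of_ne (Finset.sum_nonneg hnn) fun h => h0 ?_
    rw [eq_comm, Finset.sum_eq_zero_iff_of_nonneg hnn] at h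
    have htop := hT.1.iSup_eigenspace_eq_top
    rw [← LinearMap.ker_eq_top, ← top_le_iff, ← htop]
    refine iSup_le fun c v hv => ?_
    by_cases hc : T.maxGenEigenspace c = ⊥
    · rw [← hmg, hc, Submodule.mem_bot] at hv; simp [hv]
    · have h2 := h c ((hs c).1 hc)
      have h3 : θ c = 0 := by
        rcases mul_eq_zero.1 h2 with h | h
        · exact absurd (Submodule.finrank_eq_zero.1 (by exact_mod_cast h)) hc
        · exact mul_self_eq_zero.1 h
      have h4 := hrat c hc
      rw [h3, Rat.cast_zero] at h4
      rw [LinearMap.mem_ker, Module.End.mem_eigenspace_iff.1 hv, h4, zero_smul]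
  · rw [htr, Rat.cast_sum]
    refine Finset.sum_congr rfl fun c hc => ?_
    rw [Rat.cast_mul, Rat.cast_mul, Rat.cast_natCast, ← hrat c ((hs c).2 hc)]

end Weight

section Grading

variable {K V : Type*} [Field K] [AddCommGroup V] [Module K V] [FiniteDimensional K V]

theorem exists_eigenbasis {T : Module.End K V} (hT : ⨆ c, T.eigenspace c = ⊤) {ι : Type*}
    [Fintype ι] (hι : Module.finrank K V = Fintype.card ι) :
    ∃ (b : Module.Basis ι K V) (c : ι → K), ∀ j, T (b j) = c j • b j := by
  have hs : ⊤ ≤ Submodule.span K {v : V | ∃ c : K, T v = c • v} := by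
    rw [← hT]
    exact iSup_le fun c v hv => Submodule.subset_span ⟨c, Module.End.mem_eigenspace_iff.1 hv⟩
  let b := Module.Basis.ofSpan hs
  have hb := Module.Basis.ofSpan_subset hs
  have hfin := Module.Finite.finite_basis b
  have := Fintype.ofFinite ↑((linearIndepOn_empty K id).extend
    (Set.empty_subset {v : V | ∃ c : K, T v = c • v}))
  let e := Fintype.equivOfCardEq ((Module.finrank_eq_card_basis b).symm.trans hι)
  choose c hc using fun j => hb ⟨e.symm j, rfl⟩
  exact ⟨b.reindex e, c, fun j => by rw [Module.Basis.reindex_apply]; exact hc j⟩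

variable [CharZero K] [IsAlgClosed K]

theorem exists_toral_character {Γ : Subgroup (Module.End K V)ˣ}
    {h n : Submodule K (Module.End K V)} (hbr : BracketClosed h)
    (hrep : ReplicaClosed h) (hnd : NondegOn h) (hΓ : ConjStable Γ h) (hnh : n ≤ h)
    (hnbr : BracketClosed n) (hnil : ∀ x ∈ n, IsNilpotent x) (hnΓ : ConjStable Γ n)
    (hqn : orthIn h (normIn h n) = n) (hnq : orthIn h n = normIn h n) :
    ∃ l ∈ h, RatSS l ∧ (∀ x ∈ n, adL l x ∈ n) ∧
      (∀ γ ∈ Γ, (γ : Module.End K V) * l * (↑γ⁻¹ : Module.End K V) - l ∈ n) ∧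
      ∀ x ∈ n, x ≠ 0 → ∀ k : K, adL l x = k • x → ∃ r : ℚ, 0 < r ∧ k = r := by
  set q := normIn h n with hq
  obtain ⟨τ, hτq, hτ, htq, htnd, htspan, htc, htn⟩ :=
    exists_toral hbr hrep hnd hnh hnbr hnil hq hqn hnq
  set t := centIn h τ with ht
  have hqh : q ≤ h := fun x hx => hx.1
  have hqbr : BracketClosed q := hbr.normIn
  have hqΓ : ConjStable Γ q := hΓ.normIn hnΓ
  have hnleq : n ≤ q := fun x hx => ⟨hnh hx, fun ν hν => hnbr x hx ν hν⟩
  have hτh := hqh hτq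
  have hτt : τ ∈ t := mem_centIn.2 ⟨hτh, Commute.refl τ⟩
  have htrep : ReplicaClosed t := fun θ T T' hT hTT' =>
    mem_centIn.2 ⟨hrep θ T T' (hqh (htq hT)) hTT', hTT'.commute (mem_centIn.1 hT).2⟩
  have htss : ∀ x ∈ t, x.IsSemisimple := fun x hx =>
    isSemisimple_of_mem_span (fun x hx => hx.2.1) (fun x hx y hy => htc x hx.1 y hy.1) x (htspan hx)
  have hadq : ∀ x ∈ q, ∀ z ∈ n, adL x z ∈ n := fun x hx z hz => hx.2 z hz
  obtain ⟨κ, hκ⟩ := exists_traceOn n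
  obtain ⟨l, hlt, hl⟩ := htnd.exists_eq_trace κ
  have hκbr : ∀ x ∈ q, ∀ y ∈ q, κ (x * y - y * x) = 0 := fun x hx y hy => by
    rw [hκ _ (hadq _ (hqbr x hx y hy))]
    exact trace_restrict_adL_bracket (hadq x hx) (hadq y hy) _
  have hlq : ∀ y ∈ q, LinearMap.trace K V (l * y) = κ y := by
    intro y hy
    obtain ⟨y0, h0, h1, z, hz, rfl⟩ := exists_ker_add_range (isSemisimple_adL hτ.1) (p := q)
      (fun x hx => hqbr τ hτq x hx) hy
    rw [mul_add, map_add, map_add, trace_mul_adL_of_commute (mem_centIn.1 hlt).2,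
      hl y0 ⟨hqh h0, h1⟩, adL_apply, hκbr τ hτq z hz]
  have hlr : ∀ σ ∈ t, RatSS σ → ∃ r : ℚ, LinearMap.trace K V (l * σ) = r := fun σ hσ hσr => by
    rw [hl σ hσ, hκ σ (hadq σ (htq hσ))]
    exact (hσr.adL.restrict (hadq σ (htq hσ))).exists_trace_eq
  have hlRat : RatSS l := ratSS_of_trace_rat htrep hlt (htss l hlt) hlr
  refine ⟨l, hqh (htq hlt), hlRat, hadq l (htq hlt), fun γ hγ => ?_, ?_⟩
  · rw [← hqn]
    refine ⟨sub_mem (hΓ γ hγ l (hqh (htq hlt))) (hqh (htq hlt)), fun y hy => ?_⟩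
    have hy' := hqΓ.inv_mem hγ hy
    rw [sub_mul, map_sub, trace_conj_mul, hlq _ hy', hlq _ hy, hκ _ (hadq _ hy), hκ _ (hadq _ hy'),
      sub_eq_zero, ← trace_restrict_adL_conj hnΓ hγ (hadq _ hy') (by
        rw [conj_conj_inv]; exact hadq _ hy)]
    congr! 2
    · exact (conj_conj_inv γ y).symm ▸ rfl
  · intro x hx hx0 k hk
    have hcomm : ∀ σ ∈ t, ∀ σ' ∈ t, Commute (adL σ) (adL σ') := fun σ hσ σ' hσ' =>
      commute_adL (htc σ hσ σ' hσ')
    obtain ⟨ν, ⟨hνn, hνk⟩, hν0, hνt⟩ := exists_common_eigenvector_of_commute (adL '' (t : Set _))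
      (by rintro _ ⟨σ, hσ, rfl⟩ _ ⟨σ', hσ', rfl⟩; exact hcomm σ hσ σ' hσ')
      (n ⊓ (adL l).eigenspace k)
      ((Submodule.ne_bot_iff _).2 ⟨x, ⟨hx, Module.End.mem_eigenspace_iff.2 hk⟩, hx0⟩)
      (by
        rintro _ ⟨σ, hσ, rfl⟩ v ⟨hv1, hv2⟩
        refine ⟨hadq σ (htq hσ) v hv1, Module.End.mem_eigenspace_iff.2 ?_⟩
        rw [← Module.End.mul_apply, (hcomm l hlt σ hσ).eq, Module.End.mul_apply,
          Module.End.mem_eigenspace_iff.1 hv2, map_smul])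
    rw [SetLike.mem_coe, Module.End.mem_eigenspace_iff] at hνk
    have hνq := hnleq hνn
    obtain ⟨φ, hφ⟩ : ∃ φ : Module.Dual K (Module.End K V), φ ν ≠ 0 := by
      by_contra hcon
      push Not at hcon
      exact hν0 ((Module.forall_dual_apply_eq_zero_iff K ν).1 hcon)
    let α : Module.End K V →ₗ[K] K := (φ ν)⁻¹ • (φ ∘ₗ (-adL ν))
    have hα : ∀ σ ∈ t, adL σ ν = α σ • ν := by
      intro σ hσ
      obtain ⟨a, ha⟩ := hνt _ ⟨σ, hσ, rfl⟩
      have : (-adL ν) σ = adL σ ν := by rw [LinearMap.neg_apply, adL_apply, adL_apply, neg_sub]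
      simp only [α, LinearMap.smul_apply, LinearMap.comp_apply]
      rw [this, ha, map_smul, smul_eq_mul, smul_eq_mul, mul_comm a, inv_mul_cancel_left₀ hφ]
    obtain ⟨y, hyt, hy⟩ := htnd.exists_eq_trace α
    have hyRat : RatSS y := ratSS_of_trace_rat htrep hyt (htss y hyt) fun σ hσ hσr => by
      rw [hy σ hσ]
      obtain ⟨r, hr⟩ := hσr.adL.2 (α σ) (Module.End.hasEigenvalue_of_hasEigenvector
        ⟨Module.End.mem_eigenspace_iff.2 (hα σ hσ), hν0⟩)
      exact ⟨r, hr.symm⟩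
    have hy0 : y ≠ 0 := by
      rintro rfl
      have h1 := hy τ hτt
      rw [zero_mul, map_zero] at h1
      have h2 := hα τ hτt
      rw [← h1, zero_smul] at h2
      have : ν ∈ t ⊓ n := ⟨⟨hnh hνn, h2⟩, hνn⟩
      rw [htn] at this
      exact hν0 ((Submodule.mem_bot K).1 this)
    obtain ⟨a, ha0, ha⟩ := hyRat.exists_trace_sq_pos hy0
    rw [hy y hyt] at ha
    have hak : (a : K) ≠ 0 := Rat.cast_ne_zero.2 ha0.ne'
    have hbrtr : ∀ σ z, LinearMap.trace K V (adL σ ν * z) = - LinearMap.trace K V (ν * adL σ z) :=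
      fun σ z => trace_adL_mul σ ν z
    obtain ⟨z0, hz0h, hz0⟩ : ∃ z ∈ h, LinearMap.trace K V (ν * z) ≠ 0 := by
      by_contra! hcon
      exact hν0 (hnd ν (hnh hνn) hcon)
    let ψ : Module.End K V →ₗ[K] K := LinearMap.trace K V ∘ₗ LinearMap.mulLeft K ν
    obtain ⟨c, z1, hz1h, hcz, hψ1⟩ := exists_eigenvector_of_ne_zero (isSemisimple_adL hτ.1) (p := h)
      (fun x hx => hbr τ hτh x hx) ψ hz0h hz0
    obtain ⟨c', z2, ⟨hz2h, hz2c⟩, hcz2, hψ2⟩ := exists_eigenvector_of_ne_zero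
      (isSemisimple_adL hyRat.1) (p := h ⊓ (adL τ).eigenspace c)
      (fun x hx => ⟨hbr y (hqh (htq hyt)) x hx.1, Module.End.mem_eigenspace_iff.2 (by
        rw [← Module.End.mul_apply, (hcomm τ hτt y hyt).eq, Module.End.mul_apply,
          Module.End.mem_eigenspace_iff.1 hx.2, map_smul])⟩) ψ
      ⟨hz1h, Module.End.mem_eigenspace_iff.2 hcz⟩ hψ1
    have hz2c : adL τ z2 = c • z2 := Module.End.mem_eigenspace_iff.1 hz2c
    have hweight : ∀ σ ∈ t, ∀ c : K, adL σ z2 = c • z2 → c = - α σ := by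
      intro σ hσ c hc
      have h1 := hbrtr σ z2
      rw [hα σ hσ, hc, smul_mul_assoc, mul_smul_comm, map_smul, map_smul, smul_eq_mul, smul_eq_mul,
        ← neg_mul] at h1
      rw [mul_right_cancel₀ hψ2 h1, neg_neg]
    have hcτ := hweight τ hτt c hz2c
    have hcy := hweight y hyt c' hcz2
    set w : K := LinearMap.trace K V (ν * z2) with hw
    have hw0 : w ≠ 0 := hψ2
    set z := w⁻¹ • z2 with hz
    have hzτ : adL τ z = (- α τ) • z := by rw [hz, map_smul, hz2c, hcτ, smul_comm]
    have hzy : adL y z = (- α y) • z := by rw [hz, map_smul, hcz2, hcy, smul_comm]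
    have hνz : LinearMap.trace K V (ν * z) = 1 := by
      rw [hz, mul_smul_comm, map_smul, smul_eq_mul, ← hw, inv_mul_cancel₀ hw0]
    have hzh : z ∈ h := Submodule.smul_mem _ _ hz2h
    clear_value z
    have hνzt : adL ν z ∈ t := by
      refine ⟨hbr ν (hnh hνn) z hzh, ?_⟩
      have h1 : adL τ (adL ν z) = adL (adL τ ν) z + adL ν (adL τ z) := by
        simp only [adL_apply]; noncomm_ring
      change adL τ (adL ν z) = 0
      rw [h1, hα τ hτt, hzτ, map_smul adL, map_smul (adL ν), LinearMap.smul_apply, neg_smul,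
        add_neg_cancel]
    have hνzy : adL ν z = y := by
      rw [← sub_eq_zero]
      refine htnd _ (sub_mem hνzt hyt) fun σ hσ => ?_
      rw [sub_mul, map_sub, hy σ hσ, sub_eq_zero, trace_adL_mul]
      have h1 : adL ν σ = - (α σ • ν) := by
        rw [← hα σ hσ, adL_apply, adL_apply, neg_sub]
      rw [h1, mul_neg, map_neg, mul_smul_comm, map_smul,
        LinearMap.trace_mul_comm, hνz, smul_eq_mul, mul_one, neg_neg]
    set u : K := 2 / a with hu
    have hua : u * a = 2 := div_mul_cancel₀ _ hak
    clear_value u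
    have hnz : ∀ x ∈ n, adL ν x ∈ n := hadq ν hνq
    have hyn : ∀ x ∈ n, adL (u • y) x ∈ n := hadq _ (Submodule.smul_mem _ _ (htq hyt))
    obtain ⟨p, hp0, hp⟩ := exists_pos_trace_restrict (h := adL (u • y)) (e := adL ν)
      (f := adL (u • z)) (n := n) (ν := ν)
      (by
        rw [← adL_bracket, ← adL_apply, map_smul, LinearMap.smul_apply, hα y hyt, ha, smul_smul,
          hua, map_smul])
      (by
        rw [← adL_bracket, ← adL_apply, map_smul adL u y, LinearMap.smul_apply, map_smul (adL y),
          hzy, ha, ← map_smul adL, smul_smul, smul_smul, smul_smul]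
        congr 2
        linear_combination (-u) * hua)
      (by rw [← adL_bracket, ← adL_apply, map_smul, hνzy])
      (isSemisimple_adL (Module.End.IsSemisimple_smul u hyRat.1)) hyn hnz hνn
      (by rw [map_smul, LinearMap.smul_apply, hα y hyt, ha, smul_smul, hua])
      (by
        intro x hx hxν
        have hun := isNilpotent_adL (hnil _ (hnz x hx))
        obtain ⟨m, hm⟩ := hun
        have h1 : adL (adL ν x) ν = (-1 : K) • ν := by
          have h2 : adL (adL ν x) ν = - adL ν (adL ν x) := by
            rw [adL_apply ν (adL ν x), adL_apply (adL ν x), neg_sub]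
          rw [neg_one_smul, h2, hxν]
        have h2 : ∀ m : ℕ, ((adL (adL ν x)) ^ m) ν = ((-1 : K) ^ m) • ν := by
          intro m
          induction m with
          | zero => simp
          | succ m ih => rw [pow_succ', Module.End.mul_apply, ih, map_smul, h1, smul_smul, pow_succ]
        have h3 := h2 m
        rw [hm, LinearMap.zero_apply] at h3
        exact hν0 ((smul_eq_zero.1 h3.symm).resolve_left (pow_ne_zero _ (by simp))))
    have hkα : k = α l := by
      have := hα l hlt
      rw [hνk] at this
      exact smul_left_injective K hν0 this
    refine ⟨a / 2 * p, by positivity, ?_⟩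
    rw [hkα, ← hy l hlt, LinearMap.trace_mul_comm, hl y hyt]
    have h4 : κ (u • y) = p := by rw [hκ _ hyn, hp]
    rw [map_smul, smul_eq_mul] at h4
    push_cast
    rw [← h4]
    have h2 : (2 : K) ≠ 0 := two_ne_zero
    rw [hu]; field_simp

end Grading

section Grading

variable {K V : Type*} [Field K] [AddCommGroup V] [Module K V] [FiniteDimensional K V]
  [CharZero K] [IsAlgClosed K]

theorem RatSS.exists_integral_multiple {T : Module.End K V} (hT : RatSS T) :
    ∃ c : ℕ, 0 < c ∧ ∀ a, T.HasEigenvalue a → ∃ z : ℤ, (c : K) * a = z := by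
  classical
  have hfin := T.finite_hasEigenvalue
  choose! r hr using hT.2
  refine ⟨∏ a ∈ hfin.toFinset, (r a).den, Finset.prod_pos fun a _ => (r a).pos, fun a ha => ?_⟩
  obtain ⟨m, hm⟩ : (r a).den ∣ ∏ a ∈ hfin.toFinset, (r a).den :=
    Finset.dvd_prod_of_mem _ (hfin.mem_toFinset.2 ha)
  refine ⟨m * (r a).num, ?_⟩
  rw [hm]
  have h1 : ((r a).den : K) * a = (r a).num := by
    have h2 := congrArg (fun q : ℚ => (q : K)) (Rat.mul_den_eq_num (r a))
    simp only [Rat.cast_mul, Rat.cast_natCast, Rat.cast_intCast] at h2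
    rw [hr a ha] at h2
    rw [mul_comm, h2]
  push_cast
  rw [mul_assoc, mul_left_comm, h1]

/-- A Lie algebra with nondegenerate trace form containing a nonzero invariant algebra of nilpotent
elements contains an integral diagonalizable element whose weight filtration is invariant and is
raised by the nilpotent elements. -/
theorem exists_grading {Γ : Subgroup (Module.End K V)ˣ}
    {h n0 : Submodule K (Module.End K V)} (hbr : BracketClosed h) (hrep : ReplicaClosed h)
    (hnd : NondegOn h) (hΓ : ConjStable Γ h) (hn0 : n0 ≤ h) (hn0br : BracketClosed n0)
    (hn0nil : ∀ x ∈ n0, IsNilpotent x) (hn0Γ : ConjStable Γ n0) {ι : Type*} [Fintype ι]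
    (hι : Module.finrank K V = Fintype.card ι) :
    ∃ L ∈ h, ∃ (b : Module.Basis ι K V) (d : ι → ℤ), (∀ j, L (b j) = (d j : K) • b j) ∧
      (∀ γ ∈ Γ, ∀ i j, d i < d j → b.repr ((γ : Module.End K V) (b j)) i = 0) ∧
      ∀ ν ∈ n0, ∀ i j, d i ≤ d j → b.repr (ν (b j)) i = 0 := by
  classical
  obtain ⟨n, hn0n, hnh, hnbr, hnil, hnΓ, hqn, hnq⟩ :=
    exists_le_orthIn_normIn hbr hrep hnd hΓ hn0 hn0br hn0nil hn0Γ
  obtain ⟨l, hlh, hlR, hln, hlΓ, hlpos⟩ :=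
    exists_toral_character hbr hrep hnd hΓ hnh hnbr hnil hnΓ hqn hnq
  obtain ⟨c, hc0, hc⟩ := hlR.exists_integral_multiple
  obtain ⟨b, e, hb⟩ := exists_eigenbasis hlR.1.iSup_eigenspace_eq_top hι
  have hd : ∀ j, ∃ z : ℤ, (c : K) * e j = z := fun j => hc _
    (Module.End.hasEigenvalue_of_hasEigenvector ⟨Module.End.mem_eigenspace_iff.2 (hb j),
        b.ne_zero j⟩)
  choose d hd using hd
  have hcK : (c : K) ≠ 0 := Nat.cast_ne_zero.2 hc0.ne'
  have hrepr : ∀ v i, b.repr (l v) i = e i * b.repr v i := by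
    intro v i
    have : (Finsupp.lapply i ∘ₗ b.repr.toLinearMap ∘ₗ l : V →ₗ[K] K) =
        e i • (Finsupp.lapply i ∘ₗ b.repr.toLinearMap) := by
      refine b.ext fun j => ?_
      simp only [LinearMap.comp_apply, hb, map_smul, LinearMap.smul_apply, LinearEquiv.coe_coe,
        Module.Basis.repr_self, Finsupp.lapply_apply, smul_eq_mul]
      by_cases hij : j = i
      · subst hij; simp
      · simp [Finsupp.single_eq_of_ne (Ne.symm hij)]
    exact LinearMap.congr_fun this v
  have hnu : ∀ ν ∈ n, ∀ i j, d i ≤ d j → b.repr (ν (b j)) i = 0 := by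
    intro ν hν i j hij
    set T : Module.End K n := (adL l).restrict hln with hT
    have hTs : T.IsSemisimple := (isSemisimple_adL hlR.1).restrict (p := n)
      (by rw [Module.End.mem_invtSubmodule]; exact hln)
    have hmem : (⟨ν, hν⟩ : n) ∈ ⨆ k, T.eigenspace k := by
      rw [hTs.iSup_eigenspace_eq_top]; trivial
    suffices hsup : ∀ x ∈ ⨆ k, T.eigenspace k, b.repr ((x : Module.End K V) (b j)) i = 0 from
      hsup _ hmem
    intro x hx
    refine Submodule.iSup_induction _ (motive := fun x : n => b.repr ((x : Module.End K V)
        (b j)) i = 0)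
      hx ?_ (by simp) (fun x y hx hy => by simp [hx, hy])
    · intro k x hx
      have hxk : adL l x.1 = k • x.1 := congrArg Subtype.val (Module.End.mem_eigenspace_iff.1 hx)
      by_contra hne
      have hx0 : x.1 ≠ 0 := by rintro h; rw [h] at hne; simp at hne
      obtain ⟨r, hr0, hr⟩ := hlpos x.1 x.2 hx0 k hxk
      have h1 := congrArg (fun f : Module.End K V => b.repr (f (b j)) i) hxk
      simp only [adL_apply, LinearMap.sub_apply, Module.End.mul_apply, map_sub, Finsupp.sub_apply,
        hrepr, hb, map_smul, LinearMap.smul_apply, Finsupp.smul_apply, smul_eq_mul] at h1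
      rw [← sub_mul] at h1
      have h2 := mul_right_cancel₀ hne h1
      have h3 : ((d i - d j : ℤ) : K) = ((c * r : ℚ) : K) := by
        push_cast
        rw [← hd, ← hd, ← hr, ← h2]; ring
      have h4 : ((d i - d j : ℤ) : ℚ) = c * r := by
        have : (((d i - d j : ℤ) : ℚ) : K) = ((c * r : ℚ) : K) := by rw [← h3]; simp
        exact Rat.cast_injective this
      have h5 : (0 : ℚ) < c * r := mul_pos (Nat.cast_pos.2 hc0) hr0
      rw [← h4] at h5
      have h6 : 0 < d i - d j := by exact_mod_cast h5
      omega
  refine ⟨(c : K) • l, Submodule.smul_mem _ _ hlh, b, d, fun j => ?_, ?_,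
    fun ν hν => hnu ν (hn0n hν)⟩
  · rw [LinearMap.smul_apply, hb, smul_smul, hd]
  · intro γ hγ i j hij
    by_contra hne
    set w := (γ : Module.End K V) (b j) with hw
    set μ := (γ : Module.End K V) * l * (↑γ⁻¹ : Module.End K V) - l with hμ
    have hμn : μ ∈ n := hlΓ γ hγ
    have hlw : l w + μ w = e j • w := by
      rw [← LinearMap.add_apply, hμ, add_sub_cancel, hw, ← Module.End.mul_apply, mul_assoc,
        Units.inv_mul, mul_one, Module.End.mul_apply, hb, map_smul]
    have hne' : i ∈ Finset.univ.filter fun i => d i < d j ∧ b.repr w i ≠ 0 := by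
      simp only [Finset.mem_filter, Finset.mem_univ, true_and]; exact ⟨hij, hne⟩
    obtain ⟨m, hm, hmin⟩ := Finset.exists_min_image _ d ⟨i, hne'⟩
    simp only [Finset.mem_filter, Finset.mem_univ, true_and] at hm hmin
    have h1 := congrArg (fun v => b.repr v m) hlw
    simp only [map_add, Finsupp.add_apply, hrepr, map_smul, Finsupp.smul_apply, smul_eq_mul] at h1
    have h2 : b.repr (μ w) m = 0 := by
      conv_lhs => rw [← b.sum_repr w]
      rw [map_sum, map_sum, Finsupp.finsetSum_apply]
      refine Finset.sum_eq_zero fun k _ => ?_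
      rw [map_smul, map_smul, Finsupp.smul_apply, smul_eq_mul]
      by_cases hk : d m ≤ d k
      · rw [hnu μ hμn m k hk, mul_zero]
      · by_cases hk0 : b.repr w k = 0
        · rw [hk0, zero_mul]
        · exact absurd (hmin k ⟨by omega, hk0⟩) hk
    rw [h2, add_zero] at h1
    have h3 := mul_right_cancel₀ hm.2 h1
    have h4 : (d m : K) = d j := by rw [← hd, ← hd, h3]
    have h5 : d m = d j := by exact_mod_cast h4
    omega

end Grading

section Topology

open TopologicalSpace

variable {X : Type*} [TopologicalSpace X] [NoetherianSpace X]

/-- In a homogeneous Noetherian space every connected component is open and irreducible. -/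
theorem isOpen_isIrreducible_connectedComponent
    (hX : ∀ x y : X, ∃ φ : X ≃ₜ X, φ x = y) (x : X) :
    IsOpen (connectedComponent x) ∧ IsIrreducible (connectedComponent x) := by
  have hnb : ∀ y : X, ∃ U : Set X, IsOpen U ∧ y ∈ U ∧ IsPreirreducible U := by
    intro y
    obtain ⟨U, hU, ⟨u, hu⟩, hUZ⟩ :=
      NoetherianSpace.exists_isOpen_nonempty_subset_irreducibleComponent
        _ (irreducibleComponent_mem_irreducibleComponents x)
    obtain ⟨φ, hφ⟩ := hX u y
    have hUi : IsPreirreducible U :=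
      IsPreirreducible.open_subset isIrreducible_irreducibleComponent.2 hU hUZ
    exact ⟨φ '' U, φ.isOpenMap U hU, ⟨u, hu, hφ⟩, hUi.image φ φ.continuous.continuousOn⟩
  have hopen : IsOpen (irreducibleComponent x) := by
    rw [isOpen_iff_mem_nhds]
    intro y hy
    obtain ⟨U, hU, hyU, hUi⟩ := hnb y
    refine Filter.mem_of_superset (hU.mem_nhds hyU) ?_
    have h1 : irreducibleComponent x ⊆ closure U := by
      have := subset_closure_inter_of_isPreirreducible_of_isOpen
        (isIrreducible_irreducibleComponent (x := x)).2 hU ⟨y, hy, hyU⟩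
      exact this.trans (closure_mono Set.inter_subset_right)
    have h2 : closure U = irreducibleComponent x :=
      eq_irreducibleComponent hUi.closure h1
    exact h2 ▸ subset_closure
  have heq : connectedComponent x = irreducibleComponent x := by
    refine subset_antisymm ?_ ?_
    · exact IsClopen.connectedComponent_subset ⟨isClosed_irreducibleComponent, hopen⟩
        mem_irreducibleComponent
    · exact isIrreducible_irreducibleComponent.2.isPreconnected.subset_connectedComponent
        mem_irreducibleComponent
  rw [heq]
  exact ⟨hopen, isIrreducible_irreducibleComponent⟩

end Topology

section Points

variable {K : Type} [Field K] {N : ℕ}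

abbrev GLn (K : Type) [Field K] (N : ℕ) := Matrix.GeneralLinearGroup (Fin N) K

abbrev Mat (K : Type) (N : ℕ) := Matrix (Fin N) (Fin N) K

abbrev Tau (N : ℕ) := (Fin N × Fin N) ⊕ (Fin N × Fin N)

/-- The coordinates of a point of `GL_N`: its entries and those of its inverse. -/
noncomputable def gpt (g : GLn K N) : Tau N → K :=
  Sum.elim (fun q => (g : Mat K N) q.1 q.2) (fun q => ((g⁻¹ : GLn K N) : Mat K N) q.1 q.2)

theorem glCoords_apply {I : Type} (g : I → GLn K N) (p : I × Tau N) :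
    glCoords K N g p = gpt (g p.1) p.2 := by
  obtain ⟨i, q | q⟩ := p <;> simp [glCoords, gpt]

/-- The map from `n`-tuples in `H` to the prime spectrum of the polynomial ring. -/
noncomputable def tupleSpec (H : Subgroup (GLn K N)) (m : ℕ) (g : Fin m → H) :
    PrimeSpectrum (MvPolynomial (Fin m × Tau N) K) :=
  MvPolynomial.pointToPoint (glCoords K N fun i => (g i : GLn K N))

theorem tupleZarTop_eq_induced (H : Subgroup (GLn K N)) (m : ℕ) :
    tupleZarTop K N H m = TopologicalSpace.induced (tupleSpec H m) inferInstance := by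
  rw [PrimeSpectrum.isTopologicalBasis_basic_opens.eq_generateFrom, induced_generateFrom_eq]
  unfold tupleZarTop
  congr 1
  have key : ∀ P, tupleSpec H m ⁻¹' (PrimeSpectrum.basicOpen P : Set _) =
      {g | eval (glCoords K N fun i => (g i : GLn K N)) P ≠ 0} := by
    intro P
    ext g
    simp [tupleSpec, MvPolynomial.pointToPoint, aeval_eq_eval]
  ext U
  constructor
  · rintro ⟨f, ⟨P, hP⟩, rfl⟩
    refine ⟨_, ⟨P, rfl⟩, ?_⟩
    rw [key]
    ext g
    simp [hP g]
  · rintro ⟨_, ⟨P, rfl⟩, rfl⟩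
    exact ⟨fun g => eval (glCoords K N fun i => (g i : GLn K N)) P, ⟨P, fun _ => rfl⟩, key P⟩

theorem isClosed_tupleZarTop_iff (H : Subgroup (GLn K N)) (m : ℕ) (S : Set (Fin m → H)) :
    @IsClosed _ (tupleZarTop K N H m) S ↔
      ∀ g : Fin m → H, (∀ P : MvPolynomial (Fin m × Tau N) K,
        (∀ g' ∈ S, aeval (glCoords K N fun i => (g' i : GLn K N)) P = 0) →
          aeval (glCoords K N fun i => (g i : GLn K N)) P = 0) → g ∈ S := by
  rw [tupleZarTop_eq_induced, isClosed_induced_iff]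
  constructor
  · rintro ⟨C, hC, rfl⟩ g hg
    obtain ⟨J, rfl⟩ := (PrimeSpectrum.isClosed_iff_zeroLocus _).1 hC
    simp only [Set.mem_preimage, PrimeSpectrum.mem_zeroLocus, tupleSpec,
      MvPolynomial.pointToPoint] at hg ⊢
    intro P hP
    simp only [SetLike.mem_coe, MvPolynomial.mem_vanishingIdeal_iff, Set.mem_singleton_iff,
      forall_eq]
    refine hg P fun g' hg' => ?_
    have := hg' hP
    simpa using this
  · intro h
    refine ⟨PrimeSpectrum.zeroLocus {P | ∀ g' ∈ S,
      aeval (glCoords K N fun i => (g' i : GLn K N)) P = 0},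
      PrimeSpectrum.isClosed_zeroLocus _, ?_⟩
    ext g
    simp only [Set.mem_preimage, PrimeSpectrum.mem_zeroLocus, tupleSpec,
      MvPolynomial.pointToPoint]
    constructor
    · intro hg
      refine h g fun P hP => ?_
      have := hg hP
      simpa using this
    · intro hg P hP
      simpa using hP g hg

theorem noetherianSpace_tupleZarTop (H : Subgroup (GLn K N)) (m : ℕ) :
    @TopologicalSpace.NoetherianSpace _ (tupleZarTop K N H m) := by
  let _ := tupleZarTop K N H m
  have : Topology.IsInducing (tupleSpec H m) := ⟨tupleZarTop_eq_induced H m⟩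
  exact this.noetherianSpace

theorem continuous_tupleZarTop_of_subst {H H' : Subgroup (GLn K N)} {m m' : ℕ}
    (φ : (Fin m → H) → (Fin m' → H'))
    (Φ : MvPolynomial (Fin m' × Tau N) K →ₐ[K] MvPolynomial (Fin m × Tau N) K)
    (h : ∀ g p, aeval (glCoords K N fun i => (g i : GLn K N)) (Φ (MvPolynomial.X p)) =
      glCoords K N (fun i => (φ g i : GLn K N)) p) :
    @Continuous _ _ (tupleZarTop K N H m) (tupleZarTop K N H' m') φ := by
  have h' : ∀ g P, aeval (glCoords K N fun i => (g i : GLn K N)) (Φ P) =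
      aeval (glCoords K N fun i => (φ g i : GLn K N)) P := by
    intro g P
    have : (aeval (R := K) (glCoords K N fun i => (g i : GLn K N))).comp Φ =
        aeval (glCoords K N fun i => (φ g i : GLn K N)) :=
      MvPolynomial.algHom_ext fun p => by rw [AlgHom.comp_apply, h, aeval_X]
    exact DFunLike.congr_fun this P
  let _ := tupleZarTop K N H m
  refine continuous_generateFrom_iff.2 ?_
  rintro _ ⟨f, ⟨P, hP⟩, rfl⟩
  refine TopologicalSpace.isOpen_generateFrom_of_mem ⟨fun g => f (φ g), ⟨Φ P, fun g => ?_⟩, rfl⟩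
  refine (hP _).trans ?_
  rw [← aeval_eq_eval, ← aeval_eq_eval]
  exact (h' g P).symm

end Points

section Matrices

variable {K : Type} [Field K] {N : ℕ}

/-- A pair of matrices as a family indexed by the coordinates of `GL_N`. -/
def prM {S : Type*} (A B : Matrix (Fin N) (Fin N) S) : Tau N → S :=
  Sum.elim (fun q => A q.1 q.2) (fun q => B q.1 q.2)

theorem gpt_eq (g : GLn K N) : gpt g = prM (g : Mat K N) ((g⁻¹ : GLn K N) : Mat K N) := rfl

/-- Scalar matrices of coefficients. -/
def cM (S : Type*) [CommRing S] [Algebra K S] : Mat K N →+* Matrix (Fin N) (Fin N) S :=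
  (algebraMap K S).mapMatrix

variable (K N) in
noncomputable def XX : Matrix (Fin N) (Fin N) (MvPolynomial (Tau N) K) :=
  Matrix.of fun a b => MvPolynomial.X (Sum.inl (a, b))

variable (K N) in
noncomputable def YY : Matrix (Fin N) (Fin N) (MvPolynomial (Tau N) K) :=
  Matrix.of fun a b => MvPolynomial.X (Sum.inr (a, b))

theorem X_eq_prM : (MvPolynomial.X : Tau N → MvPolynomial (Tau N) K) = prM (XX K N) (YY K N) := by
  ext1 (q | q) <;> rfl

theorem prM_congr {S : Type*} {A B A' B' : Matrix (Fin N) (Fin N) S} (h : A = A') (h' : B = B') :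
    prM A B = prM A' B' := by rw [h, h']

theorem map_prM {S T : Type*} [CommRing S] [CommRing T] [Algebra K S] [Algebra K T]
    (f : S →ₐ[K] T) (A B : Matrix (Fin N) (Fin N) S) (t : Tau N) :
    f (prM A B t) = prM (f.mapMatrix A) (f.mapMatrix B) t := by
  obtain q | q := t <;> rfl

@[simp] theorem mapMatrix_cM {S T : Type*} [CommRing S] [CommRing T] [Algebra K S] [Algebra K T]
    (f : S →ₐ[K] T) (A : Mat K N) : f.mapMatrix (cM S A) = cM T A := by
  ext i j
  simp [cM]

@[simp] theorem cM_self (A : Mat K N) : cM K A = A := by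
  ext i j
  simp [cM]

@[simp] theorem mapMatrix_aeval_XX {S : Type*} [CommRing S] [Algebra K S]
    (A B : Matrix (Fin N) (Fin N) S) :
    (aeval (R := K) (prM A B)).mapMatrix (XX K N) = A := by
  ext i j
  simp [XX, prM]

@[simp] theorem mapMatrix_aeval_YY {S : Type*} [CommRing S] [Algebra K S]
    (A B : Matrix (Fin N) (Fin N) S) :
    (aeval (R := K) (prM A B)).mapMatrix (YY K N) = B := by
  ext i j
  simp [YY, prM]

/-- Evaluation of polynomials at a point of `GL_N`. -/
noncomputable def ev (g : GLn K N) : MvPolynomial (Tau N) K →ₐ[K] K := aeval (gpt g)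

@[simp] theorem ev_XX (g : GLn K N) : (ev g).mapMatrix (XX K N) = (g : Mat K N) :=
  mapMatrix_aeval_XX _ _

@[simp] theorem ev_YY (g : GLn K N) :
    (ev g).mapMatrix (YY K N) = ((g⁻¹ : GLn K N) : Mat K N) := mapMatrix_aeval_YY _ _

/-- The substitution dual to the map `x ↦ a * x * b`. -/
noncomputable def sub (a b : GLn K N) :
    MvPolynomial (Tau N) K →ₐ[K] MvPolynomial (Tau N) K :=
  aeval (prM (cM _ (a : Mat K N) * XX K N * cM _ (b : Mat K N))
    (cM _ ((b⁻¹ : GLn K N) : Mat K N) * YY K N * cM _ ((a⁻¹ : GLn K N) : Mat K N)))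

theorem ev_sub (a b x : GLn K N) (P : MvPolynomial (Tau N) K) :
    ev x (sub a b P) = ev (a * x * b) P := by
  have : (ev x).comp (sub a b) = ev (a * x * b) := by
    refine MvPolynomial.algHom_ext fun t => ?_
    rw [AlgHom.comp_apply, sub, aeval_X, map_prM, ev, ev, aeval_X, gpt_eq, gpt_eq]
    simp only [map_mul, mapMatrix_aeval_XX, mapMatrix_aeval_YY, mapMatrix_cM, cM_self]
    congr 1
    simp [mul_assoc]
  exact DFunLike.congr_fun this P

end Matrices

section Component

variable {K : Type} [Field K] {N : ℕ}

theorem aeval_glCoords_rename {I : Type} (g : I → GLn K N) (i : I)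
    (P : MvPolynomial (Tau N) K) :
    aeval (glCoords K N g) (rename (Prod.mk i) P) = ev (g i) P := by
  rw [aeval_rename]
  congr 2
  ext t
  simp [glCoords_apply]

theorem aeval_glCoords_const {I : Type} (g : GLn K N) (P : MvPolynomial (I × Tau N) K) :
    aeval (glCoords K N fun _ : I => g) P = ev g (rename Prod.snd P) := by
  rw [ev, aeval_rename]
  congr 2
  ext t
  simp [glCoords_apply]

/-- The homeomorphism `x ↦ a * x * b` of `H`. -/
noncomputable def transl (H : Subgroup (GLn K N)) (a b : H) :
    @Homeomorph (Fin 1 → H) (Fin 1 → H) (tupleZarTop K N H 1) (tupleZarTop K N H 1) :=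
  let _ := tupleZarTop K N H 1
  have hc : ∀ a b : H, Continuous fun (x : Fin 1 → H) (i : Fin 1) => a * x i * b := fun a b =>
    continuous_tupleZarTop_of_subst _
      (aeval fun p => rename (Prod.mk p.1) (sub (a : GLn K N) b (MvPolynomial.X p.2)))
      (fun g p => by
        rw [aeval_X, aeval_glCoords_rename, ev_sub, glCoords_apply, ev, aeval_X]
        rfl)
  { toFun := fun x i => a * x i * b
    invFun := fun x i => a⁻¹ * x i * b⁻¹
    left_inv := fun x => by ext1 i; group
    right_inv := fun x => by ext1 i; group
    continuous_toFun := hc a b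
    continuous_invFun := hc a⁻¹ b⁻¹ }

theorem transl_apply (H : Subgroup (GLn K N)) (a b : H) (x : Fin 1 → H) (i : Fin 1) :
    transl H a b x i = a * x i * b := rfl

theorem mem_identityComponent_iff {H : Subgroup (GLn K N)} {x : H} :
    x ∈ identityComponent K N H ↔
      (fun _ => x) ∈ @connectedComponent _ (tupleZarTop K N H 1) (fun _ => 1) := by
  constructor
  · rintro ⟨y, hy, rfl⟩
    have : (fun _ => y 0) = y := by ext1 i; rw [Subsingleton.elim i 0]
    rwa [this]
  · intro h
    exact ⟨_, h, rfl⟩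

theorem isOpen_isIrreducible_identityComponent (H : Subgroup (GLn K N)) :
    let _ := tupleZarTop K N H 1
    IsOpen (connectedComponent fun _ : Fin 1 => (1 : H)) ∧
      IsIrreducible (connectedComponent fun _ : Fin 1 => (1 : H)) := by
  intro _
  have := noetherianSpace_tupleZarTop H 1
  refine isOpen_isIrreducible_connectedComponent (fun x y => ⟨transl H (y 0) (x 0)⁻¹ , ?_⟩) _
  ext1 i
  rw [transl_apply, Subsingleton.elim i 0]
  group

theorem transl_mem_identityComponent {H : Subgroup (GLn K N)} (a b c x : H)
    (hc : c ∈ identityComponent K N H) (habc : a * c * b ∈ identityComponent K N H)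
    (hx : x ∈ identityComponent K N H) : a * x * b ∈ identityComponent K N H := by
  let _ := tupleZarTop K N H 1
  rw [mem_identityComponent_iff] at *
  have h1 := (transl H a b).continuous.image_connectedComponent_subset (fun _ => 1)
  have h2 : (fun _ : Fin 1 => a * c * b) ∈
      connectedComponent (transl H a b (fun _ => 1)) := h1 ⟨_, hc, rfl⟩
  have h3 : (fun _ : Fin 1 => a * x * b) ∈
      connectedComponent (transl H a b (fun _ => 1)) := h1 ⟨_, hx, rfl⟩
  rw [connectedComponent_eq h2] at h3
  rwa [connectedComponent_eq habc]

theorem one_mem_identityComponent (H : Subgroup (GLn K N)) : 1 ∈ identityComponent K N H :=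
  mem_identityComponent_iff.2 (@mem_connectedComponent _ (tupleZarTop K N H 1) _)

/-- The identity component, as a subgroup of `GL_N`. -/
noncomputable def idc (H : Subgroup (GLn K N)) : Subgroup (GLn K N) where
  carrier := {x | ∃ hx : x ∈ H, ⟨x, hx⟩ ∈ identityComponent K N H}
  one_mem' := ⟨H.one_mem, one_mem_identityComponent H⟩
  mul_mem' := by
    rintro x y ⟨hx, hx'⟩ ⟨hy, hy'⟩
    refine ⟨H.mul_mem hx hy, ?_⟩
    have := transl_mem_identityComponent ⟨x, hx⟩ 1 1 ⟨y, hy⟩ (one_mem_identityComponent H)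
      (by simpa using hx') hy'
    simpa using this
  inv_mem' := by
    rintro x ⟨hx, hx'⟩
    refine ⟨H.inv_mem hx, ?_⟩
    have := transl_mem_identityComponent (⟨x, hx⟩⁻¹ : H) 1 ⟨x, hx⟩ 1 hx'
      (by simpa using one_mem_identityComponent H) (one_mem_identityComponent H)
    rw [mul_one, mul_one] at this
    exact this

theorem mem_idc {H : Subgroup (GLn K N)} {x : GLn K N} :
    x ∈ idc H ↔ ∃ hx : x ∈ H, ⟨x, hx⟩ ∈ identityComponent K N H := Iff.rfl

theorem idc_le (H : Subgroup (GLn K N)) : idc H ≤ H := fun _ h => h.1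

theorem conj_mem_idc {H : Subgroup (GLn K N)} {a x : GLn K N} (ha : a ∈ H) (hx : x ∈ idc H) :
    a * x * a⁻¹ ∈ idc H := by
  obtain ⟨hx, hx'⟩ := hx
  refine ⟨H.mul_mem (H.mul_mem ha hx) (H.inv_mem ha), ?_⟩
  have := transl_mem_identityComponent ⟨a, ha⟩ (⟨a, ha⟩⁻¹ : H) 1 ⟨x, hx⟩
    (one_mem_identityComponent H) (by simpa using one_mem_identityComponent H) hx'
  exact this

theorem idc_mono {H H' : Subgroup (GLn K N)} (h : H ≤ H') : idc H ≤ idc H' := by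
  rintro x ⟨hx, hx'⟩
  refine ⟨h hx, ?_⟩
  rw [mem_identityComponent_iff] at *
  let t := tupleZarTop K N H 1
  let t' := tupleZarTop K N H' 1
  have hc : Continuous fun (x : Fin 1 → H) (i : Fin 1) => Subgroup.inclusion h (x i) :=
    continuous_tupleZarTop_of_subst _ (AlgHom.id K _) (fun g p => by
      rw [AlgHom.id_apply, aeval_X]; rfl)
  exact hc.image_connectedComponent_subset _ ⟨_, hx', rfl⟩

theorem idc_finite (H : Subgroup (GLn K N)) : ((idc H).subgroupOf H).FiniteIndex := by
  let _ := tupleZarTop K N H 1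
  have hN := noetherianSpace_tupleZarTop H 1
  have hcomp : CompactSpace (Fin 1 → H) := inferInstance
  have hopen := (isOpen_isIrreducible_identityComponent H).1
  obtain ⟨t, ht⟩ := isCompact_univ.elim_finite_subcover
    (fun a : H => transl H a 1 '' (connectedComponent fun _ : Fin 1 => (1 : H)))
    (fun a => (transl H a 1).isOpenMap _ hopen)
    (fun x _ => Set.mem_iUnion.2 ⟨x 0, fun _ => 1, mem_connectedComponent, by
      ext1 i
      rw [transl_apply, Subsingleton.elim i 0]
      simp⟩)
  have : Finite (H ⧸ (idc H).subgroupOf H) := by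
    refine Finite.of_surjective (fun a : t => (QuotientGroup.mk (a : H) : H ⧸
        (idc H).subgroupOf H)) ?_
    intro y
    obtain ⟨x, rfl⟩ := QuotientGroup.mk_surjective y
    obtain ⟨a, ha', ha, z, hz, hzx⟩ := by
      simpa using ht (Set.mem_univ (fun _ : Fin 1 => x))
    refine ⟨⟨⟨a, ha'⟩, ha⟩, ?_⟩
    rw [QuotientGroup.eq, Subgroup.mem_subgroupOf]
    have h0 := congrFun hzx 0
    rw [transl_apply] at h0
    have : (⟨a, ha'⟩ : H)⁻¹ * x = z 0 := by rw [← h0]; simp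
    rw [this]
    exact ⟨(z 0).2, z, hz, rfl⟩
  exact Subgroup.finiteIndex_of_finite_quotient

/-- The ideal of a subgroup of `GL_N`. -/
noncomputable def ptI (G : Set (GLn K N)) : Ideal (MvPolynomial (Tau N) K) :=
  vanishingIdeal K (gpt '' G)

theorem mem_ptI {G : Set (GLn K N)} {P : MvPolynomial (Tau N) K} :
    P ∈ ptI G ↔ ∀ g ∈ G, ev g P = 0 := by
  simp only [ptI, mem_vanishingIdeal_iff, Set.forall_mem_image]
  rfl

theorem ptI_idc_isPrime (H : Subgroup (GLn K N)) : (ptI (idc H : Set (GLn K N))).IsPrime := by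
  let _ := tupleZarTop K N H 1
  have hirr := (isOpen_isIrreducible_identityComponent H).2
  refine ⟨fun h => ?_, fun {P Q} hPQ => ?_⟩
  · have := mem_ptI.1 ((Ideal.eq_top_iff_one _).1 h) 1 (idc H).one_mem
    simp at this
  · by_contra hcon
    push Not at hcon
    obtain ⟨hP, hQ⟩ := hcon
    rw [mem_ptI] at hP hQ
    push Not at hP hQ
    have hop : ∀ P : MvPolynomial (Tau N) K,
        IsOpen {x : Fin 1 → H | ev (x 0 : GLn K N) P ≠ 0} := fun P =>
      TopologicalSpace.isOpen_generateFrom_of_mem ⟨fun x => ev (x 0 : GLn K N) P,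
        ⟨rename (Prod.mk 0) P, fun g => by
          rw [← aeval_eq_eval]
          exact (aeval_glCoords_rename (fun i => (g i : GLn K N)) 0 P).symm⟩, rfl⟩
    obtain ⟨x, ⟨hx, hx'⟩, hxP⟩ := hP
    obtain ⟨y, ⟨hy, hy'⟩, hyQ⟩ := hQ
    obtain ⟨z, hz, hzP, hzQ⟩ := hirr.2 _ _ (hop P) (hop Q)
      ⟨fun _ => ⟨x, hx⟩, mem_identityComponent_iff.1 hx', hxP⟩
      ⟨fun _ => ⟨y, hy⟩, mem_identityComponent_iff.1 hy', hyQ⟩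
    have := mem_ptI.1 hPQ (z 0) ⟨(z 0).2, z, hz, rfl⟩
    rw [map_mul] at this
    exact (mul_ne_zero hzP hzQ) this

/-- A subset of `GL_N` is closed. -/
def GClosed (G : Set (GLn K N)) : Prop := ∀ x, (∀ P ∈ ptI G, ev x P = 0) → x ∈ G

theorem gClosed_of_isZarClosed {H : Subgroup (GLn K N)} (hH : IsZarClosed K N H) :
    GClosed (H : Set (GLn K N)) := by
  obtain ⟨𝒮, h⟩ := hH
  intro x hx
  refine (h x).2 fun P hP => ?_
  rw [← aeval_eq_eval]
  refine (aeval_glCoords_const x P).trans (hx _ (mem_ptI.2 fun g hg => ?_))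
  rw [← aeval_glCoords_const (I := Unit), aeval_eq_eval]
  exact (h g).1 hg P hP

theorem gClosed_idc {H : Subgroup (GLn K N)} (hH : GClosed (H : Set (GLn K N))) :
    GClosed (idc H : Set (GLn K N)) := by
  intro x hx
  have hxH : x ∈ H := hH x fun P hP => hx P (mem_ptI.2 fun g hg => mem_ptI.1 hP g (idc_le H hg))
  refine mem_idc.2 ⟨hxH, mem_identityComponent_iff.2 ?_⟩
  refine (isClosed_tupleZarTop_iff H 1 _).1
    (@isClosed_connectedComponent _ (tupleZarTop K N H 1) (fun _ : Fin 1 => (1 : H)))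
    (fun _ => ⟨x, hxH⟩) fun P hP => ?_
  have h1 := aeval_glCoords_const (I := Fin 1) x P
  have h2 : ev x (rename Prod.snd P) = 0 := by
    refine hx _ (mem_ptI.2 fun g hg => ?_)
    obtain ⟨hg, hg'⟩ := mem_idc.1 hg
    have h3 := hP _ (mem_identityComponent_iff.1 hg')
    rw [← aeval_glCoords_const (I := Fin 1)]
    exact h3
  exact h1.trans h2

end Component

section Filtration

variable {K σ : Type*} [Field K]

/-- The filtration of a polynomial ring by powers of the span of `1` and the variables. -/
noncomputable def fil (σ K : Type*) [Field K] (d : ℕ) : Submodule K (MvPolynomial σ K) :=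
  (Submodule.span K (insert 1 (Set.range MvPolynomial.X))) ^ d

theorem fil_finite [Finite σ] (d : ℕ) : FiniteDimensional K (fil σ K d) := by
  have h : (Submodule.span K (insert (1 : MvPolynomial σ K) (Set.range MvPolynomial.X))).FG :=
    Submodule.fg_span ((Set.finite_range _).insert _)
  exact Module.Finite.iff_fg.2 (h.pow d)

theorem one_mem_fil_one : (1 : MvPolynomial σ K) ∈ fil σ K 1 := by
  rw [fil, pow_one]
  exact Submodule.subset_span (Set.mem_insert _ _)

theorem X_mem_fil_one (t : σ) : (MvPolynomial.X t : MvPolynomial σ K) ∈ fil σ K 1 := by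
  rw [fil, pow_one]
  exact Submodule.subset_span (Set.mem_insert_of_mem _ ⟨t, rfl⟩)

theorem mul_mem_fil {d e : ℕ} {P Q : MvPolynomial σ K} (hP : P ∈ fil σ K d)
    (hQ : Q ∈ fil σ K e) : P * Q ∈ fil σ K (d + e) := by
  rw [fil, pow_add]
  exact Submodule.mul_mem_mul hP hQ

theorem one_mem_fil (d : ℕ) : (1 : MvPolynomial σ K) ∈ fil σ K d := by
  induction d with
  | zero => rw [fil, pow_zero]; exact Submodule.one_le.1 le_rfl
  | succ d ih => simpa using mul_mem_fil ih one_mem_fil_one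

theorem fil_mono {d e : ℕ} (h : d ≤ e) : fil σ K d ≤ fil σ K e := by
  obtain ⟨k, rfl⟩ := Nat.exists_eq_add_of_le h
  intro P hP
  simpa using mul_mem_fil hP (one_mem_fil k)

theorem exists_mem_fil (P : MvPolynomial σ K) : ∃ d, P ∈ fil σ K d := by
  induction P using MvPolynomial.induction_on with
  | C a =>
    refine ⟨0, ?_⟩
    rw [← mul_one (C a), ← smul_eq_C_mul]
    exact Submodule.smul_mem _ _ (one_mem_fil 0)
  | add p q hp hq =>
    obtain ⟨d, hd⟩ := hp
    obtain ⟨e, he⟩ := hq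
    exact ⟨max d e, add_mem (fil_mono (le_max_left _ _) hd) (fil_mono (le_max_right _ _) he)⟩
  | mul_X p t hp =>
    obtain ⟨d, hd⟩ := hp
    exact ⟨d + 1, mul_mem_fil hd (X_mem_fil_one t)⟩

theorem derivation_mem_fil {D : Derivation K (MvPolynomial σ K) (MvPolynomial σ K)}
    (hD : ∀ t, D (MvPolynomial.X t) ∈ fil σ K 1) {d : ℕ} {P : MvPolynomial σ K}
    (hP : P ∈ fil σ K d) : D P ∈ fil σ K d := by
  have h1 : ∀ P ∈ fil σ K 1, D P ∈ fil σ K 1 := by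
    intro P hP
    rw [fil, pow_one] at hP
    induction hP using Submodule.span_induction with
    | mem x hx =>
      obtain rfl | ⟨t, rfl⟩ := hx
      · simp
      · exact hD t
    | zero => simp
    | add x y _ _ hx hy => rw [map_add]; exact add_mem hx hy
    | smul a x _ hx => rw [Derivation.map_smul]; exact Submodule.smul_mem _ _ hx
  induction d generalizing P with
  | zero =>
    rw [fil, pow_zero, Submodule.mem_one] at hP
    obtain ⟨y, rfl⟩ := hP
    rw [Derivation.map_algebraMap]
    exact zero_mem _
  | succ d ih =>
    rw [fil, pow_succ] at hP
    induction hP using Submodule.mul_induction_on' with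
    | mem_mul_mem x hx y hy =>
      have hy' : y ∈ fil σ K 1 := by rwa [fil, pow_one]
      rw [Derivation.leibniz, smul_eq_mul, smul_eq_mul]
      refine add_mem ?_ ?_
      · exact mul_mem_fil hx (h1 _ hy')
      · rw [mul_comm]; exact mul_mem_fil (ih hx) hy'
    | add x _ y _ hx hy => rw [map_add]; exact add_mem hx hy

end Filtration

section Replica

variable {K σ : Type*} [Field K] [CharZero K]

theorem isReplica_derivation {A : Type*} [CommRing A] [Algebra K A] {θ : K →ₗ[ℚ] ℚ}
    {D D' : Derivation K A A} {s : Set A} (hs : Algebra.adjoin K s = ⊤)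
    (h : ∀ x ∈ s, x ∈ ⨆ c, replicaSpace θ (D : A →ₗ[K] A) (D' : A →ₗ[K] A) c) :
    IsReplica θ (D : A →ₗ[K] A) (D' : A →ₗ[K] A) := by
  refine isReplica_of_iSup_replicaSpace ?_
  rw [eq_top_iff]
  intro x _
  have hx : x ∈ Algebra.adjoin K s := hs ▸ Algebra.mem_top
  have h1 : ∀ (E : Derivation K A A) (r : K), E (algebraMap K A r) = 0 :=
    fun E r => E.map_algebraMap r
  induction hx using Algebra.adjoin_induction with
  | mem x hx => exact h x hx
  | algebraMap r =>
    refine Submodule.mem_iSup_of_mem 0 (mem_replicaSpace.2 ⟨?_, by simp⟩)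
    rw [Module.End.mem_maxGenEigenspace]
    exact ⟨1, by simp⟩
  | add x y _ _ hx hy => exact add_mem (hx trivial) (hy trivial)
  | mul x y _ _ hx hy =>
    have hl : ∀ (E : Derivation K A A) (v w : A), (E : A →ₗ[K] A) (LinearMap.mul K A v w) =
        LinearMap.mul K A ((E : A →ₗ[K] A) v) w + LinearMap.mul K A v ((E : A →ₗ[K] A) w) := by
      intro E v w
      simp [Derivation.leibniz]
      ring
    refine Submodule.iSup_induction _ (motive := fun z => z * y ∈ _) (hx trivial) ?_ ?_ ?_
    · intro c z hz
      refine Submodule.iSup_induction _ (motive := fun w => z * w ∈ _) (hy trivial) ?_ ?_ ?_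
      · intro d w hw
        exact Submodule.mem_iSup_of_mem (c + d) (mem_replicaSpace_bilin (hl D) (hl D') hz hw)
      · simp
      · intro a b ha hb; rw [mul_add]; exact add_mem ha hb
    · simp
    · intro a b ha hb; rw [add_mul]; exact add_mem ha hb

/-- Subspaces stable under a locally finite derivation are stable under its replicas. -/
theorem IsReplica.mem_of_derivation [IsAlgClosed K] [Finite σ] {θ : K →ₗ[ℚ] ℚ}
    {D D' : Derivation K (MvPolynomial σ K) (MvPolynomial σ K)}
    (h : IsReplica θ (D : _ →ₗ[K] MvPolynomial σ K) (D' : _ →ₗ[K] MvPolynomial σ K))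
    (hD : ∀ t, D (MvPolynomial.X t) ∈ fil σ K 1) (hD' : ∀ t, D' (MvPolynomial.X t) ∈ fil σ K 1)
    {I : Submodule K (MvPolynomial σ K)} (hI : ∀ P ∈ I, D P ∈ I) : ∀ P ∈ I, D' P ∈ I := by
  intro P hP
  obtain ⟨d, hd⟩ := exists_mem_fil P
  have := fil_finite (K := K) (σ := σ) d
  have h1 : ∀ a ∈ fil σ K d, (D : _ →ₗ[K] MvPolynomial σ K) a ∈ fil σ K d :=
    fun a ha => derivation_mem_fil hD ha
  have h2 : ∀ a ∈ fil σ K d, (D' : _ →ₗ[K] MvPolynomial σ K) a ∈ fil σ K d :=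
    fun a ha => derivation_mem_fil hD' ha
  exact (h.restrict h1 h2).mem_of_forall_mem (A := I.comap (fil σ K d).subtype)
    (fun a ha => hI _ ha) ⟨P, hd⟩ hP

end Replica

section Transport

variable {K σ : Type*} [Field K]

theorem pointDerivation_ext {B : Type*} [CommRing B] [Algebra K B]
    (b : MvPolynomial σ K →ₐ[K] B) (d d' : MvPolynomial σ K →ₗ[K] B)
    (hd : ∀ P Q, d (P * Q) = b P * d Q + b Q * d P)
    (hd' : ∀ P Q, d' (P * Q) = b P * d' Q + b Q * d' P)
    (h : ∀ t, d (MvPolynomial.X t) = d' (MvPolynomial.X t)) : d = d' := by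
  have h1 : ∀ e : MvPolynomial σ K →ₗ[K] B,
      (∀ P Q, e (P * Q) = b P * e Q + b Q * e P) → e 1 = 0 := by
    intro e he
    have := he 1 1
    simpa using this
  refine LinearMap.ext fun P => ?_
  induction P using MvPolynomial.induction_on with
  | C a => rw [← mul_one (C a), ← smul_eq_C_mul, map_smul, map_smul, h1 d hd, h1 d' hd']
  | add p q hp hq => rw [map_add, map_add, hp, hq]
  | mul_X p t hp => rw [hd, hd', hp, h]

theorem derivation_transport {A B : Type*} [CommRing A] [Algebra K A] [CommRing B] [Algebra K B]
    (φ : MvPolynomial σ K →ₐ[K] A) (D : Derivation K A A) (a : A →ₐ[K] B)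
    (E : Derivation K (MvPolynomial σ K) (MvPolynomial σ K)) (b : MvPolynomial σ K →ₐ[K] B)
    (hab : ∀ P, a (φ P) = b P)
    (h : ∀ t, a (D (φ (MvPolynomial.X t))) = b (E (MvPolynomial.X t)))
    (P : MvPolynomial σ K) : a (D (φ P)) = b (E P) := by
  have := pointDerivation_ext b (a.toLinearMap ∘ₗ (D : A →ₗ[K] A) ∘ₗ φ.toLinearMap)
    (b.toLinearMap ∘ₗ (E : MvPolynomial σ K →ₗ[K] MvPolynomial σ K))
    (fun P Q => by simp [hab]) (fun P Q => by simp) h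
  exact DFunLike.congr_fun this P

end Transport

section Derivations

variable {K : Type} [Field K] {N : ℕ}

theorem map_derivation_mul {A : Type*} [CommRing A] [Algebra K A] (D : Derivation K A A)
    (P Q : Matrix (Fin N) (Fin N) A) : (P * Q).map D = P.map D * Q + P * Q.map D := by
  ext i j
  simp [Matrix.mul_apply, Derivation.leibniz, Finset.sum_add_distrib]
  rw [add_comm]
  congr 1
  exact Finset.sum_congr rfl fun _ _ => mul_comm _ _

@[simp] theorem map_derivation_cM {A : Type*} [CommRing A] [Algebra K A] (D : Derivation K A A)
    (P : Mat K N) : (cM A P).map D = 0 := by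
  ext i j
  simp [cM]

theorem derivation_prM {A : Type*} [CommRing A] [Algebra K A] (D : Derivation K A A)
    (P Q : Matrix (Fin N) (Fin N) A) (t : Tau N) :
    D (prM P Q t) = prM (P.map D) (Q.map D) t := by
  obtain q | q := t <;> rfl

/-- The left-invariant derivation attached to a matrix. -/
noncomputable def Dv (ξ : Mat K N) :
    Derivation K (MvPolynomial (Tau N) K) (MvPolynomial (Tau N) K) :=
  mkDerivation K (prM (XX K N * cM _ ξ) (-(cM _ ξ * YY K N)))

@[simp] theorem Dv_X (ξ : Mat K N) (t : Tau N) :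
    Dv ξ (MvPolynomial.X t) = prM (XX K N * cM _ ξ) (-(cM _ ξ * YY K N)) t :=
  mkDerivation_X _ _ _

@[simp] theorem map_Dv_XX (ξ : Mat K N) : (XX K N).map (Dv ξ) = XX K N * cM _ ξ := by
  ext i j
  exact congrArg _ (Dv_X ξ (Sum.inl (i, j)))

@[simp] theorem map_Dv_YY (ξ : Mat K N) : (YY K N).map (Dv ξ) = -(cM _ ξ * YY K N) := by
  ext i j
  exact congrArg _ (Dv_X ξ (Sum.inr (i, j)))

theorem cM_smul {A : Type*} [CommRing A] [Algebra K A] (c : K) (ξ : Mat K N) :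
    cM A (c • ξ) = c • cM A ξ := by
  ext i j
  show algebraMap K A (c * ξ i j) = c • algebraMap K A (ξ i j)
  rw [map_mul, Algebra.smul_def]

theorem Dv_add (ξ η : Mat K N) : Dv (ξ + η) = Dv ξ + Dv η := by
  refine MvPolynomial.derivation_ext fun t => ?_
  rw [Derivation.add_apply, Dv_X, Dv_X, Dv_X, map_add]
  obtain q | q := t
  · simp only [prM, mul_add, Sum.elim_inl, Matrix.add_apply]
  · simp only [prM, add_mul, Sum.elim_inr, Matrix.add_apply, neg_add, Matrix.neg_apply]

theorem Dv_smul (c : K) (ξ : Mat K N) : Dv (c • ξ) = c • Dv ξ := by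
  refine MvPolynomial.derivation_ext fun t => ?_
  rw [Derivation.smul_apply, Dv_X, Dv_X, cM_smul]
  obtain q | q := t
  · simp only [prM, mul_smul_comm, Sum.elim_inl, Matrix.smul_apply]
  · simp only [prM, smul_mul_assoc, Sum.elim_inr, Matrix.smul_apply, Matrix.neg_apply, smul_neg]

theorem Dv_sub (a b : GLn K N) (ξ : Mat K N) (P : MvPolynomial (Tau N) K) :
    Dv ξ (sub a b P) =
      sub a b (Dv (((b⁻¹ : GLn K N) : Mat K N) * ξ * (b : Mat K N)) P) := by
  refine derivation_transport (sub a b) (Dv ξ) (AlgHom.id K _) _ (sub a b) (fun _ => rfl)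
    (fun t => ?_) P
  have hb : cM (MvPolynomial (Tau N) K) (b : Mat K N) *
      cM (MvPolynomial (Tau N) K) ((b⁻¹ : GLn K N) : Mat K N) = 1 := by
    rw [← map_mul, ← Units.val_mul]; simp
  have hb' : cM (MvPolynomial (Tau N) K) ((b⁻¹ : GLn K N) : Mat K N) *
      cM (MvPolynomial (Tau N) K) (b : Mat K N) = 1 := by
    rw [← map_mul, ← Units.val_mul]; simp
  rw [AlgHom.id_apply, Dv_X, map_prM, sub, aeval_X, derivation_prM]
  refine congrFun (prM_congr ?_ ?_) t
  · simp only [map_derivation_mul, map_derivation_cM, map_Dv_XX, map_mul, mapMatrix_aeval_XX,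
      mapMatrix_cM, zero_mul, mul_zero, zero_add, add_zero, mul_assoc]
    rw [← mul_assoc (cM _ (b : Mat K N)) (cM _ ((b⁻¹ : GLn K N) : Mat K N)), hb, one_mul]
  · simp only [map_derivation_mul, map_derivation_cM, map_Dv_YY, map_mul, mapMatrix_aeval_YY,
      mapMatrix_cM, zero_mul, mul_zero, zero_add, add_zero, mul_assoc, map_neg, mul_neg, neg_mul]
    rw [← mul_assoc (cM _ (b : Mat K N)) (cM _ ((b⁻¹ : GLn K N) : Mat K N)), hb, one_mul]

theorem Dv_bracket (ξ η : Mat K N) : ⁅Dv ξ, Dv η⁆ = Dv (ξ * η - η * ξ) := by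
  refine MvPolynomial.derivation_ext fun t => ?_
  rw [Derivation.commutator_apply, Dv_X, Dv_X, Dv_X, derivation_prM, derivation_prM]
  simp only [map_derivation_mul, map_derivation_cM, map_Dv_XX, map_sub, map_mul, mul_zero,
    add_zero]
  have h2 : ∀ ξ η : Mat K N, (-(cM (MvPolynomial (Tau N) K) η * YY K N)).map (Dv ξ) =
      cM _ η * (cM _ ξ * YY K N) := by
    intro ξ η
    have : (-(cM (MvPolynomial (Tau N) K) η * YY K N)).map (Dv ξ) =
        -((cM (MvPolynomial (Tau N) K) η * YY K N)).map (Dv ξ) := by ext i j; simp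
    rw [this, map_derivation_mul]
    simp
  rw [h2, h2]
  obtain q | q := t
  · simp only [prM, Sum.elim_inl, mul_sub, mul_assoc, Matrix.sub_apply]
  · simp only [prM, Sum.elim_inr, sub_mul, mul_assoc, Matrix.sub_apply, Matrix.neg_apply]
    ring

end Derivations

section LieAlgebra

variable {K : Type} [Field K] {N : ℕ}

/-- The Lie algebra of a subset of `GL_N`, as a space of matrices. -/
noncomputable def lieM (G : Set (GLn K N)) : Submodule K (Mat K N) where
  carrier := {ξ | ∀ P ∈ ptI G, ev 1 (Dv ξ P) = 0}
  add_mem' := by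
    intro ξ η hξ hη P hP
    rw [Dv_add, Derivation.add_apply, map_add, hξ P hP, hη P hP, add_zero]
  zero_mem' := by
    intro P _
    have : Dv (0 : Mat K N) = 0 := by
      have := Dv_smul (0 : K) (0 : Mat K N)
      rwa [zero_smul, zero_smul] at this
    rw [this]; simp
  smul_mem' := by
    intro c ξ hξ P hP
    rw [Dv_smul, Derivation.smul_apply, map_smul, hξ P hP, smul_zero]

theorem ptI_anti {G G' : Set (GLn K N)} (h : G ⊆ G') : ptI G' ≤ ptI G :=
  fun _ hP => mem_ptI.2 fun g hg => mem_ptI.1 hP g (h hg)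

theorem lieM_mono {G G' : Set (GLn K N)} (h : G ⊆ G') : lieM G ≤ lieM G' :=
  fun _ hξ P hP => hξ P (ptI_anti h hP)

theorem ev_Dv_eq {G : Subgroup (GLn K N)} {ξ : Mat K N} (hξ : ξ ∈ lieM (G : Set (GLn K N)))
    {P : MvPolynomial (Tau N) K} (hP : P ∈ ptI (G : Set (GLn K N))) :
    Dv ξ P ∈ ptI (G : Set (GLn K N)) := by
  refine mem_ptI.2 fun g hg => ?_
  have h1 : sub g 1 P ∈ ptI (G : Set (GLn K N)) := mem_ptI.2 fun x hx => by
    rw [ev_sub, mul_one]; exact mem_ptI.1 hP _ (G.mul_mem hg hx)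
  have := hξ _ h1
  rw [Dv_sub, ev_sub] at this
  simpa using this

theorem mem_lieM_of_stable {G : Subgroup (GLn K N)} {ξ : Mat K N}
    (h : ∀ P ∈ ptI (G : Set (GLn K N)), Dv ξ P ∈ ptI (G : Set (GLn K N))) :
    ξ ∈ lieM (G : Set (GLn K N)) := fun P hP => mem_ptI.1 (h P hP) 1 G.one_mem

theorem lieM_bracket {G : Subgroup (GLn K N)} {ξ η : Mat K N}
    (hξ : ξ ∈ lieM (G : Set (GLn K N))) (hη : η ∈ lieM (G : Set (GLn K N))) :
    ξ * η - η * ξ ∈ lieM (G : Set (GLn K N)) := by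
  refine mem_lieM_of_stable fun P hP => ?_
  rw [← Dv_bracket, Derivation.commutator_apply]
  exact sub_mem (ev_Dv_eq hξ (ev_Dv_eq hη hP)) (ev_Dv_eq hη (ev_Dv_eq hξ hP))

theorem lieM_conj {G : Subgroup (GLn K N)} {x : GLn K N} (hx : ∀ g ∈ G, x * g * x⁻¹ ∈ G)
    {ξ : Mat K N} (hξ : ξ ∈ lieM (G : Set (GLn K N))) :
    (x : Mat K N) * ξ * ((x⁻¹ : GLn K N) : Mat K N) ∈ lieM (G : Set (GLn K N)) := by
  intro P hP
  have h1 : sub x x⁻¹ P ∈ ptI (G : Set (GLn K N)) := mem_ptI.2 fun g hg => by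
    rw [ev_sub]; exact mem_ptI.1 hP _ (hx g hg)
  have := hξ _ h1
  rw [Dv_sub, ev_sub] at this
  simpa using this

end LieAlgebra

section Conj

variable {K : Type} [Field K] {N : ℕ} {I : Type}

/-- Evaluation of polynomials at a tuple of points of `GL_N`. -/
noncomputable def tev (g : I → GLn K N) : MvPolynomial (I × Tau N) K →ₐ[K] K :=
  aeval (glCoords K N g)

variable (K N) in
/-- The generic matrix with index `i`. -/
noncomputable def tX (i : I) : Matrix (Fin N) (Fin N) (MvPolynomial (I × Tau N) K) :=
  Matrix.of fun a b => MvPolynomial.X (i, Sum.inl (a, b))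

variable (K N) in
/-- The generic inverse matrix with index `i`. -/
noncomputable def tY (i : I) : Matrix (Fin N) (Fin N) (MvPolynomial (I × Tau N) K) :=
  Matrix.of fun a b => MvPolynomial.X (i, Sum.inr (a, b))

theorem tX_eq_prM (p : I × Tau N) :
    (MvPolynomial.X p : MvPolynomial (I × Tau N) K) = prM (tX K N p.1) (tY K N p.1) p.2 := by
  obtain ⟨i, q | q⟩ := p <;> rfl

theorem tev_X (g : I → GLn K N) (p : I × Tau N) : tev g (MvPolynomial.X p) =
    prM (g p.1 : Mat K N) (((g p.1)⁻¹ : GLn K N) : Mat K N) p.2 := by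
  rw [tev, aeval_X, glCoords_apply]; rfl

@[simp] theorem tev_tX (g : I → GLn K N) (i : I) : (tev g).mapMatrix (tX K N i) = (g i :
    Mat K N) := by
  ext a b
  exact tev_X g (i, Sum.inl (a, b))

@[simp] theorem tev_tY (g : I → GLn K N) (i : I) :
    (tev g).mapMatrix (tY K N i) = (((g i)⁻¹ : GLn K N) : Mat K N) := by
  ext a b
  exact tev_X g (i, Sum.inr (a, b))

/-- The derivation of the coordinate ring of tuples given by infinitesimal conjugation. -/
noncomputable def Dc (ξ : Mat K N) :
    Derivation K (MvPolynomial (I × Tau N) K) (MvPolynomial (I × Tau N) K) :=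
  mkDerivation K fun p => prM (cM _ ξ * tX K N p.1 - tX K N p.1 * cM _ ξ)
    (cM _ ξ * tY K N p.1 - tY K N p.1 * cM _ ξ) p.2

theorem Dc_X (ξ : Mat K N) (p : I × Tau N) : Dc ξ (MvPolynomial.X p) =
    prM (cM _ ξ * tX K N p.1 - tX K N p.1 * cM _ ξ)
    (cM _ ξ * tY K N p.1 - tY K N p.1 * cM _ ξ) p.2 :=
  mkDerivation_X _ _ _

@[simp] theorem map_Dc_tX (ξ : Mat K N) (i : I) :
    (tX K N i).map (Dc ξ) = cM _ ξ * tX K N i - tX K N i * cM _ ξ := by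
  ext a b
  exact congrArg _ (Dc_X ξ (i, Sum.inl (a, b)))

@[simp] theorem map_Dc_tY (ξ : Mat K N) (i : I) :
    (tY K N i).map (Dc ξ) = cM _ ξ * tY K N i - tY K N i * cM _ ξ := by
  ext a b
  exact congrArg _ (Dc_X ξ (i, Sum.inr (a, b)))

theorem Dc_add (ξ η : Mat K N) : Dc (I := I) (ξ + η) = Dc ξ + Dc η := by
  refine MvPolynomial.derivation_ext fun t => ?_
  rw [Derivation.add_apply, Dc_X, Dc_X, Dc_X, map_add]
  obtain ⟨i, q | q⟩ := t <;>
    simp only [prM, mul_add, add_mul, Sum.elim_inl, Sum.elim_inr, Matrix.add_apply,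
      Matrix.sub_apply] <;> ring

theorem Dc_smul (c : K) (ξ : Mat K N) : Dc (I := I) (c • ξ) = c • Dc ξ := by
  refine MvPolynomial.derivation_ext fun t => ?_
  rw [Derivation.smul_apply, Dc_X, Dc_X, cM_smul]
  obtain ⟨i, q | q⟩ := t <;>
    simp only [prM, mul_smul_comm, smul_mul_assoc, ← smul_sub, Sum.elim_inl, Sum.elim_inr,
      Matrix.smul_apply]

theorem Dc_bracket (ξ η : Mat K N) : ⁅Dc (I := I) ξ, Dc (I := I) η⁆
    = -Dc (I := I) (ξ * η - η * ξ) := by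
  have hmap : ∀ (ξ : Mat K N) (A B : Matrix (Fin N) (Fin N) (MvPolynomial (I × Tau N) K)),
      (A - B).map (Dc ξ) = A.map (Dc ξ) - B.map (Dc ξ) := fun ξ A B => by ext i j; simp
  refine MvPolynomial.derivation_ext fun t => ?_
  rw [Derivation.commutator_apply, Dc_X, Dc_X, derivation_prM, derivation_prM,
    Derivation.neg_apply, Dc_X]
  simp only [hmap, map_derivation_mul, map_derivation_cM, map_Dc_tX, map_Dc_tY, map_sub, map_mul,
    mul_zero, zero_mul, zero_add, add_zero]
  obtain ⟨i, q | q⟩ := t <;>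
    simp only [prM, Sum.elim_inl, Sum.elim_inr, mul_sub, sub_mul, mul_assoc, Matrix.sub_apply] <;>
    ring

/-- The conjugate of a tuple. -/
def conjT (x : GLn K N) (g : I → GLn K N) : I → GLn K N := fun i => x * g i * x⁻¹

/-- The pull-back of functions along the orbit map of a tuple. -/
noncomputable def orb (g : I → GLn K N) :
    MvPolynomial (I × Tau N) K →ₐ[K] MvPolynomial (Tau N) K :=
  aeval fun p => prM (XX K N * cM _ (g p.1 : Mat K N) * YY K N)
    (XX K N * cM _ (((g p.1)⁻¹ : GLn K N) : Mat K N) * YY K N) p.2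

theorem ev_orb (g : I → GLn K N) (x : GLn K N) (P : MvPolynomial (I × Tau N) K) :
    ev x (orb g P) = tev (conjT x g) P := by
  have : (ev x).comp (orb g) = tev (conjT x g) := by
    refine MvPolynomial.algHom_ext fun t => ?_
    rw [AlgHom.comp_apply, orb, aeval_X, map_prM, tev_X]
    simp only [map_mul, ev_XX, ev_YY, mapMatrix_cM, cM_self, conjT]
    congr 1
    simp [mul_assoc]
  exact DFunLike.congr_fun this P

theorem ev_Dv_orb (g : I → GLn K N) (x : GLn K N) (ξ : Mat K N)
    (P : MvPolynomial (I × Tau N) K) :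
    ev x (Dv ξ (orb g P)) =
      tev (conjT x g) (Dc ((x : Mat K N) * ξ * ((x⁻¹ : GLn K N) : Mat K N)) P) := by
  refine derivation_transport (orb g) (Dv ξ) (ev x) _ (tev (conjT x g)) (ev_orb g x)
    (fun t => ?_) P
  have hx : ((x⁻¹ : GLn K N) : Mat K N) * (x : Mat K N) = 1 := by
    rw [← Units.val_mul]; simp
  have hx2 : ∀ M : Mat K N, ((x⁻¹ : GLn K N) : Mat K N) * ((x : Mat K N) * M) = M := by
    intro M; rw [← mul_assoc, hx, one_mul]
  rw [Dc_X, orb, aeval_X, derivation_prM, map_prM, map_prM]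
  refine congrFun (prM_congr ?_ ?_) t.2
  · simp only [map_derivation_mul, map_derivation_cM, map_Dv_XX, map_Dv_YY, map_mul, zero_mul,
      zero_add, map_add, map_neg, ev_XX, ev_YY, tev_tX, mapMatrix_cM, cM_self, conjT,
      Units.val_mul, mul_neg, mul_assoc, hx2, sub_eq_add_neg]
  · simp only [map_derivation_mul, map_derivation_cM, map_Dv_XX, map_Dv_YY, map_mul, zero_mul,
      zero_add, map_add, map_neg, ev_XX, ev_YY, tev_tY, mapMatrix_cM, cM_self, conjT,
      _root_.mul_inv_rev, inv_inv, Units.val_mul, mul_neg, mul_assoc, hx2, sub_eq_add_neg]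

end Conj

section MatrixForm

variable {K : Type} [Field K] {N : ℕ}

variable (K N) in
/-- The algebra isomorphism from endomorphisms of `K^N` to matrices. -/
noncomputable def mt : Module.End K (Fin N → K) ≃ₐ[K] Mat K N := LinearMap.toMatrixAlgEquiv'

theorem mt_apply (T : Module.End K (Fin N → K)) (i j : Fin N) :
    mt K N T i j = T (Pi.single j 1) i := by
  simp [mt, LinearMap.toMatrixAlgEquiv'_apply]

theorem mt_mulVec (T : Module.End K (Fin N → K)) (w : Fin N → K) : mt K N T *ᵥ w = T w :=
  congrFun (congrArg DFunLike.coe ((mt K N).symm_apply_apply T)) w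

theorem sum_dual_mul_mt (T : Module.End K (Fin N → K)) (φ : Module.Dual K (Fin N → K)) (c : Fin N) :
    ∑ a, φ (Pi.single a 1) * mt K N T a c = φ (T (Pi.single c 1)) := by
  conv_rhs => rw [pi_eq_sum_univ' (T (Pi.single c 1)), map_sum]
  refine Finset.sum_congr rfl fun a _ => ?_
  rw [map_smul, smul_eq_mul, mt_apply, mul_comm]

/-- The bilinear form given by a matrix with entries in an algebra. -/
noncomputable def mb {S : Type*} [CommRing S] [Algebra K S] (A : Matrix (Fin N) (Fin N) S) :
    Module.Dual K (Fin N → K) →ₗ[K] (Fin N → K) →ₗ[K] S :=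
  LinearMap.mk₂ K (fun φ w => ∑ a, ∑ c, (φ (Pi.single a 1) * w c) • A a c)
    (by intros; simp only [LinearMap.add_apply, add_mul, add_smul, Finset.sum_add_distrib])
    (by intros; simp only [LinearMap.smul_apply, smul_eq_mul, mul_assoc, mul_smul,
      Finset.smul_sum])
    (by intros; simp only [Pi.add_apply, mul_add, add_smul, Finset.sum_add_distrib])
    (by intros; simp only [Pi.smul_apply, smul_eq_mul, mul_left_comm, mul_smul,
      Finset.smul_sum])

variable {S : Type*} [CommRing S] [Algebra K S]

theorem mb_apply (A : Matrix (Fin N) (Fin N) S) (φ : Module.Dual K (Fin N → K)) (w : Fin N → K) :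
    mb A φ w = ∑ a, ∑ c, (φ (Pi.single a 1) * w c) • A a c := rfl

theorem mb_single (A : Matrix (Fin N) (Fin N) S) (a c : Fin N) :
    mb A (LinearMap.proj a : Module.Dual K (Fin N → K)) (Pi.single c 1) = A a c := by
  simp [mb_apply, Pi.single_apply, Finset.sum_ite_eq, ite_smul]

theorem mb_neg (A : Matrix (Fin N) (Fin N) S) (φ : Module.Dual K (Fin N → K)) (w : Fin N → K) :
    mb (-A) φ w = -mb A φ w := by
  simp [mb_apply]

theorem mb_sub (A B : Matrix (Fin N) (Fin N) S) (φ : Module.Dual K (Fin N → K)) (w : Fin N → K) :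
    mb (A - B) φ w = mb A φ w - mb B φ w := by
  simp [mb_apply, smul_sub]

theorem mb_cM_mul (A : Matrix (Fin N) (Fin N) S) (T : Module.End K (Fin N → K))
    (φ : Module.Dual K (Fin N → K)) (w : Fin N → K) :
    mb (cM S (mt K N T) * A) φ w = mb A (Module.Dual.transpose T φ) w := by
  simp only [mb_apply, Module.Dual.transpose_apply, Matrix.mul_apply, Finset.smul_sum]
  have h : ∀ a c x, (φ (Pi.single a 1) * w c) • (cM S (mt K N T) a x * A x c) =
      ((φ (Pi.single a 1) * mt K N T a x) * w c) • A x c := by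
    intro a c x
    show (φ (Pi.single a 1) * w c) • (algebraMap K S (mt K N T a x) * A x c) = _
    rw [← Algebra.smul_def, smul_smul]
    ring_nf
  simp only [h]
  have h2 : ∀ x c, ∑ a, ((φ (Pi.single a 1) * mt K N T a x) * w c) • A x c =
      (φ (T (Pi.single x 1)) * w c) • A x c := by
    intro x c
    rw [← Finset.sum_smul, ← Finset.sum_mul, sum_dual_mul_mt]
  rw [Finset.sum_congr rfl fun a _ => Finset.sum_comm, Finset.sum_comm]
  refine Finset.sum_congr rfl fun x _ => ?_
  rw [Finset.sum_comm]
  exact Finset.sum_congr rfl fun c _ => h2 x c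

theorem mb_mul_cM (A : Matrix (Fin N) (Fin N) S) (T : Module.End K (Fin N → K))
    (φ : Module.Dual K (Fin N → K)) (w : Fin N → K) :
    mb (A * cM S (mt K N T)) φ w = mb A φ (T w) := by
  simp only [mb_apply, Matrix.mul_apply, Finset.smul_sum]
  have h : ∀ a c x, (φ (Pi.single a 1) * w c) • (A a x * cM S (mt K N T) x c) =
      (φ (Pi.single a 1) * (mt K N T x c * w c)) • A a x := by
    intro a c x
    show (φ (Pi.single a 1) * w c) • (A a x * algebraMap K S (mt K N T x c)) = _
    rw [mul_comm (A a x), ← Algebra.smul_def, smul_smul]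
    ring_nf
  simp only [h]
  refine Finset.sum_congr rfl fun a _ => ?_
  rw [Finset.sum_comm]
  refine Finset.sum_congr rfl fun x _ => ?_
  rw [← Finset.sum_smul, ← Finset.mul_sum, ← mt_mulVec T w]
  rfl

theorem derivation_mb (D : Derivation K S S) (A : Matrix (Fin N) (Fin N) S)
    (φ : Module.Dual K (Fin N → K)) (w : Fin N → K) : D (mb A φ w) = mb (A.map D) φ w := by
  simp [mb_apply]

theorem algHom_mb {S' : Type*} [CommRing S'] [Algebra K S'] (f : S →ₐ[K] S')
    (A : Matrix (Fin N) (Fin N) S)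
    (φ : Module.Dual K (Fin N → K)) (w : Fin N → K) : f (mb A φ w) = mb (f.mapMatrix A) φ w := by
  simp [mb_apply]

theorem Dv_mb_XX (T : Module.End K (Fin N → K))
    (φ : Module.Dual K (Fin N → K)) (w : Fin N → K) :
    Dv (mt K N T) (mb (XX K N) φ w) = mb (XX K N) φ (T w) := by
  rw [derivation_mb, map_Dv_XX, mb_mul_cM]

theorem Dv_mb_YY (T : Module.End K (Fin N → K))
    (φ : Module.Dual K (Fin N → K)) (w : Fin N → K) :
    Dv (mt K N T) (mb (YY K N) φ w) = mb (YY K N) ((-Module.Dual.transpose T) φ) w := by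
  rw [derivation_mb, map_Dv_YY, mb_neg, mb_cM_mul]
  simp

end MatrixForm

section Replica

variable {K : Type} [Field K] [CharZero K] [IsAlgClosed K] {N : ℕ}

theorem adjoin_X_eq_top {σ : Type*} :
    Algebra.adjoin K (Set.range (MvPolynomial.X : σ → MvPolynomial σ K)) = ⊤ :=
  MvPolynomial.adjoin_range_X

theorem IsReplica.transpose {V : Type*} [AddCommGroup V] [Module K V] [FiniteDimensional K V]
    {θ : K →ₗ[ℚ] ℚ} {T T' : Module.End K V}
    (h : IsReplica θ T T') : IsReplica θ (V := Module.Dual K V) (Module.Dual.transpose T)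
      (Module.Dual.transpose T') := by
  refine h.map (Module.Dual.transpose (R := K)) fun n => ?_
  induction n with
  | zero => ext; rfl
  | succ n ih => rw [pow_succ', pow_succ, ← ih]; ext; rfl

theorem IsReplica.Dv {θ : K →ₗ[ℚ] ℚ} {T T' : Module.End K (Fin N → K)} (h : IsReplica θ T T') :
    IsReplica θ (V := MvPolynomial (Tau N) K) (Dv (mt K N T) : _ →ₗ[K] MvPolynomial (Tau N) K)
      (Dv (mt K N T') : _ →ₗ[K] MvPolynomial (Tau N) K) := by
  refine isReplica_derivation adjoin_X_eq_top ?_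
  rintro _ ⟨⟨a, c⟩ | ⟨a, c⟩, rfl⟩
  · rw [X_eq_prM, prM, Sum.elim_inl, ← mb_single (K := K) (XX K N) a c]
    refine Submodule.iSup_induction _ (motive := fun w => mb (XX K N) (LinearMap.proj a) w ∈ _)
      (x := Pi.single c 1) (h.iSup_replicaSpace ▸ Submodule.mem_top) ?_ ?_ ?_
    · intro e w hw
      exact Submodule.mem_iSup_of_mem e (mem_replicaSpace_of_intertwine
        (fun v => (Dv_mb_XX T _ v).symm) (fun v => (Dv_mb_XX T' _ v).symm) hw)
    · simp
    · intro u v hu hv; rw [map_add]; exact add_mem hu hv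
  · rw [X_eq_prM, prM, Sum.elim_inr, ← mb_single (K := K) (YY K N) a c]
    refine Submodule.iSup_induction _
      (motive := fun φ => (mb (YY K N)).flip (Pi.single c 1) φ ∈ _)
      (x := LinearMap.proj a) (h.transpose.neg.iSup_replicaSpace ▸ Submodule.mem_top) ?_ ?_ ?_
    · intro e w hw
      exact Submodule.mem_iSup_of_mem e (mem_replicaSpace_of_intertwine
        (fun v => (Dv_mb_YY T v _).symm) (fun v => (Dv_mb_YY T' v _).symm) hw)
    · simp
    · intro u v hu hv; rw [map_add]; exact add_mem hu hv

theorem mb_mem_iSup_replicaSpace {S : Type*} [CommRing S] [Algebra K S]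
    {θ : K →ₗ[ℚ] ℚ} {T T' : Module.End K (Fin N → K)} (h : IsReplica θ T T')
    {D D' : Derivation K S S} {A : Matrix (Fin N) (Fin N) S}
    (hD : A.map D = cM S (mt K N T) * A - A * cM S (mt K N T))
    (hD' : A.map D' = cM S (mt K N T') * A - A * cM S (mt K N T'))
    (φ : Module.Dual K (Fin N → K)) (w : Fin N → K) :
    mb A φ w ∈ ⨆ c, replicaSpace θ (D : S →ₗ[K] S) (D' : S →ₗ[K] S) c := by
  have key : ∀ (E : Derivation K S S) (T : Module.End K (Fin N → K)),
      A.map E = cM S (mt K N T) * A - A * cM S (mt K N T) → ∀ φ w,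
      (E : S →ₗ[K] S) (mb A φ w) = mb A (Module.Dual.transpose T φ) w + mb A φ ((-T) w) := by
    intro E T hE φ w
    show E _ = _
    rw [derivation_mb, hE, mb_sub, mb_cM_mul, mb_mul_cM, LinearMap.neg_apply, map_neg,
      sub_eq_add_neg]
  refine Submodule.iSup_induction _ (motive := fun φ => mb A φ w ∈ _) (x := φ)
      (h.transpose.iSup_replicaSpace ▸ Submodule.mem_top) ?_ ?_ ?_
  · intro e φ hφ
    refine Submodule.iSup_induction _ (motive := fun w => mb A φ w ∈ _)
      (x := w) (h.neg.iSup_replicaSpace ▸ Submodule.mem_top) ?_ ?_ ?_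
    · intro e' w hw
      exact Submodule.mem_iSup_of_mem (e + e')
        (mem_replicaSpace_bilin (key D T hD) (key D' T' hD') hφ hw)
    · simp
    · intro u v hu hv; rw [map_add]; exact add_mem hu hv
  · simp
  · intro u v hu hv; rw [map_add, LinearMap.add_apply]; exact add_mem hu hv

theorem IsReplica.Dc {I : Type} {θ : K →ₗ[ℚ] ℚ} {T T' : Module.End K (Fin N → K)}
    (h : IsReplica θ T T') :
    IsReplica θ (V := MvPolynomial (I × Tau N) K)
      (Dc (I := I) (mt K N T) : _ →ₗ[K] MvPolynomial (I × Tau N) K)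
      (Dc (I := I) (mt K N T') : _ →ₗ[K] MvPolynomial (I × Tau N) K) := by
  refine isReplica_derivation adjoin_X_eq_top ?_
  rintro _ ⟨⟨i, ⟨a, c⟩ | ⟨a, c⟩⟩, rfl⟩
  · rw [tX_eq_prM, prM, Sum.elim_inl, ← mb_single (K := K) (tX K N i) a c]
    exact mb_mem_iSup_replicaSpace h (map_Dc_tX _ i) (map_Dc_tX _ i) _ _
  · rw [tX_eq_prM, prM, Sum.elim_inr, ← mb_single (K := K) (tY K N i) a c]
    exact mb_mem_iSup_replicaSpace h (map_Dc_tY _ i) (map_Dc_tY _ i) _ _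

theorem cM_mul_mem_fil {σ : Type*} {A : Matrix (Fin N) (Fin N) (MvPolynomial σ K)}
    (hA : ∀ a c, A a c ∈ fil σ K 1) (ξ : Mat K N) (a c : Fin N) :
    (cM (MvPolynomial σ K) ξ * A) a c ∈ fil σ K 1 := by
  rw [Matrix.mul_apply]
  refine sum_mem fun x _ => ?_
  show algebraMap K _ (ξ a x) * _ ∈ _
  rw [← Algebra.smul_def]
  exact Submodule.smul_mem _ _ (hA x c)

theorem mul_cM_mem_fil {σ : Type*} {A : Matrix (Fin N) (Fin N) (MvPolynomial σ K)}
    (hA : ∀ a c, A a c ∈ fil σ K 1) (ξ : Mat K N) (a c : Fin N) :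
    (A * cM (MvPolynomial σ K) ξ) a c ∈ fil σ K 1 := by
  rw [Matrix.mul_apply]
  refine sum_mem fun x _ => ?_
  show _ * algebraMap K _ (ξ x c) ∈ _
  rw [mul_comm, ← Algebra.smul_def]
  exact Submodule.smul_mem _ _ (hA a x)

theorem Dv_X_mem_fil (ξ : Mat K N) (t : Tau N) :
    Dv ξ (MvPolynomial.X t) ∈ fil (Tau N) K 1 := by
  rw [Dv_X]
  obtain ⟨a, c⟩ | ⟨a, c⟩ := t
  · exact mul_cM_mem_fil (fun a c => X_mem_fil_one _) ξ a c
  · exact neg_mem (cM_mul_mem_fil (fun a c => X_mem_fil_one _) ξ a c)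

theorem Dc_X_mem_fil {I : Type} (ξ : Mat K N) (t : I × Tau N) :
    Dc ξ (MvPolynomial.X t) ∈ fil (I × Tau N) K 1 := by
  rw [Dc_X]
  obtain ⟨i, ⟨a, c⟩ | ⟨a, c⟩⟩ := t
  · exact sub_mem (cM_mul_mem_fil (fun a c => X_mem_fil_one _) ξ a c)
      (mul_cM_mem_fil (fun a c => X_mem_fil_one _) ξ a c)
  · exact sub_mem (cM_mul_mem_fil (fun a c => X_mem_fil_one _) ξ a c)
      (mul_cM_mem_fil (fun a c => X_mem_fil_one _) ξ a c)

/-- The Lie algebra of a subset of `GL_N`, as a space of endomorphisms of `K^N`. -/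
noncomputable def lieE (G : Set (GLn K N)) : Submodule K (Module.End K (Fin N → K)) :=
  (lieM G).comap (mt K N).toLinearMap

theorem mem_lieE {G : Set (GLn K N)} {T : Module.End K (Fin N → K)} :
    T ∈ lieE G ↔ mt K N T ∈ lieM G := Iff.rfl

theorem bracketClosed_lieE (G : Subgroup (GLn K N)) :
    BracketClosed (lieE (G : Set (GLn K N))) := by
  intro x hx y hy
  rw [mem_lieE, map_sub, map_mul, map_mul]
  exact lieM_bracket hx hy

theorem replicaClosed_lieE (G : Subgroup (GLn K N)) :
    ReplicaClosed (lieE (G : Set (GLn K N))) := by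
  intro θ T T' hT h
  exact mem_lieM_of_stable (h.Dv.mem_of_derivation (Dv_X_mem_fil _) (Dv_X_mem_fil _)
    (I := (ptI (G : Set (GLn K N))).restrictScalars K) fun P hP => ev_Dv_eq hT hP)

variable (K N) in
/-- Invertible matrices as invertible endomorphisms. -/
noncomputable def toU : GLn K N →* (Module.End K (Fin N → K))ˣ :=
  Units.map ((mt K N).symm : Mat K N →* Module.End K (Fin N → K))

theorem mt_toU (g : GLn K N) : mt K N (toU K N g : Module.End K (Fin N → K)) = (g : Mat K N) :=
  (mt K N).apply_symm_apply _

theorem toU_apply (g : GLn K N) (v : Fin N → K) :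
    (toU K N g : Module.End K (Fin N → K)) v = (g : Mat K N) *ᵥ v := rfl

theorem conjStable_lieE {G M : Subgroup (GLn K N)} (h : ∀ x ∈ M, ∀ g ∈ G, x * g * x⁻¹ ∈ G) :
    ConjStable (M.map (toU K N)) (lieE (G : Set (GLn K N))) := by
  rintro _ ⟨x, hx, rfl⟩ ξ hξ
  rw [mem_lieE, map_mul, map_mul, ← map_inv, mt_toU, mt_toU]
  exact lieM_conj (h x hx) hξ

end Replica

section Cocharacter

variable {K : Type} [Field K] [CharZero K] [IsAlgClosed K] {N : ℕ}

/-- The elements of integral weight `w` for a derivation on which an algebra endomorphism acts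
by the `w`-th power of a scalar. -/
noncomputable def wtSpace {A : Type*} [CommRing A] [Algebra K A] (D : Derivation K A A)
    (E : A →ₐ[K] A) (s : Kˣ) (w : ℤ) : Submodule K A where
  carrier := {x | D x = (w : K) • x ∧ E x = ((s ^ w : Kˣ) : K) • x}
  add_mem' := fun {x y} hx hy => ⟨by rw [map_add, hx.1, hy.1, smul_add],
    by rw [map_add, hx.2, hy.2, smul_add]⟩
  zero_mem' := by simp
  smul_mem' := fun c x hx => ⟨by rw [Derivation.map_smul, hx.1, smul_comm],
    by rw [map_smul, hx.2, smul_comm]⟩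

variable {A : Type*} [CommRing A] [Algebra K A] {D : Derivation K A A} {E : A →ₐ[K] A} {s : Kˣ}

theorem iSup_wtSpace_eq_top {S : Set A} (hS : Algebra.adjoin K S = ⊤)
    (h : ∀ x ∈ S, x ∈ ⨆ w, wtSpace D E s w) : ⨆ w, wtSpace D E s w = ⊤ := by
  rw [eq_top_iff]
  intro x _
  have hx : x ∈ Algebra.adjoin K S := hS ▸ Algebra.mem_top
  induction hx using Algebra.adjoin_induction with
  | mem x hx => exact h x hx
  | algebraMap r =>
    exact Submodule.mem_iSup_of_mem 0 ⟨by simp, by simp⟩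
  | add x y _ _ hx hy => exact add_mem (hx trivial) (hy trivial)
  | mul x y _ _ hx hy =>
    refine Submodule.iSup_induction _ (motive := fun z => z * y ∈ _) (hx trivial) ?_ ?_ ?_
    · intro c z hz
      refine Submodule.iSup_induction _ (motive := fun w => z * w ∈ _) (hy trivial) ?_ ?_ ?_
      · intro d w hw
        refine Submodule.mem_iSup_of_mem (c + d) ⟨?_, ?_⟩
        · rw [Derivation.leibniz, hz.1, hw.1, Int.cast_add, add_smul, smul_eq_mul, smul_eq_mul,
            mul_smul_comm, mul_smul_comm, mul_comm w z, add_comm]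
        · rw [map_mul, hz.2, hw.2, smul_mul_smul_comm, _root_.zpow_add, Units.val_mul]
      · simp
      · intro a b ha hb; rw [mul_add]; exact add_mem ha hb
    · simp
    · intro a b ha hb; rw [add_mul]; exact add_mem ha hb

theorem algHom_mem_of_derivation_mem (h : ⨆ w, wtSpace D E s w = ⊤) {I : Submodule K A}
    (hI : ∀ P ∈ I, D P ∈ I) {P : A} (hP : P ∈ I) : E P ∈ I := by
  have hP' : P ∈ ⨆ w, wtSpace D E s w := h ▸ Submodule.mem_top
  rw [Submodule.mem_iSup_iff_exists_finsupp] at hP'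
  obtain ⟨f, hf, rfl⟩ := hP'
  have hinj : Set.InjOn (fun w : ℤ => (w : K)) f.support := fun a _ b _ hab =>
    Int.cast_injective hab
  set q := Lagrange.interpolate f.support (fun w : ℤ => (w : K)) fun w => ((s ^ w : Kˣ) : K)
    with hq
  have key : E (f.sum fun _ x => x) =
      Polynomial.aeval (D : A →ₗ[K] A) q (f.sum fun _ x => x) := by
    rw [Finsupp.sum, map_sum, map_sum]
    refine Finset.sum_congr rfl fun w hw => ?_
    rw [(hf w).2]
    have h1 : ∀ k : ℕ, ((D : A →ₗ[K] A) ^ k) (f w) = ((w : K) ^ k) • f w := by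
      intro k
      induction k with
      | zero => simp
      | succ k ih =>
        rw [pow_succ', Module.End.mul_apply, ih, map_smul, pow_succ, mul_smul]
        congr 1
        exact (hf w).1
    rw [Polynomial.aeval_eq_sum_range, LinearMap.sum_apply]
    simp only [LinearMap.smul_apply, h1, smul_smul]
    rw [← Finset.sum_smul, ← Polynomial.eval_eq_sum_range, hq,
      Lagrange.eval_interpolate_at_node _ hinj hw]
  rw [key]
  generalize q = q
  induction q using Polynomial.induction_on' with
  | add p q hp hq => rw [map_add, LinearMap.add_apply]; exact add_mem hp hq
  | monomial n a =>
    rw [Polynomial.aeval_monomial, ← Algebra.smul_def, LinearMap.smul_apply]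
    refine Submodule.smul_mem _ _ ?_
    induction n with
    | zero => simpa using hP
    | succ n ih =>
      rw [pow_succ', Module.End.mul_apply]
      exact hI _ ih

/-- An integral diagonalizable element of the Lie algebra integrates to a one-parameter
subgroup. -/
theorem mem_of_integral_mem_lieE {G : Subgroup (GLn K N)} (hG : GClosed (G : Set (GLn K N)))
    {ι : Type*} (b : Module.Basis ι K (Fin N → K)) (d : ι → ℤ) [Finite ι]
    {L : Module.End K (Fin N → K)} (hL : L ∈ lieE (G : Set (GLn K N)))
    (hb : ∀ j, L (b j) = (d j : K) • b j) (s : Kˣ) (x : GLn K N)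
    (hx : ∀ j, (x : Mat K N) *ᵥ b j = ((s ^ d j : Kˣ) : K) • b j) : x ∈ G := by
  classical
  have := Fintype.ofFinite ι
  have hxb : ∀ j, (toU K N x : Module.End K (Fin N → K)) (b j) = ((s ^ d j : Kˣ) : K) • b j := hx
  have hxb' : ∀ j, (toU K N x⁻¹ : Module.End K (Fin N → K)) (b j) =
      ((s ^ (-d j) : Kˣ) : K) • b j := by
    intro j
    have h1 : b j = ((s ^ (-d j) : Kˣ) : K) • (toU K N x : Module.End K (Fin N → K)) (b j) := by
      rw [hxb, smul_smul, ← Units.val_mul, ← _root_.zpow_add]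
      simp
    have h2 : (toU K N x⁻¹ : Module.End K (Fin N → K)) ((toU K N x : Module.End K (Fin N → K))
        (b j)) =
        b j := by
      rw [← Module.End.mul_apply, ← Units.val_mul, ← map_mul]
      simp
    conv_lhs => rw [h1]
    rw [map_smul, h2]
  have htop : ⨆ w, wtSpace (Dv (mt K N L)) (sub 1 x) s w = ⊤ := by
    refine iSup_wtSpace_eq_top adjoin_X_eq_top ?_
    have hone : cM (MvPolynomial (Tau N) K) ((1 : GLn K N) : Mat K N) = 1 := by
      rw [Units.val_one, map_one]
    have hone' : cM (MvPolynomial (Tau N) K) ((1⁻¹ : GLn K N) : Mat K N) = 1 := by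
      rw [inv_one, Units.val_one, map_one]
    have hX : (sub 1 x).mapMatrix (XX K N) = XX K N * cM _ (x : Mat K N) := by
      rw [sub, mapMatrix_aeval_XX, hone, one_mul]
    have hY : (sub 1 x).mapMatrix (YY K N) = cM _ ((x⁻¹ : GLn K N) : Mat K N) * YY K N := by
      rw [sub, mapMatrix_aeval_YY, hone', mul_one]
    rintro _ ⟨⟨a, c⟩ | ⟨a, c⟩, rfl⟩
    · rw [X_eq_prM, prM, Sum.elim_inl, ← mb_single (K := K) (XX K N) a c]
      show Pi.single c 1 ∈ (⨆ w, wtSpace (Dv (mt K N L)) (sub 1 x) s w).comap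
        (mb (XX K N) (LinearMap.proj a))
      have : ⊤ ≤ (⨆ w, wtSpace (Dv (mt K N L)) (sub 1 x) s w).comap
        (mb (XX K N) (LinearMap.proj a)) := by
        rw [← b.span_eq, Submodule.span_le]
        rintro _ ⟨j, rfl⟩
        refine Submodule.mem_iSup_of_mem (d j) ⟨?_, ?_⟩
        · rw [Dv_mb_XX, hb, map_smul]
        · rw [algHom_mb, hX, ← mt_toU, mb_mul_cM, hxb, map_smul]
      exact this Submodule.mem_top
    · rw [X_eq_prM, prM, Sum.elim_inr, ← mb_single (K := K) (YY K N) a c]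
      show LinearMap.proj a ∈ (⨆ w, wtSpace (Dv (mt K N L)) (sub 1 x) s w).comap
        ((mb (YY K N)).flip (Pi.single c 1))
      have : ⊤ ≤ (⨆ w, wtSpace (Dv (mt K N L)) (sub 1 x) s w).comap
        ((mb (YY K N)).flip (Pi.single c 1)) := by
        rw [← b.dualBasis.span_eq, Submodule.span_le]
        rintro _ ⟨j, rfl⟩
        have hc : ∀ (T : Module.End K (Fin N → K)) (e : ι → K), (∀ j, T (b j) = e j • b j) →
            Module.Dual.transpose T (b.coord j) = e j • b.coord j := by
          intro T e hT
          refine b.ext fun i => ?_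
          rw [Module.Dual.transpose_apply, LinearMap.comp_apply, hT, map_smul,
            LinearMap.smul_apply, b.coord_apply, b.repr_self, Finsupp.single_apply]
          split_ifs with h
          · rw [h]
          · simp
        refine Submodule.mem_iSup_of_mem (-d j) ⟨?_, ?_⟩
        · rw [LinearMap.flip_apply, b.coe_dualBasis, Dv_mb_YY, LinearMap.neg_apply,
            hc L (fun j => (d j : K)) hb, map_neg, map_smul, Int.cast_neg, neg_smul]
          rfl
        · rw [LinearMap.flip_apply, b.coe_dualBasis, algHom_mb, hY, ← mt_toU, mb_cM_mul,
            hc _ (fun j => ((s ^ (-d j) : Kˣ) : K)) hxb', map_smul]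
          rfl
      exact this Submodule.mem_top
  refine hG x fun P hP => ?_
  have := algHom_mem_of_derivation_mem htop (I := (ptI (G : Set (GLn K N))).restrictScalars K)
    (fun P hP => ev_Dv_eq hL hP) hP
  have h1 := mem_ptI.1 this 1 G.one_mem
  rwa [ev_sub, one_mul, one_mul] at h1

end Cocharacter

section Extension

open scoped IntermediateField.algebraAdjoinAdjoin

theorem exists_derivation_of_isTranscendenceBasis {K F ι : Type} [Field K] [CharZero K] [Field F]
    [Algebra K F] {v : ι → F} (hv : IsTranscendenceBasis K v) (a : ι → F) :
    ∃ δ : Derivation K F F, ∀ i, δ (v i) = a i := by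
  let S := MvPolynomial ι K
  let alg : Algebra S F := (aeval v).toAlgebra
  let A := Algebra.adjoin K (Set.range v)
  let L := IntermediateField.adjoin K (Set.range v)
  let e : S ≃ₐ[K] A := hv.1.aevalEquiv
  let algA : Algebra S A := (e : S →+* A).toAlgebra
  have : IsScalarTower S A F := IsScalarTower.of_algebraMap_eq fun x => by
    show aeval v x = _
    exact (hv.1.algebraMap_aevalEquiv x).symm
  have : IsScalarTower K S F :=
    IsScalarTower.of_algebraMap_eq fun x => ((aeval v).commutes x).symm
  have : Algebra.FormallyEtale S A :=
    .of_equiv (AlgEquiv.ofRingEquiv (f := e.toRingEquiv) fun _ => rfl : S ≃ₐ[S] A)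
  have : Algebra.FormallyEtale A L := .of_isLocalization (nonZeroDivisors _)
  have : Algebra.IsAlgebraic L F := hv.isAlgebraic_field
  have : Algebra.FormallyEtale L F := .of_isSeparable L F
  have : Algebra.FormallyEtale A F := .comp A L F
  have : Algebra.FormallyEtale S F := .comp S A F
  let d : Derivation K S F := mkDerivation K a
  let Λ := d.liftKaehlerDifferential.liftBaseChange F ∘ₗ
    (KaehlerDifferential.tensorKaehlerEquivOfFormallyEtale K S F).symm.toLinearMap
  refine ⟨Λ.compDer (KaehlerDifferential.D K F), fun i => ?_⟩
  have h1 : v i = algebraMap S F (MvPolynomial.X i) := (aeval_X v i).symm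
  rw [h1]
  refine (congrArg (d.liftKaehlerDifferential.liftBaseChange F)
    (KaehlerDifferential.tensorKaehlerEquivOfFormallyEtale_symm_D_algebraMap K S F
      (MvPolynomial.X i))).trans ?_
  simp [d]
  exact mkDerivation_X K a i

theorem exists_derivation_of_algebraicIndependent {K F ι : Type} [Field K] [CharZero K] [Field F]
    [Algebra K F] {v : ι → F} (hv : AlgebraicIndependent K v) (a : ι → F) :
    ∃ δ : Derivation K F F, ∀ i, δ (v i) = a i := by
  obtain ⟨t, ht, htb⟩ := exists_isTranscendenceBasis_superset hv.coe_range
  obtain ⟨δ, hδ⟩ := exists_derivation_of_isTranscendenceBasis htb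
    fun x => Function.extend v a 0 x
  refine ⟨δ, fun i => ?_⟩
  rw [hδ ⟨v i, ht ⟨i, rfl⟩⟩]
  exact hv.injective.extend_apply _ _ _

end Extension

section Jacobian

variable {K : Type} [Field K] [CharZero K] {N : ℕ}

/-- Jacobian criterion: algebraically independent functions on `G` have linearly independent
differentials at some point. -/
theorem exists_lieM_dual {G : Subgroup (GLn K N)} (hI : (ptI (G : Set (GLn K N))).IsPrime)
    {ι : Type} [Finite ι] [DecidableEq ι] (f : ι → MvPolynomial (Tau N) K)
    (hf : AlgebraicIndependent K fun j => Ideal.Quotient.mkₐ K (ptI (G : Set (GLn K N))) (f j)) :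
    ∃ g ∈ G, ∃ ξ : ι → Mat K N, ∃ s : K, s ≠ 0 ∧ (∀ i, ξ i ∈ lieM (G : Set (GLn K N))) ∧
      ∀ i j, ev g (Dv (ξ i) (f j)) = if i = j then s else 0 := by
  set I := ptI (G : Set (GLn K N)) with hIdef
  let B := MvPolynomial (Tau N) K ⧸ I
  let F := FractionRing B
  let q : MvPolynomial (Tau N) K →ₐ[K] B := Ideal.Quotient.mkₐ K I
  let π : MvPolynomial (Tau N) K →ₐ[K] F := (IsScalarTower.toAlgHom K B F).comp q
  have hinj : Function.Injective (algebraMap B F) := IsFractionRing.injective B F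
  have hπ : ∀ P, π P = 0 ↔ P ∈ I := by
    intro P
    show algebraMap B F (q P) = 0 ↔ _
    rw [map_eq_zero_iff _ hinj]
    exact Ideal.Quotient.eq_zero_iff_mem
  have hfF : AlgebraicIndependent K fun j => π (f j) :=
    hf.map' (f := IsScalarTower.toAlgHom K B F) hinj
  choose δ hδ using fun i => exists_derivation_of_algebraicIndependent hfF
    (fun j => if i = j then (1 : F) else 0)
  obtain ⟨⟨s, hs⟩, hsi⟩ := IsLocalization.exist_integer_multiples_of_finite (nonZeroDivisors B)
    (fun p : ι × Tau N => δ p.1 (π (MvPolynomial.X p.2)))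
  obtain ⟨s0, rfl⟩ := Ideal.Quotient.mkₐ_surjective K I s
  have hlift : ∀ p : ι × Tau N, ∃ A : MvPolynomial (Tau N) K,
      π A = π s0 * δ p.1 (π (MvPolynomial.X p.2)) := by
    intro p
    obtain ⟨b, hb⟩ := hsi p
    obtain ⟨A, rfl⟩ := Ideal.Quotient.mkₐ_surjective K I b
    refine ⟨A, hb.trans ?_⟩
    exact Algebra.smul_def _ _
  choose A hA using hlift
  let E : ι → Derivation K (MvPolynomial (Tau N) K) (MvPolynomial (Tau N) K) :=
    fun i => mkDerivation K fun t => A (i, t)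
  have hE : ∀ i P, π (E i P) = π s0 * δ i (π P) := by
    intro i P
    have := pointDerivation_ext π (π.toLinearMap ∘ₗ (E i : _ →ₗ[K] MvPolynomial (Tau N) K))
      (LinearMap.mulLeft K (π s0) ∘ₗ (δ i : F →ₗ[K] F) ∘ₗ π.toLinearMap)
      (fun P Q => by simp) (fun P Q => by simp; ring) (fun t => by
        show π (mkDerivation K (fun t => A (i, t)) (MvPolynomial.X t)) = _
        rw [mkDerivation_X, hA]; rfl)
    exact DFunLike.congr_fun this P
  have hs0 : s0 ∉ I := fun h => nonZeroDivisors.ne_zero hs (Ideal.Quotient.eq_zero_iff_mem.2 h)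
  have hEI : ∀ i, ∀ P ∈ I, E i P ∈ I := by
    intro i P hP
    rw [← hπ, hE, (hπ P).2 hP, map_zero, mul_zero]
  obtain ⟨g, hg, hsg⟩ : ∃ g ∈ G, ev g s0 ≠ 0 := by
    by_contra h
    push Not at h
    exact hs0 (mem_ptI.2 h)
  let M : ι → Mat K N := fun i => (ev g).mapMatrix ((XX K N).map (E i))
  let ξ : ι → Mat K N := fun i => ((g⁻¹ : GLn K N) : Mat K N) * M i
  have hgg : (g : Mat K N) * ((g⁻¹ : GLn K N) : Mat K N) = 1 := by
    rw [← Units.val_mul]; simp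
  have hgg' : ((g⁻¹ : GLn K N) : Mat K N) * (g : Mat K N) = 1 := by
    rw [← Units.val_mul]; simp
  have hXY : ∀ a c, (XX K N * YY K N - 1) a c ∈ I := by
    intro a c
    refine mem_ptI.2 fun x _ => ?_
    have : (ev x).mapMatrix (XX K N * YY K N - 1) = 0 := by
      rw [map_sub, map_mul, ev_XX, ev_YY, map_one, ← Units.val_mul]
      simp
    exact congrFun (congrFun this a) c
  have hMY : ∀ i, (ev g).mapMatrix ((YY K N).map (E i)) =
      -(ξ i * ((g⁻¹ : GLn K N) : Mat K N)) := by
    intro i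
    have h1 : (ev g).mapMatrix ((XX K N * YY K N - 1).map (E i)) = 0 := by
      ext a c
      exact mem_ptI.1 (hEI i _ (hXY a c)) g hg
    have h2 : (XX K N * YY K N - 1).map (E i) = (XX K N * YY K N).map (E i) := by
      have : (1 : Matrix (Fin N) (Fin N) (MvPolynomial (Tau N) K)).map (E i) = 0 := by
        rw [← map_one (cM (K := K) (MvPolynomial (Tau N) K)), map_derivation_cM]
      rw [← sub_zero ((XX K N * YY K N).map (E i)), ← this]
      ext a c
      simp
    rw [h2, map_derivation_mul, map_add, map_mul, map_mul, ev_XX, ev_YY] at h1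
    calc _ = ((g⁻¹ : GLn K N) : Mat K N) * ((g : Mat K N) *
          (ev g).mapMatrix ((YY K N).map (E i))) := by rw [← mul_assoc, hgg', one_mul]
      _ = _ := by rw [eq_neg_of_add_eq_zero_right h1, mul_neg, mul_assoc]
  have hED : ∀ i P, ev g (E i P) = ev g (Dv (ξ i) P) := by
    intro i P
    refine derivation_transport (AlgHom.id K _) (E i) (ev g) _ (ev g) (fun _ => rfl)
      (fun t => ?_) P
    rw [AlgHom.id_apply, X_eq_prM, derivation_prM, map_prM, derivation_prM, map_prM]
    refine congrFun (prM_congr ?_ ?_) t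
    · rw [map_Dv_XX, map_mul, ev_XX, mapMatrix_cM, cM_self, ← mul_assoc, hgg, one_mul]
    · rw [map_Dv_YY, map_neg, map_mul, ev_YY, mapMatrix_cM, cM_self, hMY]
  refine ⟨g, hg, ξ, ev g s0, hsg, fun i P hP => ?_, fun i j => ?_⟩
  · have h1 : sub g⁻¹ 1 P ∈ I := mem_ptI.2 fun x hx => by
      rw [ev_sub, mul_one]; exact mem_ptI.1 hP _ (G.mul_mem (G.inv_mem hg) hx)
    have h2 := mem_ptI.1 (hEI i _ h1) g hg
    rw [hED, Dv_sub, ev_sub] at h2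
    simpa using h2
  · rw [← hED]
    have h1 : E i (f j) - (if i = j then s0 else 0) ∈ I := by
      rw [← hπ, map_sub, hE, hδ]
      split_ifs <;> simp
    have h2 := mem_ptI.1 h1 g hg
    rw [map_sub, sub_eq_zero] at h2
    rw [h2]
    split_ifs <;> simp

/-- A function with vanishing differential is constant. -/
theorem ev_eq_of_Dv_eq_zero [IsAlgClosed K] {G : Subgroup (GLn K N)}
    (hI : (ptI (G : Set (GLn K N))).IsPrime) {f : MvPolynomial (Tau N) K}
    (hf : ∀ g ∈ G, ∀ ξ ∈ lieM (G : Set (GLn K N)), ev g (Dv ξ f) = 0) {g : GLn K N} (hg : g ∈ G) :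
    ev g f = ev 1 f := by
  classical
  by_cases h : AlgebraicIndependent K fun _ : Unit =>
      Ideal.Quotient.mkₐ K (ptI (G : Set (GLn K N))) f
  · obtain ⟨x, hx, ξ, s, hs, hξ, h1⟩ := exists_lieM_dual hI _ h
    have := h1 () ()
    rw [hf x hx _ (hξ _), if_pos rfl] at this
    exact absurd this.symm hs
  · rw [algebraicIndependent_unique_type_iff, Transcendental, not_not] at h
    obtain ⟨p, hp, hp0⟩ := h
    have hmem : Polynomial.aeval f p ∈ ptI (G : Set (GLn K N)) := by
      rw [← Ideal.Quotient.eq_zero_iff_mem, ← hp0]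
      exact (Polynomial.aeval_algHom_apply (Ideal.Quotient.mkₐ K _) f p).symm
    rw [(IsAlgClosed.splits p).eq_prod_roots, map_mul, Polynomial.aeval_C,
      map_multiset_prod, Multiset.map_map] at hmem
    have hprod := (hI.mem_or_mem hmem).resolve_left fun h0 => by
      have := mem_ptI.1 h0 1 G.one_mem
      rw [algebraMap_eq, ev, aeval_C] at this
      exact hp (Polynomial.leadingCoeff_eq_zero.1 this)
    rw [hI.multiset_prod_mem_iff_exists_mem] at hprod
    obtain ⟨y, hy, hyI⟩ := hprod
    obtain ⟨r, _, rfl⟩ := Multiset.mem_map.1 hy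
    have key : ∀ x ∈ G, ev x f = r := by
      intro x hx
      have := mem_ptI.1 hyI x hx
      simp only [Function.comp_apply, map_sub, Polynomial.aeval_X, Polynomial.aeval_C,
        algebraMap_eq, ev, aeval_C, sub_eq_zero] at this
      exact this
    rw [key g hg, key 1 G.one_mem]

theorem conjT_one {I : Type} (g : I → GLn K N) : conjT 1 g = g := by
  ext1 i; simp [conjT]

theorem Dc_vanishes {G : Subgroup (GLn K N)} {I : Type} {S : Set (I → GLn K N)}
    (hS : ∀ x ∈ G, ∀ g ∈ S, conjT x g ∈ S) {P : MvPolynomial (I × Tau N) K}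
    (hP : ∀ g ∈ S, tev g P = 0) {ξ : Mat K N} (hξ : ξ ∈ lieM (G : Set (GLn K N)))
    {g : I → GLn K N} (hg : g ∈ S) : tev g (Dc ξ P) = 0 := by
  have h1 := ev_Dv_orb g 1 ξ P
  rw [conjT_one] at h1
  simp only [inv_one, Units.val_one, one_mul, mul_one] at h1
  rw [← h1]
  refine hξ _ (mem_ptI.2 fun x hx => ?_)
  rw [ev_orb]
  exact hP _ (hS x hx g hg)

theorem tev_conjT_eq_of_Dc [IsAlgClosed K] {G : Subgroup (GLn K N)}
    (hI : (ptI (G : Set (GLn K N))).IsPrime) {I : Type} {P : MvPolynomial (I × Tau N) K}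
    (hP : ∀ ξ ∈ lieM (G : Set (GLn K N)), Dc ξ P = 0) {x : GLn K N} (hx : x ∈ G)
    (g : I → GLn K N) : tev (conjT x g) P = tev g P := by
  have := ev_eq_of_Dv_eq_zero hI (f := orb g P) (fun y hy ξ hξ => by
    rw [ev_Dv_orb, hP _ (lieM_conj (fun z hz => G.mul_mem (G.mul_mem hy hz) (G.inv_mem hy)) hξ),
      map_zero]) hx
  rwa [ev_orb, ev_orb, conjT_one] at this

theorem mul_comm_of_lieM [IsAlgClosed K] {G : Subgroup (GLn K N)}
    (hI : (ptI (G : Set (GLn K N))).IsPrime) {M : Mat K N}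
    (hM : ∀ ξ ∈ lieM (G : Set (GLn K N)), ξ * M = M * ξ) {x : GLn K N} (hx : x ∈ G) :
    (x : Mat K N) * M = M * (x : Mat K N) := by
  have hev : ∀ y : GLn K N, (ev y).mapMatrix (XX K N * cM (MvPolynomial (Tau N) K) M * YY K N) =
      (y : Mat K N) * M * ((y⁻¹ : GLn K N) : Mat K N) := fun y => by
    rw [map_mul, map_mul, ev_XX, ev_YY, mapMatrix_cM, cM_self]
  have key : (x : Mat K N) * M * ((x⁻¹ : GLn K N) : Mat K N) = M := by
    have h1 := hev 1
    simp only [inv_one, Units.val_one, one_mul, mul_one] at h1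
    rw [← hev x]
    conv_rhs => rw [← h1]
    ext a c
    refine ev_eq_of_Dv_eq_zero hI (f := (XX K N * cM (MvPolynomial (Tau N) K) M * YY K N) a c)
        (fun y hy ξ hξ => ?_) hx
    have h2 : (XX K N * cM (MvPolynomial (Tau N) K) M * YY K N).map (Dv ξ) = 0 := by
      rw [map_derivation_mul, map_derivation_mul, map_derivation_cM, map_Dv_XX, map_Dv_YY]
      simp only [mul_zero, add_zero, mul_neg, mul_assoc]
      rw [← mul_assoc (cM _ ξ), ← map_mul, hM ξ hξ, map_mul, mul_assoc, add_neg_cancel]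
    have h3 := congrFun (congrFun h2 a) c
    rw [Matrix.map_apply] at h3
    rw [h3]
    simp
  calc _ = (x : Mat K N) * M * (((x⁻¹ : GLn K N) : Mat K N) * (x : Mat K N)) := by
        rw [← Units.val_mul, inv_mul_cancel, Units.val_one, mul_one]
    _ = _ := by rw [← mul_assoc, key]

end Jacobian

section LinearSpan

variable {K : Type} [Field K] [CharZero K] [IsAlgClosed K] {N : ℕ}

/-- The Lie algebra is contained in every linear space of matrices containing the group. -/
theorem lieM_le {G : Set (GLn K N)} {S : Submodule K (Mat K N)} (hS : ∀ g ∈ G, (g : Mat K N) ∈ S) :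
    lieM G ≤ S := by
  intro ξ hξ
  by_contra hcon
  obtain ⟨ψ, hψ, hle⟩ := Submodule.exists_le_ker_of_notMem hcon
  have hsum : ∀ A : Mat K N, ψ A = ∑ a, ∑ c, ψ (Matrix.single a c 1) * A a c := fun A => by
    conv_lhs => rw [Matrix.matrix_eq_sum_single A]
    simp only [map_sum]
    refine Finset.sum_congr rfl fun a _ => Finset.sum_congr rfl fun c _ => ?_
    rw [mul_comm, ← smul_eq_mul, ← map_smul, Matrix.smul_single, smul_eq_mul, mul_one]
  let P : MvPolynomial (Tau N) K := ∑ a, ∑ c, ψ (Matrix.single a c 1) • XX K N a c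
  have hP : P ∈ ptI G := mem_ptI.2 fun g hg => by
    have h1 := LinearMap.mem_ker.1 (hle (hS g hg))
    rw [hsum] at h1
    rw [← h1]
    simp only [P, map_sum, map_smul, smul_eq_mul]
    refine Finset.sum_congr rfl fun a _ => Finset.sum_congr rfl fun c _ => ?_
    rw [← congrFun (congrFun (ev_XX g) a) c]
    rfl
  refine hψ ?_
  rw [← hξ P hP, hsum]
  simp only [P, map_sum, Derivation.map_smul, map_smul, smul_eq_mul]
  refine Finset.sum_congr rfl fun a _ => Finset.sum_congr rfl fun c _ => ?_
  have := congrArg (ev (1 : GLn K N)).mapMatrix (map_Dv_XX ξ)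
  rw [map_mul, ev_XX, mapMatrix_cM, cM_self, Units.val_one, one_mul] at this
  rw [← congrFun (congrFun this a) c]
  rfl

/-- Stable subspaces are stable under the Lie algebra. -/
theorem lieE_stable {G : Set (GLn K N)} {U : Submodule K (Fin N → K)}
    (hU : ∀ g ∈ G, ∀ v ∈ U, (g : Mat K N) *ᵥ v ∈ U) {T : Module.End K (Fin N → K)}
    (hT : T ∈ lieE G) : ∀ v ∈ U, T v ∈ U := by
  let S : Submodule K (Mat K N) :=
    { carrier := {M | ∀ v ∈ U, M *ᵥ v ∈ U}
      add_mem' := fun {A B} hA hB v hv => by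
        rw [Matrix.add_mulVec]; exact add_mem (hA v hv) (hB v hv)
      zero_mem' := fun v _ => by rw [Matrix.zero_mulVec]; exact zero_mem _
      smul_mem' := fun c A hA v hv => by
        rw [Matrix.smul_mulVec]; exact U.smul_mem c (hA v hv) }
  intro v hv
  have := lieM_le (S := S) hU (mem_lieE.1 hT) v hv
  rwa [mt_mulVec] at this

end LinearSpan

section Nondegenerate

variable {K : Type} [Field K] [CharZero K] [IsAlgClosed K] {N : ℕ}

theorem BracketClosed.orthIn_self {V : Type*} [AddCommGroup V] [Module K V]
    [FiniteDimensional K V] {h : Submodule K (Module.End K V)}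
    (hbr : BracketClosed h) : BracketClosed (orthIn h h) := fun x hx y hy =>
  ⟨hbr x hx.1 y hy.1, fun z hz => by
    rw [trace_bracket_mul]
    exact hx.2 _ (hbr y hy.1 z hz)⟩

theorem ReplicaClosed.isNilpotent_of_mem_orthIn_self {V : Type*} [AddCommGroup V] [Module K V]
    [FiniteDimensional K V] {h : Submodule K (Module.End K V)} (hrep : ReplicaClosed h)
    {x : Module.End K V} (hx : x ∈ orthIn h h) : IsNilpotent x :=
  isNilpotent_of_trace_mul_replica fun θ T' hT' => hx.2 T' (hrep θ x T' hx.1 hT')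

/-- The trace form is nondegenerate on the Lie algebra of a reductive group. -/
theorem nondegOn_lieE {H : Subgroup (GLn K N)} (hH : NatSemisimpleOn K N (H : Set (GLn K N))) :
    NondegOn (lieE (idc H : Set (GLn K N))) := by
  set h := lieE (idc H : Set (GLn K N)) with hh
  set r := orthIn h h with hr
  have hΓ : ConjStable (H.map (toU K N)) h :=
    conjStable_lieE fun x hx g hg => conj_mem_idc hx hg
  have hrΓ : ConjStable (H.map (toU K N)) r := hΓ.orthIn hΓ
  let U : Submodule K (Fin N → K) := ⨅ x ∈ r, LinearMap.ker x
  have hU : ∀ v, v ∈ U ↔ ∀ x ∈ r, x v = 0 := fun v => by simp [U, Submodule.mem_iInf]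
  obtain ⟨U', hU', hc⟩ := hH U fun u hu v hv => (hU _).2 fun x hx => by
    have h1 := hrΓ.inv_mem (Subgroup.mem_map_of_mem (toU K N) hu) hx
    have h2 := (hU v).1 hv _ h1
    rw [← toU_apply]
    have h3 := congrArg (toU K N u : Module.End K (Fin N → K)) h2
    rw [map_zero, ← Module.End.mul_apply, mul_assoc, ← mul_assoc, Units.mul_inv, one_mul] at h3
    exact h3
  have hUtop : U' = ⊥ := by
    by_contra hne
    obtain ⟨b, hb, hb0, hbx⟩ := exists_mem_not_mem_of_engel r (bracketClosed_lieE _).orthIn_self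
      (fun x hx => (replicaClosed_lieE _).isNilpotent_of_mem_orthIn_self hx) ⊥ U'
      (fun hle => hne (le_bot_iff.1 hle))
      (fun x hx b hb => lieE_stable (fun g hg => hU' g (idc_le H hg)) hx.1 b hb)
    exact hb0 (hc.disjoint.le_bot ⟨(hU b).2 fun x hx => (Submodule.mem_bot K).1 (hbx x hx), hb⟩)
  intro x hx hxy
  have htop : U = ⊤ := by
    have := hc.sup_eq_top
    rwa [hUtop, sup_bot_eq] at this
  exact LinearMap.ext fun v => (hU v).1 (htop ▸ Submodule.mem_top) x ⟨hx, hxy⟩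

end Nondegenerate

section Reynolds

variable {K : Type} [Field K] [CharZero K] [IsAlgClosed K] {N : ℕ} {I κ : Type}

/-- Infinitesimal conjugation acting on families of functions. -/
noncomputable def Dp (κ : Type) (ξ : Mat K N) : Module.End K (κ → MvPolynomial (I × Tau N) K) :=
  ((Dc (I := I) ξ : Derivation K _ _) :
    MvPolynomial (I × Tau N) K →ₗ[K] MvPolynomial (I × Tau N) K).compLeft κ

theorem Dp_apply (ξ : Mat K N) (a : κ → MvPolynomial (I × Tau N) K) (i : κ) :
    Dp κ ξ a i = Dc ξ (a i) := rfl

theorem Dp_add (ξ η : Mat K N) : Dp (I := I) κ (ξ + η) = Dp κ ξ + Dp κ η :=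
  LinearMap.ext fun b => funext fun i => by
    simp only [Dp_apply, LinearMap.add_apply, Pi.add_apply, Dc_add, Derivation.add_apply]

theorem Dp_smul (c : K) (ξ : Mat K N) : Dp (I := I) κ (c • ξ) = c • Dp κ ξ :=
  LinearMap.ext fun b => funext fun i => by
    simp only [Dp_apply, LinearMap.smul_apply, Pi.smul_apply, Dc_smul, Derivation.smul_apply]

theorem IsReplica.Dp {θ : K →ₗ[ℚ] ℚ} {T T' : Module.End K (Fin N → K)} (h : IsReplica θ T T') :
    IsReplica θ (Richardson.Dp (I := I) κ (mt K N T)) (Richardson.Dp κ (mt K N T')) := by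
  intro c a ha
  funext i
  exact h.Dc c (a i) (mem_maxGenEigenspace_of_intertwine
    (f := (LinearMap.proj i : (κ → MvPolynomial (I × Tau N) K) →ₗ[K] _)) (fun _ => rfl) ha)

/-- Invariant families exist as soon as families exist modulo a stable subspace. -/
theorem exists_invariant_family [Finite I] [Finite κ] {G : Subgroup (GLn K N)}
    (hnd : NondegOn (lieE (G : Set (GLn K N))))
    {W : Submodule K (κ → MvPolynomial (I × Tau N) K)} {J : Submodule K (MvPolynomial
        (I × Tau N) K)}
    (hW : ∀ ξ ∈ lieM (G : Set (GLn K N)), ∀ a ∈ W, Dp κ ξ a ∈ W)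
    (hJ : ∀ ξ ∈ lieM (G : Set (GLn K N)), ∀ P ∈ J, Dc ξ P ∈ J) (hJ1 : 1 ∉ J)
    {μ : (κ → MvPolynomial (I × Tau N) K) →ₗ[K] MvPolynomial (I × Tau N) K}
    (hμ : ∀ ξ ∈ lieM (G : Set (GLn K N)), ∀ a ∈ W, μ (Dp κ ξ a) - Dc ξ (μ a) ∈ J)
    {a : κ → MvPolynomial (I × Tau N) K} (haW : a ∈ W) (ha : μ a - 1 ∈ J) :
    ∃ a ∈ W, (∀ ξ ∈ lieM (G : Set (GLn K N)), ∀ i, Dc ξ (a i) = 0) ∧ μ a - 1 ∈ J := by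
  have := Fintype.ofFinite κ
  choose d hd using fun i => exists_mem_fil (a i)
  let e := ∑ i, d i
  have hae : ∀ i, a i ∈ fil (I × Tau N) K e := fun i =>
    fil_mono (Finset.single_le_sum (f := d) (fun _ _ => Nat.zero_le _) (Finset.mem_univ i)) (hd i)
  have hfd : FiniteDimensional K (fil (I × Tau N) K e) := fil_finite e
  let F : Submodule K (κ → MvPolynomial (I × Tau N) K) :=
    LinearMap.range ((fil (I × Tau N) K e).subtype.compLeft κ)
  have hF : ∀ b, b ∈ F ↔ ∀ i, b i ∈ fil (I × Tau N) K e := fun b =>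
    ⟨by rintro ⟨c, rfl⟩ i; exact (c i).2, fun hb => ⟨fun i => ⟨b i, hb i⟩, rfl⟩⟩
  let X : Submodule K (κ → MvPolynomial (I × Tau N) K) :=
    F ⊓ W ⊓ (J ⊔ K ∙ (1 : MvPolynomial (I × Tau N) K)).comap μ
  have hXmem : ∀ b, b ∈ X ↔ (b ∈ F ∧ b ∈ W) ∧ ∃ c : K, μ b - c • 1 ∈ J := fun b => by
    simp only [X, Submodule.mem_inf, Submodule.mem_comap, Submodule.mem_sup,
      Submodule.mem_span_singleton]
    refine and_congr_right fun _ => ⟨?_, ?_⟩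
    · rintro ⟨y, hy, z, ⟨c, rfl⟩, h⟩
      exact ⟨c, by rwa [← h, add_sub_cancel_right]⟩
    · rintro ⟨c, hc⟩
      exact ⟨_, hc, _, ⟨c, rfl⟩, sub_add_cancel _ _⟩
  have hXfd : FiniteDimensional K X := Submodule.finiteDimensional_of_le
    (inf_le_left.trans inf_le_left : X ≤ F)
  have hXJ : ∀ ξ ∈ lieM (G : Set (GLn K N)), ∀ b ∈ X, μ (Dp κ ξ b) ∈ J := fun ξ hξ b hb => by
    obtain ⟨⟨hbF, hbW⟩, c, hc⟩ := (hXmem b).1 hb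
    have h1 := hJ ξ hξ _ hc
    rw [map_sub, Derivation.map_smul, Derivation.map_one_eq_zero, smul_zero, sub_zero] at h1
    have h2 := add_mem (hμ ξ hξ b hbW) h1
    rwa [sub_add_cancel] at h2
  have hXst : ∀ ξ ∈ lieM (G : Set (GLn K N)), ∀ b ∈ X, Dp κ ξ b ∈ X := fun ξ hξ b hb => by
    obtain ⟨⟨hbF, hbW⟩, c, hc⟩ := (hXmem b).1 hb
    exact (hXmem _).2 ⟨⟨(hF _).2 fun i => derivation_mem_fil (Dc_X_mem_fil ξ) ((hF b).1 hbF i),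
      hW ξ hξ b hbW⟩, 0, by rw [zero_smul, sub_zero]; exact hXJ ξ hξ b hb⟩
  obtain ⟨π, hπ⟩ := LinearMap.exists_leftInverse_of_injective X.subtype X.ker_subtype
  have hπ' : ∀ x (hx : x ∈ X), π x = ⟨x, hx⟩ := fun x hx => LinearMap.congr_fun hπ ⟨x, hx⟩
  let ρ : Module.End K (Fin N → K) →ₗ[K] Module.End K X :=
    { toFun := fun T => π ∘ₗ (-Dp κ (mt K N T)) ∘ₗ X.subtype
      map_add' := fun S T => LinearMap.ext fun x => by
        simp only [map_add, Dp_add, LinearMap.comp_apply, LinearMap.neg_apply,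
          LinearMap.add_apply, map_neg, neg_add]
      map_smul' := fun c T => LinearMap.ext fun x => by
        simp only [map_smul, Dp_smul, LinearMap.comp_apply, LinearMap.neg_apply,
          LinearMap.smul_apply, smul_neg, RingHom.id_apply, map_neg] }
  have hρ : ∀ T ∈ lieE (G : Set (GLn K N)), ∀ x : X,
      (ρ T x : κ → MvPolynomial (I × Tau N) K) = -Dp κ (mt K N T) x := fun T hT x =>
    congrArg Subtype.val (hπ' _ (neg_mem (hXst _ (mem_lieE.1 hT) x x.2)))
  have hrep : IsRep (lieE (G : Set (GLn K N))) ρ := by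
    refine ⟨fun S hS T hT => LinearMap.ext fun x => Subtype.ext ?_, fun θ T T' hT h => ?_⟩
    · rw [hρ _ (bracketClosed_lieE G S hS T hT), LinearMap.sub_apply, Submodule.coe_sub,
        Module.End.mul_apply, Module.End.mul_apply, hρ S hS, hρ T hT, hρ T hT, hρ S hS, map_neg,
        map_neg, neg_neg, neg_neg]
      funext i
      have := Derivation.congr_fun (Dc_bracket (I := I) (mt K N S) (mt K N T))
        ((x : κ → MvPolynomial (I × Tau N) K) i)
      rw [Derivation.commutator_apply, Derivation.neg_apply] at this
      rw [map_sub, map_mul, map_mul]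
      exact this.symm
    · have hT' := replicaClosed_lieE G θ T T' hT h
      have h1 := (IsReplica.Dp (I := I) (κ := κ) h).neg.restrict (A := X)
        (fun b hb => neg_mem (hXst _ (mem_lieE.1 hT) b hb))
        (fun b hb => neg_mem (hXst _ (mem_lieE.1 hT') b hb))
      convert h1 using 1
      · exact LinearMap.ext fun x => Subtype.ext (hρ T hT x)
      · exact LinearMap.ext fun x => Subtype.ext (hρ T' hT' x)
  let X0 : Submodule K X := (J.comap μ).comap X.subtype
  have haX : a ∈ X := (hXmem a).2 ⟨⟨(hF a).2 hae, haW⟩, 1, by rwa [one_smul]⟩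
  have hX0 : X0 ≠ ⊤ := fun htop => by
    have h1 : (⟨a, haX⟩ : X) ∈ X0 := htop ▸ Submodule.mem_top
    have h2 : μ a ∈ J := h1
    exact hJ1 (by simpa using sub_mem h2 ha)
  obtain ⟨v, hv, hinv⟩ := IsRep.exists_invariant (bracketClosed_lieE G) (replicaClosed_lieE G) hnd
    hrep hX0 (fun T hT x => by
      show μ (ρ T x : κ → MvPolynomial (I × Tau N) K) ∈ J
      rw [hρ T hT, map_neg]
      exact neg_mem (hXJ _ (mem_lieE.1 hT) x x.2))
  obtain ⟨⟨-, hvW⟩, c, hc⟩ := (hXmem v).1 v.2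
  have hc0 : c ≠ 0 := by
    rintro rfl
    rw [zero_smul, sub_zero] at hc
    exact hv hc
  refine ⟨c⁻¹ • (v : κ → MvPolynomial (I × Tau N) K), W.smul_mem _ hvW, fun ξ hξ i => ?_, ?_⟩
  · have h1 := hρ ((mt K N).symm ξ) (by rwa [mem_lieE, AlgEquiv.apply_symm_apply]) v
    rw [hinv _ (by rwa [mem_lieE, AlgEquiv.apply_symm_apply]), AlgEquiv.apply_symm_apply] at h1
    have h2 := congrFun (neg_eq_zero.1 h1.symm) i
    rw [Dp_apply] at h2
    rw [Pi.smul_apply, Derivation.map_smul, h2]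
    exact smul_zero _
  · have h1 := J.smul_mem c⁻¹ hc
    rwa [smul_sub, smul_smul, inv_mul_cancel₀ hc0, one_smul, ← map_smul] at h1

end Reynolds

section TupleIdeals

variable {K : Type} [Field K] [CharZero K] [IsAlgClosed K] {N : ℕ} {I : Type}

/-- The ideal of a set of tuples. -/
noncomputable def tptI (S : Set (I → GLn K N)) : Ideal (MvPolynomial (I × Tau N) K) :=
  ⨅ t ∈ S, RingHom.ker (tev t)

theorem mem_tptI {S : Set (I → GLn K N)} {P : MvPolynomial (I × Tau N) K} :
    P ∈ tptI S ↔ ∀ t ∈ S, tev t P = 0 := by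
  simp [tptI, Submodule.mem_iInf, RingHom.mem_ker]

/-- Zariski-closed sets of tuples. -/
def TClosed (S : Set (I → GLn K N)) : Prop := ∀ t, (∀ P ∈ tptI S, tev t P = 0) → t ∈ S

theorem tptI_anti {S S' : Set (I → GLn K N)} (h : S ⊆ S') : tptI S' ≤ tptI S :=
  fun _ hP => mem_tptI.2 fun t ht => mem_tptI.1 hP t (h ht)

theorem one_notMem_tptI {S : Set (I → GLn K N)} (h : S.Nonempty) : 1 ∉ tptI S := fun h1 => by
  obtain ⟨t, ht⟩ := h
  have := mem_tptI.1 h1 t ht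
  rw [map_one] at this
  exact one_ne_zero this

/-- Stability under conjugation. -/
def TStable (G : Subgroup (GLn K N)) (S : Set (I → GLn K N)) : Prop :=
  ∀ x ∈ G, ∀ t ∈ S, conjT x t ∈ S

theorem tX_mul_tY_mem (S : Set (I → GLn K N)) (i : I) (a c : Fin N) :
    (tX K N i * tY K N i - 1) a c ∈ tptI S := mem_tptI.2 fun t _ => by
  have : (tev t).mapMatrix (tX K N i * tY K N i - 1) = 0 := by
    rw [map_sub, map_mul, tev_tX, tev_tY, map_one, ← Units.val_mul, mul_inv_cancel, Units.val_one,
      sub_self]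
  exact congrFun (congrFun this a) c

/-- Nullstellensatz for tuples of invertible matrices. -/
theorem exists_tev_eq_zero [Finite I] {J : Ideal (MvPolynomial (I × Tau N) K)}
    (hJ : J ≠ ⊤) (hU : tptI Set.univ ≤ J) : ∃ t : I → GLn K N, ∀ P ∈ J, tev t P = 0 := by
  obtain ⟨M, hM, hJM⟩ := Ideal.exists_le_maximal J hJ
  obtain ⟨x, hx⟩ := (MvPolynomial.isMaximal_iff_eq_vanishingIdeal_singleton (K := K) (I := M)).1 hM
  have hz : ∀ P ∈ J, aeval x P = 0 := fun P hP => by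
    have h1 := hJM hP
    rw [hx, mem_vanishingIdeal_iff] at h1
    exact h1 x rfl
  have h1 : ∀ i, (aeval (R := K) x).mapMatrix (tX K N i) * (aeval x).mapMatrix (tY K N i) = 1 := by
    intro i
    rw [← map_mul, ← sub_eq_zero, ← map_one (aeval (R := K) x).mapMatrix, ← map_sub]
    ext a c
    exact hz _ (hU (tX_mul_tY_mem _ i a c))
  let t : I → GLn K N := fun i => ⟨(aeval (R := K) x).mapMatrix (tX K N i),
    (aeval x).mapMatrix (tY K N i), h1 i, mul_eq_one_comm.1 (h1 i)⟩
  have ht : tev t = aeval x := MvPolynomial.algHom_ext fun p => by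
    rw [tev_X, tX_eq_prM, map_prM]
    rfl
  exact ⟨t, fun P hP => by rw [ht]; exact hz P hP⟩

theorem Dc_invariant {G : Subgroup (GLn K N)} {P : MvPolynomial (I × Tau N) K} {g : I → GLn K N}
    (h : ∀ x ∈ G, tev (conjT x g) P = tev g P) {ξ : Mat K N}
    (hξ : ξ ∈ lieM (G : Set (GLn K N))) : tev g (Dc ξ P) = 0 := by
  have h1 : orb g P - MvPolynomial.C (tev g P) ∈ ptI (G : Set (GLn K N)) :=
    mem_ptI.2 fun x hx => by
      rw [map_sub, ev_orb, h x hx, ← MvPolynomial.algebraMap_eq, AlgHom.commutes]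
      exact sub_self _
  have h2 := hξ _ h1
  rw [map_sub, ← MvPolynomial.algebraMap_eq, Derivation.map_algebraMap, sub_zero, ev_Dv_orb,
    conjT_one] at h2
  simpa using h2

end TupleIdeals

section Separation

variable {K : Type} [Field K] [CharZero K] [IsAlgClosed K] {N : ℕ} {I : Type}

/-- Disjoint closed stable sets are separated by invariants. -/
theorem exists_separating_invariant [Finite I] {G : Subgroup (GLn K N)}
    (hnd : NondegOn (lieE (G : Set (GLn K N))))
    {S₁ S₂ : Set (I → GLn K N)} (h₁ : TClosed S₁) (h₂ : TClosed S₂) (hs₁ : TStable G S₁)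
    (hs₂ : TStable G S₂) (hd : Disjoint S₁ S₂) :
    ∃ f : MvPolynomial (I × Tau N) K, (∀ ξ ∈ lieM (G : Set (GLn K N)), Dc ξ f = 0) ∧
      (∀ t ∈ S₁, tev t f = 0) ∧ ∀ t ∈ S₂, tev t f = 1 := by
  obtain rfl | hne := S₂.eq_empty_or_nonempty
  · exact ⟨0, fun ξ _ => map_zero _, fun t _ => map_zero _, fun t ht => ht.elim⟩
  have htop : tptI S₁ ⊔ tptI S₂ = ⊤ := by
    by_contra hcon
    obtain ⟨t, ht⟩ := exists_tev_eq_zero hcon ((tptI_anti (Set.subset_univ _)).trans le_sup_left)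
    exact Set.disjoint_left.1 hd (h₁ t fun P hP => ht P (Ideal.mem_sup_left hP))
      (h₂ t fun P hP => ht P (Ideal.mem_sup_right hP))
  obtain ⟨a, ha, b, hb, hab⟩ := Submodule.mem_sup.1 ((Ideal.eq_top_iff_one _).1 htop)
  obtain ⟨f, hf, hinv, h1⟩ := exists_invariant_family hnd
    (W := ((tptI S₁).restrictScalars K).comap
      (LinearMap.proj () : (Unit → MvPolynomial (I × Tau N) K) →ₗ[K] _))
    (J := (tptI S₂).restrictScalars K) (μ := LinearMap.proj ())
    (fun ξ hξ a ha => mem_tptI.2 fun t ht => Dc_vanishes hs₁ (mem_tptI.1 ha) hξ ht)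
    (fun ξ hξ P hP => mem_tptI.2 fun t ht => Dc_vanishes hs₂ (mem_tptI.1 hP) hξ ht)
    (one_notMem_tptI hne) (fun ξ hξ a ha => by
      show Dc ξ (a ()) - Dc ξ (a ()) ∈ _
      rw [sub_self]; exact zero_mem _) (a := fun _ => a) ha
    (by
      show a - 1 ∈ tptI S₂
      rw [← hab, sub_add_cancel_left]
      exact neg_mem hb)
  refine ⟨f (), fun ξ hξ => hinv ξ hξ _, mem_tptI.1 hf, fun t ht => ?_⟩
  have := mem_tptI.1 (show f () - 1 ∈ tptI S₂ from h1) t ht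
  rwa [map_sub, map_one, sub_eq_zero] at this

/-- Partitions of unity can be made invariant. -/
theorem exists_invariant_combination [Finite I] {G : Subgroup (GLn K N)}
    (hnd : NondegOn (lieE (G : Set (GLn K N)))) {S : Set (I → GLn K N)} (hS : TStable G S)
    (hne : S.Nonempty) {α : Type} {P : α → MvPolynomial (I × Tau N) K}
    (hP : ∀ f, ∀ ξ ∈ lieM (G : Set (GLn K N)), Dc ξ (P f) ∈ tptI S)
    (h : 1 ∈ Ideal.span (Set.range P) ⊔ tptI S) :
    ∃ (s : Finset α) (u : α → MvPolynomial (I × Tau N) K),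
      (∀ ξ ∈ lieM (G : Set (GLn K N)), ∀ f, Dc ξ (u f) = 0) ∧
      ∑ f ∈ s, u f * P f - 1 ∈ tptI S := by
  classical
  obtain ⟨a, ha, b, hb, hab⟩ := Submodule.mem_sup.1 h
  obtain ⟨c, hc⟩ := Finsupp.mem_ideal_span_range_iff_exists_finsupp.1 ha
  let μ : (c.support → MvPolynomial (I × Tau N) K) →ₗ[K] MvPolynomial (I × Tau N) K :=
    ∑ f : c.support, LinearMap.mulRight K (P f) ∘ₗ LinearMap.proj f
  have hμ : ∀ a, μ a = ∑ f : c.support, a f * P f := fun a => by simp [μ]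
  obtain ⟨u, -, hinv, h1⟩ := exists_invariant_family hnd (κ := c.support) (W := ⊤)
    (J := (tptI S).restrictScalars K) (μ := μ) (fun _ _ _ _ => Submodule.mem_top)
    (fun ξ hξ P hP => mem_tptI.2 fun t ht => Dc_vanishes hS (mem_tptI.1 hP) hξ ht)
    (one_notMem_tptI hne)
    (fun ξ hξ a _ => by
      show _ ∈ tptI S
      rw [hμ, hμ, map_sum, ← Finset.sum_sub_distrib]
      refine sum_mem fun f _ => ?_
      rw [Derivation.leibniz, Dp_apply, smul_eq_mul, smul_eq_mul, mul_comm (P f),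
        sub_add_cancel_right]
      exact neg_mem (Ideal.mul_mem_left _ _ (hP _ ξ hξ)))
    (a := fun f => c f) Submodule.mem_top
    (by
      show _ ∈ tptI S
      rw [hμ, ← hab, ← hc, Finsupp.sum, Finset.sum_coe_sort c.support (fun f => c f * P f),
        sub_add_cancel_left]
      exact neg_mem hb)
  refine ⟨c.support, fun f => if hf : f ∈ c.support then u ⟨f, hf⟩ else 0, fun ξ hξ f => ?_, ?_⟩
  · dsimp only
    split_ifs with hf
    · exact hinv ξ hξ _
    · exact map_zero _
  · have h2 : μ u - 1 ∈ tptI S := h1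
    rw [hμ] at h2
    rw [← Finset.sum_coe_sort]
    convert h2 using 4 with f
    exact dif_pos f.2

end Separation

section Points

variable {K : Type} [Field K] [CharZero K] [IsAlgClosed K] {N n : ℕ}

/-- The underlying tuple of invertible matrices. -/
def tv {H : Subgroup (GLn K N)} (g : Fin n → H) : Fin n → GLn K N := fun i => (g i : GLn K N)

/-- The tuples with entries in a subgroup. -/
def tset (n : ℕ) (H : Subgroup (GLn K N)) : Set (Fin n → GLn K N) := {t | ∀ i, t i ∈ H}

theorem tv_mem {H : Subgroup (GLn K N)} (g : Fin n → H) : tv g ∈ tset n H := fun i => (g i).2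

theorem tClosed_tset {H : Subgroup (GLn K N)} (hH : GClosed (H : Set (GLn K N))) :
    TClosed (tset n H) := fun t ht i => hH _ fun P hP => by
  rw [← aeval_glCoords_rename t i P]
  refine ht _ (mem_tptI.2 fun t' ht' => ?_)
  refine (aeval_glCoords_rename t' i P).trans (mem_ptI.1 hP _ (ht' i))

theorem tStable_tset {G H : Subgroup (GLn K N)} (h : G ≤ H) : TStable G (tset n H) :=
  fun x hx _ ht i => H.mul_mem (H.mul_mem (h hx) (ht i)) (H.inv_mem (h hx))

theorem mem_regInvAlg {H : Subgroup (GLn K N)} {f : (Fin n → H) → K} : f ∈ regInvAlg K N H n ↔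
    (∃ P : MvPolynomial (Fin n × Tau N) K, ∀ g : Fin n → H, f g = tev (tv g) P) ∧
      ∀ x ∈ idc H, ∀ g g' : Fin n → H, tv g' = conjT x (tv g) → f g' = f g := by
  refine and_congr ⟨fun ⟨P, hP⟩ => ⟨P, hP⟩, fun ⟨P, hP⟩ => ⟨P, hP⟩⟩ ⟨fun h _ hx g g' hg => ?_,
    fun h x hx g => h x (mem_idc.2 ⟨x.2, hx⟩) g _ rfl⟩
  obtain ⟨hxH, hx⟩ := mem_idc.1 hx
  rw [← h _ hx g]
  exact congrArg f (funext fun i => Subtype.ext (congrFun hg i))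

/-- Every character of the algebra of invariants is the evaluation at a point. -/
theorem exists_point_of_character {H : Subgroup (GLn K N)} (hH : GClosed (H : Set (GLn K N)))
    (hnd : NondegOn (lieE (idc H : Set (GLn K N)))) (χ : regInvAlg K N H n →ₐ[K] K) :
    ∃ g : Fin n → H, ∀ f : regInvAlg K N H n, χ f = (f : (Fin n → H) → K) g := by
  choose P hP using fun f : regInvAlg K N H n => (mem_regInvAlg.1 f.2).1
  have hDP : ∀ f, ∀ ξ ∈ lieM (idc H : Set (GLn K N)), Dc ξ (P f) ∈ tptI (tset n H) :=
    fun f ξ hξ => mem_tptI.2 fun t ht => Dc_invariant (fun x hx => by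
      have := (mem_regInvAlg.1 f.2).2 x hx (fun i => ⟨t i, ht i⟩)
        (fun i => ⟨conjT x t i, tStable_tset (idc_le H) x hx t ht i⟩) rfl
      rwa [hP, hP] at this) hξ
  by_cases htop : Ideal.span (Set.range fun f : RingHom.ker χ => P f) ⊔ tptI (tset n H) = ⊤
  · exfalso
    obtain ⟨s, u, hinv, h1⟩ := exists_invariant_combination hnd (tStable_tset (idc_le H))
      ⟨fun _ => 1, fun _ => H.one_mem⟩ (fun f : RingHom.ker χ => hDP f.1)
      ((Ideal.eq_top_iff_one _).1 htop)
    have hu : ∀ f, (fun g : Fin n → H => tev (tv g) (u f)) ∈ regInvAlg K N H n := fun f =>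
      mem_regInvAlg.2 ⟨⟨u f, fun _ => rfl⟩, fun x hx g g' hg => by
        rw [hg]
        exact tev_conjT_eq_of_Dc (ptI_idc_isPrime H) (fun ξ hξ => hinv ξ hξ f) hx _⟩
    have hone : ∑ f ∈ s, (⟨_, hu f⟩ : regInvAlg K N H n) * f.1 = 1 := by
      refine Subtype.ext (funext fun g => ?_)
      have h2 := mem_tptI.1 h1 _ (tv_mem g)
      rw [map_sub, map_one, sub_eq_zero, map_sum] at h2
      rw [AddSubmonoidClass.coe_finsetSum, Finset.sum_apply]
      refine Eq.trans (Finset.sum_congr rfl fun f _ => ?_) h2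
      rw [map_mul, ← hP]
      rfl
    have h3 := congrArg χ hone
    rw [map_one, map_sum] at h3
    refine zero_ne_one (α := K) ((Finset.sum_eq_zero fun f _ => ?_).symm.trans h3)
    have h4 : χ f.1 = 0 := RingHom.mem_ker.1 f.2
    rw [map_mul, h4, mul_zero]
  · obtain ⟨t, ht⟩ := exists_tev_eq_zero htop
      ((tptI_anti (Set.subset_univ _)).trans le_sup_right)
    have htH : t ∈ tset n H := tClosed_tset hH t fun P hP => ht P (Ideal.mem_sup_right hP)
    refine ⟨fun i => ⟨t i, htH i⟩, fun f => ?_⟩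
    let f' : regInvAlg K N H n := f - algebraMap K _ (χ f)
    have hf' : f' ∈ RingHom.ker χ := by
      rw [RingHom.mem_ker, map_sub, AlgHom.commutes]
      exact sub_self _
    have h1 := ht _ (Ideal.mem_sup_left (Ideal.subset_span ⟨⟨f', hf'⟩, rfl⟩))
    have h2 := hP f' (fun i => ⟨t i, htH i⟩)
    exact (sub_eq_zero.1 (h2.trans h1)).symm

end Points

section Orbits

variable {K : Type} [Field K] [CharZero K] [IsAlgClosed K] {N : ℕ} {I : Type}

theorem exists_ev_eq_zero {J : Ideal (MvPolynomial (Tau N) K)} (hJ : J ≠ ⊤)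
    (hU : ptI Set.univ ≤ J) : ∃ x : GLn K N, ∀ P ∈ J, ev x P = 0 := by
  let ψ : MvPolynomial (Unit × Tau N) K →ₐ[K] MvPolynomial (Tau N) K := rename Prod.snd
  obtain ⟨t, ht⟩ := exists_tev_eq_zero (I := Unit) (J := J.comap ψ)
    (fun h => hJ ((Ideal.eq_top_iff_one _).2 (by
      have := (Ideal.eq_top_iff_one _).1 h
      rwa [Ideal.mem_comap, map_one] at this)))
    (fun Q hQ => hU (mem_ptI.2 fun g _ =>
      (aeval_glCoords_const g Q).symm.trans (mem_tptI.1 hQ (fun _ => g) trivial)))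
  refine ⟨t (), fun P hP => ?_⟩
  rw [← aeval_glCoords_rename t () P]
  refine ht _ ?_
  rw [Ideal.mem_comap]
  have : ψ (rename (Prod.mk ()) P) = P := by
    rw [rename_rename]
    exact rename_id_apply P
  rwa [this]

theorem tuple_eq_of_tev {t t' : I → GLn K N} (h : ∀ P, tev t P = 0 → tev t' P = 0) : t' = t := by
  have h1 : tev t' = tev t := AlgHom.ext fun P => by
    have := h (P - MvPolynomial.C (tev t P)) (by
      rw [map_sub, ← MvPolynomial.algebraMap_eq, AlgHom.commutes]
      exact sub_self _)
    rw [map_sub, ← MvPolynomial.algebraMap_eq, AlgHom.commutes] at this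
    exact sub_eq_zero.1 this
  funext i
  refine Units.ext ?_
  rw [← tev_tX t' i, h1, tev_tX]

/-- The orbit of a tuple. -/
def orbT (G : Subgroup (GLn K N)) (t : I → GLn K N) : Set (I → GLn K N) :=
  {t' | ∃ x ∈ G, t' = conjT x t}

/-- The Zariski closure of a set of tuples. -/
def clT (S : Set (I → GLn K N)) : Set (I → GLn K N) := {t | ∀ P ∈ tptI S, tev t P = 0}

theorem conjT_conjT (x y : GLn K N) (t : I → GLn K N) : conjT x (conjT y t) = conjT (x * y) t := by
  funext i
  simp only [conjT, _root_.mul_inv_rev, mul_assoc]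

theorem mem_orbT_self (G : Subgroup (GLn K N)) (t : I → GLn K N) : t ∈ orbT G t :=
  ⟨1, G.one_mem, (conjT_one t).symm⟩

theorem tStable_orbT (G : Subgroup (GLn K N)) (t : I → GLn K N) : TStable G (orbT G t) := by
  rintro x hx _ ⟨y, hy, rfl⟩
  exact ⟨x * y, G.mul_mem hx hy, conjT_conjT x y t⟩

theorem orbT_subset {G : Subgroup (GLn K N)} {S : Set (I → GLn K N)} (hS : TStable G S)
    {t : I → GLn K N} (ht : t ∈ S) : orbT G t ⊆ S := by
  rintro _ ⟨x, hx, rfl⟩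
  exact hS x hx t ht

theorem orbT_eq_of_mem {G : Subgroup (GLn K N)} {t t' : I → GLn K N} (h : t' ∈ orbT G t) :
    orbT G t' = orbT G t := by
  refine (orbT_subset (tStable_orbT G t) h).antisymm (orbT_subset (tStable_orbT G t') ?_)
  obtain ⟨x, hx, rfl⟩ := h
  refine ⟨x⁻¹, G.inv_mem hx, ?_⟩
  rw [conjT_conjT, inv_mul_cancel, conjT_one]

theorem subset_clT (S : Set (I → GLn K N)) : S ⊆ clT S := fun _ ht _ hP => mem_tptI.1 hP _ ht

theorem tptI_clT (S : Set (I → GLn K N)) : tptI (clT S) = tptI S :=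
  (tptI_anti (subset_clT S)).antisymm fun P hP => mem_tptI.2 fun _ ht => ht P hP

theorem tClosed_clT (S : Set (I → GLn K N)) : TClosed (clT S) := fun t ht P hP =>
  ht P (by rwa [tptI_clT])

theorem clT_subset {S S' : Set (I → GLn K N)} (h : S ⊆ S') (hS' : TClosed S') : clT S ⊆ S' :=
  fun t ht => hS' t fun P hP => ht P (tptI_anti h hP)

theorem tStable_clT {G : Subgroup (GLn K N)} {S : Set (I → GLn K N)} (hS : TStable G S) :
    TStable G (clT S) := by
  intro x hx t ht P hP
  let ψ : MvPolynomial (I × Tau N) K →ₐ[K] MvPolynomial (I × Tau N) K :=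
    aeval fun p => prM (cM _ (x : Mat K N) * tX K N p.1 * cM _ ((x⁻¹ : GLn K N) : Mat K N))
      (cM _ (x : Mat K N) * tY K N p.1 * cM _ ((x⁻¹ : GLn K N) : Mat K N)) p.2
  have hψ : ∀ (t : I → GLn K N) P, tev t (ψ P) = tev (conjT x t) P := fun t P => by
    have : (tev t).comp ψ = tev (conjT x t) := by
      refine MvPolynomial.algHom_ext fun p => ?_
      rw [AlgHom.comp_apply, aeval_X, map_prM, tev_X]
      simp only [map_mul, tev_tX, tev_tY, mapMatrix_cM, cM_self, conjT]
      congr 1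
      simp [mul_assoc]
    exact DFunLike.congr_fun this P
  rw [← hψ]
  exact ht _ (mem_tptI.2 fun t' ht' => by
    rw [hψ]
    exact mem_tptI.1 hP _ (hS x hx t' ht'))

/-- Orbits contain an open subset of their closure. -/
theorem exists_open_subset_orbT [Finite I] {G : Subgroup (GLn K N)}
    (hI : (ptI (G : Set (GLn K N))).IsPrime) (hG : GClosed (G : Set (GLn K N)))
    (a : I → GLn K N) : ∃ f ∉ tptI (orbT G a), ∀ t ∈ clT (orbT G a), tev t f ≠ 0 →
        t ∈ orbT G a := by
  let φ : MvPolynomial (I × Tau N) K →ₐ[K] MvPolynomial (Tau N) K ⧸ ptI (G : Set (GLn K N)) :=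
    (Ideal.Quotient.mkₐ K _).comp (orb a)
  have hφ : ∀ P, φ P = 0 ↔ P ∈ tptI (orbT G a) := fun P => by
    refine Ideal.Quotient.eq_zero_iff_mem.trans ⟨fun h => mem_tptI.2 ?_, fun h => mem_ptI.2 ?_⟩
    · rintro _ ⟨x, hx, rfl⟩
      rw [← ev_orb]
      exact mem_ptI.1 h x hx
    · intro x hx
      exact (ev_orb a x P).trans (mem_tptI.1 h _ ⟨x, hx, rfl⟩)
  have hfp : (φ : MvPolynomial (I × Tau N) K →+*
      MvPolynomial (Tau N) K ⧸ ptI (G : Set (GLn K N))).FinitePresentation := by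
    refine RingHom.FinitePresentation.of_finiteType.1 ?_
    refine RingHom.FiniteType.of_comp_finiteType (f := algebraMap K _) ?_
    have : (φ : MvPolynomial (I × Tau N) K →+* _).comp (algebraMap K _) = algebraMap K
        (MvPolynomial (Tau N) K ⧸ ptI (G : Set (GLn K N))) := φ.comp_algebraMap
    rw [this, RingHom.finiteType_algebraMap]
    infer_instance
  obtain ⟨S, hS⟩ := PrimeSpectrum.exists_constructibleSetData_iff.2
    (PrimeSpectrum.isConstructible_range_comap hfp)
  have hmem : ∀ q, q ∈ Set.range (PrimeSpectrum.comap (φ : MvPolynomial (I × Tau N) K →+*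
      MvPolynomial (Tau N) K ⧸ ptI (G : Set (GLn K N)))) ↔
      ∃ C ∈ S, (∀ i, C.g i ∈ q.asIdeal) ∧ C.f ∉ q.asIdeal := fun q => by
    rw [← hS]
    simp [PrimeSpectrum.ConstructibleSetData.toSet, PrimeSpectrum.BasicConstructibleSetData.toSet,
      PrimeSpectrum.mem_zeroLocus, Set.range_subset_iff]
    exact exists_congr fun C => and_left_comm
  have hdom : IsDomain (MvPolynomial (Tau N) K ⧸ ptI (G : Set (GLn K N))) :=
    Ideal.Quotient.isDomain _
  obtain ⟨C, hC, hg, hf⟩ := (hmem _).1 ⟨⟨⊥, Ideal.isPrime_bot⟩, rfl⟩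
  have hker : ∀ P, P ∈ (PrimeSpectrum.comap (φ : MvPolynomial (I × Tau N) K →+*
      MvPolynomial (Tau N) K ⧸ ptI (G : Set (GLn K N)))
      ⟨⊥, Ideal.isPrime_bot⟩).asIdeal ↔ P ∈ tptI (orbT G a) := fun P => by
    rw [← hφ]
    exact Ideal.mem_bot
  refine ⟨C.f, fun h => hf ((hker _).2 h), fun t ht htf => ?_⟩
  obtain ⟨q, hq⟩ := (hmem ⟨RingHom.ker (tev t), RingHom.ker_isPrime _⟩).2
    ⟨C, hC, fun i => ht _ ((hker _).1 (hg i)), htf⟩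
  let q' := q.asIdeal.comap (Ideal.Quotient.mk (ptI (G : Set (GLn K N))))
  have hGq : ptI (G : Set (GLn K N)) ≤ q' := fun P hP => by
    rw [Ideal.mem_comap, Ideal.Quotient.eq_zero_iff_mem.2 hP]
    exact zero_mem _
  obtain ⟨x, hx⟩ := exists_ev_eq_zero (J := q') (Ideal.comap_ne_top _ q.2.ne_top)
    ((ptI_anti (Set.subset_univ _)).trans hGq)
  have hxG : x ∈ G := hG x fun P hP => hx P (hGq hP)
  refine ⟨x, hxG, (tuple_eq_of_tev fun P hP => ?_).symm⟩
  rw [← ev_orb]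
  refine hx _ ?_
  have h1 : P ∈ (⟨RingHom.ker (tev t), RingHom.ker_isPrime _⟩ :
    PrimeSpectrum (MvPolynomial (I × Tau N) K)).asIdeal := hP
  rw [← hq] at h1
  exact h1

theorem orbT_eq_of_tptI_eq [Finite I] {G : Subgroup (GLn K N)}
    (hI : (ptI (G : Set (GLn K N))).IsPrime) (hG : GClosed (G : Set (GLn K N)))
    {a b : I → GLn K N} (h : tptI (orbT G a) = tptI (orbT G b)) : orbT G a = orbT G b := by
  obtain ⟨f, hf, hopen⟩ := exists_open_subset_orbT hI hG a
  rw [h, mem_tptI] at hf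
  push Not at hf
  obtain ⟨t, ht, htf⟩ := hf
  have hta : t ∈ orbT G a := hopen t (fun P hP => mem_tptI.1 (h ▸ hP) t ht) htf
  rw [← orbT_eq_of_mem hta, orbT_eq_of_mem ht]

/-- Every orbit closure contains a closed orbit. -/
theorem exists_closed_orbT [Finite I] {G : Subgroup (GLn K N)}
    (hI : (ptI (G : Set (GLn K N))).IsPrime) (hG : GClosed (G : Set (GLn K N)))
    (a : I → GLn K N) : ∃ b ∈ clT (orbT G a), TClosed (orbT G b) := by
  obtain ⟨J, ⟨b, hb, rfl⟩, hmax⟩ := wellFounded_gt.has_min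
    {J : Ideal (MvPolynomial (I × Tau N) K) | ∃ b ∈ clT (orbT G a), tptI (orbT G b) = J}
    ⟨_, a, subset_clT _ (mem_orbT_self G a), rfl⟩
  have hst := tStable_clT (tStable_orbT G a)
  refine ⟨b, hb, fun c hc => ?_⟩
  have hcb : c ∈ clT (orbT G b) := hc
  have hca : c ∈ clT (orbT G a) := clT_subset (orbT_subset hst hb) (tClosed_clT _) hcb
  have hle : tptI (orbT G b) ≤ tptI (orbT G c) := by
    rw [← tptI_clT (orbT G b)]
    exact tptI_anti (orbT_subset (tStable_clT (tStable_orbT G b)) hcb)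
  have heq : tptI (orbT G b) = tptI (orbT G c) := by
    by_contra hne
    exact hmax _ ⟨c, hca, rfl⟩ (lt_of_le_of_ne hle hne)
  rw [orbT_eq_of_tptI_eq hI hG heq]
  exact mem_orbT_self G c

end Orbits

section Invariants

variable {K : Type} {V X : Type*} [Field K] [CharZero K] [IsAlgClosed K] [AddCommGroup V] [Module K V]
  [FiniteDimensional K V] [AddCommGroup X] [Module K X] [FiniteDimensional K X]
  {h : Submodule K (Module.End K V)} {ρ : Module.End K V →ₗ[K] Module.End K X}

/-- Lifting of invariants inside a stable subspace. -/
theorem IsRep.exists_invariant_mem (hbr : BracketClosed h) (hrep : ReplicaClosed h)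
    (hnd : NondegOn h) (hρ : IsRep h ρ) {p p0 : Submodule K X} (h0 : p0 ≤ p) (hne : ¬ p ≤ p0)
    (hp : ∀ ξ ∈ h, ∀ x ∈ p, ρ ξ x ∈ p0) : ∃ v ∈ p, v ∉ p0 ∧ ∀ ξ ∈ h, ρ ξ v = 0 := by
  obtain ⟨π, hπ⟩ := LinearMap.exists_leftInverse_of_injective p.subtype p.ker_subtype
  have hπ' : ∀ x (hx : x ∈ p), π x = ⟨x, hx⟩ := fun x hx => LinearMap.congr_fun hπ ⟨x, hx⟩
  let σ : Module.End K V →ₗ[K] Module.End K p :=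
    { toFun := fun T => π ∘ₗ ρ T ∘ₗ p.subtype
      map_add' := fun S T => LinearMap.ext fun x => by simp
      map_smul' := fun c T => LinearMap.ext fun x => by simp }
  have hst : ∀ T ∈ h, ∀ x ∈ p, ρ T x ∈ p := fun T hT x hx => h0 (hp T hT x hx)
  have hσ : ∀ T ∈ h, ∀ x : p, (σ T x : X) = ρ T x := fun T hT x =>
    congrArg Subtype.val (hπ' _ (hst T hT x x.2))
  have hrσ : IsRep h σ := by
    refine ⟨fun S hS T hT => LinearMap.ext fun x => Subtype.ext ?_, fun θ T T' hT h => ?_⟩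
    · rw [hσ _ (hbr S hS T hT), LinearMap.sub_apply, Submodule.coe_sub, Module.End.mul_apply,
        Module.End.mul_apply, hσ S hS, hσ T hT, hσ T hT, hσ S hS, hρ.bracket S hS T hT,
        LinearMap.sub_apply, Module.End.mul_apply, Module.End.mul_apply]
    · have hT' := hrep θ T T' hT h
      convert (hρ.replica θ T T' hT h).restrict (A := p) (hst T hT) (hst T' hT') using 1
      · exact LinearMap.ext fun x => Subtype.ext (hσ T hT x)
      · exact LinearMap.ext fun x => Subtype.ext (hσ T' hT' x)
  obtain ⟨v, hv, hv0⟩ := hrσ.exists_invariant hbr hrep hnd (X0 := p0.comap p.subtype)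
    (fun htop => hne fun x hx => by
      have h1 : (⟨x, hx⟩ : p) ∈ p0.comap p.subtype := htop ▸ Submodule.mem_top
      exact h1)
    (fun ξ hξ x => by
      change (σ ξ x : X) ∈ p0
      rw [hσ ξ hξ]
      exact hp ξ hξ x x.2)
  exact ⟨v, v.2, hv, fun ξ hξ => by rw [← hσ ξ hξ, hv0 ξ hξ, Submodule.coe_zero]⟩

theorem isRep_adL (h : Submodule K (Module.End K V)) :
    IsRep h (Richardson.adL : Module.End K V →ₗ[K] _) :=
  ⟨fun x _ y _ => adL_bracket x y, fun _ _ _ _ h => h.adL⟩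

/-- Nondegeneracy of the trace form from a complement of the kernel of its radical. -/
theorem nondegOn_of_isCompl (hbr : BracketClosed h) (hrep : ReplicaClosed h) {U : Submodule K V}
    (hU : ∀ T ∈ h, ∀ v ∈ U, T v ∈ U) (hc : IsCompl (⨅ x ∈ orthIn h h, LinearMap.ker x) U) :
    NondegOn h := by
  have hmem : ∀ v, v ∈ ⨅ x ∈ orthIn h h, LinearMap.ker x ↔ ∀ x ∈ orthIn h h, x v = 0 :=
    fun v => by simp [Submodule.mem_iInf]
  have hUbot : U = ⊥ := by
    by_contra hne
    obtain ⟨b, hb, hb0, hbx⟩ := exists_mem_not_mem_of_engel (orthIn h h) hbr.orthIn_self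
      (fun x hx => ReplicaClosed.isNilpotent_of_mem_orthIn_self hrep hx) ⊥ U
      (fun hle => hne (le_bot_iff.1 hle)) (fun x hx b hb => hU x hx.1 b hb)
    exact hb0 (hc.disjoint.le_bot
      ⟨(hmem b).2 fun x hx => (Submodule.mem_bot K).1 (hbx x hx), hb⟩)
  intro x hx hxy
  have htop := hc.sup_eq_top
  rw [hUbot, sup_bot_eq] at htop
  exact LinearMap.ext fun v => (hmem v).1 (htop ▸ Submodule.mem_top) x ⟨hx, hxy⟩

theorem isRep_mulLeft_adL (h : Submodule K (Module.End K V)) :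
    IsRep h ((LinearMap.mul K (Module.End K (Module.End K V))).comp
      (Richardson.adL : Module.End K V →ₗ[K] _)) := by
  refine ⟨fun x _ y _ => LinearMap.ext fun z => ?_, fun θ T T' _ hT => ?_⟩
  · rw [LinearMap.comp_apply, adL_bracket]
    simp only [LinearMap.comp_apply, map_sub, LinearMap.sub_apply, LinearMap.mul_apply',
      Module.End.mul_apply, mul_assoc]
  · refine hT.adL.map (LinearMap.mul K (Module.End K (Module.End K V))) fun n => ?_
    change LinearMap.mulLeft K _ = LinearMap.mulLeft K _ ^ n
    rw [LinearMap.pow_mulLeft]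

/-- Separability of associative algebras of operators with nondegenerate trace form. -/
theorem exists_separating_projection (hmul : ∀ x ∈ h, ∀ y ∈ h, x * y ∈ h) (h1 : 1 ∈ h)
    (hnd : NondegOn h) : ∃ c : h × h →₀ K,
      (∑ p ∈ c.support, c p • ((p.1 : Module.End K V) * (p.2 : Module.End K V)) = 1) ∧
      ∀ T ∈ h, ∀ X : Module.End K V,
        T * (∑ p ∈ c.support, c p • ((p.1 : Module.End K V) * X * (p.2 : Module.End K V))) =
        (∑ p ∈ c.support, c p • ((p.1 : Module.End K V) * X * (p.2 : Module.End K V))) * T := by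
  have hbr : BracketClosed h := fun x hx y hy => sub_mem (hmul x hx y hy) (hmul y hy x hx)
  have hrep : ReplicaClosed h := fun θ T T' hT hTT' => by
    obtain ⟨p, rfl⟩ := hTT'.exists_eq_aeval
    rw [Polynomial.aeval_eq_sum_range]
    refine sum_mem fun i hi => h.smul_mem _ ?_
    clear hi
    induction i with
    | zero => rwa [pow_zero]
    | succ i ih => rw [pow_succ]; exact hmul _ ih _ hT
  let B : h × h → Module.End K (Module.End K V) := fun p =>
    LinearMap.mulLeft K (p.1 : Module.End K V) * LinearMap.mulRight K (p.2 : Module.End K V)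
  have hB : ∀ p X, B p X = (p.1 : Module.End K V) * X * (p.2 : Module.End K V) := fun p X =>
    (mul_assoc _ _ _).symm
  let S : Submodule K (Module.End K (Module.End K V)) := Submodule.span K (Set.range B)
  let μ : Module.End K (Module.End K V) →ₗ[K] Module.End K V := LinearMap.applyₗ 1
  let p : Submodule K (Module.End K (Module.End K V)) :=
    S ⊓ (K ∙ (1 : Module.End K V)).comap μ
  let p0 : Submodule K (Module.End K (Module.End K V)) := S ⊓ LinearMap.ker μ
  have hS : ∀ T ∈ h, ∀ E ∈ S, adL T * E ∈ S := fun T hT E hE => by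
    induction hE using Submodule.span_induction with
    | mem E hE =>
      obtain ⟨q, rfl⟩ := hE
      have h2 : adL T * B q = B (⟨T * q.1, hmul _ hT _ q.1.2⟩, q.2) -
          B (q.1, ⟨q.2 * T, hmul _ q.2.2 _ hT⟩) := LinearMap.ext fun X => by
        simp only [Module.End.mul_apply, adL_apply, LinearMap.sub_apply, hB, mul_assoc]
      rw [h2]
      exact sub_mem (Submodule.subset_span ⟨_, rfl⟩) (Submodule.subset_span ⟨_, rfl⟩)
    | zero => rw [mul_zero]; exact zero_mem _
    | add x y _ _ hx hy => rw [mul_add]; exact add_mem hx hy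
    | smul c x _ hx => rw [mul_smul_comm]; exact S.smul_mem c hx
  have hone : (1 : Module.End K (Module.End K V)) ∈ S := Submodule.subset_span
    ⟨(⟨1, h1⟩, ⟨1, h1⟩), LinearMap.ext fun X => by simp [hB]⟩
  rcases (subsingleton_or_nontrivial V).symm with hV | hV
  · obtain ⟨E, hE, hE0, hEh⟩ := (isRep_mulLeft_adL h).exists_invariant_mem hbr hrep hnd
      (p := p) (p0 := p0)
      (inf_le_inf_left _ fun x hx => by
        rw [Submodule.mem_comap, LinearMap.mem_ker.1 hx]; exact zero_mem _)
      (fun hle => by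
        have h2 := (hle (⟨hone, Submodule.mem_span_singleton_self _⟩ :
          (1 : Module.End K (Module.End K V)) ∈ p)).2
        exact one_ne_zero (α := Module.End K V) (LinearMap.mem_ker.1 h2))
      (fun T hT E hE => ⟨hS T hT E hE.1, by
        obtain ⟨c, hc⟩ := Submodule.mem_span_singleton.1 (Submodule.mem_comap.1 hE.2)
        change T * E 1 - E 1 * T = 0
        have h3 : E 1 = c • 1 := hc.symm
        rw [h3, mul_smul_comm, smul_mul_assoc, mul_one, one_mul, sub_self]⟩)
    obtain ⟨c, hc⟩ := Submodule.mem_span_singleton.1 (Submodule.mem_comap.1 hE.2)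
    have hc' : E 1 = c • 1 := hc.symm
    have hc0 : c ≠ 0 := fun h0 => hE0 ⟨hE.1, by
      change E 1 = 0
      rw [hc', h0, zero_smul]⟩
    obtain ⟨d, hd⟩ := (Finsupp.mem_span_range_iff_exists_finsupp).1 (S.smul_mem c⁻¹ hE.1)
    have hdE : ∀ X, ∑ q ∈ d.support, d q • ((q.1 : Module.End K V) * X * (q.2 : Module.End K V)) =
        c⁻¹ • E X := fun X => by
      rw [← LinearMap.smul_apply, ← hd, Finsupp.sum, LinearMap.sum_apply]
      exact Finset.sum_congr rfl fun q _ => by rw [LinearMap.smul_apply, hB]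
    refine ⟨d, ?_, fun T hT X => ?_⟩
    · have h3 := hdE 1
      simp only [mul_one] at h3
      rw [h3, hc', inv_smul_smul₀ hc0]
    · rw [hdE, mul_smul_comm, smul_mul_assoc]
      congr 1
      exact sub_eq_zero.1 (LinearMap.congr_fun (hEh T hT) X)
  · exact ⟨0, Subsingleton.elim _ _, fun T _ X => Subsingleton.elim _ _⟩

end Invariants

section Words

variable {K : Type} [Field K] [CharZero K] [IsAlgClosed K] {N : ℕ} {I : Type}

/-- The algebra of matrices generated by a tuple. -/
noncomputable def wordAlg (g : I → GLn K N) : Subalgebra K (Mat K N) :=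
  Algebra.adjoin K (Set.range fun i => (g i : Mat K N))

theorem mem_wordAlg (g : I → GLn K N) (i : I) : (g i : Mat K N) ∈ wordAlg g :=
  Algebra.subset_adjoin ⟨i, rfl⟩

theorem inv_mem_of_mem_subalgebra {A : Subalgebra K (Mat K N)} {x : GLn K N}
    (hx : (x : Mat K N) ∈ A) : ((x⁻¹ : GLn K N) : Mat K N) ∈ A := by
  have hinj : Function.Injective (LinearMap.mulLeft K (⟨x, hx⟩ : A)) := fun a b hab =>
    Subtype.ext ((Units.mul_right_inj x).1 (congrArg Subtype.val hab))
  obtain ⟨b, hb⟩ := (LinearMap.injective_iff_surjective.1 hinj) 1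
  have hb' : (x : Mat K N) * (b : Mat K N) = 1 := congrArg Subtype.val hb
  rw [show ((x⁻¹ : GLn K N) : Mat K N) = b from Units.inv_eq_of_mul_eq_one_right hb']
  exact b.2

theorem closure_subset_wordAlg {g : I → GLn K N} {x : GLn K N}
    (hx : x ∈ Subgroup.closure (Set.range g)) : (x : Mat K N) ∈ wordAlg g := by
  induction hx using Subgroup.closure_induction with
  | mem x hx => obtain ⟨i, rfl⟩ := hx; exact mem_wordAlg g i
  | one => exact one_mem _
  | mul x y _ _ hx hy => exact mul_mem hx hy
  | inv x _ hx => exact inv_mem_of_mem_subalgebra hx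

theorem wordAlg_stable {g : I → GLn K N} {U : Submodule K (Fin N → K)}
    (hU : ∀ i, ∀ v ∈ U, (g i : Mat K N) *ᵥ v ∈ U) {a : Mat K N} (ha : a ∈ wordAlg g) :
    ∀ v ∈ U, a *ᵥ v ∈ U := by
  induction ha using Algebra.adjoin_induction with
  | mem x hx => obtain ⟨i, rfl⟩ := hx; exact hU i
  | algebraMap r =>
    intro v hv
    rw [Algebra.algebraMap_eq_smul_one, Matrix.smul_mulVec, Matrix.one_mulVec]
    exact U.smul_mem r hv
  | add x y _ _ hx hy => intro v hv; rw [Matrix.add_mulVec]; exact add_mem (hx v hv) (hy v hv)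
  | mul x y _ _ hx hy => intro v hv; rw [← Matrix.mulVec_mulVec]; exact hx _ (hy v hv)

/-- The operators in the algebra generated by a tuple. -/
noncomputable def wordE (g : I → GLn K N) : Submodule K (Module.End K (Fin N → K)) :=
  (wordAlg g).toSubmodule.comap (mt K N).toLinearMap

theorem mem_wordE {g : I → GLn K N} {T : Module.End K (Fin N → K)} :
    T ∈ wordE g ↔ mt K N T ∈ wordAlg g := Iff.rfl

theorem nondegOn_wordE {g : I → GLn K N}
    (hg : NatSemisimpleOn K N (Subgroup.closure (Set.range g) : Set (GLn K N))) :
    NondegOn (wordE g) := by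
  have hmul : ∀ x ∈ wordE g, ∀ y ∈ wordE g, x * y ∈ wordE g := fun x hx y hy => by
    rw [mem_wordE, map_mul]; exact mul_mem hx hy
  have hrep : ReplicaClosed (wordE g) := fun θ T T' hT hTT' => by
    obtain ⟨p, rfl⟩ := hTT'.exists_eq_aeval
    rw [mem_wordE, ← Polynomial.aeval_algHom_apply]
    exact Algebra.adjoin_le (Set.singleton_subset_iff.2 hT)
      (Polynomial.aeval_mem_adjoin_singleton K (mt K N T))
  obtain ⟨U, hU, hc⟩ := hg (⨅ x ∈ orthIn (wordE g) (wordE g), LinearMap.ker x)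
    fun u hu v hv => by
      simp only [Submodule.mem_iInf, LinearMap.mem_ker] at hv ⊢
      intro x hx
      have hu' : (mt K N).symm (u : Mat K N) ∈ wordE g := by
        rw [mem_wordE, AlgEquiv.apply_symm_apply]
        exact closure_subset_wordAlg hu
      have h1 := hv (x * (mt K N).symm (u : Mat K N)) ⟨hmul _ hx.1 _ hu', fun y hy => by
        rw [mul_assoc]; exact hx.2 _ (hmul _ hu' _ hy)⟩
      rwa [Module.End.mul_apply, ← mt_mulVec ((mt K N).symm _), AlgEquiv.apply_symm_apply] at h1
  refine nondegOn_of_isCompl (fun x hx y hy => sub_mem (hmul x hx y hy) (hmul y hy x hx)) hrep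
    (fun T hT v hv => ?_) hc
  rw [← mt_mulVec]
  exact wordAlg_stable (fun i => hU _ (Subgroup.subset_closure ⟨i, rfl⟩)) hT v hv

/-- Words lift to equivariant matrices of polynomials. -/
theorem exists_equivariant_lift {g : I → GLn K N} {a : Mat K N} (ha : a ∈ wordAlg g) :
    ∃ U : Matrix (Fin N) (Fin N) (MvPolynomial (I × Tau N) K), (tev g).mapMatrix U = a ∧
      (∀ (x : GLn K N) (t : I → GLn K N), (tev (conjT x t)).mapMatrix U =
        (x : Mat K N) * (tev t).mapMatrix U * ((x⁻¹ : GLn K N) : Mat K N)) ∧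
      ∀ (t : I → GLn K N), (tev t).mapMatrix U ∈ wordAlg t := by
  induction ha using Algebra.adjoin_induction with
  | mem x hx =>
    obtain ⟨i, rfl⟩ := hx
    exact ⟨tX K N i, tev_tX _ _, fun x t => by rw [tev_tX, tev_tX]; rfl,
      fun t => by rw [tev_tX]; exact mem_wordAlg t i⟩
  | algebraMap r =>
    refine ⟨algebraMap K _ r, AlgHom.commutes _ r, fun x t => ?_, fun t => ?_⟩
    · rw [AlgHom.commutes, AlgHom.commutes, ← Algebra.commutes, mul_assoc, ← Units.val_mul,
        mul_inv_cancel, Units.val_one, mul_one]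
    · rw [AlgHom.commutes]
      exact Subalgebra.algebraMap_mem _ r
  | add x y _ _ hx hy =>
    obtain ⟨U, hU, hU', hU''⟩ := hx
    obtain ⟨W, hW, hW', hW''⟩ := hy
    exact ⟨U + W, by rw [map_add, hU, hW], fun x t => by
      rw [map_add, map_add, hU', hW', mul_add, add_mul], fun t => by
      rw [map_add]; exact add_mem (hU'' t) (hW'' t)⟩
  | mul x y _ _ hx hy =>
    obtain ⟨U, hU, hU', hU''⟩ := hx
    obtain ⟨W, hW, hW', hW''⟩ := hy
    refine ⟨U * W, by rw [map_mul, hU, hW], fun x t => ?_, fun t => by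
      rw [map_mul]; exact mul_mem (hU'' t) (hW'' t)⟩
    have : ((x⁻¹ : GLn K N) : Mat K N) * (x : Mat K N) = 1 := Units.inv_mul x
    rw [map_mul, map_mul, hU', hW']
    simp only [mul_assoc]
    rw [← mul_assoc _ (x : Mat K N), this, one_mul]

theorem wordAlg_comm {t : I → GLn K N} {X a : Mat K N}
    (hX : ∀ i, X * (t i : Mat K N) = (t i : Mat K N) * X) (ha : a ∈ wordAlg t) : X * a = a * X := by
  have h1 : wordAlg t ≤ Subalgebra.centralizer K {X} := Algebra.adjoin_le <| by
    rintro _ ⟨i, rfl⟩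
    exact Subalgebra.mem_centralizer_iff K |>.2 fun y hy => by rw [Set.mem_singleton_iff.1 hy, hX]
  exact (Subalgebra.mem_centralizer_iff K).1 (h1 ha) X rfl

end Words

section Centralizers

variable {K : Type} [Field K] [CharZero K] [IsAlgClosed K] {N : ℕ} {I : Type}

theorem trace_mt (T : Module.End K (Fin N → K)) :
    LinearMap.trace K (Fin N → K) T = (mt K N T).trace := by
  rw [LinearMap.trace_eq_matrix_trace K (Pi.basisFun K (Fin N)), LinearMap.toMatrix_eq_toMatrix']
  rfl

/-- Projection to the Lie algebra along its orthogonal. -/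
theorem exists_lie_projection {G M : Subgroup (GLn K N)}
    (hnd : NondegOn (lieE (G : Set (GLn K N)))) (hM : ∀ x ∈ M, ∀ g ∈ G, x * g * x⁻¹ ∈ G) :
    ∃ π : Module.End K (Mat K N), (∀ X, π X ∈ lieM (G : Set (GLn K N))) ∧
      (∀ X ∈ lieM (G : Set (GLn K N)), π X = X) ∧
      ∀ x ∈ M, ∀ X, X * (x : Mat K N) = (x : Mat K N) * X →
        π X * (x : Mat K N) = (x : Mat K N) * π X := by
  set p := lieM (G : Set (GLn K N)) with hp
  have htr : ∀ X Y : Mat K N, (X * Y).trace =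
      LinearMap.trace K _ ((mt K N).symm X * (mt K N).symm Y) := fun X Y => by
    rw [trace_mt, map_mul, AlgEquiv.apply_symm_apply, AlgEquiv.apply_symm_apply]
  have hmem : ∀ X, X ∈ p ↔ (mt K N).symm X ∈ lieE (G : Set (GLn K N)) := fun X => by
    rw [mem_lieE, AlgEquiv.apply_symm_apply]
  have hnd' : ∀ X ∈ p, (∀ Y ∈ p, (X * Y).trace = 0) → X = 0 := fun X hX h => by
    refine (mt K N).symm.map_eq_zero_iff.1 (hnd _ ((hmem X).1 hX) fun y hy => ?_)
    rw [← h _ (mem_lieE.1 hy), htr, AlgEquiv.symm_apply_apply]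
    rfl
  let q : Submodule K (Mat K N) :=
    { carrier := {X | ∀ Y ∈ p, (X * Y).trace = 0}
      add_mem' := fun {X X'} h h' Y hY => by
        rw [add_mul, Matrix.trace_add, h Y hY, h' Y hY, add_zero]
      zero_mem' := fun Y _ => by rw [zero_mul, Matrix.trace_zero]
      smul_mem' := fun c X h Y hY => by
        rw [smul_mul_assoc, Matrix.trace_smul, h Y hY, smul_zero] }
  have hc : IsCompl p q := by
    refine ⟨Submodule.disjoint_def.2 fun X hX hXq => hnd' X hX hXq, codisjoint_iff.2 ?_⟩
    refine eq_top_iff.2 fun X _ => ?_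
    obtain ⟨a, ha, haX⟩ := hnd.exists_sub_mem_orthIn (h := ⊤) le_top
      (x := (mt K N).symm X) Submodule.mem_top
    refine Submodule.mem_sup.2 ⟨mt K N a, mem_lieE.1 ha, X - mt K N a, fun Y hY => ?_,
      add_sub_cancel _ _⟩
    rw [htr, map_sub, AlgEquiv.symm_apply_apply]
    exact (mem_orthIn.1 haX).2 _ ((hmem Y).1 hY)
  let π : Module.End K (Mat K N) := p.subtype ∘ₗ p.projectionOnto q hc
  have hπmem : ∀ X, π X ∈ p := fun X => (p.projectionOnto q hc X).2
  have hπid : ∀ X ∈ p, π X = X := fun X hX =>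
    congrArg Subtype.val (Submodule.projectionOnto_apply_left hc ⟨X, hX⟩)
  have hπq : ∀ X, X - π X ∈ q := fun X => by
    rw [← Submodule.ker_projectionOnto hc, LinearMap.mem_ker, map_sub]
    exact sub_eq_zero.2 (Submodule.projectionOnto_apply_left hc _).symm
  refine ⟨π, hπmem, hπid, fun x hx X hX => ?_⟩
  have hcomm : π X = (x : Mat K N) * π X * ((x⁻¹ : GLn K N) : Mat K N) := by
    refine sub_eq_zero.1 (hnd' _ (sub_mem (hπmem X) (lieM_conj (hM x hx) (hπmem X)))
      fun Y hY => ?_)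
    have hxX : (x : Mat K N) * X * ((x⁻¹ : GLn K N) : Mat K N) = X := by
      rw [← hX, mul_assoc, Units.mul_inv, mul_one]
    have h1 : π X - (x : Mat K N) * π X * ((x⁻¹ : GLn K N) : Mat K N) =
        (x : Mat K N) * (X - π X) * ((x⁻¹ : GLn K N) : Mat K N) - (X - π X) := by
      rw [mul_sub, sub_mul, hxX]; abel
    have h2 := lieM_conj (hM _ (M.inv_mem hx)) hY
    rw [h1, sub_mul, Matrix.trace_sub, hπq X Y hY, sub_zero, mul_assoc, mul_assoc,
      Matrix.trace_mul_comm, mul_assoc]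
    refine hπq X _ ?_
    rwa [inv_inv] at h2
  conv_lhs => rw [hcomm]
  rw [mul_assoc, Units.inv_mul, mul_one]

theorem linearMap_matrix_apply (φ : Mat K N →ₗ[K] K) (A : Mat K N) :
    φ A = ∑ a, ∑ b, A a b * φ (Matrix.single a b 1) := by
  conv_lhs => rw [Matrix.matrix_eq_sum_single A]
  simp only [map_sum]
  refine Finset.sum_congr rfl fun a _ => Finset.sum_congr rfl fun b _ => ?_
  rw [← smul_eq_mul, ← map_smul, Matrix.smul_single, smul_eq_mul, mul_one]

theorem exists_tev_eq_bilin (b : Mat K N →ₗ[K] Mat K N →ₗ[K] K)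
    (U W : Matrix (Fin N) (Fin N) (MvPolynomial (I × Tau N) K)) :
    ∃ T : MvPolynomial (I × Tau N) K, ∀ t : I → GLn K N,
      tev t T = b ((tev t).mapMatrix U) ((tev t).mapMatrix W) := by
  refine ⟨∑ i, ∑ j, U i j * ∑ k, ∑ l, W k l *
    MvPolynomial.C (b (Matrix.single i j 1) (Matrix.single k l 1)), fun t => ?_⟩
  have h := linearMap_matrix_apply (b.flip ((tev t).mapMatrix W)) ((tev t).mapMatrix U)
  rw [LinearMap.flip_apply] at h
  rw [h, map_sum]
  refine Finset.sum_congr rfl fun i _ => ?_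
  rw [map_sum]
  refine Finset.sum_congr rfl fun j _ => ?_
  rw [LinearMap.flip_apply, linearMap_matrix_apply, map_mul, map_sum]
  refine congrArg _ (Finset.sum_congr rfl fun k _ => ?_)
  rw [map_sum]
  refine Finset.sum_congr rfl fun l _ => ?_
  rw [map_mul]
  exact congrArg _ (MvPolynomial.aeval_C _ _)

/-- Polynomial families of projections to the centralizers. -/
theorem exists_cen_projection {G : Subgroup (GLn K N)} {g : I → GLn K N}
    (hg : NatSemisimpleOn K N (Subgroup.closure (Set.range g) : Set (GLn K N))) :
    ∃ (κ : Type) (s : Finset κ)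
      (U W : κ → Matrix (Fin N) (Fin N) (MvPolynomial (I × Tau N) K)),
      ∀ t ∈ clT (orbT G g),
        (∀ X i, (t i : Mat K N) * ∑ k ∈ s, (tev t).mapMatrix (U k) * X * (tev t).mapMatrix (W k) =
          (∑ k ∈ s, (tev t).mapMatrix (U k) * X * (tev t).mapMatrix (W k)) * (t i : Mat K N)) ∧
        ∀ X, (∀ i, X * (t i : Mat K N) = (t i : Mat K N) * X) →
          ∑ k ∈ s, (tev t).mapMatrix (U k) * X * (tev t).mapMatrix (W k) = X := by
  obtain ⟨c, hc1, hc⟩ := exists_separating_projection (h := wordE g)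
    (fun x hx y hy => by rw [mem_wordE, map_mul]; exact mul_mem hx hy)
    (by rw [mem_wordE, map_one]; exact one_mem _) (nondegOn_wordE hg)
  choose L hL hL' hL'' using fun T : wordE g => exists_equivariant_lift (mem_wordE.1 T.2)
  let U : wordE g × wordE g → Matrix (Fin N) (Fin N) (MvPolynomial (I × Tau N) K) :=
    fun p => c p • L p.1
  let W : wordE g × wordE g → Matrix (Fin N) (Fin N) (MvPolynomial (I × Tau N) K) := fun p => L p.2
  let E : (I → GLn K N) → Mat K N → Mat K N := fun t X =>
    ∑ k ∈ c.support, (tev t).mapMatrix (U k) * X * (tev t).mapMatrix (W k)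
  have hUs : ∀ t k, (tev t).mapMatrix (U k) = c k • (tev t).mapMatrix (L k.1) := fun t k =>
    map_smul _ _ _
  have hE1 : ∀ t, E t 1 = ∑ k ∈ c.support, (tev t).mapMatrix (U k) * (tev t).mapMatrix (W k) :=
    fun t => by simp only [E, mul_one]
  have hEc : ∀ x t X, E (conjT x t) X = (x : Mat K N) *
      E t (((x⁻¹ : GLn K N) : Mat K N) * X * (x : Mat K N)) * ((x⁻¹ : GLn K N) : Mat K N) :=
    fun x t X => by
      simp only [E, Finset.mul_sum, Finset.sum_mul]
      refine Finset.sum_congr rfl fun k _ => ?_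
      rw [hUs, hUs, hL' k.1 x t, show (tev (conjT x t)).mapMatrix (W k) = _ from hL' k.2 x t]
      simp only [mul_assoc, smul_mul_assoc, mul_smul_comm]
      rfl
  have hEg : ∀ X, E g (mt K N X) = mt K N (∑ p ∈ c.support, c p •
      ((p.1 : Module.End K (Fin N → K)) * X * (p.2 : Module.End K (Fin N → K)))) := fun X => by
    rw [map_sum]
    refine Finset.sum_congr rfl fun k _ => ?_
    rw [hUs, hL k.1, hL k.2, map_smul, map_mul, map_mul, smul_mul_assoc, smul_mul_assoc]
  have hEg1 : E g 1 = 1 := by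
    have := hEg 1
    simp only [mul_one, hc1, map_one] at this
    exact this
  have hEgc : ∀ X i, (g i : Mat K N) * E g X = E g X * (g i : Mat K N) := fun X i => by
    have h1 := congrArg (mt K N) (hc ((mt K N).symm (g i : Mat K N))
      (by rw [mem_wordE, AlgEquiv.apply_symm_apply]; exact mem_wordAlg g i) ((mt K N).symm X))
    rwa [map_mul, map_mul, AlgEquiv.apply_symm_apply, ← hEg, AlgEquiv.apply_symm_apply] at h1
  have hinv : ∀ x : GLn K N, ((x⁻¹ : GLn K N) : Mat K N) * (x : Mat K N) = 1 := Units.inv_mul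
  have hcl : ∀ F : Matrix (Fin N) (Fin N) (MvPolynomial (I × Tau N) K),
      (∀ x ∈ G, (tev (conjT x g)).mapMatrix F = 0) →
      ∀ t ∈ clT (orbT G g), (tev t).mapMatrix F = 0 := fun F hF t ht => by
    ext a b
    refine ht (F a b) (mem_tptI.2 ?_)
    rintro _ ⟨x, hx, rfl⟩
    exact congrFun (congrFun (hF x hx) a) b
  refine ⟨_, c.support, U, W, fun t ht => ⟨fun X i => ?_, fun X hX => ?_⟩⟩
  · have hev : ∀ t : I → GLn K N, (tev t).mapMatrix
        (tX K N i * ∑ k ∈ c.support, U k * cM _ X * W k -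
          (∑ k ∈ c.support, U k * cM _ X * W k) * tX K N i) =
        (t i : Mat K N) * E t X - E t X * (t i : Mat K N) := fun t => by
      rw [map_sub, map_mul, map_mul, tev_tX, map_sum]
      simp only [map_mul, mapMatrix_cM, cM_self]
      rfl
    have h1 := hcl _ (fun x hx => by
      rw [hev, hEc]
      have h2 := hEgc (((x⁻¹ : GLn K N) : Mat K N) * X * (x : Mat K N)) i
      change (x : Mat K N) * (g i : Mat K N) * ((x⁻¹ : GLn K N) : Mat K N) * _ -
        _ * ((x : Mat K N) * (g i : Mat K N) * ((x⁻¹ : GLn K N) : Mat K N)) = 0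
      set Z := E g (((x⁻¹ : GLn K N) : Mat K N) * X * (x : Mat K N))
      have e1 : (x : Mat K N) * (g i : Mat K N) * ((x⁻¹ : GLn K N) : Mat K N) *
          ((x : Mat K N) * Z * ((x⁻¹ : GLn K N) : Mat K N)) =
          (x : Mat K N) * ((g i : Mat K N) * (((x⁻¹ : GLn K N) : Mat K N) * (x : Mat K N)) * Z) *
            ((x⁻¹ : GLn K N) : Mat K N) := by simp only [mul_assoc]
      have e2 : ((x : Mat K N) * Z * ((x⁻¹ : GLn K N) : Mat K N)) *
          ((x : Mat K N) * (g i : Mat K N) * ((x⁻¹ : GLn K N) : Mat K N)) =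
          (x : Mat K N) * (Z * (((x⁻¹ : GLn K N) : Mat K N) * (x : Mat K N)) * (g i : Mat K N)) *
            ((x⁻¹ : GLn K N) : Mat K N) := by simp only [mul_assoc]
      rw [e1, e2, hinv, mul_one, mul_one, h2, sub_self]) t ht
    rw [hev] at h1
    exact sub_eq_zero.1 h1
  · have h1 := hcl (∑ k ∈ c.support, U k * W k - 1) (fun x hx => by
      rw [map_sub, map_one, map_sum]
      simp only [map_mul]
      rw [← hE1, hEc, mul_one, hinv, hEg1, mul_one, Units.mul_inv, sub_self]) t ht
    rw [map_sub, map_one, map_sum] at h1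
    simp only [map_mul] at h1
    calc _ = (∑ k ∈ c.support, (tev t).mapMatrix (U k) * (tev t).mapMatrix (W k)) * X := by
          rw [Finset.sum_mul]
          exact Finset.sum_congr rfl fun k _ => by
            rw [mul_assoc, wordAlg_comm hX (hL'' k.2 t), mul_assoc]
      _ = X := by rw [sub_eq_zero.1 h1, one_mul]

end Centralizers

section OrbitDimension

variable {K : Type} [Field K] [CharZero K] [IsAlgClosed K] {N : ℕ} {I : Type}

/-- The centralizer of a tuple in the matrix algebra. -/
def cenM (t : I → GLn K N) : Submodule K (Mat K N) where
  carrier := {X | ∀ i, X * (t i : Mat K N) = (t i : Mat K N) * X}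
  add_mem' hX hY i := by rw [add_mul, mul_add, hX i, hY i]
  zero_mem' i := by simp
  smul_mem' c X hX i := by rw [smul_mul_assoc, mul_smul_comm, hX i]

theorem conj_comm_of_comm {R : Type*} [Ring R] {x x' X t : R} (h : x' * x = 1)
    (hX : X * (x * t * x') = x * t * x' * X) : x' * X * x * t = t * (x' * X * x) := by
  calc x' * X * x * t = x' * (X * (x * t * x')) * x := by simp only [mul_assoc, h, mul_one]
    _ = (x' * x) * t * (x' * X * x) := by rw [hX]; simp only [mul_assoc]
    _ = _ := by rw [h, one_mul]

theorem conj_conj_cancel {R : Type*} [Ring R] {x x' X : R} (h : x * x' = 1) :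
    x * (x' * X * x * x') = X := by
  rw [mul_assoc (x' * X), h, mul_one, ← mul_assoc, h, one_mul]

theorem finrank_cen_conjT_le {G : Subgroup (GLn K N)} {x : GLn K N} (hx : x ∈ G)
    (t : I → GLn K N) :
    Module.finrank K ↥(lieM (G : Set (GLn K N)) ⊓ cenM (conjT x t)) ≤
      Module.finrank K ↥(lieM (G : Set (GLn K N)) ⊓ cenM t) := by
  have h1 : (x : Mat K N) * ((x⁻¹ : GLn K N) : Mat K N) = 1 := Units.mul_inv x
  have h2 : ((x⁻¹ : GLn K N) : Mat K N) * (x : Mat K N) = 1 := Units.inv_mul x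
  have h3 : ∀ X ∈ lieM (G : Set (GLn K N)),
      ((x⁻¹ : GLn K N) : Mat K N) * X * (x : Mat K N) ∈ lieM (G : Set (GLn K N)) := by
    intro X hX
    have h := lieM_conj (x := x⁻¹) (G := G)
      (fun g hg => G.mul_mem (G.mul_mem (G.inv_mem hx) hg) (by rwa [inv_inv])) hX
    rwa [inv_inv] at h
  have hle : lieM (G : Set (GLn K N)) ⊓ cenM (conjT x t) ≤
      (lieM (G : Set (GLn K N)) ⊓ cenM t).map
        (LinearMap.mulLeft K (x : Mat K N) ∘ₗ
          LinearMap.mulRight K ((x⁻¹ : GLn K N) : Mat K N)) := by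
    rintro X ⟨hX, hXc⟩
    refine ⟨((x⁻¹ : GLn K N) : Mat K N) * X * (x : Mat K N), ⟨h3 X hX, fun i => ?_⟩, ?_⟩
    · exact conj_comm_of_comm h2 (hXc i)
    · rw [LinearMap.comp_apply, LinearMap.mulRight_apply, LinearMap.mulLeft_apply]
      exact conj_conj_cancel h1
  exact (Submodule.finrank_mono hle).trans (Submodule.finrank_map_le _ _)

theorem finrank_cen_conjT {G : Subgroup (GLn K N)} {x : GLn K N} (hx : x ∈ G)
    (t : I → GLn K N) :
    Module.finrank K ↥(lieM (G : Set (GLn K N)) ⊓ cenM (conjT x t)) =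
      Module.finrank K ↥(lieM (G : Set (GLn K N)) ⊓ cenM t) := by
  refine le_antisymm (finrank_cen_conjT_le hx t) ?_
  have := finrank_cen_conjT_le (G.inv_mem hx) (conjT x t)
  rwa [conjT_conjT, inv_mul_cancel, conjT_one] at this

/-- Centralizers in the Lie algebra do not grow along the orbit closure of a semisimple tuple. -/
theorem finrank_cen_eq {G M : Subgroup (GLn K N)}
    (hnd : NondegOn (lieE (G : Set (GLn K N)))) (hM : ∀ x ∈ M, ∀ g ∈ G, x * g * x⁻¹ ∈ G)
    {g : I → GLn K N} (hcl : ∀ t ∈ clT (orbT G g), ∀ i, t i ∈ M)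
    (hg : NatSemisimpleOn K N (Subgroup.closure (Set.range g) : Set (GLn K N)))
    {t : I → GLn K N} (ht : t ∈ clT (orbT G g)) :
    Module.finrank K ↥(lieM (G : Set (GLn K N)) ⊓ cenM t) =
      Module.finrank K ↥(lieM (G : Set (GLn K N)) ⊓ cenM g) := by
  obtain ⟨π, hπ1, hπ2, hπ3⟩ := exists_lie_projection hnd hM
  obtain ⟨κ, s, U, W, hUW⟩ := exists_cen_projection (G := G) hg
  let b : Mat K N →ₗ[K] Mat K N →ₗ[K] K :=
    ((LinearMap.mul K (Module.End K (Mat K N))).compl₁₂ (LinearMap.mul K (Mat K N))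
      (LinearMap.mul K (Mat K N)).flip).compr₂
      (LinearMap.trace K (Mat K N) ∘ₗ
        (LinearMap.mulLeft K π * LinearMap.mulRight K π : Module.End K (Module.End K (Mat K N))))
  have hb : ∀ A B, b A B = LinearMap.trace K (Mat K N)
      (π * ((LinearMap.mulLeft K A * LinearMap.mulRight K B) * π)) := fun A B => rfl
  choose T hT using fun k => exists_tev_eq_bilin (I := I) b (U k) (W k)
  have key : ∀ t ∈ clT (orbT G g), tev t (∑ k ∈ s, T k) =
      (Module.finrank K ↥(lieM (G : Set (GLn K N)) ⊓ cenM t) : K) := by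
    intro t ht
    obtain ⟨h1, h2⟩ := hUW t ht
    set E : Module.End K (Mat K N) := ∑ k ∈ s, LinearMap.mulLeft K ((tev t).mapMatrix (U k)) *
      LinearMap.mulRight K ((tev t).mapMatrix (W k)) with hE
    have hEa : ∀ X, E X = ∑ k ∈ s, (tev t).mapMatrix (U k) * X * (tev t).mapMatrix (W k) := by
      intro X
      rw [hE, LinearMap.sum_apply]
      exact Finset.sum_congr rfl fun k _ => (mul_assoc _ _ _).symm
    have hproj : LinearMap.IsProj (lieM (G : Set (GLn K N)) ⊓ cenM t) (π * (E * π)) := by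
      refine ⟨fun X => ⟨hπ1 _, fun i => ?_⟩, ?_⟩
      · refine hπ3 _ (hcl t ht i) _ ?_
        show E (π X) * _ = _ * E (π X)
        rw [hEa]
        exact (h1 _ i).symm
      · rintro X ⟨hX, hXc⟩
        show π (E (π X)) = X
        rw [hπ2 X hX, hEa, h2 X hXc, hπ2 X hX]
    rw [← hproj.trace, hE, Finset.sum_mul, Finset.mul_sum, map_sum, map_sum]
    exact Finset.sum_congr rfl fun k _ => hT k t
  have hgc : g ∈ clT (orbT G g) := subset_clT _ (mem_orbT_self G g)
  have hP : (∑ k ∈ s, T k) -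
      MvPolynomial.C (Module.finrank K ↥(lieM (G : Set (GLn K N)) ⊓ cenM g) : K) ∈
      tptI (orbT G g) := by
    rw [mem_tptI]
    rintro t' ⟨x, hx, rfl⟩
    rw [map_sub, key _ (subset_clT _ ⟨x, hx, rfl⟩), finrank_cen_conjT hx]
    simp [tev]
  have := ht _ hP
  rw [map_sub, key t ht, sub_eq_zero] at this
  have h3 : tev t (MvPolynomial.C
      (Module.finrank K ↥(lieM (G : Set (GLn K N)) ⊓ cenM g) : K)) =
      (Module.finrank K ↥(lieM (G : Set (GLn K N)) ⊓ cenM g) : K) := by simp [tev]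
  rw [h3] at this
  exact_mod_cast this

end OrbitDimension

section Independence

variable {K B ι : Type} [Field K] [CommRing B] [Algebra K B]

theorem derivation_aeval [Fintype ι] (D : Derivation K B B) (f : ι → B) (Q : MvPolynomial ι K) :
    D (aeval f Q) = ∑ j, aeval f (pderiv j Q) * D (f j) := by
  classical
  induction Q using MvPolynomial.induction_on with
  | C a => simp
  | add P Q hP hQ => simp only [map_add, hP, hQ, add_mul, Finset.sum_add_distrib]
  | mul_X P i hP =>
    rw [map_mul, Derivation.leibniz, hP, aeval_X, smul_eq_mul, smul_eq_mul, Finset.mul_sum]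
    have h : ∀ j, aeval f (pderiv j (P * MvPolynomial.X i)) * D (f j) =
        f i * (aeval f (pderiv j P) * D (f j)) +
          if j = i then aeval f P * D (f j) else 0 := by
      intro j
      rw [Derivation.leibniz, pderiv_X, Pi.single_apply]
      by_cases hj : i = j
      · subst hj
        simp; ring
      · simp [hj, Ne.symm hj]; ring
    simp only [h, Finset.sum_add_distrib, Finset.sum_ite_eq', Finset.mem_univ, if_true]
    ring

theorem eq_C_of_pderiv_eq_zero [CharZero K] {Q : MvPolynomial ι K}
    (h : ∀ j, pderiv j Q = 0) : Q = MvPolynomial.C (coeff 0 Q) := by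
  classical
  ext m
  rw [coeff_C]
  split_ifs with hm
  · rw [hm]
  · obtain ⟨j, hj⟩ : ∃ j, m j ≠ 0 := by
      by_contra hc
      push Not at hc
      exact hm (Finsupp.ext fun j => (hc j).symm)
    have h1 := coeff_pderiv (i := j) Q (m - Finsupp.single j 1)
    rw [h j, coeff_zero, tsub_add_cancel_of_le
      (by rw [Finsupp.single_le_iff]; exact Nat.one_le_iff_ne_zero.2 hj)] at h1
    exact (mul_eq_zero.1 h1.symm).resolve_right (Nat.cast_add_one_ne_zero _)

theorem totalDegree_pderiv_le {Q : MvPolynomial ι K} {n : ℕ} (h : Q.totalDegree ≤ n + 1) (j : ι) :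
    (pderiv j Q).totalDegree ≤ n := by
  refine Finset.sup_le fun m hm => ?_
  rw [mem_support_iff, coeff_pderiv] at hm
  have h1 := (le_totalDegree (mem_support_iff.2 (left_ne_zero_of_mul hm))).trans h
  rw [Finsupp.sum_add_index' (fun _ => rfl) (fun _ _ _ => rfl), Finsupp.sum_single_index rfl] at h1
  omega

/-- Jacobian criterion: a nonzero Jacobian implies algebraic independence. -/
theorem algebraicIndependent_of_det [CharZero K] [Fintype ι] [DecidableEq ι] {q : Ideal B}
    (hq : q.IsPrime) (D : ι → Derivation K B B) (hD : ∀ i, ∀ P ∈ q, D i P ∈ q) (f : ι → B)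
    (hdet : (Matrix.of fun i j => D i (f j)).det ∉ q) :
    AlgebraicIndependent K fun j => Ideal.Quotient.mkₐ K q (f j) := by
  have hcomp : ∀ Q, aeval (fun j => Ideal.Quotient.mkₐ K q (f j)) Q =
      Ideal.Quotient.mkₐ K q (aeval f Q) := fun Q => by
    rw [← comp_aeval_apply]
  have hconst : ∀ Q : MvPolynomial ι K, aeval f Q ∈ q → Q = MvPolynomial.C (coeff 0 Q) → Q = 0 := by
    intro Q hQ hC
    rw [hC, aeval_C] at hQ
    by_cases h0 : coeff 0 Q = 0
    · rw [hC, h0, map_zero]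
    · exact absurd (Ideal.eq_top_of_isUnit_mem _ hQ ((isUnit_iff_ne_zero.2 h0).map _)) hq.ne_top
  have key : ∀ n, ∀ Q : MvPolynomial ι K, Q.totalDegree ≤ n → aeval f Q ∈ q → Q = 0 := by
    intro n
    induction n with
    | zero =>
      exact fun Q hn hQ => hconst Q hQ (totalDegree_eq_zero_iff_eq_C.1 (Nat.le_zero.1 hn))
    | succ n ih =>
      intro Q hn hQ
      refine hconst Q hQ (eq_C_of_pderiv_eq_zero fun j => ih _ (totalDegree_pderiv_le hn j) ?_)
      have h1 : ∀ i, ((Matrix.of fun i j => D i (f j)) *ᵥ fun j => aeval f (pderiv j Q)) i ∈ q := by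
        intro i
        have := hD i _ hQ
        rw [derivation_aeval] at this
        simpa [Matrix.mulVec, dotProduct, mul_comm] using this
      have h2 : (Matrix.of fun i j => D i (f j)).det * aeval f (pderiv j Q) ∈ q := by
        have : (Matrix.of fun i j => D i (f j)).adjugate *ᵥ
            ((Matrix.of fun i j => D i (f j)) *ᵥ fun j => aeval f (pderiv j Q)) =
            (Matrix.of fun i j => D i (f j)).det • fun j => aeval f (pderiv j Q) := by
          rw [Matrix.mulVec_mulVec, Matrix.adjugate_mul, Matrix.smul_mulVec, Matrix.one_mulVec]
        have hj := congrFun this j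
        rw [Pi.smul_apply, smul_eq_mul] at hj
        rw [← hj]
        exact Ideal.sum_mem _ fun i _ => q.mul_mem_left _ (h1 i)
      exact (hq.mem_or_mem h2).resolve_left hdet
  rw [algebraicIndependent_iff]
  intro Q hQ
  rw [hcomp] at hQ
  exact key _ Q le_rfl (Ideal.Quotient.eq_zero_iff_mem.1 hQ)

/-- The transcendence degree drops along a proper specialization. -/
theorem algebraicIndependent_option {p q : Ideal B} (hp : p.IsPrime) (hpq : p ≤ q) {f0 : B}
    (h0 : f0 ∈ q) (h0p : f0 ∉ p) {f : ι → B}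
    (hf : AlgebraicIndependent K fun j => Ideal.Quotient.mkₐ K q (f j)) :
    AlgebraicIndependent K fun o : Option ι => Ideal.Quotient.mkₐ K p (o.elim f0 f) := by
  have hfac : (fun j => Ideal.Quotient.mkₐ K q (f j)) =
      (Ideal.Quotient.factorₐ K hpq) ∘ fun j => Ideal.Quotient.mkₐ K p (f j) := rfl
  have hfp : AlgebraicIndependent K fun j => Ideal.Quotient.mkₐ K p (f j) :=
    AlgebraicIndependent.of_comp (Ideal.Quotient.factorₐ K hpq) (hfac ▸ hf)
  have heq : (fun o : Option ι => Ideal.Quotient.mkₐ K p (o.elim f0 f)) =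
      fun o : Option ι => o.elim (Ideal.Quotient.mkₐ K p f0)
        fun j => Ideal.Quotient.mkₐ K p (f j) := by
    funext o; cases o <;> rfl
  rw [heq, hfp.option_iff_transcendental]
  intro halg
  have hnz : Ideal.Quotient.mkₐ K p f0 ≠ 0 := fun h => h0p (Ideal.Quotient.eq_zero_iff_mem.1 h)
  obtain ⟨r, hr0, hr⟩ := halg.exists_nonzero_coeff_and_aeval_eq_zero
    (mem_nonZeroDivisors_of_ne_zero hnz)
  refine hr0 (Subtype.ext ?_)
  obtain ⟨Q, hQ⟩ := (Algebra.adjoin_range_eq_range_aeval K _).le (r.coeff 0).2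
  have h1 : Ideal.Quotient.factorₐ K hpq (r.coeff 0 : B ⧸ p) = 0 := by
    have h2 := congrArg (Polynomial.aeval (Ideal.Quotient.mkₐ K p f0)) r.divX_mul_X_add
    rw [hr, map_add, map_mul, Polynomial.aeval_X, Polynomial.aeval_C] at h2
    have h3 := congrArg (Ideal.Quotient.factorₐ K hpq) h2
    have h4 : Ideal.Quotient.factorₐ K hpq (Ideal.Quotient.mkₐ K p f0) = 0 :=
      Ideal.Quotient.eq_zero_iff_mem.2 h0
    rwa [map_add, map_mul, h4, mul_zero, zero_add, map_zero] at h3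
  have h5 : aeval (fun j => Ideal.Quotient.mkₐ K q (f j)) Q = 0 := by
    have hQ' : aeval (fun j => Ideal.Quotient.mkₐ K p (f j)) Q = (r.coeff 0 : B ⧸ p) := hQ
    rw [← h1, ← hQ', hfac]
    exact (comp_aeval_apply (fun j => Ideal.Quotient.mkₐ K p (f j))
      (Ideal.Quotient.factorₐ K hpq) Q).symm
  rw [algebraicIndependent_iff.1 hf Q h5] at hQ
  exact hQ.symm.trans (map_zero _)

end Independence

section ClosedOrbits

variable {K : Type} [Field K] [CharZero K] [IsAlgClosed K] {N : ℕ} {I : Type}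

theorem finrank_map_add_finrank_inf_ker {E F : Type*} [AddCommGroup E] [Module K E]
    [FiniteDimensional K E] [AddCommGroup F] [Module K F] (Φ : E →ₗ[K] F) (p : Submodule K E) :
    Module.finrank K (p.map Φ) + Module.finrank K ↥(p ⊓ LinearMap.ker Φ) =
      Module.finrank K p := by
  have h := (Φ.domRestrict p).finrank_range_add_finrank_ker
  rwa [LinearMap.range_domRestrict, LinearMap.ker_domRestrict,
    ← Submodule.finrank_map_subtype_eq p, Submodule.map_comap_subtype] at h

/-- The differential of the conjugation orbit map. -/
noncomputable def comM (t : I → GLn K N) : Mat K N →ₗ[K] (I → Mat K N) :=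
  LinearMap.pi fun i => LinearMap.mulRight K (t i : Mat K N) - LinearMap.mulLeft K (t i : Mat K N)

theorem comM_apply (t : I → GLn K N) (X : Mat K N) (i : I) :
    comM t X i = X * (t i : Mat K N) - (t i : Mat K N) * X := rfl

theorem ker_comM (t : I → GLn K N) : LinearMap.ker (comM t) = cenM t := by
  ext X
  rw [LinearMap.mem_ker, funext_iff]
  exact forall_congr' fun i => sub_eq_zero

theorem tev_Dc_tX (t : I → GLn K N) (ξ : Mat K N) (i : I) (a b : Fin N) :
    tev t (Dc ξ (tX K N i a b)) = comM t ξ i a b := by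
  have h := congrArg (fun A => (tev t).mapMatrix A a b) (map_Dc_tX ξ i)
  simp only [map_sub, map_mul, tev_tX, mapMatrix_cM] at h
  exact h

theorem tev_Dc_eq_zero {t : I → GLn K N} {ξ : Mat K N} (hξ : ξ ∈ cenM t)
    (P : MvPolynomial (I × Tau N) K) : tev t (Dc ξ P) = 0 := by
  have hY : ∀ i, ξ * (((t i)⁻¹ : GLn K N) : Mat K N) = (((t i)⁻¹ : GLn K N) : Mat K N) * ξ := by
    intro i
    exact (Commute.units_inv_right (u := t i) (show Commute ξ (t i : Mat K N) from hξ i)).eq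
  induction P using MvPolynomial.induction_on with
  | C a => rw [← MvPolynomial.algebraMap_eq, Derivation.map_algebraMap, map_zero]
  | add P Q hP hQ => rw [map_add, map_add, hP, hQ, add_zero]
  | mul_X P p hP =>
    rw [Derivation.leibniz, map_add, smul_eq_mul, smul_eq_mul, map_mul, map_mul, hP, mul_zero,
      add_zero]
    obtain ⟨i, ⟨a, b⟩ | ⟨a, b⟩⟩ := p
    · have := tev_Dc_tX t ξ i a b
      rw [comM_apply, hξ i, sub_self] at this
      exact mul_eq_zero_of_right _ this
    · have h := congrArg (fun A => (tev t).mapMatrix A a b) (map_Dc_tY ξ i)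
      simp only [map_sub, map_mul, tev_tY, mapMatrix_cM, cM_self, hY i, sub_self] at h
      exact mul_eq_zero_of_right _ h

theorem exists_linear_function [Finite I] (φ : (I → Mat K N) →ₗ[K] K) :
    ∃ f : MvPolynomial (I × Tau N) K, ∀ t : I → GLn K N, ∀ ξ,
      tev t (Dc ξ f) = φ (comM t ξ) := by
  classical
  have := Fintype.ofFinite I
  refine ⟨∑ i, ∑ a, ∑ b, φ (Pi.single i (Matrix.single a b 1)) • tX K N i a b, fun t ξ => ?_⟩
  have h : ∀ Z : I → Mat K N, φ Z =
      ∑ i, ∑ a, ∑ b, φ (Pi.single i (Matrix.single a b 1)) * Z i a b := by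
    intro Z
    conv_lhs => rw [← Finset.univ_sum_single Z, map_sum]
    refine Finset.sum_congr rfl fun i _ => ?_
    have := linearMap_matrix_apply (φ ∘ₗ LinearMap.single K (fun _ : I => Mat K N) i) (Z i)
    simp only [LinearMap.comp_apply, LinearMap.single_apply] at this
    rw [this]
    exact Finset.sum_congr rfl fun a _ => Finset.sum_congr rfl fun b _ => mul_comm _ _
  rw [h]
  simp only [map_sum, Derivation.map_smul, map_smul, smul_eq_mul, tev_Dc_tX]

theorem exists_dual_family [Finite I] (p : Submodule K (Mat K N)) (t : I → GLn K N) :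
    ∃ (ξ : Fin (Module.finrank K (p.map (comM t))) → Mat K N)
      (f : Fin (Module.finrank K (p.map (comM t))) → MvPolynomial (I × Tau N) K),
      (∀ i, ξ i ∈ p) ∧ ∀ i j, tev t (Dc (ξ i) (f j)) = if i = j then 1 else 0 := by
  have := Fintype.ofFinite I
  let b := Module.finBasis K (p.map (comM t))
  choose ξ hξ hξb using fun i => (b i).2
  choose φ hφ using fun j => LinearMap.exists_extend (b.coord j)
  choose f hf using fun j => exists_linear_function (φ j)
  refine ⟨ξ, f, hξ, fun i j => ?_⟩
  rw [hf, hξb]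
  have := LinearMap.congr_fun (hφ j) (b i)
  rw [LinearMap.comp_apply, Submodule.subtype_apply] at this
  rw [this, Module.Basis.coord_apply, Module.Basis.repr_self, Finsupp.single_apply]

theorem card_add_finrank_le {ι : Type} [Fintype ι] [DecidableEq ι] (p : Submodule K (Mat K N))
    {t : I → GLn K N} {η : ι → Mat K N} {f : ι → MvPolynomial (I × Tau N) K} {s : K}
    (hs : s ≠ 0) (hη : ∀ i, η i ∈ p)
    (hf : ∀ i j, tev t (Dc (η i) (f j)) = if i = j then s else 0) :
    Fintype.card ι + Module.finrank K ↥(p ⊓ cenM t) ≤ Module.finrank K p := by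
  let Ψ : Mat K N →ₗ[K] (ι → K) := LinearMap.pi fun j =>
    { toFun := fun ξ => tev t (Dc ξ (f j))
      map_add' := fun x y => by rw [Dc_add, Derivation.add_apply, map_add]
      map_smul' := fun c x => by rw [Dc_smul, Derivation.smul_apply, map_smul]; rfl }
  have hΨ : ∀ i, Ψ (η i) = s • Pi.single i (1 : K) := by
    intro i
    funext j
    show tev t (Dc (η i) (f j)) = _
    rw [hf, Pi.smul_apply, Pi.single_apply, smul_eq_mul, mul_ite, mul_one, mul_zero]
    simp only [eq_comm]
  have htop : p.map Ψ = ⊤ := by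
    rw [eq_top_iff, ← (Pi.basisFun K ι).span_eq, Submodule.span_le]
    rintro _ ⟨i, rfl⟩
    refine ⟨s⁻¹ • η i, p.smul_mem _ (hη i), ?_⟩
    rw [map_smul, hΨ, smul_smul, inv_mul_cancel₀ hs, one_smul, Pi.basisFun_apply]
  have h1 := finrank_map_add_finrank_inf_ker Ψ p
  rw [htop, finrank_top, Module.finrank_fintype_fun_eq_card] at h1
  rw [← h1]
  refine Nat.add_le_add_left (Submodule.finrank_mono (inf_le_inf_left _ fun ξ hξ => ?_)) _
  rw [LinearMap.mem_ker]
  funext j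
  exact tev_Dc_eq_zero hξ (f j)

theorem tptI_orbT (G : Subgroup (GLn K N)) (g : I → GLn K N) :
    tptI (orbT G g) = (ptI (G : Set (GLn K N))).comap (orb g) := by
  ext P
  rw [mem_tptI, Ideal.mem_comap, mem_ptI]
  constructor
  · intro h x hx
    exact (ev_orb g x P).trans (h _ ⟨x, hx, rfl⟩)
  · rintro h _ ⟨x, hx, rfl⟩
    exact (ev_orb g x P).symm.trans (h x hx)

/-- An orbit in the closure with centralizer of the same dimension is the whole orbit. -/
theorem mem_orbT_of_finrank_eq [Finite I] {G : Subgroup (GLn K N)}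
    (hI : (ptI (G : Set (GLn K N))).IsPrime) (hG : GClosed (G : Set (GLn K N)))
    {g y : I → GLn K N} (hy : y ∈ clT (orbT G g))
    (h : Module.finrank K ↥(lieM (G : Set (GLn K N)) ⊓ cenM y) =
      Module.finrank K ↥(lieM (G : Set (GLn K N)) ⊓ cenM g)) :
    orbT G y = orbT G g := by
  classical
  refine orbT_eq_of_tptI_eq hI hG ?_
  have hle : tptI (orbT G g) ≤ tptI (orbT G y) := by
    rw [← tptI_clT]
    exact tptI_anti (orbT_subset (tStable_clT (tStable_orbT G g)) hy)
  refine (le_antisymm hle ?_).symm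
  by_contra hne
  obtain ⟨f0, h0, h0p⟩ := SetLike.not_le_iff_exists.1 hne
  have hprime : ∀ t : I → GLn K N, (tptI (orbT G t)).IsPrime := fun t => by
    rw [tptI_orbT]; exact hI.comap _
  obtain ⟨ξ, f, hξ, hf⟩ := exists_dual_family (lieM (G : Set (GLn K N))) y
  have hind : AlgebraicIndependent K fun j => Ideal.Quotient.mkₐ K (tptI (orbT G y)) (f j) := by
    refine algebraicIndependent_of_det (hprime y) (fun i => Dc (ξ i)) (fun i P hP => ?_) f ?_
    · exact mem_tptI.2 fun t ht => Dc_vanishes (tStable_orbT G y) (mem_tptI.1 hP) (hξ i) ht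
    · intro hdet
      have h1 := mem_tptI.1 hdet y (mem_orbT_self G y)
      rw [AlgHom.map_det] at h1
      have h2 : (tev y).mapMatrix (Matrix.of fun i j => Dc (ξ i) (f j)) = 1 := by
        ext i j
        exact (hf i j).trans (Matrix.one_apply).symm
      rw [h2, Matrix.det_one] at h1
      exact one_ne_zero h1
  have hopt := algebraicIndependent_option (hprime g) hle h0 h0p hind
  have hGind : AlgebraicIndependent K fun o : Option _ =>
      Ideal.Quotient.mkₐ K (ptI (G : Set (GLn K N))) (orb g (Option.elim o f0 f)) := by
    rw [algebraicIndependent_iff] at hopt ⊢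
    intro Q hQ
    refine hopt Q ?_
    have e1 : aeval (fun o : Option _ => Ideal.Quotient.mkₐ K (ptI (G : Set (GLn K N)))
        (orb g (Option.elim o f0 f))) Q = Ideal.Quotient.mkₐ K (ptI (G : Set (GLn K N)))
        (orb g (aeval (fun o : Option _ => Option.elim o f0 f) Q)) := by
      rw [comp_aeval_apply, comp_aeval_apply]
    have e2 : aeval (fun o : Option _ => Ideal.Quotient.mkₐ K (tptI (orbT G g))
        (Option.elim o f0 f)) Q = Ideal.Quotient.mkₐ K (tptI (orbT G g))
        (aeval (fun o : Option _ => Option.elim o f0 f) Q) := by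
      rw [comp_aeval_apply]
    rw [e1] at hQ
    rw [e2]
    refine Ideal.Quotient.eq_zero_iff_mem.2 ?_
    rw [tptI_orbT, Ideal.mem_comap]
    exact Ideal.Quotient.eq_zero_iff_mem.1 hQ
  obtain ⟨x, hx, η, s, hs, hη, hηf⟩ := exists_lieM_dual hI _ hGind
  have hcard := card_add_finrank_le (lieM (G : Set (GLn K N))) (t := conjT x g)
    (η := fun i => (x : Mat K N) * η i * ((x⁻¹ : GLn K N) : Mat K N))
    (f := fun o : Option _ => Option.elim o f0 f) hs
    (fun i => lieM_conj (fun a ha => G.mul_mem (G.mul_mem hx ha) (G.inv_mem hx)) (hη i))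
    (fun i j => by rw [← ev_Dv_orb]; exact hηf i j)
  rw [finrank_cen_conjT hx, ← h, Fintype.card_option, Fintype.card_fin] at hcard
  have h3 := finrank_map_add_finrank_inf_ker (comM y) (lieM (G : Set (GLn K N)))
  rw [ker_comM] at h3
  omega

/-- The orbit of a semisimple tuple is closed. -/
theorem tClosed_orbT_of_semisimple [Finite I] {G M : Subgroup (GLn K N)}
    (hI : (ptI (G : Set (GLn K N))).IsPrime) (hG : GClosed (G : Set (GLn K N)))
    (hnd : NondegOn (lieE (G : Set (GLn K N)))) (hM : ∀ x ∈ M, ∀ g ∈ G, x * g * x⁻¹ ∈ G)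
    {g : I → GLn K N} (hcl : ∀ t ∈ clT (orbT G g), ∀ i, t i ∈ M)
    (hg : NatSemisimpleOn K N (Subgroup.closure (Set.range g) : Set (GLn K N))) :
    TClosed (orbT G g) := by
  obtain ⟨y, hy, hyc⟩ := exists_closed_orbT hI hG g
  rwa [mem_orbT_of_finrank_eq hI hG hy (finrank_cen_eq hnd hM hcl hg hy)] at hyc

end ClosedOrbits

section Degeneration

variable {K : Type} [Field K] {N : ℕ} {I : Type}

/-- The diagonal one-parameter subgroup with weights `d`. -/
def diagGL (d : Fin N → ℤ) (s : Kˣ) : GLn K N where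
  val := Matrix.diagonal fun i => ((s ^ d i : Kˣ) : K)
  inv := Matrix.diagonal fun i => ((s ^ (-d i) : Kˣ) : K)
  val_inv := by
    rw [Matrix.diagonal_mul_diagonal, ← Matrix.diagonal_one]
    congr 1
    funext i
    rw [← Units.val_mul, ← _root_.zpow_add, add_neg_cancel, _root_.zpow_zero, Units.val_one]
  inv_val := by
    rw [Matrix.diagonal_mul_diagonal, ← Matrix.diagonal_one]
    congr 1
    funext i
    rw [← Units.val_mul, ← _root_.zpow_add, neg_add_cancel, _root_.zpow_zero, Units.val_one]

theorem coe_diagGL (d : Fin N → ℤ) (s : Kˣ) :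
    (diagGL d s : Mat K N) = Matrix.diagonal fun i => ((s ^ d i : Kˣ) : K) := rfl

theorem coe_diagGL_inv (d : Fin N → ℤ) (s : Kˣ) :
    (((diagGL d s)⁻¹ : GLn K N) : Mat K N) = Matrix.diagonal fun i => ((s ^ (-d i) : Kˣ) : K) := rfl

/-- The polynomial curve of conjugates of a triangular matrix. -/
noncomputable def cur (d : Fin N → ℤ) (A : Mat K N) : Matrix (Fin N) (Fin N) (Polynomial K) :=
  Matrix.of fun i j => Polynomial.C (A i j) * Polynomial.X ^ (d i - d j).toNat

/-- The block diagonal part. -/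
def gr (d : Fin N → ℤ) (A : Mat K N) : Mat K N := Matrix.of fun i j => if d i =
    d j then A i j else 0

/-- Block triangular matrices. -/
def IsTri (d : Fin N → ℤ) (A : Mat K N) : Prop := ∀ i j, d i < d j → A i j = 0

theorem eval_cur {d : Fin N → ℤ} {A : Mat K N} (hA : IsTri d A) (s : Kˣ) :
    (Polynomial.aeval (s : K)).mapMatrix (cur d A) =
      (diagGL d s : Mat K N) * A * (((diagGL d s)⁻¹ : GLn K N) : Mat K N) := by
  ext i j
  rw [coe_diagGL, coe_diagGL_inv, Matrix.mul_diagonal, Matrix.diagonal_mul]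
  rw [AlgHom.mapMatrix_apply, Matrix.map_apply, cur, Matrix.of_apply, map_mul, map_pow,
    Polynomial.aeval_C, Polynomial.aeval_X]
  by_cases h : d i < d j
  · rw [hA i j h]; simp
  · have h1 : ((d i - d j).toNat : ℤ) = d i - d j := Int.toNat_of_nonneg (by omega)
    have h2 : (s : K) ^ (d i - d j).toNat = ((s ^ d i : Kˣ) : K) * ((s ^ (-d j) : Kˣ) : K) := by
      rw [← Units.val_mul, ← _root_.zpow_add, ← sub_eq_add_neg, ← h1, _root_.zpow_natCast,
          Units.val_pow_eq_pow_val]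
      rfl
    rw [h2]
    simp only [Algebra.algebraMap_self, RingHom.id_apply]
    ring

theorem eval_cur_zero {d : Fin N → ℤ} {A : Mat K N} (hA : IsTri d A) :
    (Polynomial.aeval (0 : K)).mapMatrix (cur d A) = gr d A := by
  ext i j
  rw [AlgHom.mapMatrix_apply, Matrix.map_apply, cur, gr, Matrix.of_apply, Matrix.of_apply, map_mul,
    map_pow, Polynomial.aeval_C, Polynomial.aeval_X]
  split_ifs with h
  · rw [h, sub_self, Int.toNat_zero, pow_zero, mul_one]; rfl
  · by_cases h1 : d i < d j
    · rw [hA i j h1, map_zero, zero_mul]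
    · rw [zero_pow (by omega), mul_zero]

theorem gr_mul {d : Fin N → ℤ} {A B : Mat K N} (hA : IsTri d A) (hB : IsTri d B) :
    gr d A * gr d B = gr d (A * B) := by
  ext i j
  simp only [gr, Matrix.mul_apply, Matrix.of_apply]
  split_ifs with h
  · refine Finset.sum_congr rfl fun k _ => ?_
    rcases lt_trichotomy (d i) (d k) with h1 | h1 | h1
    · rw [hA i k h1]; simp
    · rw [if_pos h1, if_pos (h1.symm.trans h)]
    · rw [hB k j (by omega)]; simp
  · refine Finset.sum_eq_zero fun k _ => ?_
    by_cases h1 : d i = d k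
    · rw [if_neg (show ¬ d k = d j by omega), mul_zero]
    · rw [if_neg h1, zero_mul]

theorem gr_one (d : Fin N → ℤ) : gr d (1 : Mat K N) = 1 := by
  ext i j
  simp only [gr, Matrix.of_apply, Matrix.one_apply]
  by_cases h : i = j
  · simp [h]
  · simp [h]

theorem polynomial_eq_of_units [CharZero K] {p q : Polynomial K}
    (h : ∀ s : Kˣ, Polynomial.aeval (s : K) p = Polynomial.aeval (s : K) q) : p = q := by
  have : p * Polynomial.X = q * Polynomial.X := by
    refine Polynomial.funext fun s => ?_
    by_cases hs : s = 0
    · simp [hs]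
    · have := h (Units.mk0 s hs)
      simp only [Polynomial.coe_aeval_eq_eval, Units.val_mk0] at this
      rw [Polynomial.eval_mul, Polynomial.eval_mul, this]
  exact mul_right_cancel₀ Polynomial.X_ne_zero this

/-- Limits of triangular tuples along a one-parameter subgroup. -/
theorem exists_limit [CharZero K] (Q : GLn K N) (d : Fin N → ℤ) {g : I → GLn K N}
    (hg : ∀ i, IsTri d ((Q⁻¹ * g i * Q : GLn K N) : Mat K N))
    (hg' : ∀ i, IsTri d ((Q⁻¹ * (g i)⁻¹ * Q : GLn K N) : Mat K N)) :
    ∃ x : I → GLn K N,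
      (∀ P, (∀ s : Kˣ, tev (conjT (Q * diagGL d s * Q⁻¹) g) P = 0) → tev x P = 0) ∧
      ∀ (U : Matrix (Fin N) (Fin N) (MvPolynomial (I × Tau N) K)) (a : Mat K N),
        (∀ s : Kˣ, (tev (conjT (Q * diagGL d s * Q⁻¹) g)).mapMatrix U =
          ((Q * diagGL d s * Q⁻¹ : GLn K N) : Mat K N) * a *
            (((Q * diagGL d s * Q⁻¹)⁻¹ : GLn K N) : Mat K N)) →
        (∀ i j, d i ≤ d j →
          (((Q⁻¹ : GLn K N) : Mat K N) * a * (Q : Mat K N)) i j = 0) →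
        (tev x).mapMatrix U = 0 := by
  set q : Mat K N := (Q : Mat K N) with hq
  set q' : Mat K N := ((Q⁻¹ : GLn K N) : Mat K N) with hq'
  have hqq' : q * q' = 1 := Units.mul_inv Q
  have hq'q : q' * q = 1 := Units.inv_mul Q
  let Cu : Mat K N → Matrix (Fin N) (Fin N) (Polynomial K) := fun a =>
    cM (Polynomial K) q * cur d (q' * a * q) * cM (Polynomial K) q'
  have hCu : ∀ a, IsTri d (q' * a * q) → ∀ s : Kˣ, (Polynomial.aeval (s : K)).mapMatrix (Cu a) =
      ((Q * diagGL d s * Q⁻¹ : GLn K N) : Mat K N) * a *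
        (((Q * diagGL d s * Q⁻¹)⁻¹ : GLn K N) : Mat K N) := by
    intro a ha s
    simp only [Cu, map_mul, mapMatrix_cM, cM_self, eval_cur ha]
    rw [_root_.mul_inv_rev, _root_.mul_inv_rev, inv_inv]
    simp only [Units.val_mul, mul_assoc, ← hq, ← hq']
  have hCu0 : ∀ a, IsTri d (q' * a * q) → (Polynomial.aeval (0 : K)).mapMatrix (Cu a) =
      q * gr d (q' * a * q) * q' := by
    intro a ha
    simp only [Cu, map_mul, mapMatrix_cM, cM_self, eval_cur_zero ha]
  have hmul : ∀ a b, IsTri d (q' * a * q) → IsTri d (q' * b * q) → a * b = 1 →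
      (q * gr d (q' * a * q) * q') * (q * gr d (q' * b * q) * q') = 1 := by
    intro a b ha hb hab
    have h1 : q' * a * q * (q' * b * q) = 1 := by
      calc q' * a * q * (q' * b * q) = q' * (a * (q * q') * b) * q := by simp only [mul_assoc]
        _ = 1 := by rw [hqq', mul_one, hab, mul_one, hq'q]
    calc (q * gr d (q' * a * q) * q') * (q * gr d (q' * b * q) * q')
        = q * (gr d (q' * a * q) * (q' * q) * gr d (q' * b * q)) * q' := by simp only [mul_assoc]
      _ = 1 := by rw [hq'q, mul_one, gr_mul ha hb, h1, gr_one, mul_one, hqq']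
  have hgi : ∀ i, IsTri d (q' * (g i : Mat K N) * q) := hg
  have hgi' : ∀ i, IsTri d (q' * (((g i)⁻¹ : GLn K N) : Mat K N) * q) := hg'
  let x : I → GLn K N := fun i =>
    ⟨q * gr d (q' * (g i : Mat K N) * q) * q',
      q * gr d (q' * (((g i)⁻¹ : GLn K N) : Mat K N) * q) * q',
      hmul _ _ (hgi i) (hgi' i) (Units.mul_inv (g i)),
      hmul _ _ (hgi' i) (hgi i) (Units.inv_mul (g i))⟩
  let φ : MvPolynomial (I × Tau N) K →ₐ[K] Polynomial K := aeval fun p =>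
    prM (Cu (g p.1 : Mat K N)) (Cu (((g p.1)⁻¹ : GLn K N) : Mat K N)) p.2
  have hφs : ∀ s : Kˣ, (Polynomial.aeval (s : K)).comp φ =
      tev (conjT (Q * diagGL d s * Q⁻¹) g) := by
    intro s
    refine MvPolynomial.algHom_ext fun p => ?_
    rw [AlgHom.comp_apply, aeval_X, map_prM, tev_X, hCu _ (hgi _), hCu _ (hgi' _)]
    refine congrFun (prM_congr rfl ?_) _
    show _ = (((Q * diagGL d s * Q⁻¹ * g p.1 * (Q * diagGL d s * Q⁻¹)⁻¹)⁻¹ : GLn K N) : Mat K N)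
    rw [_root_.mul_inv_rev (Q * diagGL d s * Q⁻¹ * g p.1), inv_inv,
      _root_.mul_inv_rev (Q * diagGL d s * Q⁻¹) (g p.1), ← mul_assoc]
    rfl
  have hφ0 : (Polynomial.aeval (0 : K)).comp φ = tev x := by
    refine MvPolynomial.algHom_ext fun p => ?_
    rw [AlgHom.comp_apply, aeval_X, map_prM, tev_X, hCu0 _ (hgi _), hCu0 _ (hgi' _)]
    rfl
  refine ⟨x, fun P hP => ?_, fun U a hU ha => ?_⟩
  · have h0 : φ P = 0 := polynomial_eq_of_units fun s => by
      rw [← AlgHom.comp_apply, hφs, hP, map_zero]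
    rw [← hφ0, AlgHom.comp_apply, h0, map_zero]
  · have hat : IsTri d (q' * a * q) := fun i j h => ha i j h.le
    have h0 : φ.mapMatrix U = Cu a := by
      ext i j : 1
      refine polynomial_eq_of_units fun s => ?_
      have h1 := congrFun₂ ((hU s).trans (hCu a hat s).symm) i j
      rw [← hφs] at h1
      exact h1
    have h2 : (tev x).mapMatrix U = (Polynomial.aeval (0 : K)).mapMatrix (φ.mapMatrix U) := by
      rw [← hφ0]; rfl
    have h3 : gr d (q' * a * q) = 0 := by
      ext i j
      rw [gr, Matrix.of_apply, Matrix.zero_apply]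
      split_ifs with h
      · exact ha i j h.le
      · rfl
    rw [h2, h0, hCu0 a hat, h3, mul_zero, zero_mul]

end Degeneration

section Average

variable {K : Type} [Field K] [CharZero K] {N : ℕ}

/-- Averaging over a subgroup of finite index. -/
theorem exists_average {Γ Γ₀ : Subgroup (GLn K N)} (hfin : (Γ₀.subgroupOf Γ).FiniteIndex)
    {X : Mat K N} (hX : ∀ x ∈ Γ₀, (x : Mat K N) * X = X * (x : Mat K N)) :
    ∃ Y : Mat K N, (∀ x ∈ Γ, (x : Mat K N) * Y = Y * (x : Mat K N)) ∧
      ∀ (E : Type) [AddCommGroup E] [Module K E] (φ : Mat K N →ₗ[K] E) (c : E),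
        (∀ x ∈ Γ, φ ((x : Mat K N) * X * ((x⁻¹ : GLn K N) : Mat K N)) = c) → φ Y = c := by
  classical
  set Δ := Γ₀.subgroupOf Γ
  have hft : Fintype (Γ ⧸ Δ) := Subgroup.fintypeQuotientOfFiniteIndex
  set F : Γ → Mat K N := fun x =>
    ((x : GLn K N) : Mat K N) * X * (((x : GLn K N)⁻¹ : GLn K N) : Mat K N) with hF
  have hmul : ∀ (a b : Γ), F (a * b) = ((a : GLn K N) : Mat K N) * F b *
      (((a : GLn K N)⁻¹ : GLn K N) : Mat K N) := fun a b => by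
    simp only [hF, Subgroup.coe_mul, _root_.mul_inv_rev, Units.val_mul, mul_assoc]
  have hF0 : ∀ b ∈ Δ, F b = X := fun b hb => by
    have h1 := hX b (Subgroup.mem_subgroupOf.mp hb)
    simp only [hF]
    rw [h1, mul_assoc, ← Units.val_mul, mul_inv_cancel, Units.val_one, mul_one]
  have hFmk : ∀ a b : Γ, (a : Γ ⧸ Δ) = b → F a = F b := fun a b hab => by
    have h1 := hF0 _ (QuotientGroup.eq.mp hab)
    have h2 : b = a * (a⁻¹ * b) := by group
    rw [h2, hmul, h1]
  set Z : Mat K N := ∑ q : Γ ⧸ Δ, F q.out with hZ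
  have hcard : ((Fintype.card (Γ ⧸ Δ) : ℕ) : K) ≠ 0 := Nat.cast_ne_zero.mpr Fintype.card_ne_zero
  have hcomm : ∀ x ∈ Γ, (x : Mat K N) * Z * ((x⁻¹ : GLn K N) : Mat K N) = Z := fun x hx => by
    rw [hZ, Finset.mul_sum, Finset.sum_mul]
    refine Fintype.sum_equiv (MulAction.toPerm (⟨x, hx⟩ : Γ)) _ _ fun q => ?_
    rw [← hmul ⟨x, hx⟩ q.out]
    refine hFmk _ _ ?_
    rw [QuotientGroup.out_eq', MulAction.toPerm_apply]
    conv_rhs => rw [← QuotientGroup.out_eq' q]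
    rfl
  refine ⟨((Fintype.card (Γ ⧸ Δ) : ℕ) : K)⁻¹ • Z, fun x hx => ?_, fun E _ _ φ c hc => ?_⟩
  · rw [mul_smul_comm, smul_mul_assoc]
    congr 1
    nth_rewrite 2 [← hcomm x hx]
    rw [mul_assoc, ← Units.val_mul, inv_mul_cancel, Units.val_one, mul_one]
  · rw [map_smul, hZ, map_sum, Finset.sum_congr rfl fun q _ => hc _ q.out.2, Finset.sum_const,
      Finset.card_univ, ← Nat.cast_smul_eq_nsmul K, smul_smul, inv_mul_cancel₀ hcard, one_smul]

end Average

section Semisimple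

variable {K : Type} [Field K] [CharZero K] [IsAlgClosed K] {N : ℕ}

/-- A stable subspace is the image of a commuting projection. -/
theorem exists_commuting_projection {h : Submodule K (Module.End K (Fin N → K))}
    (hbr : BracketClosed h) (hrep : ReplicaClosed h) (hnd : NondegOn h)
    {W : Submodule K (Fin N → K)}
    (hW : ∀ T ∈ h, ∀ v ∈ W, T v ∈ W) :
    ∃ P : Module.End K (Fin N → K), (∀ v, P v ∈ W) ∧ (∀ w ∈ W, P w = w) ∧
      ∀ T ∈ h, T * P = P * T := by
  by_cases hbot : W = ⊥
  · subst hbot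
    exact ⟨0, fun v => by simp, fun w hw => by simpa using ((Submodule.mem_bot K).mp hw).symm,
      fun T _ => by simp⟩
  let p : Submodule K (Module.End K (Fin N → K)) :=
    { carrier := {T | (∀ v, T v ∈ W) ∧ ∃ c : K, ∀ w ∈ W, T w = c • w}
      add_mem' := by
        rintro S T ⟨hS, c, hc⟩ ⟨hT, d, hd⟩
        exact ⟨fun v => add_mem (hS v) (hT v), c + d, fun w hw => by
          rw [LinearMap.add_apply, hc w hw, hd w hw, add_smul]⟩
      zero_mem' := ⟨fun v => zero_mem _, 0, fun w _ => by simp⟩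
      smul_mem' := by
        rintro a T ⟨hT, d, hd⟩
        exact ⟨fun v => W.smul_mem a (hT v), a * d, fun w hw => by
          rw [LinearMap.smul_apply, hd w hw, smul_smul]⟩ }
  let p0 : Submodule K (Module.End K (Fin N → K)) :=
    { carrier := {T | (∀ v, T v ∈ W) ∧ ∀ w ∈ W, T w = 0}
      add_mem' := by
        rintro S T ⟨hS, hc⟩ ⟨hT, hd⟩
        exact ⟨fun v => add_mem (hS v) (hT v), fun w hw => by
          rw [LinearMap.add_apply, hc w hw, hd w hw, add_zero]⟩
      zero_mem' := ⟨fun v => zero_mem _, fun w _ => by simp⟩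
      smul_mem' := by
        rintro a T ⟨hT, hd⟩
        exact ⟨fun v => W.smul_mem a (hT v), fun w hw => by
          rw [LinearMap.smul_apply, hd w hw, smul_zero]⟩ }
  have h0 : p0 ≤ p := fun T hT => ⟨hT.1, 0, fun w hw => by rw [hT.2 w hw, zero_smul]⟩
  have hne : ¬ p ≤ p0 := fun hle => by
    obtain ⟨W', hc⟩ := Submodule.exists_isCompl W
    obtain ⟨w, hw, hw0⟩ := Submodule.exists_mem_ne_zero_of_ne_bot hbot
    have h1 : W.subtype ∘ₗ W.projectionOnto W' hc ∈ p :=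
      ⟨fun v => (W.projectionOnto W' hc v).2, 1, fun w hw => by
        simpa using congrArg Subtype.val (Submodule.projectionOnto_apply_left hc ⟨w, hw⟩)⟩
    have h2 := (hle h1).2 w hw
    have h3 := congrArg Subtype.val (Submodule.projectionOnto_apply_left hc ⟨w, hw⟩)
    exact hw0 (h3.symm.trans h2)
  have hp : ∀ ξ ∈ h, ∀ x ∈ p, Richardson.adL ξ x ∈ p0 := fun ξ hξ T hT => by
    obtain ⟨hT1, c, hc⟩ := hT
    rw [adL_apply]
    refine ⟨fun v => sub_mem (hW ξ hξ _ (hT1 v)) (hT1 _), fun w hw => ?_⟩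
    rw [LinearMap.sub_apply, Module.End.mul_apply, Module.End.mul_apply, hc w hw,
      hc _ (hW ξ hξ w hw), map_smul, sub_self]
  obtain ⟨T, ⟨hT1, c, hc⟩, hT0, hTc⟩ := (isRep_adL h).exists_invariant_mem hbr hrep hnd h0 hne hp
  have hc0 : c ≠ 0 := fun h => hT0 ⟨hT1, fun w hw => by rw [hc w hw, h, zero_smul]⟩
  refine ⟨c⁻¹ • T, fun v => W.smul_mem _ (hT1 v), fun w hw => ?_, fun S hS => ?_⟩
  · rw [LinearMap.smul_apply, hc w hw, smul_smul, inv_mul_cancel₀ hc0, one_smul]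
  · have := hTc S hS
    rw [adL_apply, sub_eq_zero] at this
    rw [mul_smul_comm, smul_mul_assoc, this]

/-- Complete reducibility from nondegeneracy of the trace form. -/
theorem natSemisimpleOn_of_nondegOn {Γ : Subgroup (GLn K N)}
    (hnd : NondegOn (lieE (idc Γ : Set (GLn K N)))) :
    NatSemisimpleOn K N (Γ : Set (GLn K N)) := by
  intro W hW
  obtain ⟨P, hP1, hP2, hP3⟩ := exists_commuting_projection (bracketClosed_lieE (idc Γ))
    (replicaClosed_lieE (idc Γ)) hnd (W := W)
    fun T hT => lieE_stable (fun g hg v hv => hW g (idc_le Γ hg) v hv) hT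
  have hX : ∀ x ∈ idc Γ, (x : Mat K N) * mt K N P = mt K N P * (x : Mat K N) := fun x hx => by
    refine mul_comm_of_lieM (ptI_idc_isPrime Γ) (fun ξ hξ => ?_) hx
    have h1 : (mt K N).symm ξ ∈ lieE (idc Γ : Set (GLn K N)) := by
      rw [mem_lieE, AlgEquiv.apply_symm_apply]; exact hξ
    have h2 := congrArg (mt K N) (hP3 _ h1)
    rwa [map_mul, map_mul, AlgEquiv.apply_symm_apply] at h2
  obtain ⟨Y, hY, hφ⟩ := exists_average (idc_finite Γ) hX
  have hinv : ∀ x ∈ Γ, ∀ v ∈ W, ((x⁻¹ : GLn K N) : Mat K N) *ᵥ v ∈ W := fun x hx v hv =>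
    hW x⁻¹ (Γ.inv_mem hx) v hv
  let ap : (Fin N → K) → Mat K N →ₗ[K] (Fin N → K) := fun v =>
    { toFun := fun A => A *ᵥ v
      map_add' := fun A B => Matrix.add_mulVec A B v
      map_smul' := fun c A => Matrix.smul_mulVec c A v }
  have hY1 : ∀ v, Y *ᵥ v ∈ W := fun v => by
    have := hφ _ (W.mkQ ∘ₗ ap v) 0 fun x hx => by
      rw [LinearMap.comp_apply, Submodule.mkQ_apply, Submodule.Quotient.mk_eq_zero]
      change (_ * _ * _ : Mat K N) *ᵥ v ∈ W
      rw [← Matrix.mulVec_mulVec, ← Matrix.mulVec_mulVec, mt_mulVec]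
      exact hW x hx _ (hP1 _)
    rwa [LinearMap.comp_apply, Submodule.mkQ_apply, Submodule.Quotient.mk_eq_zero] at this
  have hY2 : ∀ w ∈ W, Y *ᵥ w = w := fun w hw => hφ _ (ap w) w fun x hx => by
    change (_ * _ * _ : Mat K N) *ᵥ w = w
    rw [← Matrix.mulVec_mulVec, ← Matrix.mulVec_mulVec, mt_mulVec, hP2 _ (hinv x hx w hw),
      Matrix.mulVec_mulVec, ← Units.val_mul, mul_inv_cancel, Units.val_one, Matrix.one_mulVec]
  refine ⟨LinearMap.ker (Matrix.toLin' Y), fun u hu v hv => ?_, ?_⟩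
  · rw [LinearMap.mem_ker, Matrix.toLin'_apply] at hv ⊢
    rw [Matrix.mulVec_mulVec, ← hY u hu, ← Matrix.mulVec_mulVec, hv, Matrix.mulVec_zero]
  · exact LinearMap.IsProj.isCompl (f := Matrix.toLin' Y)
      ⟨fun v => by rw [Matrix.toLin'_apply]; exact hY1 v,
        fun w hw => by rw [Matrix.toLin'_apply]; exact hY2 w hw⟩

end Semisimple

section ClosedOrbit

variable {K : Type} [Field K] {N : ℕ}

theorem exists_baseChange (b : Module.Basis (Fin N) K (Fin N → K)) :
    ∃ Q : GLn K N,
      (∀ (A : Mat K N) i j, (((Q⁻¹ : GLn K N) : Mat K N) * A * (Q : Mat K N)) i j =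
        b.repr (A *ᵥ b j) i) ∧
      ∀ (d : Fin N → ℤ) (s : Kˣ) j, ((Q * diagGL d s * Q⁻¹ : GLn K N) : Mat K N) *ᵥ b j =
        ((s ^ d j : Kˣ) : K) • b j := by
  let E : (Fin N → K) ≃ₗ[K] (Fin N → K) := b.equivFun.symm
  have h1 : (E : Module.End K (Fin N → K)) * (E.symm : Module.End K (Fin N → K)) = 1 :=
    LinearMap.ext fun v => E.apply_symm_apply v
  have h2 : (E.symm : Module.End K (Fin N → K)) * (E : Module.End K (Fin N → K)) = 1 :=
    LinearMap.ext fun v => E.symm_apply_apply v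
  let Q : GLn K N := ⟨mt K N E, mt K N E.symm, by rw [← map_mul, h1, map_one],
    by rw [← map_mul, h2, map_one]⟩
  have hQ : ∀ v, (Q : Mat K N) *ᵥ v = E v := fun v => mt_mulVec _ v
  have hQ' : ∀ v, ((Q⁻¹ : GLn K N) : Mat K N) *ᵥ v = b.equivFun v := fun v => mt_mulVec _ v
  have hE : ∀ j, E (Pi.single j 1) = b j := fun j => by
    simp [E, Module.Basis.equivFun_symm_apply, Pi.single_apply]
  refine ⟨Q, fun A i j => ?_, fun d s j => ?_⟩
  · have h := congrFun (Matrix.mulVec_single_one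
      (((Q⁻¹ : GLn K N) : Mat K N) * A * (Q : Mat K N)) j) i
    rw [Matrix.col_apply, ← Matrix.mulVec_mulVec, ← Matrix.mulVec_mulVec, hQ, hE, hQ'] at h
    exact h.symm
  · rw [Units.val_mul, Units.val_mul, ← Matrix.mulVec_mulVec, ← Matrix.mulVec_mulVec, hQ', hQ,
      coe_diagGL, ← hE j]
    have h3 : b.equivFun (E (Pi.single j 1)) = Pi.single j 1 := E.symm_apply_apply _
    rw [h3, ← map_smul]
    congr 1
    funext i
    rw [Matrix.mulVec_diagonal, Pi.smul_apply, smul_eq_mul, Pi.single_apply]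
    split_ifs with h
    · rw [h]
    · simp

variable [CharZero K] [IsAlgClosed K] {I : Type}

theorem mt_mem_wordAlg_of_mem_lieE {g : I → GLn K N} {ν : Module.End K (Fin N → K)}
    (hν : ν ∈ lieE (idc (Subgroup.closure (Set.range g)) : Set (GLn K N))) :
    mt K N ν ∈ wordAlg g :=
  lieM_le (S := Subalgebra.toSubmodule (wordAlg g))
    (fun _ hx => closure_subset_wordAlg (idc_le _ hx)) (mem_lieE.mp hν)

/-- The subgroup generated by a tuple with closed orbit is reductive. -/
theorem nondegOn_of_tClosed {H : Subgroup (GLn K N)} (hG : GClosed (idc H : Set (GLn K N)))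
    (hnd : NondegOn (lieE (idc H : Set (GLn K N)))) {g : I → GLn K N} (hg : ∀ i, g i ∈ H)
    (hc : TClosed (orbT (idc H) g)) :
    NondegOn (lieE (idc (Subgroup.closure (Set.range g)) : Set (GLn K N))) := by
  set Γ := Subgroup.closure (Set.range g) with hΓ
  have hΓH : Γ ≤ H := (Subgroup.closure_le H).mpr (Set.range_subset_iff.mpr hg)
  have hgΓ : ∀ i, g i ∈ Γ := fun i => Subgroup.subset_closure ⟨i, rfl⟩
  set m := lieE (idc Γ : Set (GLn K N)) with hm
  have hmh : m ≤ lieE (idc H : Set (GLn K N)) :=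
    Submodule.comap_mono (lieM_mono (idc_mono hΓH))
  intro ν hν hν0
  have hνm : ν ∈ orthIn m m := ⟨hν, hν0⟩
  have hst : ConjStable (Γ.map (toU K N)) m :=
    conjStable_lieE fun x hx y hy => conj_mem_idc hx hy
  obtain ⟨L, hL, b, d, hLb, htri, hstrict⟩ := exists_grading (ι := Fin N)
    (bracketClosed_lieE (idc H)) (replicaClosed_lieE (idc H)) hnd
    (conjStable_lieE (M := Γ) fun x hx y hy => conj_mem_idc (hΓH hx) hy)
    (n0 := orthIn m m) (fun x hx => hmh hx.1) (bracketClosed_lieE (idc Γ)).orthIn_self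
    (fun x hx => ReplicaClosed.isNilpotent_of_mem_orthIn_self (replicaClosed_lieE (idc Γ)) hx)
    (hst.orthIn hst) (by simp)
  obtain ⟨Q, hQ, hQd⟩ := exists_baseChange b
  have hl : ∀ s, Q * diagGL d s * Q⁻¹ ∈ idc H := fun s =>
    mem_of_integral_mem_lieE hG b d hL hLb s _ (hQd d s)
  have htriΓ : ∀ x ∈ Γ, IsTri d ((Q⁻¹ * x * Q : GLn K N) : Mat K N) := fun x hx i j hij => by
    rw [Units.val_mul, Units.val_mul, hQ, ← toU_apply]
    exact htri _ (Subgroup.mem_map_of_mem _ hx) i j hij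
  obtain ⟨x, hx, hxU⟩ := exists_limit Q d (fun i => htriΓ _ (hgΓ i))
    (fun i => htriΓ _ (Γ.inv_mem (hgΓ i)))
  have hxorb : x ∈ orbT (idc H) g := hc x fun P hP =>
    hx P fun s => mem_tptI.mp hP _ ⟨_, hl s, rfl⟩
  obtain ⟨y, hy, rfl⟩ := hxorb
  obtain ⟨U, hU, hUc, -⟩ := exists_equivariant_lift (mt_mem_wordAlg_of_mem_lieE hν)
  have h0 := hxU U (mt K N ν) (fun s => by rw [hUc, hU]) fun i j hij => by
    rw [hQ, mt_mulVec]
    exact hstrict ν hνm i j hij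
  rw [hUc, hU] at h0
  have h1 : mt K N ν = 0 := by
    have h2 : ((y⁻¹ : GLn K N) : Mat K N) * ((y : Mat K N) * mt K N ν *
        ((y⁻¹ : GLn K N) : Mat K N)) * (y : Mat K N) = mt K N ν := by
      rw [mul_assoc (y : Mat K N), ← mul_assoc, ← Units.val_mul, inv_mul_cancel, Units.val_one,
        one_mul, mul_assoc, ← Units.val_mul, inv_mul_cancel, Units.val_one, mul_one]
    rw [← h2, h0, mul_zero, zero_mul]
  exact (map_eq_zero_iff _ (mt K N).injective).mp h1

end ClosedOrbit

section Quotient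

variable {K : Type} [Field K] [CharZero K] [IsAlgClosed K] {N n : ℕ} {H : Subgroup (GLn K N)}

theorem exists_tv_eq {t : Fin n → GLn K N} (ht : t ∈ tset n H) : ∃ g : Fin n → H, tv g = t :=
  ⟨fun i => ⟨t i, ht i⟩, rfl⟩

theorem orbT_tv_subset (g : Fin n → H) : orbT (idc H) (tv g) ⊆ tset n H :=
  orbT_subset (tStable_tset (idc_le H)) (tv_mem g)

theorem mem_conjOrbit {g g' : Fin n → H} :
    g' ∈ conjOrbit K N H n g ↔ tv g' ∈ orbT (idc H) (tv g) := by
  constructor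
  · rintro ⟨x, hx, h⟩
    exact ⟨x, ⟨x.2, hx⟩, funext fun i => congrArg Subtype.val (h i)⟩
  · rintro ⟨x, ⟨hx, hx'⟩, h⟩
    exact ⟨⟨x, hx⟩, hx', fun i => Subtype.ext (congrFun h i)⟩

theorem isClosed_conjOrbit_iff (hH : GClosed (H : Set (GLn K N))) (g : Fin n → H) :
    @IsClosed _ (tupleZarTop K N H n) (conjOrbit K N H n g) ↔
      TClosed (orbT (idc H) (tv g)) := by
  rw [isClosed_tupleZarTop_iff]
  constructor
  · intro h t ht
    obtain ⟨g', rfl⟩ := exists_tv_eq (clT_subset (orbT_tv_subset g) (tClosed_tset hH) ht)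
    refine mem_conjOrbit.mp (h g' fun P hP => ht P (mem_tptI.mpr fun t' ht' => ?_))
    obtain ⟨g'', rfl⟩ := exists_tv_eq (orbT_tv_subset g ht')
    exact hP g'' (mem_conjOrbit.mpr ht')
  · intro h g' hg'
    refine mem_conjOrbit.mpr (h _ fun P hP => hg' P fun g'' hg'' => ?_)
    exact mem_tptI.mp hP _ (mem_conjOrbit.mp hg'')

theorem conjOrbit_eq_of_mem {g g' : Fin n → H} (h : g' ∈ conjOrbit K N H n g) :
    conjOrbit K N H n g' = conjOrbit K N H n g := by
  ext g''
  rw [mem_conjOrbit, mem_conjOrbit, orbT_eq_of_mem (mem_conjOrbit.mp h)]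

/-- The closed orbits are those of the tuples generating a reductive subgroup. -/
theorem isClosed_conjOrbit_iff_natSemisimpleOn (hHcl : IsZarClosed K N H)
    (hHred : NatSemisimpleOn K N (H : Set (GLn K N))) (g : Fin n → H) :
    @IsClosed _ (tupleZarTop K N H n) (conjOrbit K N H n g) ↔
      NatSemisimpleOn K N (Subgroup.closure (Set.range (tv g)) : Set (GLn K N)) := by
  have hH := gClosed_of_isZarClosed hHcl
  rw [isClosed_conjOrbit_iff hH]
  constructor
  · exact fun h => natSemisimpleOn_of_nondegOn
      (nondegOn_of_tClosed (gClosed_idc hH) (nondegOn_lieE hHred) (fun i => (g i).2) h)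
  · exact fun h => tClosed_orbT_of_semisimple (M := H) (ptI_idc_isPrime H) (gClosed_idc hH)
      (nondegOn_lieE hHred) (fun x hx y hy => conj_mem_idc hx hy)
      (fun t ht => clT_subset (orbT_tv_subset g) (tClosed_tset hH) ht) h

/-- Evaluation of invariants at a point. -/
def invEval (g : Fin n → H) : regInvAlg K N H n →ₐ[K] K :=
  (Pi.evalAlgHom K (fun _ => K) g).comp (regInvAlg K N H n).val

theorem invEval_apply (g : Fin n → H) (f : regInvAlg K N H n) :
    invEval g f = (f : (Fin n → H) → K) g := rfl

theorem invEval_eq_of_mem_clT {g g' : Fin n → H} (h : tv g' ∈ clT (orbT (idc H) (tv g))) :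
    invEval g' = invEval g := by
  ext f
  obtain ⟨⟨P, hP⟩, hinv⟩ := mem_regInvAlg.mp f.2
  rw [invEval_apply, invEval_apply, hP, hP]
  have h1 : P - MvPolynomial.C (tev (tv g) P) ∈ tptI (orbT (idc H) (tv g)) :=
    mem_tptI.mpr fun t ht => by
      obtain ⟨g'', rfl⟩ := exists_tv_eq (orbT_tv_subset g ht)
      obtain ⟨x, hx, hxt⟩ := ht
      have h2 := hinv x hx g g'' hxt
      rw [hP, hP] at h2
      rw [map_sub, h2, MvPolynomial.algHom_C, Algebra.algebraMap_self_apply, sub_self]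
  have h3 := h _ h1
  rwa [map_sub, MvPolynomial.algHom_C, Algebra.algebraMap_self_apply, sub_eq_zero] at h3

theorem conjOrbit_eq_of_invEval_eq
    (hHred : NatSemisimpleOn K N (H : Set (GLn K N))) {g g' : Fin n → H}
    (hc : TClosed (orbT (idc H) (tv g))) (hc' : TClosed (orbT (idc H) (tv g')))
    (h : invEval g = invEval g') : conjOrbit K N H n g = conjOrbit K N H n g' := by
  by_contra hne
  have hd : Disjoint (orbT (idc H) (tv g)) (orbT (idc H) (tv g')) :=
    Set.disjoint_left.mpr fun t ht ht' => by
      obtain ⟨g'', rfl⟩ := exists_tv_eq (orbT_tv_subset g ht)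
      exact hne ((conjOrbit_eq_of_mem (mem_conjOrbit.mpr ht)).symm.trans
        (conjOrbit_eq_of_mem (mem_conjOrbit.mpr ht')))
  obtain ⟨P, hD, h0, h1⟩ := exists_separating_invariant (nondegOn_lieE hHred) hc hc'
    (tStable_orbT _ _) (tStable_orbT _ _) hd
  have hf : (fun g : Fin n → H => tev (tv g) P) ∈ regInvAlg K N H n :=
    mem_regInvAlg.mpr ⟨⟨P, fun _ => rfl⟩, fun x hx a b hab => by
      rw [hab, tev_conjT_eq_of_Dc (ptI_idc_isPrime H) hD hx]⟩
  have h2 := DFunLike.congr_fun h ⟨_, hf⟩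
  rw [invEval_apply, invEval_apply] at h2
  change tev (tv g) P = tev (tv g') P at h2
  rw [h0 _ (mem_orbT_self _ _), h1 _ (mem_orbT_self _ _)] at h2
  exact zero_ne_one h2

/-- The points of the quotient are represented by closed orbits. -/
theorem exists_closed_invEval_eq (hHcl : IsZarClosed K N H)
    (hHred : NatSemisimpleOn K N (H : Set (GLn K N))) (χ : regInvAlg K N H n →ₐ[K] K) :
    ∃ g : Fin n → H, TClosed (orbT (idc H) (tv g)) ∧ invEval g = χ := by
  have hH := gClosed_of_isZarClosed hHcl
  obtain ⟨a, ha⟩ := exists_point_of_character hH (nondegOn_lieE hHred) χ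
  obtain ⟨t, ht, htc⟩ := exists_closed_orbT (ptI_idc_isPrime H) (gClosed_idc hH) (tv a)
  obtain ⟨g, rfl⟩ := exists_tv_eq (clT_subset (orbT_tv_subset a) (tClosed_tset hH) ht)
  refine ⟨g, htc, (invEval_eq_of_mem_clT ht).trans (AlgHom.ext fun f => ?_)⟩
  rw [invEval_apply, ha]

end Quotient

end Richardson

theorem stmt_13 (K : Type) [Field K] [CharZero K] [IsAlgClosed K] (N n : ℕ)
    (H : Subgroup (Matrix.GeneralLinearGroup (Fin N) K))
    (hHcl : IsZarClosed K N H) (hHred : NatSemisimpleOn K N (H : Set _)) :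
    (∀ g : Fin n → H,
      @IsClosed _ (tupleZarTop K N H n) (conjOrbit K N H n g) ↔
        NatSemisimpleOn K N
          ((Subgroup.closure
            (Set.range fun i => (g i : Matrix.GeneralLinearGroup (Fin N) K))) : Set _))
    ∧ ∃ β : {S : Set (Fin n → H) //
          (∃ g : Fin n → H, S = conjOrbit K N H n g) ∧ @IsClosed _ (tupleZarTop K N H n) S}
        ≃ (regInvAlg K N H n →ₐ[K] K),
        ∀ (S : {S : Set (Fin n → H) //
            (∃ g : Fin n → H, S = conjOrbit K N H n g) ∧ @IsClosed _ (tupleZarTop K N H n) S})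
          (g : Fin n → H), g ∈ S.1 →
          ∀ f : regInvAlg K N H n, β S f = (f : (Fin n → H) → K) g := by
  have hH := Richardson.gClosed_of_isZarClosed hHcl
  refine ⟨Richardson.isClosed_conjOrbit_iff_natSemisimpleOn hHcl hHred, ?_⟩
  refine ⟨Equiv.ofBijective (fun S => Richardson.invEval S.2.1.choose) ⟨?_, fun χ => ?_⟩,
    fun S g hg f => ?_⟩
  · intro S S' h
    have hS := S.2.1.choose_spec
    have hS' := S'.2.1.choose_spec
    refine Subtype.ext (hS.trans (Eq.trans ?_ hS'.symm))
    exact Richardson.conjOrbit_eq_of_invEval_eq hHred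
      ((Richardson.isClosed_conjOrbit_iff hH _).mp (hS ▸ S.2.2))
      ((Richardson.isClosed_conjOrbit_iff hH _).mp (hS' ▸ S'.2.2)) h
  · obtain ⟨g, hg, rfl⟩ := Richardson.exists_closed_invEval_eq hHcl hHred χ
    let S : {S : Set (Fin n → H) //
        (∃ g : Fin n → H, S = conjOrbit K N H n g) ∧ @IsClosed _ (tupleZarTop K N H n) S} :=
      ⟨conjOrbit K N H n g, ⟨g, rfl⟩, (Richardson.isClosed_conjOrbit_iff hH g).mpr hg⟩
    have hS : conjOrbit K N H n g = conjOrbit K N H n S.2.1.choose := S.2.1.choose_spec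
    have hmem : g ∈ conjOrbit K N H n S.2.1.choose := by
      rw [← hS, Richardson.mem_conjOrbit]
      exact Richardson.mem_orbT_self _ _
    exact ⟨S, (Richardson.invEval_eq_of_mem_clT
      (Richardson.subset_clT _ (Richardson.mem_conjOrbit.mp hmem))).symm⟩
  · have hS := S.2.1.choose_spec
    rw [hS] at hg
    rw [← Richardson.invEval_apply, Richardson.invEval_eq_of_mem_clT
      (Richardson.subset_clT _ (Richardson.mem_conjOrbit.mp hg))]
    rfl
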